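/- Lower bound on the near-critical truncated two-point function: Assume d = d_gr. There exist constants c, C₂ ∈ (0,∞) such that for all a ∈ ℝ with |a| ≤ c and all x, y ∈ G with d(x,y) ≥ C₂ |a|^{−2} q(a^{−1}) log(q(a^{−1})) when ν = 1, respectively d(x,y) ≥ C₂ |a|^{−2/ν} q(a^{−1}) when 1 < ν < α/2, one has: τ_a^tr(x,y) ≥ τ_0^tr(x,y) exp{−C₂ |a|² d(x,y) / log(|a|² d(x,y))} if ν = 1, and τ_a^tr(x,y) ≥ τ_0^tr(x,y) exp{−C₂ |a|^{2/ν} d(x,y) (log(|a|^{2/ν} d(x,y)))^{ν−1}} if 1 < ν < α/2. -/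

import Mathlib

open MeasureTheory ProbabilityTheory Real Filter Topology
open scoped ENNReal NNReal BigOperators Classical

noncomputable section

/-! ## Generic exponents and corrections -/

/-- The exponent `b₁`: equal to `1` if `ν = 1` and `0` otherwise. -/
def bOne (ν : ℝ) : ℝ := if ν = 1 then 1 else 0

/-- The exponent `b₂`: equal to `1` if `α = 2ν` and `0` otherwise. -/
def bTwo (ν α : ℝ) : ℝ := if α = 2 * ν then 1 else 0

/-- The polylogarithmic correction `q(r)` from Theorem 1.1. -/
def qArm (ν α r : ℝ) : ℝ :=
  if ν = 1 then Real.log (Real.log r)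
  else if ν < α / 2 then Real.log r ^ ((ν - 1) / 2) * Real.log (Real.log r) ^ ν
  else Real.log r ^ ν * Real.log (Real.log r) ^ ν

/-- `exp(-t)` for an extended nonnegative real `t`. -/
def expNegE (t : ℝ≥0∞) : ℝ≥0∞ := if t = ⊤ then 0 else ENNReal.ofReal (Real.exp (-t.toReal))

/-! ## Transient weighted graphs

A weighted graph `𝒢 = (G, λ)`, connected and locally finite, with controlled weights,
equipped with a metric `d`, a distinguished base point `o`, and exponents `α` (volume
growth) and `ν` (Green's function decay). -/

structure WGraph where
  (V : Type) (countableV : Countable V) (o : V)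
  (lam : V → V → ℝ)
  (lam_nonneg : ∀ x y, 0 ≤ lam x y)
  (lam_symm : ∀ x y, lam x y = lam y x)
  (locFin : ∀ x, (Function.support (lam x)).Finite)
  (connectedG : ∀ x y, Relation.ReflTransGen (fun u v => 0 < lam u v) x y)
  -- controlled weights: `λ_{x,y}/λ_x ≥ c₀` for all neighbours `x ∼ y`
  (ctrl : ∃ c₀ > (0:ℝ), ∀ x y, 0 < lam x y → c₀ * (∑ᶠ z, lam x z) ≤ lam x y)
  (d : V → V → ℝ)
  (d_symm : ∀ x y, d x y = d y x)
  (d_self : ∀ x, d x x = 0)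
  (d_pos : ∀ x y, x ≠ y → 0 < d x y)
  (d_triangle : ∀ x y z, d x z ≤ d x y + d y z)
  (α : ℝ) (ν : ℝ)

namespace WGraph

variable (M : WGraph)

/-- Total weight `λ_x = Σ_{y} λ_{x,y}` at a vertex. -/
def lamTot (x : M.V) : ℝ := ∑ᶠ y, M.lam x y

/-- The (closed) ball `B(x,r)` for the metric `d`. -/
def ball (x : M.V) (r : ℝ) : Set M.V := {y | M.d x y ≤ r}

/-- One-step transition probability of the random walk on `(G,λ)`. -/
def p (x y : M.V) : ℝ := M.lam x y / M.lamTot x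

/-- `n`-step transition probability of the random walk. -/
def pstep : ℕ → M.V → M.V → ℝ
  | 0, x, y => if x = y then 1 else 0
  | n + 1, x, y => ∑ᶠ z, M.p x z * pstep n z y

/-- The Green's function `g(x,y) = λ_y^{-1} Σ_{n ≥ 0} P_x[Z_n = y]` of the walk. -/
def green (x y : M.V) : ℝ := (∑' n, M.pstep n x y) / M.lamTot y

/-- Transience of the random walk on `𝒢`. -/
def Transient : Prop := ∀ x, Summable fun n => M.pstep n x x

/-- The volume growth condition `(V_α)`. -/
def VolGrowth : Prop :=
  ∃ c > (0:ℝ), ∃ C > (0:ℝ), ∀ (x : M.V) (r : ℝ), 1 ≤ r →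
    c * r ^ M.α ≤ (∑ᶠ y ∈ M.ball x r, M.lamTot y) ∧
      (∑ᶠ y ∈ M.ball x r, M.lamTot y) ≤ C * r ^ M.α

/-- The Green's function decay condition `(G_ν)`. -/
def GreenDecay : Prop :=
  ∃ c > (0:ℝ), ∃ C > (0:ℝ),
    (∀ x : M.V, c ≤ M.green x x ∧ M.green x x ≤ C) ∧
    ∀ x y : M.V, x ≠ y →
      c * M.d x y ^ (-M.ν) ≤ M.green x y ∧ M.green x y ≤ C * M.d x y ^ (-M.ν)

/-- The standing assumptions on the graph: transience, `(V_α)` and `(G_ν)`. -/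
def Standing : Prop := M.Transient ∧ M.VolGrowth ∧ M.GreenDecay

/-- The graph distance `d_gr` on `𝒢`. -/
def graphDist (x y : M.V) : ℝ :=
  sInf {r : ℝ | ∃ n : ℕ, r = n ∧ ∃ γ : Fin (n + 1) → M.V, γ 0 = x ∧ γ (Fin.last n) = y ∧
    ∀ i : Fin n, 0 < M.lam (γ i.castSucc) (γ i.succ)}

/-- Capacity of a finite set of vertices, via the variational characterization
`cap(K) = (inf_μ Σ_{x,y} μ(x) g(x,y) μ(y))⁻¹`, the infimum being over probability
measures supported on `K`. -/
def capFinset (K : Finset M.V) : ℝ :=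
  (sInf {E : ℝ | ∃ μ : M.V → ℝ, (∀ x, 0 ≤ μ x) ∧ (∀ x, x ∉ K → μ x = 0) ∧
    (∑ x ∈ K, μ x) = 1 ∧ E = ∑ x ∈ K, ∑ y ∈ K, μ x * M.green x y * μ y})⁻¹

/-- Capacity of an arbitrary set of vertices. -/
def cap (S : Set M.V) : ℝ := ⨆ K : {K : Finset M.V // ↑K ⊆ S}, M.capFinset K.1

/-- Weight `∏_{i<n} p(x_i, x_{i+1})` of a finite random walk trajectory. -/
def pathWt {n : ℕ} (γ : Fin (n + 1) → M.V) : ℝ := ∏ i : Fin n, M.p (γ i.castSucc) (γ i.succ)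

/-- `P_z[H_x < H_O]`: the probability that the random walk started at `z` hits `x`
strictly before hitting the set `O`, expressed through a first-passage path decomposition. -/
def hitBefore (z x : M.V) (O : Set M.V) : ℝ :=
  ∑' n : ℕ, ∑' γ : Fin (n + 1) → M.V,
    if γ 0 = z ∧ γ (Fin.last n) = x ∧ x ∉ O ∧
        (∀ i : Fin (n + 1), i ≠ Fin.last n → γ i ∉ O ∧ γ i ≠ x)
      then M.pathWt γ else 0

/-- Distance from a point to a set. -/
def dSet (x : M.V) (S : Set M.V) : ℝ := sInf (M.d x '' S)

/-! ### Discrete (rooted) loops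

A rooted discrete loop visiting `m + 2` vertices (`m ≥ 0`), i.e. making at least two
jumps, encoded by its skeleton `Z_0, …, Z_{n-1}` (with `Z_n = Z_0`, indices mod `n`). -/

/-- The type of rooted discrete loops on `G` making `n = m + 2 ≥ 2` jumps. -/
abbrev DLoop : Type := Σ m : ℕ, Fin (m + 2) → M.V

/-- The mass `(1/n) ∏_{0 ≤ i < n} λ_{x_i,x_{i+1}}/λ_{x_i}` that the loop measure `μ`
assigns to a given rooted discrete loop (its discrete skeleton intensity). -/
def dloopWt (γ : M.DLoop) : ℝ≥0∞ :=
  ENNReal.ofReal ((1 / ((γ.1 : ℝ) + 2)) * ∏ i : Fin (γ.1 + 2), M.p (γ.2 i) (γ.2 (i + 1)))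

/-- The set of vertices visited by a discrete loop (`range(γ) ∩ G` for the
corresponding continuous loop). -/
def dloopRange (γ : M.DLoop) : Set M.V := Set.range γ.2

/-- The loop measure `μ` evaluated on a set of (skeletons of) loops: since the events of
interest only depend on the vertices visited by a loop, the measure under `μ` of such an
event coincides with the total mass of the corresponding discrete skeletons. -/
def loopMeas (S : Set M.DLoop) : ℝ≥0∞ := ∑' γ : S, M.dloopWt γ

end WGraph

/-! ## Graphs equipped with an approximate renormalized lattice `Λ(L)` -/

structure LGraph extends WGraph where
  (Lat : ℝ → Set V)
  (Lat_base : ∀ L : ℝ, 1 ≤ L → o ∈ Lat L)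
  (Lat_cover : ∀ L : ℝ, 1 ≤ L → ∀ x, ∃ y ∈ Lat L, d y x ≤ L)
  (Lat_disj : ∀ L : ℝ, 1 ≤ L → ∀ y ∈ Lat L, ∀ z ∈ Lat L, y ≠ z →
    ∀ w, d y w ≤ L / 2 → ¬ d z w ≤ L / 2)
  (Lat_card : ∃ CΛ > (0:ℝ), ∀ L : ℝ, 1 ≤ L → ∀ (x : V) (N : ℕ), 1 ≤ N →
    {y | y ∈ Lat L ∧ d x y ≤ L * N}.Finite ∧
      ({y | y ∈ Lat L ∧ d x y ≤ L * N}.ncard : ℝ) ≤ CΛ * (N : ℝ) ^ α)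

namespace LGraph

variable (M : LGraph)

/-- A path `π = (x_i)_{1 ≤ i ≤ M}` in `Λ(L)` from the base point `0` to `A ⊆ G`. -/
def IsLatPath (L : ℝ) (A : Set M.V) {m : ℕ} (pa : Fin (m + 1) → M.V) : Prop :=
  pa 0 = M.o ∧ pa (Fin.last m) ∈ A ∧ (∀ i, pa i ∈ M.Lat L) ∧
    ∀ i : Fin m, ∃ x y, M.d (pa i.castSucc) x ≤ L ∧ M.d (pa i.succ) y ≤ L ∧ 0 < M.lam x y

/-- `𝒪 ⊆ G` is an `(L,R,n,κ)`-good obstacle: every path in `Λ(L)` from `0` to `B_R^c`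
contains at least `n` points `y` (within `B_R`) with `cap(𝒪 ∩ B(y,L)) ≥ κ`. -/
def GoodObstacle (O : Set M.V) (L R : ℝ) (n : ℝ) (κ : ℝ) : Prop :=
  ∀ (m : ℕ) (pa : Fin (m + 1) → M.V), M.IsLatPath L {y | R < M.d M.o y} pa →
    ∃ A : Finset M.V, (∀ y ∈ A, (∃ i, pa i = y) ∧ M.d M.o y ≤ R) ∧ n ≤ (A.card : ℝ) ∧
      ∀ y ∈ A, κ ≤ M.toWGraph.cap (O ∩ {z | M.d y z ≤ L})

/-- The layer `𝒜_k ⊆ Λ(L)` of lattice points whose `L`-ball meets the interior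
boundary `∂B(0, C₁ k L)`. -/
def layer (C₁ L : ℝ) (k : ℕ) : Set M.V :=
  {x | x ∈ M.Lat L ∧ ∃ y, M.d x y ≤ L ∧ M.d M.o y ≤ C₁ * k * L ∧
    ∃ z, 0 < M.lam y z ∧ C₁ * k * L < M.d M.o z}

/-- The annulus `𝔸_k = ∪_{x ∈ 𝒜_k} B(x,L)`. -/
def annulus (C₁ L : ℝ) (k : ℕ) : Set M.V := {v | ∃ x ∈ M.layer C₁ L k, M.d x v ≤ L}

end LGraph

/-! ## The Gaussian free field and its associated bond percolation `E^{≥a}` -/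

/-- A transient weighted graph together with a Gaussian free field `φ` (law `ℙ`) and,
conditionally on `φ`, independent bond percolation configurations: each edge `{x,y}` is
retained in `E^{≥a}` (i.e. `opn a`) independently with probability
`1 - exp(-2 λ_{x,y} (φ_x - a)_+ (φ_y - a)_+)`. -/
structure Model extends WGraph where
  (Ω : Type) [mΩ : MeasurableSpace Ω] (P : Measure Ω) (Pprob : IsProbabilityMeasure P)
  (φ : Ω → V → ℝ)
  (φ_meas : ∀ x, Measurable fun ω => φ ω x)
  -- `φ` is the centered Gaussian field with covariance the Green's function `g`
  (φ_gauss : ∀ (s : Finset V) (c : V → ℝ),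
    Measure.map (fun ω => ∑ x ∈ s, c x * φ ω x) P =
      gaussianReal 0 (Real.toNNReal (∑ x ∈ s, ∑ y ∈ s, c x * c y * toWGraph.green x y)))
  (opn : ℝ → Ω → V → V → Prop)
  (opn_symm : ∀ a ω x y, opn a ω x y → opn a ω y x)
  (opn_edge : ∀ a ω x y, opn a ω x y → 0 < lam x y)
  (opn_meas : ∀ a x y, MeasurableSet {ω | opn a ω x y})
  -- conditionally on `φ`, edges are open independently with the prescribed probabilities
  (opn_law : ∀ (a : ℝ) (s t : Finset (V × V)), Disjoint s t →
    (∀ e ∈ s ∪ t, ∀ f ∈ s ∪ t, e ≠ f → e ≠ Prod.swap f) →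
    ∀ B : Set (V → ℝ), MeasurableSet B →
      P ({ω | φ ω ∈ B} ∩
          {ω | (∀ e ∈ s, opn a ω e.1 e.2) ∧ (∀ e ∈ t, ¬ opn a ω e.1 e.2)}) =
      ∫⁻ ω in {ω | φ ω ∈ B},
        ENNReal.ofReal
          ((∏ e ∈ s,
            (1 - Real.exp (-(2 * lam e.1 e.2 * max (φ ω e.1 - a) 0 * max (φ ω e.2 - a) 0)))) *
           ∏ e ∈ t,
            Real.exp (-(2 * lam e.1 e.2 * max (φ ω e.1 - a) 0 * max (φ ω e.2 - a) 0))) ∂P)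

attribute [instance] Model.mΩ

namespace Model

variable (M : Model)

/-- `x` and `y` are connected by a path of open edges of `E^{≥a}`. -/
def conn (a : ℝ) (ω : M.Ω) (x y : M.V) : Prop :=
  Relation.ReflTransGen (fun u v => M.opn a ω u v) x y

/-- The open cluster `𝒦^a` of `x` in `E^{≥a}`. -/
def cluster (a : ℝ) (ω : M.Ω) (x : M.V) : Set M.V := {y | M.conn a ω x y}

/-- The probability of an event. -/
def prob (s : Set M.Ω) : ℝ := (M.P s).toReal

/-- The one-arm event `{x ↔ B(x,R)^c}` in `E^{≥0}`. -/
def armEvent (x : M.V) (R : ℝ) : Set M.Ω := {ω | ∃ y, R < M.d x y ∧ M.conn 0 ω x y}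

/-- The truncated two-point function
`τ_a^tr(x,y) = ℙ(x ↔ y in E^{≥a}, x ↮ ∞ in E^{≥a})`. -/
def tau (a : ℝ) (x y : M.V) : ℝ :=
  M.prob {ω | M.conn a ω x y ∧ (M.cluster a ω x).Finite}

/-- The truncated expected cluster volume `𝔼[|𝒦^a| 1_{|𝒦^a| < ∞}]`. -/
def clusterVol (a : ℝ) (x : M.V) : ℝ≥0∞ :=
  ∫⁻ ω, (if (M.cluster a ω x).Finite then ((M.cluster a ω x).ncard : ℝ≥0∞) else 0) ∂M.P

end Model

/-! ## The concrete case `G = ℤ³` with unit weights and the Euclidean distance -/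

/-- The vertex set `ℤ³`. -/
abbrev Z3 : Type := Fin 3 → ℤ

/-- Euclidean distance on `ℤ³`. -/
def dZ (x y : Z3) : ℝ := Real.sqrt (∑ i, ((x i : ℝ) - (y i : ℝ)) ^ 2)

/-- Unit weights: `λ_{x,y} = 1_{|x-y| = 1}`. -/
def lamZ (x y : Z3) : ℝ := if dZ x y = 1 then 1 else 0

/-- Transition probabilities of simple random walk on `ℤ³`. -/
def pZ (x y : Z3) : ℝ := lamZ x y / 6

/-- `n`-step transition probabilities of simple random walk on `ℤ³`. -/
def pstepZ : ℕ → Z3 → Z3 → ℝ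
  | 0, x, y => if x = y then 1 else 0
  | n + 1, x, y => ∑ᶠ z, pZ x z * pstepZ n z y

/-- The Green's function of simple random walk on `ℤ³` (with the normalization
`g(x,y) = λ_y^{-1} Σ_n P_x[Z_n = y]`, `λ_y = 6`). -/
def greenZ (x y : Z3) : ℝ := (∑' n, pstepZ n x y) / 6

/-- Euclidean distance between a point of `ℝ³` and a point of `ℤ³`. -/
def dMix (u : Fin 3 → ℝ) (z : Z3) : ℝ := Real.sqrt (∑ i, (u i - (z i : ℝ)) ^ 2)

/-- The Gaussian free field on `ℤ³` together with the associated bond percolation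
configurations `E^{≥a}`. -/
structure PercZ3 where
  (Ω : Type) [mΩ : MeasurableSpace Ω] (P : Measure Ω) (Pprob : IsProbabilityMeasure P)
  (φ : Ω → Z3 → ℝ)
  (φ_meas : ∀ x, Measurable fun ω => φ ω x)
  (φ_gauss : ∀ (s : Finset Z3) (c : Z3 → ℝ),
    Measure.map (fun ω => ∑ x ∈ s, c x * φ ω x) P =
      gaussianReal 0 (Real.toNNReal (∑ x ∈ s, ∑ y ∈ s, c x * c y * greenZ x y)))
  (opn : ℝ → Ω → Z3 → Z3 → Prop)
  (opn_symm : ∀ a ω x y, opn a ω x y → opn a ω y x)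
  (opn_edge : ∀ a ω x y, opn a ω x y → 0 < lamZ x y)
  (opn_meas : ∀ a x y, MeasurableSet {ω | opn a ω x y})
  (opn_law : ∀ (a : ℝ) (s t : Finset (Z3 × Z3)), Disjoint s t →
    (∀ e ∈ s ∪ t, ∀ f ∈ s ∪ t, e ≠ f → e ≠ Prod.swap f) →
    ∀ B : Set (Z3 → ℝ), MeasurableSet B →
      P ({ω | φ ω ∈ B} ∩
          {ω | (∀ e ∈ s, opn a ω e.1 e.2) ∧ (∀ e ∈ t, ¬ opn a ω e.1 e.2)}) =
      ∫⁻ ω in {ω | φ ω ∈ B},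
        ENNReal.ofReal
          ((∏ e ∈ s,
            (1 - Real.exp (-(2 * lamZ e.1 e.2 * max (φ ω e.1 - a) 0 * max (φ ω e.2 - a) 0)))) *
           ∏ e ∈ t,
            Real.exp (-(2 * lamZ e.1 e.2 * max (φ ω e.1 - a) 0 * max (φ ω e.2 - a) 0))) ∂P)

attribute [instance] PercZ3.mΩ

namespace PercZ3

variable (M : PercZ3)

/-- Connectivity by open edges in `E^{≥a}`. -/
def conn (a : ℝ) (ω : M.Ω) (x y : Z3) : Prop :=
  Relation.ReflTransGen (fun u v => M.opn a ω u v) x y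

/-- The open cluster of `x` in `E^{≥a}`. -/
def cluster (a : ℝ) (ω : M.Ω) (x : Z3) : Set Z3 := {y | M.conn a ω x y}

/-- The truncated two-point function on `ℤ³`. -/
def tau (a : ℝ) (x y : Z3) : ℝ :=
  ((M.P {ω | M.conn a ω x y ∧ (M.cluster a ω x).Finite}).toReal)

end PercZ3

/-! ## The metric graph (cable system) `𝔾̃`, killed Green's functions and killed GFFs -/

/-- The cable system `𝔾̃` over a graph `𝒢` (with renormalized lattice), together with the
killed Green's functions `g_U` and the laws `ℙ_U` of the Gaussian free field on open sets
`U ⊆ 𝔾̃` (the field killed outside `U`). -/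
structure CableG extends LGraph where
  (Gt : Type) [topGt : TopologicalSpace Gt] [msGt : MeasurableSpace Gt]
  (ι : V → Gt) (ι_inj : Function.Injective ι)
  (gU : Set Gt → Gt → Gt → ℝ)
  (gU_symm : ∀ U x y, gU U x y = gU U y x)
  (gU_zero : ∀ U x y, x ∉ U → gU U x y = 0)
  -- the Green's function of the full cable system restricts to `g` on `G`
  (gU_univ : ∀ x y : V, gU Set.univ (ι x) (ι y) = toWGraph.green x y)
  (PU : Set Gt → Measure (Gt → ℝ))
  (PU_prob : ∀ U, IsProbabilityMeasure (PU U))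
  -- `ℙ_U` is the law of the centered Gaussian field with covariance `g_U`
  (PU_gauss : ∀ (U : Set Gt) (s : Finset Gt) (c : Gt → ℝ),
    Measure.map (fun h => ∑ q ∈ s, c q * h q) (PU U) =
      gaussianReal 0 (Real.toNNReal (∑ q ∈ s, ∑ q' ∈ s, c q * c q' * gU U q q')))

attribute [instance] CableG.topGt CableG.msGt

/-- A probability space. -/
structure ProbSpace where
  (Ω : Type) [mΩ : MeasurableSpace Ω] (P : Measure Ω) (Pprob : IsProbabilityMeasure P)

attribute [instance] ProbSpace.mΩ

/-- A cable system as above, together with the laws of the vacant sets `Ṽ^u` of random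
interlacements at level `u > 0` on `𝔾̃`, axiomatized through their characterizing
properties: `Ṽ^u` is open and `ℙ(F ⊆ Ṽ^u) = exp(-u cap(F))` for finite `F ⊆ G`. -/
structure CableRI extends CableG where
  [msSetGt : MeasurableSpace (Set Gt)]
  (RIVacant : ℝ → Measure (Set Gt))
  (RIVacant_prob : ∀ u : ℝ, 0 < u → IsProbabilityMeasure (RIVacant u))
  (RIVacant_open : ∀ u : ℝ, 0 < u → ∀ᵐ S ∂(RIVacant u), @IsOpen Gt topGt S)
  (RIVacant_cap : ∀ u : ℝ, 0 < u → ∀ F : Finset V,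
    (RIVacant u {S | ∀ x ∈ F, ι x ∈ S}).toReal =
      Real.exp (-(u * toWGraph.capFinset F)))

attribute [instance] CableRI.msSetGt

/-! ## The Markovian loop soup at intensity `1/2` on the cable system -/

/-- The Poisson loop soup `ℒ` of intensity `(1/2)μ` on the cable system `𝔾̃` of a graph
`𝒢` (with renormalized lattice), under the law `Q`.  Continuous loops are axiomatized
through their ranges in `𝔾̃` and their discrete skeletons; the intensity measure `μ` is
pinned down via its (concrete) discrete skeleton intensity, and the law of the soup via
its void probabilities `Q(ℒ ∩ S = ∅) = exp(-μ(S)/2)`. -/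
structure LoopSoup extends LGraph where
  -- the cable system
  (Gt : Type) [topGt : TopologicalSpace Gt]
  (ι : V → Gt) (ι_inj : Function.Injective ι)
  (cable : V → V → Set Gt)
  (cable_symm : ∀ x y, cable x y = cable y x)
  (cable_ends : ∀ x y, 0 < lam x y → ι x ∈ cable x y ∧ ι y ∈ cable x y)
  (cable_vertices : ∀ x y, 0 < lam x y → ∀ v : V, ι v ∈ cable x y → v = x ∨ v = y)
  (cable_cover : ∀ q : Gt, (∃ v, q = ι v) ∨ ∃ x y, 0 < lam x y ∧ q ∈ cable x y)
  -- continuous loops on the cable system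
  (CLoop : Type) [msLoop : MeasurableSpace CLoop]
  (crange : CLoop → Set Gt)
  (traceG : CLoop → Set V)
  (trace_spec : ∀ γ, traceG γ = {v | ι v ∈ crange γ})
  -- the loop measure `μ` and its discrete skeleton
  (μC : Measure CLoop)
  (skel : CLoop → Option (Σ m : ℕ, Fin (m + 2) → V))
  (skel_spec : ∀ γ dγ, skel γ = some dγ → traceG γ = Set.range dγ.2)
  (skel_trivial : ∀ γ, skel γ = none → (traceG γ).Subsingleton)
  (μC_skel : ∀ S : Set (Σ m : ℕ, Fin (m + 2) → V),
    μC {γ | ∃ dγ ∈ S, skel γ = some dγ} = toWGraph.loopMeas S)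
  -- the loop soup and its law
  (Ωq : Type) [mΩq : MeasurableSpace Ωq] (Q : Measure Ωq) (Qprob : IsProbabilityMeasure Q)
  (soup : Ωq → Set CLoop)
  (soup_void : ∀ S : Set CLoop, MeasurableSet S →
    Q {ω | ∀ γ ∈ soup ω, γ ∉ S} = expNegE (μC S / 2))

attribute [instance] LoopSoup.topGt LoopSoup.msLoop LoopSoup.mΩq

namespace LoopSoup

variable (M : LoopSoup)

/-- Two loops of the soup are linked if they can be joined by a finite chain of loops of
the soup whose ranges successively intersect. -/
def linked (ω : M.Ωq) (γ γ' : M.CLoop) : Prop :=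
  Relation.ReflTransGen
    (fun g g' => g ∈ M.soup ω ∧ g' ∈ M.soup ω ∧ (M.crange g ∩ M.crange g').Nonempty) γ γ'

/-- The trace `𝒞` on `𝔾̃` of the cluster of loops of `ℒ` containing the base point `0`. -/
def C0 (ω : M.Ωq) : Set M.Gt :=
  {q | ∃ γ ∈ M.soup ω, q ∈ M.crange γ ∧
    ∃ γ₀ ∈ M.soup ω, M.ι M.o ∈ M.crange γ₀ ∧ M.linked ω γ γ₀}

/-- A loop is big (for the parameters `δ, L`) if `cap(range(γ) ∩ G) ≥ δ L^ν (log L)^{-b₂}`. -/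
def isBig (δ L : ℝ) (γ : M.CLoop) : Prop :=
  δ * L ^ M.ν * Real.log L ^ (-(bTwo M.ν M.α)) ≤ M.toWGraph.cap (M.traceG γ)

/-- The box `B̃(x,L) ⊆ 𝔾̃`: the ball `B(x,L)` together with all cables joining
neighbouring vertices of `B(x,L)`. -/
def Btilde (x : M.V) (L : ℝ) : Set M.Gt :=
  (M.ι '' {y | M.d x y ≤ L}) ∪
    ⋃ (u : M.V) (v : M.V) (_ : 0 < M.lam u v ∧ M.d x u ≤ L ∧ M.d x v ≤ L), M.cable u v

/-- A loop belongs to (the support of) `ℒ_k^b`: it is big and its range is contained in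
`B̃(x,L)` for some `x ∈ 𝒜_k`. -/
def inLayerBig (C₁ δ L : ℝ) (k : ℕ) (γ : M.CLoop) : Prop :=
  M.isBig δ L γ ∧ ∃ x ∈ M.toLGraph.layer C₁ L k, M.crange γ ⊆ M.Btilde x L

/-- The event `𝐁_k`: the cluster `𝒞` of `0` reaches `B_R^c` but contains no big loop of
`ℒ_k^b`. -/
def Bk (C₁ δ L R : ℝ) (k : ℕ) : Set M.Ωq :=
  {ω | (∃ y : M.V, R < M.d M.o y ∧ M.ι y ∈ M.C0 ω) ∧
    ∀ γ ∈ M.soup ω, M.inLayerBig C₁ δ L k γ → ¬ M.crange γ ⊆ M.C0 ω}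

/-- The number `N` of bad annuli among `k ∈ {1, …, ℓ}`. -/
def Nbad (C₁ δ L R : ℝ) (ℓ : ℕ) (ω : M.Ωq) : ℕ :=
  ((Finset.Icc 1 ℓ).filter fun k => ω ∈ M.Bk C₁ δ L R k).card

/-- The obstacle set `𝒪 = G ∩ 𝐼̃_D^b`: all vertices visited by a big loop of the soup
contained in a box `B̃(x,L)` with `x ∈ 𝒜_k` for some `k ∈ D`. -/
def obstacleD (C₁ δ L : ℝ) (D : Finset ℕ) (ω : M.Ωq) : Set M.V :=
  {v | ∃ γ ∈ M.soup ω, (∃ k ∈ D, M.inLayerBig C₁ δ L k γ) ∧ M.ι v ∈ M.crange γ}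

end LoopSoup

section BernoulliPercolation

set_option linter.unusedSectionVars false

variable {E : Type*} [Fintype E] [DecidableEq E]

/-- The weight of a configuration under independent Bernoulli variables. -/
def bernWeight (p : E → ℝ) (ω : Finset E) : ℝ := ∏ e, if e ∈ ω then p e else 1 - p e

/-- The probability of an event under independent Bernoulli variables. -/
def bernProb (p : E → ℝ) (Q : Finset E → Prop) : ℝ := ∑ ω, if Q ω then bernWeight p ω else 0

lemma prod_add_eq_sum (a b : E → ℝ) :
    ∏ e, (a e + b e) = ∑ ω : Finset E, ∏ e, if e ∈ ω then a e else b e := by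
  rw [Finset.prod_add, Finset.powerset_univ]
  refine Finset.sum_congr rfl fun ω _ => ?_
  rw [Finset.prod_ite]
  congr 1
  · exact Finset.prod_congr (by ext; simp) fun _ _ => rfl
  · exact Finset.prod_congr (by ext; simp) fun _ _ => rfl

lemma bernWeight_nonneg {p : E → ℝ} (h0 : ∀ e, 0 ≤ p e) (h1 : ∀ e, p e ≤ 1) (ω : Finset E) :
    0 ≤ bernWeight p ω := by
  refine Finset.prod_nonneg fun e _ => ?_
  split_ifs
  · exact h0 e
  · linarith [h1 e]

lemma bernProb_true (p : E → ℝ) : bernProb p (fun _ => True) = 1 := by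
  have := prod_add_eq_sum p (fun e => 1 - p e)
  simp only [add_sub_cancel, Finset.prod_const_one] at this
  simp [bernProb, bernWeight, ← this]

lemma bernProb_nonneg {p : E → ℝ} (h0 : ∀ e, 0 ≤ p e) (h1 : ∀ e, p e ≤ 1)
    (Q : Finset E → Prop) : 0 ≤ bernProb p Q := by
  refine Finset.sum_nonneg fun ω _ => ?_
  split_ifs
  · exact bernWeight_nonneg h0 h1 ω
  · exact le_rfl

lemma bernProb_mono {p : E → ℝ} (h0 : ∀ e, 0 ≤ p e) (h1 : ∀ e, p e ≤ 1)
    {Q Q' : Finset E → Prop} (h : ∀ ω, bernWeight p ω ≠ 0 → Q ω → Q' ω) :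
    bernProb p Q ≤ bernProb p Q' := by
  refine Finset.sum_le_sum fun ω _ => ?_
  have := bernWeight_nonneg h0 h1 ω
  by_cases hw : bernWeight p ω = 0
  · simp [hw]
  · by_cases hQ : Q ω
    · simp [hQ, h ω hw hQ]
    · simp only [hQ, if_false]
      split_ifs
      · exact this
      · exact le_rfl

lemma bernProb_fiber (p : E → ℝ) {T S : Finset E} (hS : S ⊆ T) :
    bernProb p (fun ω => ω ∩ T = S) = (∏ e ∈ S, p e) * ∏ e ∈ T \ S, (1 - p e) := by
  have h1 := prod_add_eq_sum (fun e => if e ∈ T \ S then 0 else p e)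
    (fun e => if e ∈ S then 0 else 1 - p e)
  have h2 : ∏ e, ((if e ∈ T \ S then 0 else p e) + (if e ∈ S then 0 else 1 - p e)) =
      (∏ e ∈ S, p e) * ∏ e ∈ T \ S, (1 - p e) := by
    have h3 : ∀ U : Finset E, ∀ f : E → ℝ, ∏ e ∈ U, f e = ∏ e, if e ∈ U then f e else 1 := by
      intro U f
      rw [Finset.prod_ite_mem]; simp
    rw [h3 S, h3 (T \ S), ← Finset.prod_mul_distrib]
    refine Finset.prod_congr rfl fun e _ => ?_
    by_cases hs : e ∈ S
    · simp [hs]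
    · by_cases ht : e ∈ T <;> simp [hs, ht]
  rw [← h2, h1, bernProb]
  refine Finset.sum_congr rfl fun ω _ => ?_
  split_ifs with h
  · refine Finset.prod_congr rfl fun e _ => ?_
    have he : (e ∈ ω ∧ e ∈ T) ↔ e ∈ S := by rw [← h, Finset.mem_inter]
    by_cases hs : e ∈ S
    · simp [hs, he.2 hs]
    · by_cases ho : e ∈ ω
      · have : e ∉ T := fun ht => hs (he.1 ⟨ho, ht⟩)
        simp [ho, this]
      · simp [hs, ho]
  · symm
    have : ∃ e, ¬ (e ∈ ω ∧ e ∈ T ↔ e ∈ S) := by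
      by_contra! hc
      exact h (by ext e; rw [Finset.mem_inter]; exact hc e)
    obtain ⟨e, he⟩ := this
    refine Finset.prod_eq_zero (Finset.mem_univ e) ?_
    have := @hS e
    by_cases hs : e ∈ S <;> by_cases ht : e ∈ T <;> by_cases ho : e ∈ ω <;> simp_all

/-- Events depending only on the edges in `T`. -/
lemma bernProb_cylinder (p : E → ℝ) (T : Finset E) (Q : Finset E → Prop)
    (hQ : ∀ ω, Q ω ↔ Q (ω ∩ T)) :
    bernProb p Q = ∑ S ∈ T.powerset, if Q S then (∏ e ∈ S, p e) * ∏ e ∈ T \ S, (1 - p e)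
      else 0 := by
  have h1 : bernProb p Q = ∑ S ∈ T.powerset, ∑ ω with ω ∩ T = S,
      if Q ω then bernWeight p ω else 0 := by
    rw [Finset.sum_fiberwise_of_maps_to]
    · rfl
    · intro ω _; simp
  rw [h1]
  refine Finset.sum_congr rfl fun S hS => ?_
  rw [← bernProb_fiber p (Finset.mem_powerset.1 hS), bernProb,
    Finset.sum_filter]
  by_cases h : Q S
  · rw [if_pos h]
    refine Finset.sum_congr rfl fun ω _ => ?_
    by_cases hω : ω ∩ T = S
    · rw [if_pos hω, if_pos hω, if_pos]
      rw [hQ, hω]; exact h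
    · rw [if_neg hω, if_neg hω]
  · rw [if_neg h]
    refine Finset.sum_eq_zero fun ω _ => ?_
    by_cases hω : ω ∩ T = S
    · rw [if_pos hω, if_neg]
      rw [hQ, hω]; exact h
    · rw [if_neg hω]

lemma bernProb_congr_on {p p' : E → ℝ} (T : Finset E) (Q : Finset E → Prop)
    (hQ : ∀ ω, Q ω ↔ Q (ω ∩ T)) (hp : ∀ e ∈ T, p e = p' e) :
    bernProb p Q = bernProb p' Q := by
  rw [bernProb_cylinder p T Q hQ, bernProb_cylinder p' T Q hQ]
  refine Finset.sum_congr rfl fun S hS => ?_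
  have hS := Finset.mem_powerset.1 hS
  have h1 : ∏ e ∈ S, p e = ∏ e ∈ S, p' e := Finset.prod_congr rfl fun e he => hp e (hS he)
  have h2 : ∏ e ∈ T \ S, (1 - p e) = ∏ e ∈ T \ S, (1 - p' e) :=
    Finset.prod_congr rfl fun e he => by rw [hp e (Finset.mem_sdiff.1 he).1]
  rw [h1, h2]

end BernoulliPercolation

section FiniteClusters

set_option linter.unusedSectionVars false

lemma sum_ite_eq_of_decidable {α : Type*} (s : Finset α) (a : α) (r : ℝ)
    {_ : ∀ b, Decidable (a = b)} [Decidable (a ∈ s)] :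
    ∑ b ∈ s, (if a = b then r else 0) = if a ∈ s then r else 0 := by
  convert Finset.sum_ite_eq s a fun _ => r

variable {ι : Type*} [Fintype ι] [DecidableEq ι]

/-- Connection in a finite set of edges. -/
def eConn (ω : Finset (ι × ι)) (x y : ι) : Prop :=
  Relation.ReflTransGen (fun u v => (u, v) ∈ ω ∨ (v, u) ∈ ω) x y

/-- The cluster of a vertex in a finite set of edges. -/
def eCluster (ω : Finset (ι × ι)) (x : ι) : Finset ι := Finset.univ.filter (eConn ω x)

lemma mem_eCluster {ω : Finset (ι × ι)} {x y : ι} : y ∈ eCluster ω x ↔ eConn ω x y := by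
  simp [eCluster]

lemma self_mem_eCluster (ω : Finset (ι × ι)) (x : ι) : x ∈ eCluster ω x :=
  mem_eCluster.2 Relation.ReflTransGen.refl

lemma eConn_mono {ω ω' : Finset (ι × ι)} (h : ω ⊆ ω') {x y : ι} (hc : eConn ω x y) :
    eConn ω' x y := by
  induction hc with
  | refl => exact Relation.ReflTransGen.refl
  | tail _ hbc ih => exact Relation.ReflTransGen.tail ih (Or.imp (@h _) (@h _) hbc)

/-- The edges with at least one endpoint in `A`. -/
def edgeTouch (A : Finset ι) : Finset (ι × ι) := Finset.univ.filter fun e => e.1 ∈ A ∨ e.2 ∈ A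

/-- The edges with exactly one endpoint in `A`. -/
def edgeBdry (A : Finset ι) : Finset (ι × ι) :=
  Finset.univ.filter fun e => (e.1 ∈ A ∧ e.2 ∉ A) ∨ (e.1 ∉ A ∧ e.2 ∈ A)

lemma eCluster_transfer {ω ω' : Finset (ι × ι)} {x : ι} {A : Finset ι} (h : eCluster ω x = A)
    (h1 : ∀ e ∈ ω, e.1 ∈ A → e.2 ∈ A → e ∈ ω')
    (h2 : ∀ e ∈ ω', (e.1 ∈ A ∨ e.2 ∈ A) → e ∈ ω) : eCluster ω' x = A := by
  have hA : ∀ y, y ∈ A ↔ eConn ω x y := fun y => by rw [← h, mem_eCluster]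
  ext y
  rw [mem_eCluster]
  constructor
  · intro hc
    induction hc with
    | refl => rw [← h]; exact self_mem_eCluster _ _
    | tail _ hbc ih =>
      rw [hA]
      refine Relation.ReflTransGen.tail ((hA _).1 ih) ?_
      rcases hbc with hbc | hbc
      · exact Or.inl (h2 _ hbc (Or.inl ih))
      · exact Or.inr (h2 _ hbc (Or.inr ih))
  · intro hy
    have hc := (hA y).1 hy
    clear hy
    induction hc with
    | refl => exact Relation.ReflTransGen.refl
    | @tail b d hb hbc ih =>
      have hbA := (hA b).2 hb
      have hdA := (hA d).2 (hb.tail hbc)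
      refine Relation.ReflTransGen.tail ih ?_
      rcases hbc with hbc | hbc
      · exact Or.inl (h1 _ hbc hbA hdA)
      · exact Or.inr (h1 _ hbc hdA hbA)

lemma eCluster_eq_inter_iff (ω : Finset (ι × ι)) (x : ι) (A : Finset ι) {T : Finset (ι × ι)}
    (hT : edgeTouch A ⊆ T) :
    eCluster ω x = A ↔ eCluster (ω ∩ T) x = A := by
  have ht : ∀ e : ι × ι, (e.1 ∈ A ∨ e.2 ∈ A) → e ∈ T := fun e he => hT (by simp [edgeTouch, he])
  constructor
  · intro h
    refine eCluster_transfer h (fun e he h1 _ => ?_) (fun e he _ => (Finset.mem_inter.1 he).1)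
    exact Finset.mem_inter.2 ⟨he, ht e (Or.inl h1)⟩
  · intro h
    refine eCluster_transfer h (fun e he _ _ => (Finset.mem_inter.1 he).1) (fun e he h1 => ?_)
    exact Finset.mem_inter.2 ⟨he, ht e h1⟩

lemma eCluster_no_bdry {ω : Finset (ι × ι)} {x : ι} {A : Finset ι} (h : eCluster ω x = A)
    {e : ι × ι} (he : e ∈ ω) : e ∉ edgeBdry A := by
  have hA : ∀ y, y ∈ A ↔ eConn ω x y := fun y => by rw [← h, mem_eCluster]
  simp only [edgeBdry, Finset.mem_filter, Finset.mem_univ, true_and, not_or, not_and, not_not]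
  refine ⟨fun h1 => ?_, fun h1 h2 => ?_⟩
  · rw [hA] at h1 ⊢
    exact h1.tail (Or.inl he)
  · refine h1 ?_
    rw [hA] at h2 ⊢
    exact h2.tail (Or.inr he)

/-- Opening probabilities of the edges, given the field. -/
def openProb (c : ι × ι → ℝ) (ψ : ι → ℝ) (e : ι × ι) : ℝ :=
  1 - Real.exp (-(2 * c e * max (ψ e.1) 0 * max (ψ e.2) 0))

lemma openProb_nonneg {c : ι × ι → ℝ} (hc : ∀ e, 0 ≤ c e) (ψ : ι → ℝ) (e) :
    0 ≤ openProb c ψ e := by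
  have := hc e
  have : 0 ≤ 2 * c e * max (ψ e.1) 0 * max (ψ e.2) 0 := by positivity
  unfold openProb
  linarith [Real.exp_le_one_iff.2 (neg_nonpos.2 this)]

lemma openProb_le_one (c : ι × ι → ℝ) (ψ : ι → ℝ) (e) : openProb c ψ e ≤ 1 := by
  unfold openProb
  linarith [Real.exp_pos (-(2 * c e * max (ψ e.1) 0 * max (ψ e.2) 0))]

lemma openProb_pos_of_ne {c : ι × ι → ℝ} {ψ : ι → ℝ} {e} (h : openProb c ψ e ≠ 0) :
    0 < ψ e.1 ∧ 0 < ψ e.2 := by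
  by_contra hc
  apply h
  rw [not_and_or, not_lt, not_lt] at hc
  unfold openProb
  rcases hc with hc | hc <;> simp [max_eq_right hc]

/-- The probability, given the field, that the cluster of `x` equals `A`. -/
def clusterProb (c : ι × ι → ℝ) (x : ι) (A : Finset ι) (ψ : ι → ℝ) : ℝ :=
  bernProb (openProb c ψ) fun ω => eCluster ω x = A

/-- The contribution of the edges inside `A` to `clusterProb`. -/
def clusterKernel (c : ι × ι → ℝ) (x : ι) (A : Finset ι) (ψ : ι → ℝ) : ℝ :=
  ∑ S ∈ (A ×ˢ A).powerset, if eCluster S x = A then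
    (∏ e ∈ S, openProb c ψ e) * ∏ e ∈ (A ×ˢ A) \ S, (1 - openProb c ψ e) else 0

lemma clusterProb_nonneg {c : ι × ι → ℝ} (hc : ∀ e, 0 ≤ c e) (x : ι) (A : Finset ι) (ψ : ι → ℝ) :
    0 ≤ clusterProb c x A ψ :=
  bernProb_nonneg (openProb_nonneg hc ψ) (openProb_le_one c ψ) _

lemma clusterKernel_nonneg {c : ι × ι → ℝ} (hc : ∀ e, 0 ≤ c e) (x : ι) (A : Finset ι)
    (ψ : ι → ℝ) : 0 ≤ clusterKernel c x A ψ := by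
  refine Finset.sum_nonneg fun S _ => ?_
  split_ifs
  · refine mul_nonneg (Finset.prod_nonneg fun e _ => openProb_nonneg hc ψ e)
      (Finset.prod_nonneg fun e _ => ?_)
    linarith [openProb_le_one c ψ e]
  · exact le_rfl

lemma clusterKernel_congr (c : ι × ι → ℝ) (x : ι) (A : Finset ι) {ψ ψ' : ι → ℝ}
    (h : ∀ i ∈ A, ψ i = ψ' i) : clusterKernel c x A ψ = clusterKernel c x A ψ' := by
  have hp : ∀ e ∈ A ×ˢ A, openProb c ψ e = openProb c ψ' e := by
    intro e he
    rw [Finset.mem_product] at he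
    simp only [openProb, h _ he.1, h _ he.2]
  refine Finset.sum_congr rfl fun S hS => ?_
  have hS := Finset.mem_powerset.1 hS
  have h1 : ∏ e ∈ S, openProb c ψ e = ∏ e ∈ S, openProb c ψ' e :=
    Finset.prod_congr rfl fun e he => hp e (hS he)
  have h2 : ∏ e ∈ (A ×ˢ A) \ S, (1 - openProb c ψ e) = ∏ e ∈ (A ×ˢ A) \ S, (1 - openProb c ψ' e) :=
    Finset.prod_congr rfl fun e he => by rw [hp e (Finset.mem_sdiff.1 he).1]
  rw [h1, h2]

lemma clusterProb_eq (c : ι × ι → ℝ) (x : ι) (A : Finset ι) (ψ : ι → ℝ) :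
    clusterProb c x A ψ =
      clusterKernel c x A ψ * ∏ e ∈ edgeBdry A, (1 - openProb c ψ e) := by
  have hT : edgeTouch A = (A ×ˢ A) ∪ edgeBdry A := by
    ext e
    simp only [edgeTouch, edgeBdry, Finset.mem_filter, Finset.mem_univ, true_and,
      Finset.mem_union, Finset.mem_product]
    tauto
  have hd : Disjoint (A ×ˢ A) (edgeBdry A) := by
    rw [Finset.disjoint_left]
    intro e he
    simp only [edgeBdry, Finset.mem_filter, Finset.mem_univ, true_and, Finset.mem_product] at he ⊢
    tauto
  have hsub : (A ×ˢ A).powerset ⊆ (edgeTouch A).powerset := by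
    rw [Finset.powerset_mono, hT]; exact Finset.subset_union_left
  have hz : ∀ S ∈ (edgeTouch A).powerset, S ∉ (A ×ˢ A).powerset → eCluster S x ≠ A := by
    intro S hS hS' h
    rw [Finset.mem_powerset] at hS hS'
    apply hS'
    intro e he
    rcases Finset.mem_union.1 (hT ▸ hS he) with h' | h'
    · exact h'
    · exact absurd h' (eCluster_no_bdry h he)
  rw [clusterProb, bernProb_cylinder _ (edgeTouch A) _
    (fun ω => eCluster_eq_inter_iff ω x A (subset_refl _)),
    clusterKernel, Finset.sum_mul]
  refine (Finset.sum_subset hsub fun S hS hS' => if_neg (hz S hS hS')).symm.trans ?_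
  refine Finset.sum_congr rfl fun S hS => ?_
  have hS := Finset.mem_powerset.1 hS
  have : edgeTouch A \ S = ((A ×ˢ A) \ S) ∪ edgeBdry A := by
    rw [hT, Finset.union_sdiff_distrib]
    congr 1
    rw [Finset.sdiff_eq_self_iff_disjoint]
    exact (hd.mono_left hS).symm
  rw [this, Finset.prod_union (hd.mono_left Finset.sdiff_subset)]
  split_ifs
  · ring
  · ring

lemma clusterProb_pos_on {c : ι × ι → ℝ} {x : ι} {A : Finset ι} {ψ : ι → ℝ}
    (h : clusterProb c x A ψ ≠ 0) {y : ι} (hy : y ∈ A) (hxy : x ≠ y) : ∀ i ∈ A, 0 < ψ i := by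
  obtain ⟨ω, -, hω⟩ := Finset.exists_ne_zero_of_sum_ne_zero h
  have hA : eCluster ω x = A := by
    by_contra hA; exact hω (by rw [if_neg hA])
  rw [if_pos hA] at hω
  have hpos : ∀ e ∈ ω, 0 < ψ e.1 ∧ 0 < ψ e.2 := by
    intro e he
    have := Finset.prod_ne_zero_iff.1 hω e (Finset.mem_univ e)
    rw [if_pos he] at this
    exact openProb_pos_of_ne this
  have key : ∀ i, eConn ω x i → x ≠ i → 0 < ψ x ∧ 0 < ψ i := by
    intro i hi
    induction hi with
    | refl => intro h; exact absurd rfl h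
    | @tail b d hb hbd ih =>
      intro _
      have hbd' : 0 < ψ b ∧ 0 < ψ d := by
        rcases hbd with hh | hh
        · exact hpos _ hh
        · exact (hpos _ hh).symm
      by_cases hxb : x = b
      · rw [hxb]; exact hbd'
      · exact ⟨(ih hxb).1, hbd'.2⟩
  intro i hi
  by_cases hxi : x = i
  · rw [← hxi]
    rw [← hA, mem_eCluster] at hy
    exact (key y hy hxy).1
  · rw [← hA, mem_eCluster] at hi
    exact (key i hi hxi).2

lemma bernProb_eConn_eq_sum (p : ι × ι → ℝ) (x y : ι) :
    bernProb p (fun ω => eConn ω x y) =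
      ∑ A with y ∈ A, bernProb p fun ω => eCluster ω x = A := by
  simp only [bernProb]
  rw [Finset.sum_comm]
  refine Finset.sum_congr rfl fun ω _ => ?_
  refine Eq.trans ?_ (sum_ite_eq_of_decidable _ _ _).symm
  simp [mem_eCluster]

lemma sum_clusterProb (c : ι × ι → ℝ) (x : ι) (ψ : ι → ℝ) :
    ∑ A, clusterProb c x A ψ = 1 := by
  rw [← bernProb_true (openProb c ψ)]
  simp only [clusterProb, bernProb]
  rw [Finset.sum_comm]
  refine Finset.sum_congr rfl fun ω _ => ?_
  refine (sum_ite_eq_of_decidable _ _ _).trans ?_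
  simp

lemma prod_bdry_eq (c : ι × ι → ℝ) (A : Finset ι) (ψ : ι → ℝ) (hψ : ∀ i ∈ A, 0 ≤ ψ i) :
    ∏ e ∈ edgeBdry A, (1 - openProb c ψ e) =
      Real.exp (-∑ i ∈ A, ∑ j ∈ Aᶜ, 2 * (c (i, j) + c (j, i)) * ψ i * max (ψ j) 0) := by
  simp only [openProb, sub_sub_cancel]
  rw [← Real.exp_sum]
  congr 1
  rw [Finset.sum_neg_distrib]
  congr 1
  have hsplit : edgeBdry A = (A ×ˢ Aᶜ) ∪ (Aᶜ ×ˢ A) := by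
    ext e
    simp only [edgeBdry, Finset.mem_filter, Finset.mem_univ, true_and, Finset.mem_union,
      Finset.mem_product, Finset.mem_compl]
  have hd : Disjoint (A ×ˢ Aᶜ) (Aᶜ ×ˢ A) := by
    rw [Finset.disjoint_left]
    intro e he
    simp only [Finset.mem_product, Finset.mem_compl] at he ⊢
    tauto
  rw [hsplit, Finset.sum_union hd, Finset.sum_product, Finset.sum_product_right,
    ← Finset.sum_add_distrib]
  refine Finset.sum_congr rfl fun i hi => ?_
  rw [← Finset.sum_add_distrib]
  refine Finset.sum_congr rfl fun j _ => ?_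
  simp only [max_eq_left (hψ i hi)]
  ring

end FiniteClusters

section IsingModel

set_option linter.unusedSectionVars false

variable {ι : Type*} [Fintype ι] [DecidableEq ι]

/-- The real value of a spin. -/
def spin (σ : ι → ℤˣ) (i : ι) : ℝ := ((σ i : ℤ) : ℝ)

lemma spin_sq (σ : ι → ℤˣ) (i : ι) : spin σ i * spin σ i = 1 := by
  rcases Int.units_eq_one_or (σ i) with h | h <;> simp [spin, h]

lemma spin_mul (σ τ : ι → ℤˣ) (i : ι) : spin (σ * τ) i = spin σ i * spin τ i := by
  simp [spin]

lemma spin_eq_or (σ : ι → ℤˣ) (i : ι) : spin σ i = 1 ∨ spin σ i = -1 := by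
  rcases Int.units_eq_one_or (σ i) with h | h <;> simp [spin, h]

lemma spin_mul_spin (σ : ι → ℤˣ) (i j : ι) :
    spin σ i * spin σ j = if σ i = σ j then 1 else -1 := by
  rcases Int.units_eq_one_or (σ i) with h | h <;> rcases Int.units_eq_one_or (σ j) with h' | h' <;>
    simp [spin, h, h']

/-- Monomials in the spins. -/
def spinMon (m : ι → ℕ) (σ : ι → ℤˣ) : ℝ := ∏ i, spin σ i ^ m i

lemma spinMon_mul (m : ι → ℕ) (σ τ : ι → ℤˣ) : spinMon m (σ * τ) = spinMon m σ * spinMon m τ := by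
  simp only [spinMon, spin_mul, mul_pow, Finset.prod_mul_distrib]

lemma spinMon_add (m m' : ι → ℕ) (σ : ι → ℤˣ) :
    spinMon (m + m') σ = spinMon m σ * spinMon m' σ := by
  simp only [spinMon, Pi.add_apply, pow_add, Finset.prod_mul_distrib]

lemma spinMon_pair (i j : ι) (σ : ι → ℤˣ) :
    spinMon (Pi.single i 1 + Pi.single j 1) σ = spin σ i * spin σ j := by
  rw [spinMon_add]
  congr 1
  · rw [spinMon, Finset.prod_eq_single i] <;> simp +contextual
  · rw [spinMon, Finset.prod_eq_single j] <;> simp +contextual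

lemma spinMon_le_one (m : ι → ℕ) (σ : ι → ℤˣ) : spinMon m σ ≤ 1 := by
  refine (le_abs_self _).trans ?_
  rw [spinMon, Finset.abs_prod]
  refine Finset.prod_le_one (fun _ _ => abs_nonneg _) fun i _ => ?_
  rcases spin_eq_or σ i with h | h <;> simp [h]

lemma sum_spinMon_nonneg (m : ι → ℕ) : 0 ≤ ∑ σ : ι → ℤˣ, spinMon m σ := by
  have h := Finset.prod_univ_sum (fun _ : ι => (Finset.univ : Finset ℤˣ))
    fun i s => (((s : ℤ) : ℝ)) ^ m i
  rw [Fintype.piFinset_univ] at h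
  have h2 : ∑ σ : ι → ℤˣ, spinMon m σ = ∏ i, ∑ s : ℤˣ, (((s : ℤ) : ℝ)) ^ m i := h.symm
  rw [h2]
  refine Finset.prod_nonneg fun i _ => ?_
  rw [show (Finset.univ : Finset ℤˣ) = {1, -1} from rfl, Finset.sum_pair (by decide)]
  rcases neg_one_pow_eq_or ℝ (m i) with h | h <;> simp [h]

/-- The Boltzmann weight of the Ising model with couplings `J`. -/
def isingWt (J : ι × ι → ℝ) (σ : ι → ℤˣ) : ℝ :=
  Real.exp (∑ e, J e * (spin σ e.1 * spin σ e.2))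

lemma isingWt_pos (J : ι × ι → ℝ) (σ : ι → ℤˣ) : 0 < isingWt J σ := Real.exp_pos _

lemma isingWt_add (J K : ι × ι → ℝ) (σ : ι → ℤˣ) :
    isingWt (J + K) σ = isingWt J σ * isingWt K σ := by
  simp only [isingWt, ← Real.exp_add, ← Finset.sum_add_distrib, Pi.add_apply, add_mul]

lemma exp_mul_sign {t s : ℝ} (hs : s = 1 ∨ s = -1) :
    Real.exp (t * s) = Real.cosh t + Real.sinh t * s := by
  rcases hs with h | h
  · simp [h, Real.cosh_add_sinh]
  · rw [h, mul_neg_one, mul_neg_one, ← sub_eq_add_neg, Real.cosh_sub_sinh]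

/-- A convex cone of functions containing all monomials contains all products of monomials and
ferromagnetic Boltzmann weights. -/
lemma isingWt_induction (R : ((ι → ℤˣ) → ℝ) → Prop)
    (hadd : ∀ f g, R f → R g → R fun σ => f σ + g σ)
    (hsmul : ∀ (c : ℝ) f, 0 ≤ c → R f → R fun σ => c * f σ)
    (hmon : ∀ m, R (spinMon m)) (J : ι × ι → ℝ) (hJ : ∀ e, 0 ≤ J e) (m : ι → ℕ) :
    R fun σ => spinMon m σ * isingWt J σ := by
  have key : ∀ s : Finset (ι × ι), ∀ m, R fun σ =>
      spinMon m σ * ∏ e ∈ s, Real.exp (J e * (spin σ e.1 * spin σ e.2)) := by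
    intro s
    induction s using Finset.induction_on with
    | empty => intro m; simpa using hmon m
    | insert e s he ih =>
      intro m
      have h1 := hsmul (Real.cosh (J e)) _ (Real.cosh_pos _).le (ih m)
      have h2 := hsmul (Real.sinh (J e)) _ (Real.sinh_nonneg_iff.2 (hJ e))
        (ih (m + (Pi.single e.1 1 + Pi.single e.2 1)))
      convert hadd _ _ h1 h2 using 2 with σ
      rw [Finset.prod_insert he, exp_mul_sign, spinMon_add m, spinMon_pair]
      · ring
      · rw [spin_mul_spin]; split_ifs <;> simp
  have := key Finset.univ m
  simpa only [isingWt, Real.exp_sum] using this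

/-- Griffiths' first inequality. -/
lemma griffiths_first (J : ι × ι → ℝ) (hJ : ∀ e, 0 ≤ J e) (m : ι → ℕ) :
    0 ≤ ∑ σ, spinMon m σ * isingWt J σ := by
  refine isingWt_induction (fun f => 0 ≤ ∑ σ, f σ) ?_ ?_ sum_spinMon_nonneg J hJ m
  · intro f g hf hg
    simpa [Finset.sum_add_distrib] using add_nonneg hf hg
  · intro c f hc hf
    simpa [← Finset.mul_sum] using mul_nonneg hc hf

/-- The partition function. -/
def isingZ (J : ι × ι → ℝ) : ℝ := ∑ σ, isingWt J σ

lemma isingZ_pos (J : ι × ι → ℝ) : 0 < isingZ J :=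
  Finset.sum_pos (fun σ _ => isingWt_pos J σ) ⟨1, Finset.mem_univ _⟩

lemma griffiths_mono_mon (J K : ι × ι → ℝ) (hJ : ∀ e, 0 ≤ J e) (hK : ∀ e, 0 ≤ K e) (m : ι → ℕ) :
    (∑ σ, spinMon m σ * isingWt J σ) * isingZ (J + K) ≤
      (∑ σ, spinMon m σ * isingWt (J + K) σ) * isingZ J := by
  rw [← sub_nonneg]
  have h1 : (∑ σ, spinMon m σ * isingWt (J + K) σ) * isingZ J -
      (∑ σ, spinMon m σ * isingWt J σ) * isingZ (J + K) =
      ∑ σ : ι → ℤˣ, ∑ τ : ι → ℤˣ, (spinMon m σ - spinMon m τ) * isingWt K σ *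
        (isingWt J σ * isingWt J τ) := by
    simp only [isingZ]
    rw [mul_comm (∑ σ, spinMon m σ * isingWt J σ)]
    simp only [Finset.sum_mul_sum, isingWt_add]
    rw [← Finset.sum_sub_distrib]
    refine Finset.sum_congr rfl fun σ _ => ?_
    rw [← Finset.sum_sub_distrib]
    refine Finset.sum_congr rfl fun τ _ => ?_
    ring
  rw [h1]
  have h2 : ∀ σ : ι → ℤˣ, ∑ τ : ι → ℤˣ, (spinMon m σ - spinMon m τ) * isingWt K σ *
        (isingWt J σ * isingWt J τ) = ∑ ρ : ι → ℤˣ, (1 - spinMon m ρ) *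
          (spinMon m σ * isingWt (fun e => K e + J e * (1 + spin ρ e.1 * spin ρ e.2)) σ) := by
    intro σ
    rw [← Equiv.sum_comp (Equiv.mulLeft σ)]
    refine Finset.sum_congr rfl fun ρ _ => ?_
    simp only [Equiv.coe_mulLeft, spinMon_mul]
    have : isingWt (fun e => K e + J e * (1 + spin ρ e.1 * spin ρ e.2)) σ =
        isingWt K σ * (isingWt J σ * isingWt J (σ * ρ)) := by
      simp only [isingWt, ← Real.exp_add, ← Finset.sum_add_distrib, spin_mul]
      congr 1
      refine Finset.sum_congr rfl fun e _ => ?_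
      ring
    rw [this]
    ring
  simp only [h2]
  rw [Finset.sum_comm]
  refine Finset.sum_nonneg fun ρ _ => ?_
  rw [← Finset.mul_sum]
  refine mul_nonneg (sub_nonneg.2 (spinMon_le_one m ρ)) (griffiths_first _ (fun e => ?_) m)
  refine add_nonneg (hK e) (mul_nonneg (hJ e) ?_)
  rw [spin_mul_spin]
  split_ifs <;> norm_num

/-- Two-point functions of ferromagnetic Ising models. -/
def isingNum (J : ι × ι → ℝ) (x y : ι) : ℝ := ∑ σ, spin σ x * spin σ y * isingWt J σ

lemma isingNum_nonneg (J : ι × ι → ℝ) (hJ : ∀ e, 0 ≤ J e) (x y : ι) : 0 ≤ isingNum J x y := by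
  have := griffiths_first J hJ (Pi.single x 1 + Pi.single y 1)
  simpa only [spinMon_pair, isingNum] using this

/-- Griffiths' second inequality for two-point functions. -/
lemma griffiths_second (J J' : ι × ι → ℝ) (hJ : ∀ e, 0 ≤ J e) (h : ∀ e, J e ≤ J' e) (x y : ι) :
    isingNum J x y * isingZ J' ≤ isingNum J' x y * isingZ J := by
  have := griffiths_mono_mon J (J' - J) hJ (fun e => sub_nonneg.2 (h e))
    (Pi.single x 1 + Pi.single y 1)
  simpa only [spinMon_pair, add_sub_cancel, isingNum] using this

/-- Griffiths' second inequality for partition functions. -/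
lemma isingZ_ratio_mono (J J' K : ι × ι → ℝ) (hJ : ∀ e, 0 ≤ J e) (h : ∀ e, J e ≤ J' e)
    (hK : ∀ e, 0 ≤ K e) : isingZ (J + K) * isingZ J' ≤ isingZ (J' + K) * isingZ J := by
  have key := isingWt_induction (fun f => (∑ σ, f σ * isingWt J σ) * isingZ J' ≤
      (∑ σ, f σ * isingWt J' σ) * isingZ J) ?_ ?_ ?_ K hK 0
  · simp only [isingZ, isingWt_add] at key ⊢
    simpa [spinMon, mul_comm] using key
  · intro f g hf hg
    simp only [add_mul, Finset.sum_add_distrib]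
    exact add_le_add hf hg
  · intro c f hc hf
    have h1 : ∀ K : ι × ι → ℝ, ∑ σ, c * f σ * isingWt K σ = c * ∑ σ, f σ * isingWt K σ := by
      intro K
      rw [Finset.mul_sum]
      exact Finset.sum_congr rfl fun σ _ => mul_assoc _ _ _
    rw [h1, h1, mul_assoc, mul_assoc]
    exact mul_le_mul_of_nonneg_left hf hc
  · intro m
    have := griffiths_mono_mon J (J' - J) hJ (fun e => sub_nonneg.2 (h e)) m
    simpa only [add_sub_cancel] using this

lemma isingZ_mono (J J' : ι × ι → ℝ) (hJ : ∀ e, 0 ≤ J e) (h : ∀ e, J e ≤ J' e) :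
    isingZ J ≤ isingZ J' := by
  have h2 := isingZ_ratio_mono 0 J (J' - J) (fun _ => le_rfl) hJ (fun e => sub_nonneg.2 (h e))
  rw [zero_add, add_sub_cancel] at h2
  have h3 : isingZ (0 : ι × ι → ℝ) ≤ isingZ (J' - J) := by
    have h5 : ∀ σ : ι → ℤˣ, isingWt (0 : ι × ι → ℝ) σ = 1 := by intro σ; simp [isingWt]
    simp only [isingZ, h5]
    have h6 : ∀ σ : ι → ℤˣ, 1 + ∑ e, (J' - J) e * (spin σ e.1 * spin σ e.2) ≤
        isingWt (J' - J) σ := by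
      intro σ
      rw [add_comm]
      exact Real.add_one_le_exp _
    refine le_trans ?_ (Finset.sum_le_sum fun σ _ => h6 σ)
    rw [Finset.sum_add_distrib, le_add_iff_nonneg_right, Finset.sum_comm]
    refine Finset.sum_nonneg fun e _ => ?_
    rw [← Finset.mul_sum]
    refine mul_nonneg (sub_nonneg.2 (h e)) ?_
    have := sum_spinMon_nonneg (ι := ι) (Pi.single e.1 1 + Pi.single e.2 1)
    simpa only [spinMon_pair] using this
  have hz := isingZ_pos (0 : ι × ι → ℝ)
  have hJ' := (isingZ_pos J')
  have hJJ := (isingZ_pos J)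
  have : isingZ (0 : ι × ι → ℝ) * isingZ J ≤ isingZ J' * isingZ 0 :=
    (mul_le_mul_of_nonneg_right h3 hJJ.le).trans h2
  nlinarith

end IsingModel

section RandomCluster

set_option linter.unusedSectionVars false

variable {ι : Type*} [Fintype ι] [DecidableEq ι]

/-- The spin configurations which are constant along the edges of `ω`. -/
def fkSpins (ω : Finset (ι × ι)) : Finset (ι → ℤˣ) :=
  Finset.univ.filter fun σ => ∀ e ∈ ω, σ e.1 = σ e.2

lemma mem_fkSpins {ω : Finset (ι × ι)} {σ : ι → ℤˣ} :
    σ ∈ fkSpins ω ↔ ∀ e ∈ ω, σ e.1 = σ e.2 := by simp [fkSpins]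

/-- The edge weights in the random cluster representation. -/
def fkW (J : ι × ι → ℝ) (ω : Finset (ι × ι)) : ℝ :=
  ∏ e, if e ∈ ω then Real.exp (J e) - Real.exp (-J e) else Real.exp (-J e)

lemma fkW_nonneg {J : ι × ι → ℝ} (hJ : ∀ e, 0 ≤ J e) (ω : Finset (ι × ι)) : 0 ≤ fkW J ω := by
  refine Finset.prod_nonneg fun e _ => ?_
  split_ifs
  · exact sub_nonneg.2 (Real.exp_le_exp.2 (by linarith [hJ e]))
  · exact (Real.exp_pos _).le

lemma fkW_inter_union (J : ι × ι → ℝ) (ω ω' : Finset (ι × ι)) :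
    fkW J (ω ∩ ω') * fkW J (ω ∪ ω') = fkW J ω * fkW J ω' := by
  simp only [fkW, ← Finset.prod_mul_distrib]
  refine Finset.prod_congr rfl fun e _ => ?_
  by_cases h : e ∈ ω <;> by_cases h' : e ∈ ω' <;> simp [h, h', mul_comm]

lemma isingWt_eq_sum_fkW (J : ι × ι → ℝ) (σ : ι → ℤˣ) :
    isingWt J σ = ∑ ω, if σ ∈ fkSpins ω then fkW J ω else 0 := by
  have h1 : isingWt J σ = ∏ e, ((if σ e.1 = σ e.2 then Real.exp (J e) - Real.exp (-J e) else 0) +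
      Real.exp (-J e)) := by
    rw [isingWt, Real.exp_sum]
    refine Finset.prod_congr rfl fun e _ => ?_
    rw [spin_mul_spin]
    split_ifs <;> simp
  rw [h1, prod_add_eq_sum]
  refine Finset.sum_congr rfl fun ω _ => ?_
  split_ifs with h
  · rw [mem_fkSpins] at h
    refine Finset.prod_congr rfl fun e _ => ?_
    by_cases he : e ∈ ω
    · simp [he, h e he]
    · simp [he]
  · rw [mem_fkSpins] at h
    push Not at h
    obtain ⟨e, he, hne⟩ := h
    exact Finset.prod_eq_zero (Finset.mem_univ e) (by simp [he, hne])

/-- The number of spin configurations compatible with `ω`. -/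
def fkN (ω : Finset (ι × ι)) : ℝ := (fkSpins ω).card

lemma fkN_nonneg (ω : Finset (ι × ι)) : 0 ≤ fkN ω := Nat.cast_nonneg _

lemma units_mul_self_fun (σ : ι → ℤˣ) : σ * σ = 1 := by
  ext i; simp

lemma fkN_supermodular (ω ω' : Finset (ι × ι)) :
    fkN ω * fkN ω' ≤ fkN (ω ∩ ω') * fkN (ω ∪ ω') := by
  simp only [fkN]
  rw [← Nat.cast_mul, ← Nat.cast_mul, Nat.cast_le, ← Finset.card_product, mul_comm]
  refine Finset.card_le_mul_card_image_of_maps_to (f := fun p : (ι → ℤˣ) × (ι → ℤˣ) => p.1 * p.2)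
    ?_ _ ?_
  · intro p hp
    rw [Finset.mem_product, mem_fkSpins, mem_fkSpins] at hp
    rw [mem_fkSpins]
    intro e he
    rw [Finset.mem_inter] at he
    simp [hp.1 e he.1, hp.2 e he.2]
  · intro τ _
    rcases Finset.eq_empty_or_nonempty
      ((fkSpins ω ×ˢ fkSpins ω').filter fun p : (ι → ℤˣ) × (ι → ℤˣ) => p.1 * p.2 = τ) with h0 | h0
    · rw [h0]; simp
    obtain ⟨p₀, hp₀⟩ := h0
    rw [Finset.mem_filter, Finset.mem_product, mem_fkSpins, mem_fkSpins] at hp₀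
    refine Finset.card_le_card_of_injOn (fun p => p.1 * p₀.1) ?_ ?_
    · intro p hp
      have hp := Finset.mem_coe.1 hp
      rw [Finset.mem_filter, Finset.mem_product, mem_fkSpins, mem_fkSpins] at hp
      refine Finset.mem_coe.2 (mem_fkSpins.2 fun e he => ?_)
      rcases Finset.mem_union.1 he with he | he
      · simp [hp.1.1 e he, hp₀.1.1 e he]
      · have : p.1 * p₀.1 = p.2 * p₀.2 := by
          have h1 : p.1 * p.2 = p₀.1 * p₀.2 := hp.2.trans hp₀.2.symm
          calc p.1 * p₀.1 = p.1 * p.2 * (p.2 * p₀.1) := by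
                rw [mul_assoc, ← mul_assoc p.2, units_mul_self_fun, one_mul]
            _ = (p₀.1 * p₀.1) * (p.2 * p₀.2) := by
                rw [h1, mul_comm p.2 p₀.1, mul_mul_mul_comm, mul_comm p₀.2]
            _ = p.2 * p₀.2 := by rw [units_mul_self_fun, one_mul]
        simp only [this]
        simp [hp.1.2 e he, hp₀.1.2 e he]
    · intro p hp q hq hpq
      have hp := Finset.mem_coe.1 hp
      have hq := Finset.mem_coe.1 hq
      rw [Finset.mem_filter] at hp hq
      have h1 : p.1 = q.1 := mul_right_cancel hpq
      have h2 : p.2 = q.2 := by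
        have := hp.2.trans hq.2.symm
        rw [h1] at this
        exact mul_left_cancel this
      exact Prod.ext h1 h2

lemma isingZ_eq_sum_fk (J : ι × ι → ℝ) : isingZ J = ∑ ω, fkW J ω * fkN ω := by
  simp only [isingZ, isingWt_eq_sum_fkW]
  rw [Finset.sum_comm]
  refine Finset.sum_congr rfl fun ω _ => ?_
  rw [← Finset.sum_filter, Finset.sum_const, nsmul_eq_mul, mul_comm, fkN]
  congr 3
  ext; simp

lemma fkSpins_eConn {ω : Finset (ι × ι)} {σ : ι → ℤˣ} (hσ : σ ∈ fkSpins ω) {x y : ι}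
    (h : eConn ω x y) : σ x = σ y := by
  rw [mem_fkSpins] at hσ
  induction h with
  | refl => rfl
  | tail _ hbc ih =>
    rw [ih]
    rcases hbc with h | h
    · exact hσ _ h
    · exact (hσ _ h).symm

lemma sum_fkSpins_pair (ω : Finset (ι × ι)) (x y : ι) :
    ∑ σ ∈ fkSpins ω, spin σ x * spin σ y = if eConn ω x y then fkN ω else 0 := by
  split_ifs with h
  · rw [fkN, Finset.card_eq_sum_ones, Nat.cast_sum]
    refine Finset.sum_congr rfl fun σ hσ => ?_
    rw [spin_mul_spin, if_pos (fkSpins_eConn hσ h), Nat.cast_one]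
  · set τ : ι → ℤˣ := fun i => if eConn ω x i then -1 else 1 with hτ
    have hτω : ∀ e ∈ ω, τ e.1 = τ e.2 := by
      intro e he
      have : eConn ω x e.1 ↔ eConn ω x e.2 :=
        ⟨fun hc => hc.tail (Or.inl he), fun hc => hc.tail (Or.inr he)⟩
      simp only [hτ, this]
    have hsum : ∑ σ ∈ fkSpins ω, spin σ x * spin σ y =
        ∑ σ ∈ fkSpins ω, -(spin σ x * spin σ y) := by
      refine Finset.sum_bij' (fun σ _ => σ * τ) (fun σ _ => σ * τ) ?_ ?_ ?_ ?_ ?_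
      · intro σ hσ
        rw [mem_fkSpins] at hσ ⊢
        intro e he
        simp [hσ e he, hτω e he]
      · intro σ hσ
        rw [mem_fkSpins] at hσ ⊢
        intro e he
        simp [hσ e he, hτω e he]
      · intro σ _
        rw [mul_assoc, units_mul_self_fun, mul_one]
      · intro σ _
        rw [mul_assoc, units_mul_self_fun, mul_one]
      · intro σ _
        have hx : τ x = -1 := by simp [hτ, eConn, Relation.ReflTransGen.refl]
        have hy : τ y = 1 := by simp [hτ, h]
        rw [spin_mul, spin_mul]
        simp [spin, hx, hy]
    rw [Finset.sum_neg_distrib] at hsum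
    linarith

lemma isingNum_eq_sum_fk (J : ι × ι → ℝ) (x y : ι) :
    isingNum J x y = ∑ ω, if eConn ω x y then fkW J ω * fkN ω else 0 := by
  simp only [isingNum, isingWt_eq_sum_fkW, Finset.mul_sum]
  rw [Finset.sum_comm]
  refine Finset.sum_congr rfl fun ω _ => ?_
  have h1 : ∑ σ, spin σ x * spin σ y * (if σ ∈ fkSpins ω then fkW J ω else 0) =
      (∑ σ ∈ fkSpins ω, spin σ x * spin σ y) * fkW J ω := by
    rw [Finset.sum_mul, ← Finset.sum_filter_add_sum_filter_not Finset.univ (· ∈ fkSpins ω)]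
    have h0 : ∑ σ with σ ∉ fkSpins ω, spin σ x * spin σ y *
        (if σ ∈ fkSpins ω then fkW J ω else 0) = 0 :=
      Finset.sum_eq_zero fun σ hσ => by
        rw [if_neg (Finset.mem_filter.1 hσ).2, mul_zero]
    rw [h0, add_zero]
    refine Finset.sum_congr (by ext; simp) fun σ hσ => by rw [if_pos hσ]
  rw [h1, sum_fkSpins_pair]
  split_ifs
  · ring
  · ring

/-- Comparison of the random cluster model with its restriction to a set of edges. -/
lemma fk_restrict_le (J : ι × ι → ℝ) (hJ : ∀ e, 0 ≤ J e) (E' : Finset (ι × ι)) (x y : ι) :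
    isingNum (fun e => if e ∈ E' then J e else 0) x y * isingZ J ≤
      (∑ ω, if eConn (ω ∩ E') x y then fkW J ω * fkN ω else 0) *
        isingZ (fun e => if e ∈ E' then J e else 0) := by
  set J' : ι × ι → ℝ := fun e => if e ∈ E' then J e else 0 with hJ'
  set K := ∏ e, if e ∈ E' then 1 else Real.exp (-J e) with hK
  have hKpos : 0 < K := Finset.prod_pos fun e _ => by split_ifs <;> positivity
  have hW : ∀ ω, K * fkW J' ω = if ω ⊆ E' then fkW J ω else 0 := by
    intro ω
    rw [hK, fkW, ← Finset.prod_mul_distrib]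
    split_ifs with h
    · refine Finset.prod_congr rfl fun e _ => ?_
      by_cases he : e ∈ ω
      · simp [hJ', he, h he]
      · by_cases he' : e ∈ E' <;> simp [hJ', he, he']
    · rw [Finset.not_subset] at h
      obtain ⟨e, he, he'⟩ := h
      exact Finset.prod_eq_zero (Finset.mem_univ e) (by simp [hJ', he, he'])
  set f₁ : Finset (ι × ι) → ℝ := fun ω => if eConn ω x y then K * fkW J' ω * fkN ω else 0
  set f₂ : Finset (ι × ι) → ℝ := fun ω => fkW J ω * fkN ω
  set f₃ : Finset (ι × ι) → ℝ := fun ω => K * fkW J' ω * fkN ω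
  set f₄ : Finset (ι × ι) → ℝ := fun ω => if eConn (ω ∩ E') x y then fkW J ω * fkN ω else 0
  have hJ'0 : ∀ e, 0 ≤ J' e := fun e => by simp only [hJ']; split_ifs; exacts [hJ e, le_rfl]
  have p₂ : 0 ≤ f₂ := fun ω => mul_nonneg (fkW_nonneg hJ ω) (fkN_nonneg ω)
  have p₃ : 0 ≤ f₃ := fun ω =>
    mul_nonneg (mul_nonneg hKpos.le (fkW_nonneg hJ'0 ω)) (fkN_nonneg ω)
  have p₁ : 0 ≤ f₁ := fun ω => by
    simp only [f₁, Pi.zero_apply]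
    split_ifs
    · exact p₃ ω
    · exact le_rfl
  have p₄ : 0 ≤ f₄ := fun ω => by
    simp only [f₄, Pi.zero_apply]
    split_ifs
    · exact p₂ ω
    · exact le_rfl
  have h4 := four_functions_theorem_univ f₁ f₂ f₃ f₄ p₁ p₂ p₃ p₄ (by
    intro ω ω'
    by_cases hc : eConn ω x y
    · by_cases hs : ω ⊆ E'
      · have hs' : ω ⊓ ω' ⊆ E' := (Finset.inter_subset_left).trans hs
        have hc' : eConn ((ω ⊔ ω') ∩ E') x y :=
          eConn_mono (Finset.subset_inter Finset.subset_union_left hs) hc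
        simp only [f₁, f₂, f₃, f₄, hc, hc', if_true, hW, hs, hs']
        have := fkW_inter_union J ω ω'
        calc fkW J ω * fkN ω * (fkW J ω' * fkN ω') =
              (fkW J ω * fkW J ω') * (fkN ω * fkN ω') := by ring
          _ ≤ (fkW J ω * fkW J ω') * (fkN (ω ∩ ω') * fkN (ω ∪ ω')) :=
              mul_le_mul_of_nonneg_left (fkN_supermodular ω ω')
                (mul_nonneg (fkW_nonneg hJ _) (fkW_nonneg hJ _))
          _ = fkW J (ω ⊓ ω') * fkN (ω ⊓ ω') * (fkW J (ω ⊔ ω') * fkN (ω ⊔ ω')) := by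
              rw [← this]; simp only [Finset.inf_eq_inter, Finset.sup_eq_union]; ring
      · have : f₁ ω = 0 := by simp [f₁, hW, hs]
        rw [this, zero_mul]
        exact mul_nonneg (p₃ _) (p₄ _)
    · have : f₁ ω = 0 := by simp [f₁, hc]
      rw [this, zero_mul]
      exact mul_nonneg (p₃ _) (p₄ _))
  have e₁ : ∑ ω, f₁ ω = K * isingNum J' x y := by
    rw [isingNum_eq_sum_fk, Finset.mul_sum]
    refine Finset.sum_congr rfl fun ω _ => ?_
    simp only [f₁]
    split_ifs
    · ring
    · ring
  have e₂ : ∑ ω, f₂ ω = isingZ J := (isingZ_eq_sum_fk J).symm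
  have e₃ : ∑ ω, f₃ ω = K * isingZ J' := by
    rw [isingZ_eq_sum_fk, Finset.mul_sum]
    exact Finset.sum_congr rfl fun ω _ => mul_assoc _ _ _
  rw [e₁, e₂, e₃] at h4
  have : K * (isingNum J' x y * isingZ J) ≤ K * ((∑ ω, f₄ ω) * isingZ J') := by
    linarith
  exact le_of_mul_le_mul_left this hKpos

lemma openProb_eq_agree {c : ι × ι → ℝ} {r : ι → ℝ} (hr : ∀ i, 0 ≤ r i) {σ : ι → ℤˣ}
    {e : ι × ι} (h1 : σ e.1 = 1) (h2 : σ e.2 = 1) :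
    openProb c (fun i => spin σ i * r i) e =
      1 - Real.exp (-(2 * (c e * r e.1 * r e.2))) := by
  simp only [openProb, spin, h1, h2, Units.val_one, Int.cast_one, one_mul, max_eq_left (hr _)]
  ring_nf

/-- Opening probabilities, ignoring signs, along edges with agreeing spins. -/
def agreeProb (J : ι × ι → ℝ) (σ : ι → ℤˣ) (e : ι × ι) : ℝ :=
  if σ e.1 = σ e.2 then 1 - Real.exp (-(2 * J e)) else 0

lemma agreeProb_nonneg {J : ι × ι → ℝ} (hJ : ∀ e, 0 ≤ J e) (σ : ι → ℤˣ) (e) :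
    0 ≤ agreeProb J σ e := by
  unfold agreeProb
  split_ifs
  · exact sub_nonneg.2 (Real.exp_le_one_iff.2 (by linarith [hJ e]))
  · exact le_rfl

lemma agreeProb_le_one (J : ι × ι → ℝ) (σ : ι → ℤˣ) (e) : agreeProb J σ e ≤ 1 := by
  unfold agreeProb
  split_ifs
  · linarith [Real.exp_pos (-(2 * J e))]
  · exact zero_le_one

lemma isingWt_mul_agree (J : ι × ι → ℝ) (σ : ι → ℤˣ) (ω : Finset (ι × ι)) :
    isingWt J σ * bernWeight (agreeProb J σ) ω = if σ ∈ fkSpins ω then fkW J ω else 0 := by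
  rw [isingWt, Real.exp_sum, bernWeight, ← Finset.prod_mul_distrib]
  have hexp : ∀ t : ℝ, Real.exp t * Real.exp (-(2 * t)) = Real.exp (-t) := fun t => by
    rw [← Real.exp_add]; ring_nf
  split_ifs with h
  · rw [mem_fkSpins] at h
    refine Finset.prod_congr rfl fun e _ => ?_
    rw [spin_mul_spin]
    by_cases he : e ∈ ω
    · simp only [he, if_true, h e he, agreeProb, mul_one, mul_sub, hexp]
    · by_cases ha : σ e.1 = σ e.2
      · simp only [he, if_false, ha, if_true, agreeProb, mul_one, sub_sub_cancel, hexp]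
      · simp [he, ha, agreeProb]
  · rw [mem_fkSpins] at h
    push Not at h
    obtain ⟨e, he, hne⟩ := h
    exact Finset.prod_eq_zero (Finset.mem_univ e) (by simp [he, hne, agreeProb])

lemma bernWeight_ne_zero {p : ι × ι → ℝ} {ω : Finset (ι × ι)} (h : bernWeight p ω ≠ 0)
    {e : ι × ι} (he : e ∈ ω) : p e ≠ 0 := by
  have := Finset.prod_ne_zero_iff.1 h e (Finset.mem_univ e)
  rwa [if_pos he] at this

lemma bernProb_openProb_agree {c : ι × ι → ℝ} (hc : ∀ e, 0 ≤ c e) {r : ι → ℝ}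
    (hr : ∀ i, 0 ≤ r i) (σ : ι → ℤˣ) (E' : Finset (ι × ι)) {x y : ι} (hxy : x ≠ y) :
    bernProb (openProb c fun i => spin σ i * r i) (fun ω => eConn (ω ∩ E') x y) =
      if σ x = 1 then
        bernProb (agreeProb (fun e => c e * r e.1 * r e.2) σ) (fun ω => eConn (ω ∩ E') x y)
      else 0 := by
  set J : ι × ι → ℝ := fun e => c e * r e.1 * r e.2
  have hJ : ∀ e, 0 ≤ J e := fun e => mul_nonneg (mul_nonneg (hc e) (hr _)) (hr _)
  set ψ : ι → ℝ := fun i => spin σ i * r i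
  have hpos : ∀ e, openProb c ψ e ≠ 0 → σ e.1 = 1 ∧ σ e.2 = 1 := by
    intro e he
    have h := openProb_pos_of_ne he
    have key : ∀ i, 0 < ψ i → σ i = 1 := by
      intro i hi
      rcases Int.units_eq_one_or (σ i) with h | h
      · exact h
      · have : ψ i = -r i := by simp [ψ, spin, h]
        linarith [hr i]
    exact ⟨key _ h.1, key _ h.2⟩
  set T : Finset (ι × ι) := Finset.univ.filter fun e => σ e.1 = 1 ∧ σ e.2 = 1 with hT
  have p0 := openProb_nonneg hc ψ
  have p1 := openProb_le_one c ψ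
  split_ifs with hx
  · have q0 := agreeProb_nonneg hJ σ
    have q1 := agreeProb_le_one J σ
    have hcyl : ∀ ω : Finset (ι × ι), eConn (ω ∩ E' ∩ T) x y ↔ eConn (ω ∩ T ∩ E' ∩ T) x y := by
      intro ω
      rw [show ω ∩ T ∩ E' ∩ T = ω ∩ E' ∩ T by ext; simp]
    have hmid : bernProb (openProb c ψ) (fun ω => eConn (ω ∩ E' ∩ T) x y) =
        bernProb (agreeProb J σ) (fun ω => eConn (ω ∩ E' ∩ T) x y) := by
      refine bernProb_congr_on T _ hcyl fun e he => ?_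
      rw [hT, Finset.mem_filter] at he
      rw [openProb_eq_agree hr he.2.1 he.2.2, agreeProb, if_pos (he.2.1.trans he.2.2.symm)]
    have hsub : ∀ ω : Finset (ι × ι), eConn (ω ∩ E' ∩ T) x y → eConn (ω ∩ E') x y :=
      fun ω => eConn_mono Finset.inter_subset_left
    apply le_antisymm
    · refine (bernProb_mono p0 p1 fun ω hw hQ => ?_).trans
        (hmid.le.trans (bernProb_mono q0 q1 fun ω _ => hsub ω))
      have : ω ∩ E' ∩ T = ω ∩ E' := Finset.inter_eq_left.2 fun e he => by
        rw [hT, Finset.mem_filter]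
        exact ⟨Finset.mem_univ _, hpos e (bernWeight_ne_zero hw (Finset.mem_inter.1 he).1)⟩
      rwa [this]
    · refine (bernProb_mono q0 q1 fun ω hw hQ => ?_).trans
        (hmid.symm.le.trans (bernProb_mono p0 p1 fun ω _ => hsub ω))
      have hag : ∀ e ∈ ω, σ e.1 = σ e.2 := by
        intro e he
        by_contra hne
        exact bernWeight_ne_zero hw he (by simp [agreeProb, hne])
      have key : ∀ z, eConn (ω ∩ E') x z → σ z = 1 ∧ eConn (ω ∩ E' ∩ T) x z := by
        intro z hz
        clear hQ hxy hcyl hmid hsub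
        induction hz with
        | refl => exact ⟨hx, Relation.ReflTransGen.refl⟩
        | tail _ hbc ih =>
          obtain ⟨hb, hcon⟩ := ih
          rcases hbc with h | h
          · have h1 := hag _ (Finset.mem_inter.1 h).1
            have h2 : σ _ = 1 := h1.symm.trans hb
            refine ⟨h2, hcon.tail (Or.inl ?_)⟩
            simp only [hT, Finset.mem_inter, Finset.mem_filter, Finset.mem_univ, true_and]
            exact ⟨Finset.mem_inter.1 h, hb, h2⟩
          · have h1 := hag _ (Finset.mem_inter.1 h).1
            have h2 : σ _ = 1 := h1.trans hb
            refine ⟨h2, hcon.tail (Or.inr ?_)⟩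
            simp only [hT, Finset.mem_inter, Finset.mem_filter, Finset.mem_univ, true_and]
            exact ⟨Finset.mem_inter.1 h, h2, hb⟩
      exact (key _ hQ).2
  · refine Finset.sum_eq_zero fun ω _ => ?_
    by_cases hw : bernWeight (openProb c ψ) ω = 0
    · simp [hw]
    · rw [if_neg]
      intro hcon
      rcases Relation.ReflTransGen.cases_head hcon with h | ⟨z, hz, -⟩
      · exact hxy h
      · rcases hz with hz | hz
        · exact hx (hpos _ (bernWeight_ne_zero hw (Finset.mem_inter.1 hz).1)).1
        · exact hx (hpos _ (bernWeight_ne_zero hw (Finset.mem_inter.1 hz).1)).2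

lemma sum_isingWt_bernProb {c : ι × ι → ℝ} (hc : ∀ e, 0 ≤ c e) {r : ι → ℝ}
    (hr : ∀ i, 0 ≤ r i) (E' : Finset (ι × ι)) {x y : ι} (hxy : x ≠ y) :
    ∑ σ, isingWt (fun e => c e * r e.1 * r e.2) σ *
        bernProb (openProb c fun i => spin σ i * r i) (fun ω => eConn (ω ∩ E') x y) =
      (1 / 2) * ∑ ω, if eConn (ω ∩ E') x y then
        fkW (fun e => c e * r e.1 * r e.2) ω * fkN ω else 0 := by
  set J : ι × ι → ℝ := fun e => c e * r e.1 * r e.2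
  have h1 : ∀ σ : ι → ℤˣ, isingWt J σ *
      bernProb (openProb c fun i => spin σ i * r i) (fun ω => eConn (ω ∩ E') x y) =
      if σ x = 1 then ∑ ω, if eConn (ω ∩ E') x y then
        (if σ ∈ fkSpins ω then fkW J ω else 0) else 0 else 0 := by
    intro σ
    rw [bernProb_openProb_agree hc hr σ E' hxy]
    split_ifs with h
    · rw [bernProb, Finset.mul_sum]
      refine Finset.sum_congr rfl fun ω _ => ?_
      rw [mul_ite, mul_zero, isingWt_mul_agree]
    · rw [mul_zero]
  simp only [h1]
  rw [← Finset.sum_filter, Finset.sum_comm, Finset.mul_sum]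
  refine Finset.sum_congr rfl fun ω _ => ?_
  by_cases hQ : eConn (ω ∩ E') x y
  · simp only [hQ, if_true]
    have hflip : ∑ σ : ι → ℤˣ with σ x = 1, (if σ ∈ fkSpins ω then fkW J ω else 0) =
        ∑ σ : ι → ℤˣ with ¬ σ x = 1, (if σ ∈ fkSpins ω then fkW J ω else 0) := by
      refine Finset.sum_bij' (fun σ _ => -σ) (fun σ _ => -σ) ?_ ?_ ?_ ?_ ?_
      · intro σ hσ
        rw [Finset.mem_filter] at hσ ⊢
        refine ⟨Finset.mem_univ _, ?_⟩
        rw [Pi.neg_apply, hσ.2]; decide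
      · intro σ hσ
        rw [Finset.mem_filter] at hσ ⊢
        refine ⟨Finset.mem_univ _, ?_⟩
        rcases Int.units_eq_one_or (σ x) with h | h
        · exact absurd h hσ.2
        · rw [Pi.neg_apply, h]; decide
      · intro σ _; exact neg_neg σ
      · intro σ _; exact neg_neg σ
      · intro σ _
        simp only [mem_fkSpins, Pi.neg_apply, neg_inj]
    have hall := Finset.sum_filter_add_sum_filter_not (Finset.univ : Finset (ι → ℤˣ))
      (fun σ => σ x = 1) fun σ => if σ ∈ fkSpins ω then fkW J ω else 0
    have htot : ∑ σ : ι → ℤˣ, (if σ ∈ fkSpins ω then fkW J ω else 0) = fkW J ω * fkN ω := by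
      rw [← Finset.sum_filter, Finset.sum_const, nsmul_eq_mul, mul_comm, fkN]
      congr 3
      ext; simp
    linarith
  · simp [hQ]

/-- The sum over all sign patterns of the connection probability inside `E'`. -/
lemma sum_isingWt_bernProb_ge {c : ι × ι → ℝ} (hc : ∀ e, 0 ≤ c e) {r : ι → ℝ}
    (hr : ∀ i, 0 ≤ r i) (E' : Finset (ι × ι)) {x y : ι} (hxy : x ≠ y) :
    (1 / 2) * isingNum (fun e => if e ∈ E' then c e * r e.1 * r e.2 else 0) x y *
        isingZ (fun e => c e * r e.1 * r e.2) ≤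
      (∑ σ, isingWt (fun e => c e * r e.1 * r e.2) σ *
        bernProb (openProb c fun i => spin σ i * r i) (fun ω => eConn (ω ∩ E') x y)) *
      isingZ (fun e => if e ∈ E' then c e * r e.1 * r e.2 else 0) := by
  rw [sum_isingWt_bernProb hc hr E' hxy]
  have := fk_restrict_le (fun e => c e * r e.1 * r e.2)
    (fun e => mul_nonneg (mul_nonneg (hc e) (hr _)) (hr _)) E' x y
  linarith

lemma sum_isingWt_bernProb_univ {c : ι × ι → ℝ} (hc : ∀ e, 0 ≤ c e) {r : ι → ℝ}
    (hr : ∀ i, 0 ≤ r i) {x y : ι} (hxy : x ≠ y) :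
    ∑ σ, isingWt (fun e => c e * r e.1 * r e.2) σ *
        bernProb (openProb c fun i => spin σ i * r i) (fun ω => eConn ω x y) =
      (1 / 2) * isingNum (fun e => c e * r e.1 * r e.2) x y := by
  have := sum_isingWt_bernProb hc hr Finset.univ hxy
  simp only [Finset.inter_univ] at this
  rw [this, isingNum_eq_sum_fk]

end RandomCluster

section GaussianDensity

open Matrix

set_option linter.unusedSectionVars false

variable {ι : Type*} [Fintype ι] [DecidableEq ι] {B : Matrix ι ι ℝ}

lemma quadForm_eq_sum (B : Matrix ι ι ℝ) (ψ : ι → ℝ) :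
    ψ ⬝ᵥ B *ᵥ ψ = ∑ i, ∑ j, B i j * ψ i * ψ j := by
  simp only [dotProduct, mulVec, Finset.mul_sum]
  exact Finset.sum_congr rfl fun i _ => Finset.sum_congr rfl fun j _ => by ring

lemma posDef_isSymm (hB : B.PosDef) (u v : ι → ℝ) : u ⬝ᵥ B *ᵥ v = v ⬝ᵥ B *ᵥ u := by
  have h : Bᵀ = B := by simpa [IsHermitian] using hB.1
  rw [dotProduct_mulVec, dotProduct_comm, ← mulVec_transpose, h]

lemma posDef_quadForm_pos (hB : B.PosDef) {ψ : ι → ℝ} (h : ψ ≠ 0) : 0 < ψ ⬝ᵥ B *ᵥ ψ := by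
  simpa using hB.dotProduct_mulVec_pos h

lemma posDef_quadForm_nonneg (hB : B.PosDef) (ψ : ι → ℝ) : 0 ≤ ψ ⬝ᵥ B *ᵥ ψ := by
  by_cases h : ψ = 0
  · simp [h]
  · exact (posDef_quadForm_pos hB h).le

@[fun_prop]
lemma continuous_quadForm (B : Matrix ι ι ℝ) : Continuous fun ψ : ι → ℝ => ψ ⬝ᵥ B *ᵥ ψ := by
  simp only [quadForm_eq_sum]
  fun_prop

lemma quadForm_add (hB : B.PosDef) (u v : ι → ℝ) :
    (u + v) ⬝ᵥ B *ᵥ (u + v) = u ⬝ᵥ B *ᵥ u + 2 * (u ⬝ᵥ B *ᵥ v) + v ⬝ᵥ B *ᵥ v := by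
  rw [mulVec_add, add_dotProduct, dotProduct_add, dotProduct_add, posDef_isSymm hB v u]
  ring

/-- A positive definite quadratic form dominates a multiple of the Euclidean one. -/
lemma exists_quadForm_ge (hB : B.PosDef) :
    ∃ ε > 0, ∀ ψ : ι → ℝ, ε * ∑ i, ψ i ^ 2 ≤ ψ ⬝ᵥ B *ᵥ ψ := by
  rcases isEmpty_or_nonempty ι with hι | hι
  · exact ⟨1, one_pos, fun ψ => by simp [dotProduct]⟩
  set S : Set (ι → ℝ) := {ψ | ∑ i, ψ i ^ 2 = 1} with hS
  have hcl : IsClosed S := isClosed_eq (by fun_prop) continuous_const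
  have hbd : S ⊆ Metric.closedBall 0 1 := by
    intro ψ hψ
    rw [mem_closedBall_zero_iff, pi_norm_le_iff_of_nonneg zero_le_one]
    intro i
    have h1 : ψ i ^ 2 ≤ ∑ j, ψ j ^ 2 :=
      Finset.single_le_sum (f := fun j => ψ j ^ 2) (fun j _ => sq_nonneg _) (Finset.mem_univ i)
    rw [hψ] at h1
    exact (sq_le_one_iff_abs_le_one _).1 h1
  have hcpt : IsCompact S := (isCompact_closedBall 0 1).of_isClosed_subset hcl hbd
  obtain ⟨i₀⟩ := hι
  have hne : S.Nonempty := ⟨Pi.single i₀ 1, by simp [hS, Pi.single_apply]⟩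
  obtain ⟨m, hm, hmin⟩ := hcpt.exists_isMinOn hne (continuous_quadForm B).continuousOn
  have hm0 : m ≠ 0 := by
    rintro rfl
    simp [hS] at hm
  refine ⟨_, posDef_quadForm_pos hB hm0, fun ψ => ?_⟩
  have hs : 0 ≤ ∑ i, ψ i ^ 2 := Finset.sum_nonneg fun i _ => sq_nonneg _
  rcases hs.eq_or_lt with h | h
  · rw [← h, mul_zero]; exact posDef_quadForm_nonneg hB ψ
  · set s := √(∑ i, ψ i ^ 2) with hs'
    have hs0 : 0 < s := Real.sqrt_pos.2 h
    have hsq : s ^ 2 = ∑ i, ψ i ^ 2 := Real.sq_sqrt hs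
    have hmem : s⁻¹ • ψ ∈ S := by
      simp only [hS, Set.mem_ofPred_eq, Pi.smul_apply, smul_eq_mul, mul_pow, ← Finset.mul_sum]
      rw [← hsq]; field_simp
    have h1 := hmin hmem
    simp only [Set.mem_ofPred_eq, mulVec_smul, smul_dotProduct, dotProduct_smul, smul_eq_mul] at h1
    rw [← hsq]
    calc _ ≤ (s⁻¹ * (s⁻¹ * (ψ ⬝ᵥ B *ᵥ ψ))) * s ^ 2 := by gcongr
      _ = _ := by field_simp

/-- The unnormalised Gaussian density with precision matrix `B`. -/
def gaussWt (B : Matrix ι ι ℝ) (ψ : ι → ℝ) : ℝ := Real.exp (-(1 / 2) * (ψ ⬝ᵥ B *ᵥ ψ))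

lemma gaussWt_pos (B : Matrix ι ι ℝ) (ψ : ι → ℝ) : 0 < gaussWt B ψ := Real.exp_pos _

@[fun_prop]
lemma continuous_gaussWt (B : Matrix ι ι ℝ) : Continuous (gaussWt B) := by
  unfold gaussWt; fun_prop

@[fun_prop]
lemma measurable_gaussWt (B : Matrix ι ι ℝ) : Measurable (gaussWt B) :=
  (continuous_gaussWt B).measurable

lemma gaussWt_neg (B : Matrix ι ι ℝ) (ψ : ι → ℝ) : gaussWt B (-ψ) = gaussWt B ψ := by
  simp [gaussWt, mulVec_neg]

lemma integrable_gaussWt (hB : B.PosDef) : Integrable (gaussWt B) := by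
  obtain ⟨ε, hε, h⟩ := exists_quadForm_ge hB
  have h1 : Integrable fun ψ : ι → ℝ => ∏ i, Real.exp (-(ε / 2) * ψ i ^ 2) :=
    Integrable.fintype_prod (μ := fun _ : ι => (volume : Measure ℝ))
      (f := fun _ x => Real.exp (-(ε / 2) * x ^ 2))
      fun i => integrable_exp_neg_mul_sq (by positivity)
  refine h1.mono' (continuous_gaussWt B).aestronglyMeasurable (ae_of_all _ fun ψ => ?_)
  rw [Real.norm_of_nonneg (gaussWt_pos _ _).le, ← Real.exp_sum, gaussWt, ← Finset.mul_sum]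
  refine Real.exp_le_exp.2 ?_
  have := h ψ
  nlinarith

/-- The normalising constant of the Gaussian density. -/
def gaussZ (B : Matrix ι ι ℝ) : ℝ≥0∞ := ∫⁻ ψ, ENNReal.ofReal (gaussWt B ψ)

lemma gaussZ_ne_top (hB : B.PosDef) : gaussZ B ≠ ⊤ :=
  ((integrable_gaussWt hB).lintegral_lt_top).ne

lemma gaussZ_ne_zero (B : Matrix ι ι ℝ) : gaussZ B ≠ 0 := by
  intro h
  rw [gaussZ, lintegral_eq_zero_iff (by fun_prop)] at h
  have h2 : ∀ᵐ _ψ : ι → ℝ, False := by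
    filter_upwards [h] with ψ hψ
    simp only [Pi.zero_apply, ENNReal.ofReal_eq_zero] at hψ
    exact absurd (gaussWt_pos B ψ) (not_lt.2 hψ)
  simp only [ae_iff, not_false_eq_true, Set.ofPred_true] at h2
  exact (NeZero.ne (volume : Measure (ι → ℝ))) (Measure.measure_univ_eq_zero.1 h2)

/-- The centred Gaussian measure with precision matrix `B`. -/
def gaussM (B : Matrix ι ι ℝ) : Measure (ι → ℝ) :=
  (gaussZ B)⁻¹ • volume.withDensity fun ψ => ENNReal.ofReal (gaussWt B ψ)

lemma lintegral_gaussM (B : Matrix ι ι ℝ) {F : (ι → ℝ) → ℝ≥0∞} (hF : Measurable F) :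
    ∫⁻ ψ, F ψ ∂gaussM B = (gaussZ B)⁻¹ * ∫⁻ ψ, ENNReal.ofReal (gaussWt B ψ) * F ψ := by
  rw [gaussM, lintegral_smul_measure, lintegral_withDensity_eq_lintegral_mul _ (by fun_prop) hF]
  rfl

lemma gaussM_isProb (hB : B.PosDef) : IsProbabilityMeasure (gaussM B) := by
  refine ⟨?_⟩
  rw [← lintegral_one, lintegral_gaussM B measurable_const]
  simp only [mul_one]
  exact ENNReal.inv_mul_cancel (gaussZ_ne_zero B) (gaussZ_ne_top hB)

lemma lintegral_gaussM_translate (hB : B.PosDef) {F : (ι → ℝ) → ℝ≥0∞} (hF : Measurable F)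
    (h : ι → ℝ) :
    ∫⁻ ψ, F ψ ∂gaussM B = ∫⁻ ψ, ENNReal.ofReal (Real.exp (-(ψ ⬝ᵥ B *ᵥ h) -
      (1 / 2) * (h ⬝ᵥ B *ᵥ h))) * F (ψ + h) ∂gaussM B := by
  have hm : Measurable fun ψ : ι → ℝ => ψ ⬝ᵥ B *ᵥ h := by
    simp only [dotProduct]; fun_prop
  rw [lintegral_gaussM B hF, lintegral_gaussM B (by fun_prop),
    ← lintegral_add_right_eq_self _ h]
  congr 1
  refine lintegral_congr fun ψ => ?_
  rw [← mul_assoc, ← ENNReal.ofReal_mul (gaussWt_pos _ _).le]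
  congr 2
  rw [gaussWt, gaussWt, ← Real.exp_add, quadForm_add hB]
  congr 1; ring

lemma lintegral_gaussM_neg (B : Matrix ι ι ℝ) {F : (ι → ℝ) → ℝ≥0∞} (hF : Measurable F) :
    ∫⁻ ψ, F (-ψ) ∂gaussM B = ∫⁻ ψ, F ψ ∂gaussM B := by
  rw [lintegral_gaussM B hF, lintegral_gaussM B (by fun_prop)]
  congr 1
  rw [← lintegral_neg_eq_self]
  simp only [gaussWt_neg, neg_neg]

lemma mulVec_inv_mulVec (hB : B.PosDef) (t : ι → ℝ) : B *ᵥ (B⁻¹ *ᵥ t) = t := by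
  rw [mulVec_mulVec, mul_nonsing_inv _ (B.isUnit_iff_isUnit_det.1 hB.isUnit), one_mulVec]

lemma inv_mulVec_mulVec (hB : B.PosDef) (t : ι → ℝ) : B⁻¹ *ᵥ (B *ᵥ t) = t := by
  rw [mulVec_mulVec, nonsing_inv_mul _ (B.isUnit_iff_isUnit_det.1 hB.isUnit), one_mulVec]

/-- Laplace transform of the Gaussian measure. -/
lemma lintegral_exp_gaussM (hB : B.PosDef) (t : ι → ℝ) :
    ∫⁻ ψ, ENNReal.ofReal (Real.exp (t ⬝ᵥ ψ)) ∂gaussM B =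
      ENNReal.ofReal (Real.exp ((t ⬝ᵥ B⁻¹ *ᵥ t) / 2)) := by
  have hm : Measurable fun ψ : ι → ℝ => t ⬝ᵥ ψ := by
    simp only [dotProduct]; fun_prop
  have := gaussM_isProb hB
  rw [lintegral_gaussM_translate hB (by fun_prop) (B⁻¹ *ᵥ t)]
  simp only [mulVec_inv_mulVec hB, ← ENNReal.ofReal_mul (Real.exp_pos _).le, ← Real.exp_add,
    dotProduct_add]
  have : ∀ ψ : ι → ℝ, -(ψ ⬝ᵥ t) - 1 / 2 * (B⁻¹ *ᵥ t ⬝ᵥ t) + (t ⬝ᵥ ψ + t ⬝ᵥ B⁻¹ *ᵥ t) =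
      (t ⬝ᵥ B⁻¹ *ᵥ t) / 2 := by
    intro ψ
    rw [dotProduct_comm ψ t, dotProduct_comm _ t]; ring
  simp only [this, lintegral_const, measure_univ, mul_one]

/-- A finite measure on `ℝ` with a Gaussian Laplace transform is Gaussian. -/
lemma eq_gaussianReal_of_laplace {μ : Measure ℝ} (v : ℝ≥0)
    (h : ∀ s : ℝ, ∫⁻ x, ENNReal.ofReal (Real.exp (s * x)) ∂μ =
      ENNReal.ofReal (Real.exp (v * s ^ 2 / 2))) : μ = gaussianReal 0 v := by
  have h0 : IsProbabilityMeasure μ := ⟨by simpa using h 0⟩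
  have hmgf : mgf id μ = mgf id (gaussianReal 0 v) := by
    rw [mgf_id_gaussianReal]
    ext s
    rw [mgf, integral_eq_lintegral_of_nonneg_ae (ae_of_all _ fun x => (Real.exp_pos _).le)
      (by fun_prop)]
    simp only [id, h s]
    rw [ENNReal.toReal_ofReal (Real.exp_pos _).le]
    simp
  have hset : integrableExpSet id μ = Set.univ := by
    rw [integrableExpSet_eq_of_mgf hmgf, integrableExpSet_id_gaussianReal]
  refine Measure.ext_of_complexMGF_id_eq ?_
  ext z
  exact eqOn_complexMGF_of_mgf hmgf (by simp [hset])

/-- Finite measures are determined by Gaussian Laplace transforms. -/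
lemma measure_eq_of_laplace {E : Type*} [NormedAddCommGroup E] [NormedSpace ℝ E]
    [MeasurableSpace E] [BorelSpace E] [SecondCountableTopology E] [CompleteSpace E]
    {μ ν : Measure E} [IsFiniteMeasure μ] [IsFiniteMeasure ν] (v : StrongDual ℝ E → ℝ≥0)
    (hμ : ∀ L : StrongDual ℝ E, μ.map L = gaussianReal 0 (v L))
    (hν : ∀ L : StrongDual ℝ E, ν.map L = gaussianReal 0 (v L)) : μ = ν := by
  refine Measure.ext_of_charFunDual ?_
  ext L
  rw [charFunDual_eq_charFun_map_one, charFunDual_eq_charFun_map_one, hμ, hν]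

lemma strongDual_pi_apply (L : StrongDual ℝ (ι → ℝ)) (ψ : ι → ℝ) :
    L ψ = (fun i => L (Pi.single i 1)) ⬝ᵥ ψ := by
  conv_lhs => rw [← Finset.univ_sum_single ψ]
  rw [map_sum, dotProduct]
  refine Finset.sum_congr rfl fun i _ => ?_
  rw [show (Pi.single i (ψ i) : ι → ℝ) = ψ i • Pi.single i 1 by
    rw [← Pi.single_smul]; simp, map_smul, smul_eq_mul, mul_comm]

/-- `μ` is the centred Gaussian law with covariance `G`, in terms of its Laplace transform. -/
def HasCov (μ : Measure (ι → ℝ)) (G : Matrix ι ι ℝ) : Prop :=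
  ∀ t : ι → ℝ, ∫⁻ ψ, ENNReal.ofReal (Real.exp (t ⬝ᵥ ψ)) ∂μ =
    ENNReal.ofReal (Real.exp ((t ⬝ᵥ G *ᵥ t) / 2))

lemma hasCov_gaussM (hB : B.PosDef) : HasCov (gaussM B) B⁻¹ := lintegral_exp_gaussM hB

@[fun_prop]
lemma measurable_dotProduct_left (t : ι → ℝ) : Measurable fun ψ : ι → ℝ => t ⬝ᵥ ψ := by
  simp only [dotProduct]; fun_prop

lemma HasCov.map_dotProduct {μ : Measure (ι → ℝ)} {G : Matrix ι ι ℝ} (h : HasCov μ G)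
    (t : ι → ℝ) (ht : 0 ≤ t ⬝ᵥ G *ᵥ t) :
    μ.map (fun ψ => t ⬝ᵥ ψ) = gaussianReal 0 (t ⬝ᵥ G *ᵥ t).toNNReal := by
  refine eq_gaussianReal_of_laplace _ fun s => ?_
  rw [lintegral_map (by fun_prop) (by fun_prop)]
  have := h (s • t)
  simp only [smul_dotProduct, mulVec_smul, dotProduct_smul, smul_eq_mul] at this
  rw [this, Real.coe_toNNReal _ ht]
  congr 2; ring

lemma HasCov.isProb {μ : Measure (ι → ℝ)} {G : Matrix ι ι ℝ} (h : HasCov μ G) :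
    IsProbabilityMeasure μ := ⟨by simpa using h 0⟩

lemma HasCov.eq {μ ν : Measure (ι → ℝ)} {G : Matrix ι ι ℝ} (hG : ∀ t, 0 ≤ t ⬝ᵥ G *ᵥ t)
    (h : HasCov μ G) (h' : HasCov ν G) : μ = ν := by
  have := h.isProb
  have := h'.isProb
  refine measure_eq_of_laplace
    (fun L => ((fun i => L (Pi.single i 1)) ⬝ᵥ G *ᵥ (fun i => L (Pi.single i 1))).toNNReal) ?_ ?_
  · intro L
    rw [← h.map_dotProduct _ (hG _)]
    congr 1; ext ψ; exact strongDual_pi_apply L ψ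
  · intro L
    rw [← h'.map_dotProduct _ (hG _)]
    congr 1; ext ψ; exact strongDual_pi_apply L ψ

lemma gaussM_map_dotProduct (hB : B.PosDef) (t : ι → ℝ) :
    (gaussM B).map (fun ψ => t ⬝ᵥ ψ) = gaussianReal 0 (t ⬝ᵥ B⁻¹ *ᵥ t).toNNReal :=
  (hasCov_gaussM hB).map_dotProduct t (posDef_quadForm_nonneg hB.inv t)

lemma memLp_dotProduct_gaussM (hB : B.PosDef) (t : ι → ℝ) :
    MemLp (fun ψ => t ⬝ᵥ ψ) 2 (gaussM B) := by
  have h := memLp_id_gaussianReal (μ := 0) (v := (t ⬝ᵥ B⁻¹ *ᵥ t).toNNReal) 2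
  rw [← gaussM_map_dotProduct hB t, memLp_map_measure_iff (by fun_prop) (by fun_prop)] at h
  exact h

lemma integral_dotProduct_gaussM (hB : B.PosDef) (t : ι → ℝ) :
    ∫ ψ, t ⬝ᵥ ψ ∂gaussM B = 0 := by
  have h := integral_id_gaussianReal (μ := 0) (v := (t ⬝ᵥ B⁻¹ *ᵥ t).toNNReal)
  rwa [← gaussM_map_dotProduct hB t, integral_map (by fun_prop) (by fun_prop)] at h

lemma integral_dotProduct_sq_gaussM (hB : B.PosDef) (t : ι → ℝ) :
    ∫ ψ, (t ⬝ᵥ ψ) ^ 2 ∂gaussM B = t ⬝ᵥ B⁻¹ *ᵥ t := by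
  have := gaussM_isProb hB
  have h := variance_id_gaussianReal (μ := 0) (v := (t ⬝ᵥ B⁻¹ *ᵥ t).toNNReal)
  rw [← gaussM_map_dotProduct hB t, variance_map (by fun_prop) (by fun_prop),
    Real.coe_toNNReal _ (posDef_quadForm_nonneg hB.inv t)] at h
  rw [← h]
  rw [variance_of_integral_eq_zero (by fun_prop)]
  · rfl
  · exact integral_dotProduct_gaussM hB t

lemma dotProduct_mul_integrable (hB : B.PosDef) (s t : ι → ℝ) :
    Integrable (fun ψ => (s ⬝ᵥ ψ) * (t ⬝ᵥ ψ)) (gaussM B) :=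
  (memLp_dotProduct_gaussM hB s).integrable_mul (memLp_dotProduct_gaussM hB t)

lemma integral_dotProduct_mul_gaussM (hB : B.PosDef) (s t : ι → ℝ) :
    ∫ ψ, (s ⬝ᵥ ψ) * (t ⬝ᵥ ψ) ∂gaussM B = s ⬝ᵥ B⁻¹ *ᵥ t := by
  have hst := integral_dotProduct_sq_gaussM hB (s + t)
  have hs := integral_dotProduct_sq_gaussM hB s
  have ht := integral_dotProduct_sq_gaussM hB t
  have h1 : ∀ ψ : ι → ℝ, ((s + t) ⬝ᵥ ψ) ^ 2 =
      (s ⬝ᵥ ψ) ^ 2 + ((t ⬝ᵥ ψ) ^ 2 + 2 * ((s ⬝ᵥ ψ) * (t ⬝ᵥ ψ))) := by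
    intro ψ; rw [add_dotProduct]; ring
  have hi := fun u : ι → ℝ => (memLp_dotProduct_gaussM hB u).integrable_sq
  have hm := (dotProduct_mul_integrable hB s t).const_mul 2
  have htm : Integrable (fun ψ => (t ⬝ᵥ ψ) ^ 2 + 2 * ((s ⬝ᵥ ψ) * (t ⬝ᵥ ψ))) (gaussM B) :=
    (hi t).add hm
  rw [integral_congr_ae (ae_of_all _ h1), integral_add (hi s) htm,
    integral_add (hi t) hm, integral_const_mul, hs, ht, quadForm_add hB.inv] at hst
  linarith

end GaussianDensity

section FourFunctions

set_option linter.unusedSectionVars false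

/-- The argument with larger modulus. -/
def absJoin (x y : ℝ) : ℝ := if |x| ≤ |y| then y else x

/-- The argument with smaller modulus. -/
def absMeet (x y : ℝ) : ℝ := if |x| ≤ |y| then x else y

lemma abs_absJoin (x y : ℝ) : |absJoin x y| = max |x| |y| := by
  unfold absJoin; split_ifs with h
  · rw [max_eq_right h]
  · rw [max_eq_left (not_le.1 h).le]

lemma abs_absMeet (x y : ℝ) : |absMeet x y| = min |x| |y| := by
  unfold absMeet; split_ifs with h
  · rw [min_eq_left h]
  · rw [min_eq_right (not_le.1 h).le]

lemma ENNReal.add_le_add_of_mul_le {a b c d : ℝ≥0∞} (hac : a ≤ c) (hbc : b ≤ c)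
    (h : a * b ≤ c * d) : a + b ≤ c + d := by
  by_cases hc : c = ⊤
  · simp [hc]
  by_cases hd : d = ⊤
  · simp [hd]
  by_cases hc0 : c = 0
  · rw [hc0] at hac hbc
    rw [le_antisymm hac zero_le, le_antisymm hbc zero_le]; simp
  lift c to ℝ≥0 using hc
  lift d to ℝ≥0 using hd
  lift a to ℝ≥0 using ne_top_of_le_ne_top (by simp) hac
  lift b to ℝ≥0 using ne_top_of_le_ne_top (by simp) hbc
  norm_cast at *
  have hc1 : (0 : ℝ) < c := by exact_mod_cast pos_iff_ne_zero.2 hc0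
  rw [← NNReal.coe_le_coe] at *
  push_cast at *
  nlinarith [mul_nonneg (sub_nonneg.2 hac) (sub_nonneg.2 hbc)]

lemma lintegral_mul_le_of_absJoin {f₁ f₂ f₃ f₄ : ℝ → ℝ≥0∞} (h₁ : Measurable f₁)
    (h₂ : Measurable f₂) (h₃ : Measurable f₃) (h₄ : Measurable f₄)
    (h : ∀ x y, f₁ x * f₂ y ≤ f₃ (absJoin x y) * f₄ (absMeet x y)) :
    (∫⁻ x, f₁ x) * ∫⁻ x, f₂ x ≤ (∫⁻ x, f₃ x) * ∫⁻ x, f₄ x := by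
  have key (x y : ℝ) : f₁ x * f₂ y + f₁ y * f₂ x ≤ f₃ x * f₄ y + f₃ y * f₄ x := by
    wlog hxy : |x| ≤ |y| generalizing x y
    · rw [add_comm, add_comm (f₃ x * _)]
      exact this y x (not_le.1 hxy).le
    have e1 := h x y
    have e2 := h y x
    simp only [absJoin, absMeet, hxy, if_true] at e1 e2
    rcases hxy.eq_or_lt with he | hlt
    · rw [if_pos he.symm.le, if_pos he.symm.le] at e2
      rw [add_comm (f₃ x * _)]
      exact add_le_add e1 e2
    · rw [if_neg (not_le.2 hlt), if_neg (not_le.2 hlt)] at e2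
      rw [add_comm (f₃ x * _)]
      refine ENNReal.add_le_add_of_mul_le e1 e2 ?_
      have hx := h x x
      have hy := h y y
      simp only [absJoin, absMeet, le_refl, if_true] at hx hy
      calc _ = (f₁ x * f₂ x) * (f₁ y * f₂ y) := by ring
        _ ≤ (f₃ x * f₄ x) * (f₃ y * f₄ y) := mul_le_mul' hx hy
        _ = _ := by ring
  have dbl {f g : ℝ → ℝ≥0∞} (hf : Measurable f) (hg : Measurable g) :
      ∫⁻ x, ∫⁻ y, (f x * g y + f y * g x) = 2 * ((∫⁻ x, f x) * ∫⁻ x, g x) := by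
    have e (x : ℝ) : ∫⁻ y, (f x * g y + f y * g x) = f x * (∫⁻ y, g y) + (∫⁻ y, f y) * g x := by
      rw [lintegral_add_left (by fun_prop), lintegral_const_mul _ hg, lintegral_mul_const _ hf]
    simp only [e]
    rw [lintegral_add_left (by fun_prop), lintegral_const_mul _ hg, lintegral_mul_const _ hf,
      two_mul]
  have := lintegral_mono (μ := volume) fun x => lintegral_mono (μ := volume) fun y => key x y
  rw [dbl h₁ h₂, dbl h₃ h₄] at this
  exact (ENNReal.mul_le_mul_iff_right (by simp) (by simp)).1 this

variable {ι : Type*} [Fintype ι] [DecidableEq ι]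

/-- Continuous four functions inequality for the lattice structure on moduli. -/
theorem lintegral_pi_mul_le_of_absJoin {f₁ f₂ f₃ f₄ : (ι → ℝ) → ℝ≥0∞} (h₁ : Measurable f₁)
    (h₂ : Measurable f₂) (h₃ : Measurable f₃) (h₄ : Measurable f₄)
    (h : ∀ ψ ψ' : ι → ℝ, f₁ ψ * f₂ ψ' ≤
      f₃ (fun i => absJoin (ψ i) (ψ' i)) * f₄ (fun i => absMeet (ψ i) (ψ' i))) :
    (∫⁻ x, f₁ x) * ∫⁻ x, f₂ x ≤ (∫⁻ x, f₃ x) * ∫⁻ x, f₄ x := by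
  let μ : ι → Measure ℝ := fun _ => volume
  have main (s : Finset ι) : ∀ ψ ψ' : ι → ℝ, lmarginal μ s f₁ ψ * lmarginal μ s f₂ ψ' ≤
      lmarginal μ s f₃ (fun i => absJoin (ψ i) (ψ' i)) *
        lmarginal μ s f₄ (fun i => absMeet (ψ i) (ψ' i)) := by
    induction s using Finset.induction_on with
    | empty => simpa using h
    | insert i s hi ih =>
      intro ψ ψ'
      rw [lmarginal_insert _ h₁ hi, lmarginal_insert _ h₂ hi, lmarginal_insert _ h₃ hi,
        lmarginal_insert _ h₄ hi]
      refine lintegral_mul_le_of_absJoin ?_ ?_ ?_ ?_ fun t t' => ?_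
      · exact (h₁.lmarginal μ).comp (measurable_update _)
      · exact (h₂.lmarginal μ).comp (measurable_update _)
      · exact (h₃.lmarginal μ).comp (measurable_update _)
      · exact (h₄.lmarginal μ).comp (measurable_update _)
      · refine (ih _ _).trans (le_of_eq ?_)
        congr 2 <;> funext k <;> by_cases hk : k = i
        · subst hk; simp
        · simp [hk]
        · subst hk; simp
        · simp [hk]
  have := main Finset.univ 0 0
  simpa only [lmarginal_univ, μ, ← volume_pi] using this

end FourFunctions

section SignFlip

open Matrix

set_option linter.unusedSectionVars false

variable {ι : Type*} [Fintype ι] [DecidableEq ι]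

/-- Multiplication of a field by spins. -/
def spinFlip (σ : ι → ℤˣ) (ψ : ι → ℝ) : ι → ℝ := fun i => spin σ i * ψ i

lemma flip_mul (σ τ : ι → ℤˣ) (ψ : ι → ℝ) : spinFlip (σ * τ) ψ = spinFlip σ (spinFlip τ ψ) := by
  funext i; simp [spinFlip, spin_mul, mul_assoc]

@[fun_prop]
lemma measurable_flip (σ : ι → ℤˣ) : Measurable (spinFlip σ) := by
  unfold spinFlip; fun_prop

lemma volume_preserving_flip (σ : ι → ℤˣ) :
    MeasurePreserving (spinFlip σ : (ι → ℝ) → ι → ℝ) volume volume := by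
  refine volume_preserving_pi (f := fun i (x : ℝ) => spin σ i * x) fun i => ?_
  rcases spin_eq_or σ i with h | h
  · simp only [h, one_mul]; exact MeasurePreserving.id _
  · simpa [h] using Measure.measurePreserving_neg (volume : Measure ℝ)

lemma exists_flip_abs (ψ : ι → ℝ) : ∃ τ : ι → ℤˣ, ψ = spinFlip τ fun i => |ψ i| := by
  refine ⟨fun i => if 0 ≤ ψ i then 1 else -1, ?_⟩
  funext i
  by_cases h : 0 ≤ ψ i
  · simp [spinFlip, spin, h, abs_of_nonneg h]
  · simp [spinFlip, spin, h, abs_of_neg (not_le.1 h)]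

lemma sum_flip_abs (F : (ι → ℝ) → ℝ≥0∞) (ψ : ι → ℝ) :
    ∑ σ, F (spinFlip σ ψ) = ∑ σ, F (spinFlip σ fun i => |ψ i|) := by
  obtain ⟨τ, hτ⟩ := exists_flip_abs ψ
  conv_lhs => rw [hτ]
  simp only [← flip_mul]
  exact Equiv.sum_comp (Equiv.mulRight τ) fun σ => F (spinFlip σ fun i => |ψ i|)

lemma card_mul_lintegral {F : (ι → ℝ) → ℝ≥0∞} (hF : Measurable F) :
    (Fintype.card (ι → ℤˣ) : ℝ≥0∞) * ∫⁻ ψ, F ψ = ∫⁻ ψ : ι → ℝ, ∑ σ, F (spinFlip σ fun i => |ψ i|) := by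
  simp only [← sum_flip_abs]
  rw [lintegral_finsetSum _ fun σ _ => by fun_prop]
  simp only [fun σ => (volume_preserving_flip (ι := ι) σ).lintegral_comp hF]
  simp

/-- The conductances `c` represent the off-diagonal part of the quadratic form of `M`. -/
structure Coupled (c : ι × ι → ℝ) (M : Matrix ι ι ℝ) : Prop where
  nonneg : ∀ e, 0 ≤ c e
  diag : ∀ i, c (i, i) = 0
  add_swap : ∀ i j, i ≠ j → c (i, j) + c (j, i) = -M i j

lemma Coupled.quadForm {c : ι × ι → ℝ} {M : Matrix ι ι ℝ} (h : Coupled c M) (ψ : ι → ℝ) :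
    ψ ⬝ᵥ M *ᵥ ψ = ∑ i, M i i * ψ i ^ 2 - 2 * ∑ e, c e * ψ e.1 * ψ e.2 := by
  have hM (i j : ι) : M i j = (if i = j then M i i else 0) - (c (i, j) + c (j, i)) := by
    by_cases hij : i = j
    · subst hij; simp [h.diag]
    · rw [if_neg hij, h.add_swap i j hij]; ring
  have h1 : ∑ e : ι × ι, c e * ψ e.1 * ψ e.2 = ∑ i, ∑ j, c (i, j) * ψ i * ψ j :=
    Fintype.sum_prod_type _
  have h2 : ∑ e : ι × ι, c e * ψ e.1 * ψ e.2 = ∑ i, ∑ j, c (j, i) * ψ i * ψ j := by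
    rw [h1, Finset.sum_comm]
    exact Finset.sum_congr rfl fun i _ => Finset.sum_congr rfl fun j _ => by ring
  rw [quadForm_eq_sum, two_mul, ← sub_sub]
  nth_rw 1 [h1]
  rw [h2, ← Finset.sum_sub_distrib, ← Finset.sum_sub_distrib]
  refine Finset.sum_congr rfl fun i _ => ?_
  have h3 : M i i * ψ i ^ 2 = ∑ j, if i = j then M i i * ψ i * ψ j else 0 := by
    rw [Finset.sum_ite_eq]; simp; ring
  rw [h3, ← Finset.sum_sub_distrib, ← Finset.sum_sub_distrib]
  refine Finset.sum_congr rfl fun j _ => ?_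
  rw [hM i j]
  split_ifs <;> ring

/-- The diagonal factor of the Gaussian weight. -/
def gaussD (M : Matrix ι ι ℝ) (r : ι → ℝ) : ℝ := Real.exp (-(1 / 2) * ∑ i, M i i * r i ^ 2)

lemma gaussD_pos (M : Matrix ι ι ℝ) (r : ι → ℝ) : 0 < gaussD M r := Real.exp_pos _

/-- The couplings induced by a field. -/
def fieldJ (c : ι × ι → ℝ) (r : ι → ℝ) (e : ι × ι) : ℝ := c e * r e.1 * r e.2

lemma Coupled.gaussWt_flip {c : ι × ι → ℝ} {M : Matrix ι ι ℝ} (h : Coupled c M) (σ : ι → ℤˣ)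
    (r : ι → ℝ) : gaussWt M (spinFlip σ r) = gaussD M r * isingWt (fieldJ c r) σ := by
  rw [gaussWt, h.quadForm, gaussD, isingWt, ← Real.exp_add]
  congr 1
  have h1 : ∑ i, M i i * spinFlip σ r i ^ 2 = ∑ i, M i i * r i ^ 2 := by
    refine Finset.sum_congr rfl fun i _ => ?_
    rw [spinFlip, mul_pow, sq (spin σ i), spin_sq, one_mul]
  have h2 : ∑ e : ι × ι, c e * spinFlip σ r e.1 * spinFlip σ r e.2 =
      ∑ e, fieldJ c r e * (spin σ e.1 * spin σ e.2) := by
    refine Finset.sum_congr rfl fun e _ => ?_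
    simp only [spinFlip, fieldJ]; ring
  rw [h1, h2]; ring

lemma gaussD_absJoin (M : Matrix ι ι ℝ) (r s : ι → ℝ) :
    gaussD M (fun i => |r i|) * gaussD M (fun i => |s i|) =
      gaussD M (fun i => |absJoin (r i) (s i)|) * gaussD M (fun i => |absMeet (r i) (s i)|) := by
  simp only [gaussD, ← Real.exp_add, ← mul_add, ← Finset.sum_add_distrib, sq_abs]
  congr 2
  refine Finset.sum_congr rfl fun i _ => ?_
  unfold absJoin absMeet
  split_ifs <;> ring

lemma isingZ_join_meet {c c' : ι × ι → ℝ} (hc' : ∀ e, 0 ≤ c' e) (hcc : ∀ e, c' e ≤ c e)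
    {r s : ι → ℝ} (hr : ∀ i, 0 ≤ r i) (hs : ∀ i, 0 ≤ s i) :
    isingZ (fieldJ c' r) * isingZ (fieldJ c s) ≤
      isingZ (fieldJ c fun i => max (r i) (s i)) * isingZ (fieldJ c' fun i => min (r i) (s i)) := by
  have hm (i : ι) : 0 ≤ min (r i) (s i) := le_min (hr i) (hs i)
  have hc (e) : 0 ≤ c e := (hc' e).trans (hcc e)
  have mono {a a' : ℝ} {u u' : ι → ℝ} (ha : 0 ≤ a) (haa : a ≤ a') (hu : ∀ i, 0 ≤ u i)
      (huu : ∀ i, u i ≤ u' i) (e : ι × ι) : a * u e.1 * u e.2 ≤ a' * u' e.1 * u' e.2 :=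
    mul_le_mul (mul_le_mul haa (huu _) (hu _) (ha.trans haa)) (huu _) (hu _)
      (mul_nonneg (ha.trans haa) ((hu _).trans (huu _)))
  set A := fieldJ c' fun i => min (r i) (s i) with hA
  set K := fieldJ c' r - A with hK
  have hA0 (e) : 0 ≤ A e := mul_nonneg (mul_nonneg (hc' e) (hm _)) (hm _)
  have hK0 (e) : 0 ≤ K e := sub_nonneg.2
    (mono (hc' e) le_rfl hm (fun i => min_le_left _ _) e)
  have h1 := isingZ_ratio_mono A (fieldJ c s) K hA0
    (fun e => mono (hc' e) (hcc e) hm (fun i => min_le_right _ _) e) hK0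
  rw [hK, add_sub_cancel] at h1
  refine h1.trans (mul_le_mul_of_nonneg_right (isingZ_mono _ _ ?_ ?_) (isingZ_pos _).le)
  · intro e
    exact add_nonneg (mul_nonneg (mul_nonneg (hc e) (hs _)) (hs _)) (hK0 e)
  · intro e
    simp only [fieldJ, Pi.add_apply, Pi.sub_apply, hA]
    have e1 := hc' e; have e2 := hcc e; have e0 := hc e
    have a1 := hr e.1; have a2 := hr e.2; have b1 := hs e.1; have b2 := hs e.2
    rcases le_total (r e.1) (s e.1) with p | p <;> rcases le_total (r e.2) (s e.2) with q | q <;>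
      simp only [p, q, max_eq_left, max_eq_right, min_eq_left, min_eq_right]
    · linarith
    · have : c' e * (r e.1 * (r e.2 - s e.2)) ≤ c e * (s e.1 * (r e.2 - s e.2)) :=
        mul_le_mul e2 (mul_le_mul_of_nonneg_right p (by linarith))
          (mul_nonneg a1 (by linarith)) e0
      linarith
    · have : c' e * (r e.2 * (r e.1 - s e.1)) ≤ c e * (s e.2 * (r e.1 - s e.1)) :=
        mul_le_mul e2 (mul_le_mul_of_nonneg_right q (by linarith))
          (mul_nonneg a2 (by linarith)) e0
      linarith
    · have : c' e * (r e.1 * r e.2 - s e.1 * s e.2) ≤ c e * (r e.1 * r e.2 - s e.1 * s e.2) :=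
        mul_le_mul_of_nonneg_right e2 (sub_nonneg.2 (mul_le_mul p q b2 a1))
      linarith

@[fun_prop]
lemma measurable_isingZ (c : ι × ι → ℝ) :
    Measurable fun ψ : ι → ℝ => isingZ (fieldJ c fun i => |ψ i|) := by
  unfold isingZ isingWt fieldJ; fun_prop

@[fun_prop]
lemma measurable_isingNum (c : ι × ι → ℝ) (x y : ι) :
    Measurable fun ψ : ι → ℝ => isingNum (fieldJ c fun i => |ψ i|) x y := by
  unfold isingNum isingWt fieldJ; fun_prop

@[fun_prop]
lemma measurable_gaussD (M : Matrix ι ι ℝ) :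
    Measurable fun ψ : ι → ℝ => gaussD M fun i => |ψ i| := by
  unfold gaussD; fun_prop

@[fun_prop]
lemma measurable_bernProb_openProb (c : ι × ι → ℝ) (Q : Finset (ι × ι) → Prop) :
    Measurable fun ψ : ι → ℝ => bernProb (openProb c ψ) Q := by
  unfold bernProb bernWeight
  refine Finset.measurable_sum _ fun ω _ => ?_
  split_ifs
  · refine Finset.measurable_prod _ fun e _ => ?_
    unfold openProb
    split_ifs <;> fun_prop
  · exact measurable_const

/-- Integral against the Gaussian measure, resolved according to signs. -/
lemma Coupled.lintegral_gaussM {c : ι × ι → ℝ} {M : Matrix ι ι ℝ} (h : Coupled c M)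
    (hM : M.PosDef) {F : (ι → ℝ) → ℝ} (hF : Measurable F) (hF0 : ∀ ψ, 0 ≤ F ψ) :
    (Fintype.card (ι → ℤˣ) : ℝ≥0∞) * gaussZ M * ∫⁻ ψ, ENNReal.ofReal (F ψ) ∂gaussM M =
      ∫⁻ ψ : ι → ℝ, ENNReal.ofReal (gaussD M (fun i => |ψ i|) *
        ∑ σ, isingWt (fieldJ c fun i => |ψ i|) σ * F (spinFlip σ fun i => |ψ i|)) := by
  rw [_root_.lintegral_gaussM M (by fun_prop), mul_assoc, ← mul_assoc (gaussZ M),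
    ENNReal.mul_inv_cancel (gaussZ_ne_zero M) (gaussZ_ne_top hM), one_mul,
    card_mul_lintegral (by fun_prop)]
  refine lintegral_congr fun ψ => ?_
  rw [Finset.mul_sum, ENNReal.ofReal_sum_of_nonneg]
  · refine Finset.sum_congr rfl fun σ _ => ?_
    rw [h.gaussWt_flip, ← ENNReal.ofReal_mul (mul_pos (gaussD_pos _ _) (isingWt_pos _ _)).le,
      mul_assoc]
  · intro σ _
    exact mul_nonneg (gaussD_pos _ _).le (mul_nonneg (isingWt_pos _ _).le (hF0 _))

lemma Coupled.gaussZ_eq {c : ι × ι → ℝ} {M : Matrix ι ι ℝ} (h : Coupled c M)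
    (hM : M.PosDef) : (Fintype.card (ι → ℤˣ) : ℝ≥0∞) * gaussZ M =
      ∫⁻ ψ : ι → ℝ, ENNReal.ofReal (gaussD M (fun i => |ψ i|) * isingZ (fieldJ c fun i => |ψ i|)) := by
  have := gaussM_isProb hM
  simpa [isingZ] using h.lintegral_gaussM hM (F := fun _ => 1) measurable_const (by simp)

lemma Coupled.fieldJ_nonneg {c : ι × ι → ℝ} {M : Matrix ι ι ℝ} (h : Coupled c M) (ψ : ι → ℝ)
    (e : ι × ι) : 0 ≤ fieldJ c (fun i => |ψ i|) e :=
  mul_nonneg (mul_nonneg (h.nonneg e) (abs_nonneg _)) (abs_nonneg _)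

/-- The probability that two coordinates have the same sign. -/
lemma Coupled.gaussM_sameSign {c : ι × ι → ℝ} {M : Matrix ι ι ℝ} (h : Coupled c M)
    (hM : M.PosDef) (x y : ι) :
    (Fintype.card (ι → ℤˣ) : ℝ≥0∞) * gaussZ M * gaussM M {ψ | 0 < ψ x * ψ y} =
      (Fintype.card (ι → ℤˣ) : ℝ≥0∞) * gaussZ M * (1 / 2) +
      ∫⁻ ψ : ι → ℝ, ENNReal.ofReal (gaussD M (fun i => |ψ i|) *
        ((1 / 2) * isingNum (fieldJ c fun i => |ψ i|) x y)) := by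
  have hms : MeasurableSet {ψ : ι → ℝ | 0 < ψ x * ψ y} :=
    measurableSet_lt measurable_const (by fun_prop)
  have h1 : gaussM M {ψ | 0 < ψ x * ψ y} = ∫⁻ ψ, ENNReal.ofReal
      (({ψ | 0 < ψ x * ψ y} : Set (ι → ℝ)).indicator 1 ψ) ∂gaussM M := by
    rw [← lintegral_indicator_one hms]
    refine lintegral_congr fun ψ => ?_
    by_cases hψ : 0 < ψ x * ψ y <;> simp [Set.indicator, hψ]
  rw [h1, h.lintegral_gaussM hM (measurable_one.indicator hms)
    (fun ψ => Set.indicator_nonneg (by simp) _), h.gaussZ_eq hM,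
    ← lintegral_mul_const _ (by fun_prop), ← lintegral_add_left (by fun_prop)]
  have hx : ∀ᵐ ψ : ι → ℝ, ψ x ≠ 0 := by
    rw [volume_pi]; exact Measure.ae_eval_ne _ x 0
  have hy : ∀ᵐ ψ : ι → ℝ, ψ y ≠ 0 := by
    rw [volume_pi]; exact Measure.ae_eval_ne _ y 0
  refine lintegral_congr_ae ?_
  filter_upwards [hx, hy] with ψ hψx hψy
  have hh : (1 / 2 : ℝ≥0∞) = ENNReal.ofReal (1 / 2) := by
    rw [ENNReal.ofReal_div_of_pos (by norm_num)]; simp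
  rw [hh, ← ENNReal.ofReal_mul (mul_pos (gaussD_pos _ _) (isingZ_pos _)).le,
    ← ENNReal.ofReal_add]
  · congr 1
    rw [mul_assoc, ← mul_add]
    congr 1
    rw [isingZ, isingNum, Finset.sum_mul, Finset.mul_sum, ← Finset.sum_add_distrib]
    refine Finset.sum_congr rfl fun σ _ => ?_
    have hpos : 0 < |ψ x| * |ψ y| := mul_pos (abs_pos.2 hψx) (abs_pos.2 hψy)
    have e1 : spinFlip σ (fun i => |ψ i|) x * spinFlip σ (fun i => |ψ i|) y =
        (spin σ x * spin σ y) * (|ψ x| * |ψ y|) := by simp only [spinFlip]; ring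
    simp only [Set.indicator, Set.mem_ofPred_eq, e1, spin_mul_spin]
    split_ifs with h2 h3 h3
    · simp; ring
    · linarith
    · linarith
    · ring
  · exact mul_nonneg (mul_pos (gaussD_pos _ _) (isingZ_pos _)).le (by norm_num)
  · exact mul_nonneg (gaussD_pos _ _).le (mul_nonneg (by norm_num)
      (isingNum_nonneg _ (h.fieldJ_nonneg ψ) x y))

lemma card_mul_gaussZ_ne_zero (M : Matrix ι ι ℝ) :
    (Fintype.card (ι → ℤˣ) : ℝ≥0∞) * gaussZ M ≠ 0 :=
  mul_ne_zero (by simp) (gaussZ_ne_zero M)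

lemma card_mul_gaussZ_ne_top {M : Matrix ι ι ℝ} (hM : M.PosDef) :
    (Fintype.card (ι → ℤˣ) : ℝ≥0∞) * gaussZ M ≠ ⊤ :=
  ENNReal.mul_ne_top (by simp) (gaussZ_ne_top hM)

/-- Lupu's identity at the level of the discrete field. -/
theorem Coupled.sameSign_eq {c : ι × ι → ℝ} {M : Matrix ι ι ℝ} (h : Coupled c M)
    (hM : M.PosDef) {x y : ι} (hxy : x ≠ y) :
    gaussM M {ψ | 0 < ψ x * ψ y} = 1 / 2 +
      ∫⁻ ψ, ENNReal.ofReal (bernProb (openProb c ψ) fun ω => eConn ω x y) ∂gaussM M := by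
  refine (ENNReal.mul_right_inj (card_mul_gaussZ_ne_zero M) (card_mul_gaussZ_ne_top hM)).1 ?_
  rw [h.gaussM_sameSign hM, mul_add, h.lintegral_gaussM hM (by fun_prop)
    (fun ψ => bernProb_nonneg (openProb_nonneg h.nonneg ψ) (openProb_le_one c ψ) _)]
  congr 1
  refine lintegral_congr fun ψ => ?_
  congr 2
  exact (sum_isingWt_bernProb_univ h.nonneg (fun i => abs_nonneg (ψ i)) hxy).symm

/-- Connection probabilities inside an edge set dominate those of the decoupled field. -/
theorem Coupled.sameSign_le {c : ι × ι → ℝ} {M M' : Matrix ι ι ℝ} (h : Coupled c M)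
    (hM : M.PosDef) (hM' : M'.PosDef) (E' : Finset (ι × ι))
    (h' : Coupled (fun e => if e ∈ E' then c e else 0) M') (hd : ∀ i, M' i i = M i i)
    {x y : ι} (hxy : x ≠ y) :
    gaussM M' {ψ | 0 < ψ x * ψ y} ≤ 1 / 2 +
      ∫⁻ ψ, ENNReal.ofReal (bernProb (openProb c ψ) fun ω => eConn (ω ∩ E') x y) ∂gaussM M := by
  set c' : ι × ι → ℝ := fun e => if e ∈ E' then c e else 0 with hc'
  have hZ := card_mul_gaussZ_ne_zero M
  have hZt := card_mul_gaussZ_ne_top hM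
  have hZ' := card_mul_gaussZ_ne_zero M'
  have hZt' := card_mul_gaussZ_ne_top hM'
  have hDD : gaussD M' = gaussD M := by funext r; simp only [gaussD, hd]
  set I := ∫⁻ ψ, ENNReal.ofReal (bernProb (openProb c ψ) fun ω => eConn (ω ∩ E') x y) ∂gaussM M
  have hI := h.lintegral_gaussM hM (F := fun ψ => bernProb (openProb c ψ)
    fun ω => eConn (ω ∩ E') x y) (by fun_prop)
    (fun ψ => bernProb_nonneg (openProb_nonneg h.nonneg ψ) (openProb_le_one c ψ) _)
  set Fb : (ι → ℝ) → ℝ := fun ψ => ∑ σ, isingWt (fieldJ c fun i => |ψ i|) σ *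
    bernProb (openProb c (spinFlip σ fun i => |ψ i|)) (fun ω => eConn (ω ∩ E') x y) with hFb
  have hFbm : Measurable Fb := by
    refine Finset.measurable_sum _ fun σ _ => ?_
    refine Measurable.mul ?_ ?_
    · unfold isingWt fieldJ; fun_prop
    · exact (measurable_bernProb_openProb c _).comp
        ((measurable_flip σ).comp (by fun_prop : Measurable fun ψ : ι → ℝ => fun i => |ψ i|))
  have hFb0 (ψ) : 0 ≤ Fb ψ := Finset.sum_nonneg fun σ _ => mul_nonneg (isingWt_pos _ _).le
    (bernProb_nonneg (openProb_nonneg h.nonneg _) (openProb_le_one c _) _)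
  have hff (r : ι → ℝ) : fieldJ c' r = fun e => if e ∈ E' then c e * r e.1 * r e.2 else 0 := by
    funext e; simp only [fieldJ, hc']; split_ifs <;> ring
  have h4 := lintegral_pi_mul_le_of_absJoin
    (f₁ := fun ψ => ENNReal.ofReal (gaussD M (fun i => |ψ i|) *
      ((1 / 2) * isingNum (fieldJ c' fun i => |ψ i|) x y)))
    (f₂ := fun ψ => ENNReal.ofReal (gaussD M (fun i => |ψ i|) * isingZ (fieldJ c fun i => |ψ i|)))
    (f₃ := fun ψ => ENNReal.ofReal (gaussD M (fun i => |ψ i|) * Fb ψ))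
    (f₄ := fun ψ => ENNReal.ofReal (gaussD M (fun i => |ψ i|) * isingZ (fieldJ c' fun i => |ψ i|)))
    (by fun_prop) (by fun_prop) (by fun_prop) (by fun_prop) ?_
  · rw [← h.gaussZ_eq hM, ← hI, ← hDD, ← h'.gaussZ_eq hM'] at h4
    rw [← ENNReal.mul_le_mul_iff_right hZ' hZt', h'.gaussM_sameSign hM', mul_add]
    refine add_le_add le_rfl ?_
    rw [← ENNReal.mul_le_mul_iff_right hZ hZt, mul_comm]
    refine h4.trans (le_of_eq ?_)
    ring
  · intro ψ ψ'
    have hn := isingNum_nonneg _ (h'.fieldJ_nonneg ψ) x y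
    rw [← ENNReal.ofReal_mul (mul_nonneg (gaussD_pos _ _).le (by positivity)),
      ← ENNReal.ofReal_mul (mul_nonneg (gaussD_pos _ _).le (hFb0 _))]
    refine ENNReal.ofReal_le_ofReal ?_
    have hD := gaussD_absJoin M ψ ψ'
    set θ : ι → ℝ := fun i => absJoin (ψ i) (ψ' i) with hθ
    set η : ι → ℝ := fun i => absMeet (ψ i) (ψ' i) with hη
    have hmain : (1 / 2) * isingNum (fieldJ c' fun i => |ψ i|) x y *
        isingZ (fieldJ c fun i => |ψ' i|) ≤ Fb θ * isingZ (fieldJ c' fun i => |η i|) := by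
      have g1 := isingZ_join_meet (c := c) h'.nonneg
        (fun e => by simp only [hc']; split_ifs; exacts [le_rfl, h.nonneg e])
        (fun i => abs_nonneg (ψ i)) (fun i => abs_nonneg (ψ' i))
      simp only [← abs_absJoin, ← abs_absMeet] at g1
      have g2 := griffiths_second (fieldJ c' fun i => |ψ i|) (fieldJ c' fun i => |θ i|)
        (h'.fieldJ_nonneg ψ) (fun e => by
          have hle (i : ι) : |ψ i| ≤ |θ i| := by
            simp only [hθ, abs_absJoin]; exact le_max_left _ _
          exact mul_le_mul (mul_le_mul_of_nonneg_left (hle _) (h'.nonneg e)) (hle _) (abs_nonneg _)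
            (mul_nonneg (h'.nonneg e) (abs_nonneg _))) x y
      have g3 : (1 / 2) * isingNum (fieldJ c' fun i => |θ i|) x y *
          isingZ (fieldJ c fun i => |θ i|) ≤ Fb θ * isingZ (fieldJ c' fun i => |θ i|) := by
        rw [hff]
        exact sum_isingWt_bernProb_ge h.nonneg (fun i => abs_nonneg (θ i)) E' hxy
      have p1 := isingZ_pos (fieldJ c' fun i => |ψ i|)
      have p2 := isingZ_pos (fieldJ c' fun i => |θ i|)
      have p3 := isingZ_pos (fieldJ c fun i => |ψ' i|)
      have p4 := isingZ_pos (fieldJ c' fun i => |η i|)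
      have p5 := isingZ_pos (fieldJ c fun i => |θ i|)
      have hnθ := isingNum_nonneg _ (h'.fieldJ_nonneg θ) x y
      refine le_of_mul_le_mul_right ?_ p2
      calc _ = (1 / 2) * (isingNum (fieldJ c' fun i => |ψ i|) x y *
              isingZ (fieldJ c' fun i => |θ i|)) * isingZ (fieldJ c fun i => |ψ' i|) := by ring
        _ ≤ (1 / 2) * (isingNum (fieldJ c' fun i => |θ i|) x y *
              isingZ (fieldJ c' fun i => |ψ i|)) * isingZ (fieldJ c fun i => |ψ' i|) := by gcongr
        _ = (1 / 2) * isingNum (fieldJ c' fun i => |θ i|) x y *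
              (isingZ (fieldJ c' fun i => |ψ i|) * isingZ (fieldJ c fun i => |ψ' i|)) := by ring
        _ ≤ (1 / 2) * isingNum (fieldJ c' fun i => |θ i|) x y *
              (isingZ (fieldJ c fun i => |θ i|) * isingZ (fieldJ c' fun i => |η i|)) := by gcongr
        _ = (1 / 2) * isingNum (fieldJ c' fun i => |θ i|) x y *
              isingZ (fieldJ c fun i => |θ i|) * isingZ (fieldJ c' fun i => |η i|) := by ring
        _ ≤ Fb θ * isingZ (fieldJ c' fun i => |θ i|) * isingZ (fieldJ c' fun i => |η i|) := by
            gcongr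
        _ = _ := by ring
    calc _ = gaussD M (fun i => |ψ i|) * gaussD M (fun i => |ψ' i|) *
          ((1 / 2) * isingNum (fieldJ c' fun i => |ψ i|) x y *
            isingZ (fieldJ c fun i => |ψ' i|)) := by ring
      _ ≤ gaussD M (fun i => |ψ i|) * gaussD M (fun i => |ψ' i|) *
          (Fb θ * isingZ (fieldJ c' fun i => |η i|)) :=
          mul_le_mul_of_nonneg_left hmain (mul_pos (gaussD_pos _ _) (gaussD_pos _ _)).le
      _ = _ := by rw [hD]; ring

end SignFlip

section SignCorrelation

open Matrix

set_option linter.unusedSectionVars false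

variable {ι : Type*} [Fintype ι] [DecidableEq ι]

lemma lintegral_exp_gaussianReal (t : ℝ) :
    ∫⁻ x, ENNReal.ofReal (Real.exp (t * x)) ∂gaussianReal 0 1 =
      ENNReal.ofReal (Real.exp (t ^ 2 / 2)) := by
  rw [← ofReal_integral_eq_lintegral_ofReal (integrable_exp_mul_gaussianReal t)
    (ae_of_all _ fun _ => (Real.exp_pos _).le)]
  have := mgf_gaussianReal (μ := 0) (v := 1) (p := gaussianReal 0 1) (X := id) (by simp) t
  simp only [mgf, id] at this
  rw [this]
  simp

lemma gaussM_map_pair {M : Matrix ι ι ℝ} (hM : M.PosDef) {s t : ι → ℝ}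
    (hs : s ⬝ᵥ M⁻¹ *ᵥ s = 1) (ht : t ⬝ᵥ M⁻¹ *ᵥ t = 1) (hst : s ⬝ᵥ M⁻¹ *ᵥ t = 0) :
    (gaussM M).map (fun ψ => (s ⬝ᵥ ψ, t ⬝ᵥ ψ)) = (gaussianReal 0 1).prod (gaussianReal 0 1) := by
  have := gaussM_isProb hM
  have hm : Measurable fun ψ : ι → ℝ => (s ⬝ᵥ ψ, t ⬝ᵥ ψ) := by fun_prop
  have : IsProbabilityMeasure ((gaussM M).map (fun ψ => (s ⬝ᵥ ψ, t ⬝ᵥ ψ))) :=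
    Measure.isProbabilityMeasure_map hm.aemeasurable
  have hL (L : StrongDual ℝ (ℝ × ℝ)) (p : ℝ × ℝ) : L p = L (1, 0) * p.1 + L (0, 1) * p.2 := by
    conv_lhs => rw [show p = p.1 • ((1 : ℝ), (0 : ℝ)) + p.2 • ((0 : ℝ), (1 : ℝ)) by simp]
    rw [map_add, map_smul, map_smul]
    simp only [smul_eq_mul]; ring
  refine measure_eq_of_laplace (fun L => (L (1, 0) ^ 2 + L (0, 1) ^ 2).toNNReal) (fun L => ?_)
    fun L => ?_
  · rw [Measure.map_map (by fun_prop) hm]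
    have h1 : (L : ℝ × ℝ → ℝ) ∘ (fun ψ : ι → ℝ => (s ⬝ᵥ ψ, t ⬝ᵥ ψ)) =
        fun ψ => (L (1, 0) • s + L (0, 1) • t) ⬝ᵥ ψ := by
      funext ψ
      simp only [Function.comp, add_dotProduct, smul_dotProduct, smul_eq_mul]
      rw [hL]
    rw [h1, gaussM_map_dotProduct hM]
    congr 2
    rw [quadForm_add hM.inv]
    simp only [smul_dotProduct, mulVec_smul, dotProduct_smul, hs, ht, hst, smul_eq_mul]
    ring
  · refine eq_gaussianReal_of_laplace _ fun r => ?_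
    rw [lintegral_map (by fun_prop) (by fun_prop)]
    have h1 (p : ℝ × ℝ) : ENNReal.ofReal (Real.exp (r * L p)) =
        ENNReal.ofReal (Real.exp ((r * L (1, 0)) * p.1)) *
          ENNReal.ofReal (Real.exp ((r * L (0, 1)) * p.2)) := by
      rw [← ENNReal.ofReal_mul (Real.exp_pos _).le, ← Real.exp_add, hL L p]
      congr 2; ring
    simp only [h1]
    rw [lintegral_prod_mul (f := fun x => ENNReal.ofReal (Real.exp ((r * L (1, 0)) * x)))
      (g := fun x => ENNReal.ofReal (Real.exp ((r * L (0, 1)) * x))) (by fun_prop) (by fun_prop),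
      lintegral_exp_gaussianReal, lintegral_exp_gaussianReal,
      ← ENNReal.ofReal_mul (Real.exp_pos _).le, ← Real.exp_add,
      Real.coe_toNNReal _ (by positivity)]
    congr 2; ring

/-- Reduction of the sign correlation to two independent standard Gaussians. -/
lemma gaussianReal_prod_sameSign {κ : ℝ} (hκ : 0 ≤ κ) :
    2 * (gaussianReal 0 1).prod (gaussianReal 0 1) {p : ℝ × ℝ | 0 < κ * p.1 ^ 2 + p.1 * p.2} =
      1 + (gaussianReal 0 1).prod (gaussianReal 0 1) {p : ℝ × ℝ | |p.1 * p.2| < κ * p.1 ^ 2} := by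
  set γ := gaussianReal 0 1
  set A := {p : ℝ × ℝ | 0 < κ * p.1 ^ 2 + p.1 * p.2} with hA
  set A' := {p : ℝ × ℝ | 0 < κ * p.1 ^ 2 - p.1 * p.2} with hA'
  have hmA : MeasurableSet A := measurableSet_lt measurable_const (by fun_prop)
  have hmA' : MeasurableSet A' := measurableSet_lt measurable_const (by fun_prop)
  have hneg : γ.map (fun x => -x) = γ := by
    have := gaussianReal_map_neg (μ := 0) (v := 1); simpa using this
  have h1 : γ.prod γ A = γ.prod γ A' := by
    have : (γ.prod γ).map (Prod.map id fun x => -x) = γ.prod γ := by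
      rw [← Measure.map_prod_map _ _ measurable_id measurable_neg, hneg, Measure.map_id]
    rw [← this, Measure.map_apply (by fun_prop) hmA, this]
    congr 1
    ext p
    simp [hA, hA', sub_eq_add_neg]
  have h2 : A ∩ A' = {p : ℝ × ℝ | |p.1 * p.2| < κ * p.1 ^ 2} := by
    ext p
    simp only [hA, hA', Set.mem_inter_iff, Set.mem_ofPred_eq, abs_lt]
    constructor
    · rintro ⟨h, h'⟩; constructor <;> linarith
    · rintro ⟨h, h'⟩; constructor <;> linarith
  have h3 : γ.prod γ (A ∪ A') = 1 := by
    have : NullSingletonClass γ := nullSingletonClass_gaussianReal (by simp)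
    rw [prob_compl_eq_zero_iff (hmA.union hmA') |>.symm]
    refine measure_mono_null (t := ({0} ×ˢ Set.univ) ∪ (Set.univ ×ˢ {0})) ?_ ?_
    · intro p hp
      by_contra hc
      simp only [Set.mem_union, Set.mem_prod, Set.mem_singleton_iff, Set.mem_univ, and_true,
        true_and, not_or] at hc
      apply hp
      simp only [hA, hA', Set.mem_union, Set.mem_ofPred_eq]
      rcases lt_or_gt_of_ne (mul_ne_zero hc.1 hc.2) with h | h
      · right; nlinarith [mul_nonneg hκ (sq_nonneg p.1)]
      · left; nlinarith [mul_nonneg hκ (sq_nonneg p.1)]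
    · rw [measure_union_null_iff, Measure.prod_prod, Measure.prod_prod, measure_singleton]
      simp
  have := measure_union_add_inter (μ := γ.prod γ) A hmA'
  rw [h3, h2, ← h1] at this
  rw [this, two_mul]

lemma gaussM_sameSign_eq {M : Matrix ι ι ℝ} (hM : M.PosDef) {x y : ι} (hxy : x ≠ y)
    (h0 : 0 ≤ M⁻¹ x y) : 0 < M⁻¹ x x * M⁻¹ y y - M⁻¹ x y ^ 2 ∧
    2 * gaussM M {ψ | 0 < ψ x * ψ y} = 1 + (gaussianReal 0 1).prod (gaussianReal 0 1)
      {p : ℝ × ℝ | |p.1 * p.2| < M⁻¹ x y / √(M⁻¹ x x * M⁻¹ y y - M⁻¹ x y ^ 2) * p.1 ^ 2} := by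
  set G := M⁻¹ with hG
  have hGp : G.PosDef := hM.inv
  set ex : ι → ℝ := Pi.single x 1
  set ey : ι → ℝ := Pi.single y 1
  have e (i j : ι) : (Pi.single i 1 : ι → ℝ) ⬝ᵥ G *ᵥ (Pi.single j 1) = G i j := by simp
  have hsym : G y x = G x y := by rw [← e y x, posDef_isSymm hGp, e]
  have hv : 0 < G x x := by
    rw [← e x x]; exact posDef_quadForm_pos hGp (by simp)
  set v := G x x with hvd
  set g := G x y with hgd
  set w := G y y with hwd
  have hw : 0 < v * w - g ^ 2 := by
    have hne : v • ey - g • ex ≠ 0 := by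
      intro h
      have := congrFun h y
      simp [ex, ey, hxy.symm] at this
      exact hv.ne' this
    have := posDef_quadForm_pos hGp hne
    rw [sub_eq_add_neg, quadForm_add hGp] at this
    simp only [smul_dotProduct, mulVec_smul, dotProduct_smul, mulVec_neg, dotProduct_neg,
      neg_dotProduct, smul_eq_mul, ex, ey, e, hsym] at this
    have h2 : 0 < v * (v * w - g ^ 2) := by
      simp only [← hvd, ← hwd] at this; linarith
    exact (mul_pos_iff_of_pos_left hv).1 h2
  refine ⟨hw, ?_⟩
  set D := v * w - g ^ 2 with hD
  have hsv : 0 < √v := Real.sqrt_pos.2 hv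
  have hsD : 0 < √D := Real.sqrt_pos.2 hw
  have hv2 : √v * √v = v := Real.mul_self_sqrt hv.le
  have hD2 : √D * √D = D := Real.mul_self_sqrt hw.le
  set s : ι → ℝ := (√v)⁻¹ • ex with hs
  set t : ι → ℝ := (√v / √D) • ey + (-(√v / √D * (g / v))) • ex with ht
  have hpair := gaussM_map_pair hM (s := s) (t := t) ?_ ?_ ?_
  · rw [← gaussianReal_prod_sameSign (div_nonneg h0 hsD.le), ← hpair,
      Measure.map_apply (by fun_prop) (measurableSet_lt measurable_const (by fun_prop))]
    congr 2
    ext ψ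
    have h1 : s ⬝ᵥ ψ = (√v)⁻¹ * ψ x := by simp [hs, ex]
    have h2 : t ⬝ᵥ ψ = √v / √D * (ψ y - g / v * ψ x) := by
      simp [ht, ex, ey, add_dotProduct]; ring
    simp only [Set.mem_ofPred_eq, Set.preimage, h1, h2]
    have h3 : g / √D * ((√v)⁻¹ * ψ x) ^ 2 + (√v)⁻¹ * ψ x * (√v / √D * (ψ y - g / v * ψ x)) =
        (√D)⁻¹ * (ψ x * ψ y) := by
      have hne := hsD.ne'
      have hne' := hsv.ne'
      have hne2 := hv.ne'
      have hi : g / v * ψ x = g * ((√v)⁻¹ * ((√v)⁻¹ * ψ x)) := by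
        rw [← mul_assoc (√v)⁻¹, ← mul_inv, hv2]; ring
      rw [hi]; field_simp; ring
    rw [h3]
    exact (mul_pos_iff_of_pos_left (inv_pos.2 hsD)).symm
  · simp only [hs, smul_dotProduct, mulVec_smul, dotProduct_smul, smul_eq_mul, ex, e, ← hG, ← hvd]
    field_simp; linarith [hv2]
  · rw [← hG, ht, quadForm_add hGp]
    simp only [smul_dotProduct, mulVec_smul, dotProduct_smul, smul_eq_mul, ex, ey, e, ← hvd, ← hwd,
      hsym]
    have hw' : w = (D + g ^ 2) / v := by rw [hD]; field_simp; ring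
    have hr : √v / √D * (√v / √D) = v / D := by rw [div_mul_div_comm, hv2, hD2]
    have hw2 := hw.ne'
    have hv3 := hv.ne'
    calc _ = √v / √D * (√v / √D) * (w - g ^ 2 / v) := by field_simp; ring
      _ = v / D * (D / v) := by rw [hr, hw']; congr 1; field_simp; ring
      _ = 1 := by field_simp
  · rw [← hG, ht, hs]
    simp only [smul_dotProduct, mulVec_smul, dotProduct_smul, smul_eq_mul, ex, ey, e, ← hvd,
      mulVec_add, dotProduct_add, ← hgd]
    field_simp; ring

end SignCorrelation

section SignBounds

open Matrix

set_option linter.unusedSectionVars false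

variable {ι : Type*} [Fintype ι] [DecidableEq ι]

lemma gaussianReal_ge_volume {s : Set ℝ} (hs : s ⊆ Set.Icc (-2) 2) (hm : MeasurableSet s) :
    ENNReal.ofReal (gaussianPDFReal 0 1 2) * volume s ≤ gaussianReal 0 1 s := by
  rw [gaussianReal_apply _ (by simp), ← setLIntegral_const]
  refine setLIntegral_mono' hm fun x hx => ENNReal.ofReal_le_ofReal ?_
  have h := hs hx
  simp only [gaussianPDFReal]
  have : x ^ 2 ≤ 2 ^ 2 := sq_le_sq' h.1 h.2
  gcongr ?_ * Real.exp ?_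
  simp only [sub_zero, NNReal.coe_one, mul_one]
  linarith

lemma gaussianReal_le_volume (s : Set ℝ) :
    gaussianReal 0 1 s ≤ ENNReal.ofReal (1 / 2) * volume s := by
  rw [gaussianReal_apply _ (by simp), ← setLIntegral_const]
  refine lintegral_mono fun x => ENNReal.ofReal_le_ofReal ?_
  simp only [gaussianPDFReal, NNReal.coe_one, mul_one]
  have h2 : (2 : ℝ) ≤ √(2 * π) := by
    refine Real.le_sqrt_of_sq_le ?_
    nlinarith [Real.pi_gt_three]
  have h1 : Real.exp (-(x - 0) ^ 2 / 2) ≤ 1 := by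
    rw [Real.exp_le_one_iff]; nlinarith [sq_nonneg (x - 0)]
  calc _ ≤ (√(2 * π))⁻¹ * 1 := by gcongr
    _ ≤ 1 / 2 := by rw [mul_one, one_div]; gcongr

lemma exists_gaussianReal_prod_lower : ∃ c > 0, ∀ κ : ℝ, 0 ≤ κ → ENNReal.ofReal (c * min κ 1) ≤
    (gaussianReal 0 1).prod (gaussianReal 0 1) {p : ℝ × ℝ | |p.1 * p.2| < κ * p.1 ^ 2} := by
  have hm : 0 < gaussianPDFReal 0 1 2 := gaussianPDFReal_pos 0 1 2 (by simp)
  refine ⟨gaussianPDFReal 0 1 2 * gaussianPDFReal 0 1 2, mul_pos hm hm, fun κ hκ => ?_⟩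
  have hmin : 0 ≤ min κ 1 := le_min hκ zero_le_one
  have h1 := gaussianReal_ge_volume (s := Set.Ioo 1 2) (fun x hx => ⟨by linarith [hx.1], hx.2.le⟩)
    measurableSet_Ioo
  have h2 := gaussianReal_ge_volume (s := Set.Ioo 0 (min κ 1))
    (fun x hx => ⟨by linarith [hx.1], by linarith [hx.2, min_le_right κ 1]⟩) measurableSet_Ioo
  rw [Real.volume_Ioo] at h1 h2
  have hsub : Set.Ioo (1 : ℝ) 2 ×ˢ Set.Ioo 0 (min κ 1) ⊆
      {p : ℝ × ℝ | |p.1 * p.2| < κ * p.1 ^ 2} := by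
    rintro ⟨a, b⟩ ⟨⟨ha, -⟩, hb, hb'⟩
    simp only [Set.mem_ofPred_eq]
    simp only [] at ha hb hb'
    have hb2 : b < κ := hb'.trans_le (min_le_left _ _)
    rw [abs_of_pos (mul_pos (by linarith) hb)]
    nlinarith [mul_nonneg hκ (by linarith : 0 ≤ a - 1)]
  refine le_trans ?_ (measure_mono hsub)
  rw [Measure.prod_prod]
  refine le_trans (le_of_eq ?_) (mul_le_mul' h1 h2)
  rw [← ENNReal.ofReal_mul hm.le, ← ENNReal.ofReal_mul hm.le, ← ENNReal.ofReal_mul (by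
    norm_num; exact hm.le)]
  congr 1; ring

lemma gaussianReal_prod_upper {κ : ℝ} (hκ : 0 ≤ κ) :
    (gaussianReal 0 1).prod (gaussianReal 0 1) {p : ℝ × ℝ | |p.1 * p.2| < κ * p.1 ^ 2} ≤
      ENNReal.ofReal (4 * κ) := by
  have hm : MeasurableSet {p : ℝ × ℝ | |p.1 * p.2| < κ * p.1 ^ 2} :=
    measurableSet_lt (by fun_prop) (by fun_prop)
  rw [Measure.prod_apply hm]
  have h1 (x : ℝ) : gaussianReal 0 1 (Prod.mk x ⁻¹' {p : ℝ × ℝ | |p.1 * p.2| < κ * p.1 ^ 2}) ≤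
      ENNReal.ofReal κ * (ENNReal.ofReal (Real.exp (1 * x)) +
        ENNReal.ofReal (Real.exp (-1 * x))) := by
    have hsub : Prod.mk x ⁻¹' {p : ℝ × ℝ | |p.1 * p.2| < κ * p.1 ^ 2} ⊆
        Set.Ioo (-(κ * |x|)) (κ * |x|) := by
      intro y hy
      simp only [Set.mem_preimage, Set.mem_ofPred_eq, abs_mul] at hy
      have hx : 0 < |x| := by
        rcases (abs_nonneg x).eq_or_lt with h | h
        · have : x = 0 := abs_eq_zero.1 h.symm
          simp [this] at hy
        · exact h
      rw [← sq_abs] at hy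
      have : |y| < κ * |x| := by
        by_contra hc; push Not at hc; nlinarith
      exact abs_lt.1 this
    refine (measure_mono hsub).trans ((gaussianReal_le_volume _).trans ?_)
    rw [Real.volume_Ioo, ← ENNReal.ofReal_add (Real.exp_pos _).le (Real.exp_pos _).le,
      ← ENNReal.ofReal_mul hκ, ← ENNReal.ofReal_mul (by norm_num)]
    refine ENNReal.ofReal_le_ofReal ?_
    have : |x| ≤ Real.exp (1 * x) + Real.exp (-1 * x) := by
      have e1 := Real.add_one_le_exp (1 * x)
      have e2 := Real.add_one_le_exp (-1 * x)
      have e3 := Real.exp_pos (1 * x)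
      have e4 := Real.exp_pos (-1 * x)
      rcases abs_cases x with ⟨h, -⟩ | ⟨h, -⟩ <;> linarith
    nlinarith
  refine (lintegral_mono h1).trans ?_
  rw [lintegral_const_mul _ (by fun_prop), lintegral_add_left (by fun_prop),
    lintegral_exp_gaussianReal, lintegral_exp_gaussianReal,
    ← ENNReal.ofReal_add (Real.exp_pos _).le (Real.exp_pos _).le, ← ENNReal.ofReal_mul hκ]
  refine ENNReal.ofReal_le_ofReal ?_
  have : Real.exp (1 / 2) ≤ 2 := by
    have h := Real.exp_one_lt_d9
    have h2 : Real.exp (1 / 2) * Real.exp (1 / 2) = Real.exp 1 := by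
      rw [← Real.exp_add]; norm_num
    have := Real.exp_pos (1 / 2)
    nlinarith
  norm_num at this ⊢
  nlinarith

lemma ENNReal.eq_half_add_of_two_mul {a q : ℝ≥0∞} (h : 2 * a = 1 + q) : a = 1 / 2 + q / 2 := by
  rw [← ENNReal.add_div, ← h, mul_comm, ENNReal.mul_div_cancel_right (by simp) (by simp)]

lemma exists_sameSign_lower : ∃ c > 0, ∀ {ι : Type*} [Fintype ι] [DecidableEq ι]
    (M : Matrix ι ι ℝ) (_ : M.PosDef) (x y : ι) (_ : x ≠ y) (K : ℝ) (_ : M⁻¹ x x ≤ K)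
    (_ : M⁻¹ y y ≤ K) (_ : 0 ≤ M⁻¹ x y),
    1 / 2 + ENNReal.ofReal (c * (M⁻¹ x y / K)) ≤ gaussM M {ψ | 0 < ψ x * ψ y} := by
  obtain ⟨c, hc, hlow⟩ := exists_gaussianReal_prod_lower
  refine ⟨c / 2, by positivity, ?_⟩
  intro ι _ _ M hM x y hxy K hx hy h0
  obtain ⟨hD, h2⟩ := gaussM_sameSign_eq hM hxy h0
  rw [ENNReal.eq_half_add_of_two_mul h2]
  refine add_le_add le_rfl ?_
  have hv : 0 < M⁻¹ x x := by
    have := posDef_quadForm_pos hM.inv (ψ := Pi.single x 1) (by simp)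
    simpa using this
  have hK : 0 < K := hv.trans_le hx
  have hw : 0 < M⁻¹ y y := by
    have := posDef_quadForm_pos hM.inv (ψ := Pi.single y 1) (by simp)
    simpa using this
  set D := M⁻¹ x x * M⁻¹ y y - M⁻¹ x y ^ 2
  have hsD : 0 < √D := Real.sqrt_pos.2 hD
  have hKK : M⁻¹ x x * M⁻¹ y y ≤ K * K := mul_le_mul hx hy hw.le hK.le
  have hDK : √D ≤ K := by
    rw [Real.sqrt_le_left hK.le]
    simp only [D]; nlinarith [sq_nonneg (M⁻¹ x y)]
  have hgK : M⁻¹ x y ≤ K := by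
    by_contra hcon; push Not at hcon
    simp only [D] at hD; nlinarith
  refine le_trans ?_ (ENNReal.div_le_div_right (hlow _ (div_nonneg h0 hsD.le)) 2)
  rw [← ENNReal.ofReal_ofNat 2, ← ENNReal.ofReal_div_of_pos (by norm_num)]
  refine ENNReal.ofReal_le_ofReal ?_
  have h3 : M⁻¹ x y / K ≤ min (M⁻¹ x y / √D) 1 :=
    le_min (div_le_div_of_nonneg_left h0 hsD hDK) ((div_le_one hK).2 hgK)
  calc _ = c * (M⁻¹ x y / K) / 2 := by ring
    _ ≤ _ := by gcongr

lemma sameSign_upper {M : Matrix ι ι ℝ} (hM : M.PosDef) {x y : ι} (hxy : x ≠ y) {k : ℝ}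
    (hk : 0 < k) (hx : k ≤ M⁻¹ x x) (hy : k ≤ M⁻¹ y y) (h0 : 0 ≤ M⁻¹ x y) :
    gaussM M {ψ | 0 < ψ x * ψ y} ≤ 1 / 2 + ENNReal.ofReal (4 * (M⁻¹ x y / k)) := by
  obtain ⟨hD, h2⟩ := gaussM_sameSign_eq hM hxy h0
  have := gaussM_isProb hM
  set g := M⁻¹ x y
  have hkk : k * k ≤ M⁻¹ x x * M⁻¹ y y := mul_le_mul hx hy hk.le (hk.le.trans hx)
  by_cases hg : k ≤ 2 * g
  · refine prob_le_one.trans ?_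
    have : (1 / 2 : ℝ≥0∞) + 1 / 2 = 1 := ENNReal.add_halves 1
    refine this.symm.le.trans (add_le_add le_rfl ?_)
    rw [show (1 / 2 : ℝ≥0∞) = ENNReal.ofReal (1 / 2) by
      rw [ENNReal.ofReal_div_of_pos (by norm_num)]; simp]
    refine ENNReal.ofReal_le_ofReal ?_
    rw [← mul_div_assoc, le_div_iff₀ hk]; linarith
  · push Not at hg
    rw [ENNReal.eq_half_add_of_two_mul h2]
    refine add_le_add le_rfl ?_
    set D := M⁻¹ x x * M⁻¹ y y - g ^ 2
    have hsD : 0 < √D := Real.sqrt_pos.2 hD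
    have hDk : k / 2 ≤ √D := by
      refine Real.le_sqrt_of_sq_le ?_
      simp only [D]; nlinarith
    refine (ENNReal.div_le_div_right (gaussianReal_prod_upper (div_nonneg h0 hsD.le)) 2).trans ?_
    rw [← ENNReal.ofReal_ofNat 2, ← ENNReal.ofReal_div_of_pos (by norm_num)]
    refine ENNReal.ofReal_le_ofReal ?_
    have : g / √D ≤ g / (k / 2) := div_le_div_of_nonneg_left h0 (by positivity) hDk
    have e : g / (k / 2) = 2 * (g / k) := by field_simp
    linarith

end SignBounds

section ShiftedExponential

open Matrix

set_option linter.unusedSectionVars false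

variable {ι : Type*} [Fintype ι] [DecidableEq ι]

lemma lintegral_pi_prod (f : ι → ℝ → ℝ≥0∞) (hf : ∀ i, Measurable (f i)) :
    ∫⁻ t : ι → ℝ, ∏ i, f i (t i) = ∏ i, ∫⁻ x, f i x := by
  let μ : ι → Measure ℝ := fun _ => volume
  have hF : Measurable fun t : ι → ℝ => ∏ i, f i (t i) :=
    Finset.measurable_prod _ fun i _ => (hf i).comp (measurable_pi_apply i)
  have main (s : Finset ι) : ∀ t : ι → ℝ, lmarginal μ s (fun t => ∏ i, f i (t i)) t =
      (∏ i ∈ s, ∫⁻ x, f i x) * ∏ i ∈ sᶜ, f i (t i) := by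
    induction s using Finset.induction_on with
    | empty => simp
    | insert i s hi ih =>
      intro t
      rw [lmarginal_insert _ hF hi]
      simp only [ih]
      have hc : sᶜ = insert i (insert i s)ᶜ := by
        ext j; by_cases h : j = i <;> simp [h, hi]
      have hni : i ∉ (insert i s)ᶜ := by simp
      have e (x : ℝ) : ∏ j ∈ sᶜ, f j (Function.update t i x j) =
          f i x * ∏ j ∈ (insert i s)ᶜ, f j (t j) := by
        rw [hc, Finset.prod_insert hni]
        congr 1
        · simp
        · refine Finset.prod_congr rfl fun j hj => ?_
          rw [Function.update_of_ne (by rintro rfl; exact hni hj)]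
      simp only [e]
      rw [lintegral_const_mul _ ((hf i).mul_const _), lintegral_mul_const _ (hf i),
        Finset.prod_insert hi]
      ring
  have := main Finset.univ 0
  simpa only [lmarginal_univ, Finset.compl_univ, Finset.prod_empty, mul_one, μ, ← volume_pi]
    using this

lemma two_mul_mul_le_add_mul_self (a b : ℝ≥0∞) : 2 * (a * b) ≤ a * a + b * b := by
  rcases eq_or_ne a ⊤ with rfl | ha
  · simp
  rcases eq_or_ne b ⊤ with rfl | hb
  · simp
  lift a to ℝ≥0 using ha
  lift b to ℝ≥0 using hb
  norm_cast
  rw [← NNReal.coe_le_coe]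
  push_cast
  nlinarith [sq_nonneg ((a : ℝ) - b)]

/-- A square root, in the sense of convolutions, of the two-sided exponential kernel. -/
def expRoot (d t x : ℝ) : ℝ≥0∞ :=
  if d = 0 then (Set.Ico 0 1).indicator 1 t
  else (Set.Ici (-x)).indicator (fun t => ENNReal.ofReal (√(2 * d) * Real.exp (-d * (t + x)))) t

lemma measurable_expRoot (d : ℝ) : Measurable fun p : ℝ × ℝ => expRoot d p.1 p.2 := by
  unfold expRoot
  split_ifs
  · exact (measurable_one.indicator measurableSet_Ico).comp measurable_fst
  · have : (fun p : ℝ × ℝ => (Set.Ici (-p.2)).indicator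
        (fun t => ENNReal.ofReal (√(2 * d) * Real.exp (-d * (t + p.2)))) p.1) =
        {p : ℝ × ℝ | -p.2 ≤ p.1}.indicator
          fun p => ENNReal.ofReal (√(2 * d) * Real.exp (-d * (p.1 + p.2))) := by
      funext p
      simp [Set.indicator]
    rw [this]
    exact Measurable.indicator (by fun_prop) (measurableSet_le (by fun_prop) (by fun_prop))

@[fun_prop]
lemma Measurable.expRoot {α : Type*} [MeasurableSpace α] (d : ℝ) {f g : α → ℝ} (hf : Measurable f)
    (hg : Measurable g) : Measurable fun z => expRoot d (f z) (g z) :=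
  (measurable_expRoot d).comp (hf.prodMk hg)

lemma expRoot_sub {d u : ℝ} (h : d = 0 → u = 0) (t x : ℝ) :
    expRoot d t (x - u) = expRoot d (t - u) x := by
  unfold expRoot
  split_ifs with hd
  · rw [h hd, sub_zero]
  · simp only [Set.indicator, Set.mem_Ici]
    have e1 : (-(x - u) ≤ t) = (-x ≤ t - u) := propext ⟨fun h => by linarith, fun h => by linarith⟩
    have e2 : t + (x - u) = t - u + x := by ring
    simp only [e1, e2]

lemma lintegral_expRoot {d : ℝ} (hd : 0 ≤ d) (x y : ℝ) :
    ∫⁻ t, expRoot d t x * expRoot d t y = ENNReal.ofReal (Real.exp (-(d * |x - y|))) := by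
  wlog hxy : x ≤ y generalizing x y
  · rw [abs_sub_comm, ← this y x (not_le.1 hxy).le]
    exact lintegral_congr fun t => mul_comm _ _
  unfold expRoot
  split_ifs with h0
  · have : ∀ t : ℝ, ((Set.Ico (0 : ℝ) 1).indicator (1 : ℝ → ℝ≥0∞) t *
        (Set.Ico (0 : ℝ) 1).indicator (1 : ℝ → ℝ≥0∞) t) = (Set.Ico (0 : ℝ) 1).indicator 1 t := by
      intro t; by_cases h : t ∈ Set.Ico (0 : ℝ) 1 <;> simp [h]
    simp only [this]
    rw [lintegral_indicator_one measurableSet_Ico]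
    simp [h0]
  · have hd' : 0 < d := lt_of_le_of_ne hd (Ne.symm h0)
    have e (t : ℝ) : (Set.Ici (-x)).indicator
        (fun t => ENNReal.ofReal (√(2 * d) * Real.exp (-d * (t + x)))) t *
        (Set.Ici (-y)).indicator
        (fun t => ENNReal.ofReal (√(2 * d) * Real.exp (-d * (t + y)))) t =
        (Set.Ici (-x)).indicator (fun t => ENNReal.ofReal (2 * d * Real.exp (-d * (x + y)) *
          Real.exp ((-(2 * d)) * t))) t := by
      by_cases h : -x ≤ t
      · have h2 : -y ≤ t := by linarith
        simp only [Set.indicator, Set.mem_Ici, h, h2, if_true]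
        rw [← ENNReal.ofReal_mul (by positivity)]
        congr 1
        have hs : √(2 * d) * √(2 * d) = 2 * d := Real.mul_self_sqrt (by positivity)
        calc _ = (√(2 * d) * √(2 * d)) * (Real.exp (-d * (t + x)) * Real.exp (-d * (t + y))) := by
              ring
          _ = _ := by
              rw [hs, ← Real.exp_add, mul_assoc (2 * d), ← Real.exp_add]; congr 2; ring
      · simp [Set.indicator, h]
    simp only [e]
    rw [lintegral_indicator measurableSet_Ici, setLIntegral_congr Ioi_ae_eq_Ici.symm,
      ← ofReal_integral_eq_lintegral_ofReal
      ((integrableOn_exp_mul_Ioi (by linarith) _).const_mul _)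
      (ae_of_all _ fun t => by positivity), integral_const_mul,
      integral_exp_mul_Ioi (by linarith)]
    congr 1
    rw [abs_of_nonpos (by linarith)]
    have : 2 * d * Real.exp (-d * (x + y)) * (-Real.exp (-(2 * d) * -x) / -(2 * d)) =
      Real.exp (-d * (x + y)) * Real.exp (-(2 * d) * -x) := by field_simp
    rw [this, ← Real.exp_add]; congr 1; ring

lemma lintegral_prod_exp_shift_le_aux (μ : Measure (ι → ℝ)) [SFinite μ]
    (hμ : μ.map (fun ξ => -ξ) = μ)
    {d u : ι → ℝ} (hd : ∀ i, 0 ≤ d i) (hu : ∀ i, d i = 0 → u i = 0) (r : ℝ) :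
    ∫⁻ ξ, ∫⁻ ξ', ∏ i, ENNReal.ofReal (Real.exp (-(d i * |r * ξ i + r * ξ' i - u i|))) ∂μ ∂μ ≤
    ∫⁻ ξ, ∫⁻ ξ', ∏ i, ENNReal.ofReal (Real.exp (-(d i * |r * ξ i + r * ξ' i|))) ∂μ ∂μ := by
  set T : (ι → ℝ) → ℝ≥0∞ := fun t => ∫⁻ ξ, ∏ i, expRoot (d i) (t i) (r * ξ i) ∂μ with hT
  have hTm : Measurable T := Measurable.lintegral_prod_right'
    (f := fun p : (ι → ℝ) × (ι → ℝ) => ∏ i, expRoot (d i) (p.1 i) (r * p.2 i)) (by fun_prop)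
  have key (u : ι → ℝ) (hu : ∀ i, d i = 0 → u i = 0) :
      ∫⁻ ξ, ∫⁻ ξ', ∏ i, ENNReal.ofReal (Real.exp (-(d i * |r * ξ i + r * ξ' i - u i|))) ∂μ ∂μ =
      ∫⁻ t, T (t - u) * T t := by
    have e1 (ξ : ι → ℝ) :
        ∫⁻ ξ', ∏ i, ENNReal.ofReal (Real.exp (-(d i * |r * ξ i + r * ξ' i - u i|))) ∂μ =
        ∫⁻ t : ι → ℝ, (∏ i, expRoot (d i) (t i) (r * ξ i - u i)) * T t := by
      conv_lhs => rw [← hμ]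
      rw [lintegral_map (by fun_prop) (by fun_prop)]
      have e2 (ξ' : ι → ℝ) :
          ∏ i, ENNReal.ofReal (Real.exp (-(d i * |r * ξ i + r * (-ξ') i - u i|))) =
          ∫⁻ t : ι → ℝ, (∏ i, expRoot (d i) (t i) (r * ξ i - u i)) *
            ∏ i, expRoot (d i) (t i) (r * ξ' i) := by
        simp only [← Finset.prod_mul_distrib]
        rw [lintegral_pi_prod (fun i x => expRoot (d i) x (r * ξ i - u i) *
          expRoot (d i) x (r * ξ' i)) (fun i => by fun_prop)]
        refine Finset.prod_congr rfl fun i _ => ?_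
        rw [lintegral_expRoot (hd i)]
        congr 5
        simp only [Pi.neg_apply]; ring
      simp only [e2]
      rw [lintegral_lintegral_swap (by fun_prop)]
      refine lintegral_congr fun t => ?_
      rw [lintegral_const_mul _ (by fun_prop)]
    simp only [e1]
    rw [lintegral_lintegral_swap (by fun_prop)]
    refine lintegral_congr fun t => ?_
    rw [lintegral_mul_const _ (by fun_prop)]
    congr 1
    refine lintegral_congr fun ξ => Finset.prod_congr rfl fun i _ => ?_
    rw [expRoot_sub (hu i)]; rfl
  have h0 := key 0 (by simp)
  simp only [Pi.zero_apply, sub_zero] at h0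
  rw [key u hu, h0]
  have hs : ∫⁻ t, T (t - u) * T (t - u) = ∫⁻ t, T t * T t :=
    lintegral_sub_right_eq_self (μ := volume) (fun t => T t * T t) u
  refine (ENNReal.mul_le_mul_iff_right (a := 2) (by simp) (by simp)).1 ?_
  calc 2 * ∫⁻ t, T (t - u) * T t = ∫⁻ t, 2 * (T (t - u) * T t) :=
        (lintegral_const_mul _ (by fun_prop)).symm
    _ ≤ ∫⁻ t, (T (t - u) * T (t - u) + T t * T t) := by
        refine lintegral_mono fun t => ?_
        exact two_mul_mul_le_add_mul_self _ _
    _ = 2 * ∫⁻ t, T t * T t := by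
        rw [lintegral_add_left (by fun_prop), hs, two_mul]

/-- Shifting the centres of two-sided exponential weights decreases Gaussian-type averages. -/
lemma lintegral_prod_exp_shift_le (μ : Measure (ι → ℝ)) [SFinite μ]
    (hμ : μ.map (fun ξ => -ξ) = μ)
    {d : ι → ℝ} (hd : ∀ i, 0 ≤ d i) (u : ι → ℝ) (r : ℝ) :
    ∫⁻ ξ, ∫⁻ ξ', ∏ i, ENNReal.ofReal (Real.exp (-(d i * |r * ξ i + r * ξ' i - u i|))) ∂μ ∂μ ≤
    ∫⁻ ξ, ∫⁻ ξ', ∏ i, ENNReal.ofReal (Real.exp (-(d i * |r * ξ i + r * ξ' i|))) ∂μ ∂μ := by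
  refine le_trans (le_of_eq ?_) (lintegral_prod_exp_shift_le_aux μ hμ hd
    (u := fun i => if d i = 0 then 0 else u i) (fun i h => by simp [h]) r)
  refine lintegral_congr fun ξ => lintegral_congr fun ξ' => Finset.prod_congr rfl fun i _ => ?_
  by_cases h : d i = 0 <;> simp [h]

end ShiftedExponential

section LevelShift

open Matrix

set_option linter.unusedSectionVars false

variable {ι : Type*} [Fintype ι] [DecidableEq ι]

/-- Restriction of a vector to a set of coordinates. -/
def onSet (A : Finset ι) (ψ : ι → ℝ) : ι → ℝ := fun i => if i ∈ A then ψ i else 0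

/-- The block-diagonal part of a matrix with respect to `A` and its complement. -/
def blockM (B : Matrix ι ι ℝ) (A : Finset ι) : Matrix ι ι ℝ :=
  fun i j => if (i ∈ A ↔ j ∈ A) then B i j else 0

@[fun_prop]
lemma measurable_onSet (A : Finset ι) : Measurable (onSet A : (ι → ℝ) → ι → ℝ) := by
  refine measurable_pi_lambda _ fun i => ?_
  unfold onSet
  split_ifs <;> fun_prop

lemma onSet_add_onSet_compl (A : Finset ι) (ψ : ι → ℝ) : onSet A ψ + onSet Aᶜ ψ = ψ := by
  funext i
  by_cases h : i ∈ A <;> simp [onSet, h]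

lemma onSet_dotProduct (A : Finset ι) (u v : ι → ℝ) : onSet A u ⬝ᵥ v = u ⬝ᵥ onSet A v := by
  simp only [dotProduct, onSet]
  exact Finset.sum_congr rfl fun i _ => by split_ifs <;> simp

lemma onSet_onSet (A : Finset ι) (u : ι → ℝ) : onSet A (onSet A u) = onSet A u := by
  funext i; by_cases h : i ∈ A <;> simp [onSet, h]

lemma onSet_compl_onSet (A : Finset ι) (u : ι → ℝ) : onSet Aᶜ (onSet A u) = 0 := by
  funext i; by_cases h : i ∈ A <;> simp [onSet, h]

lemma onSet_onSet_compl (A : Finset ι) (u : ι → ℝ) : onSet A (onSet Aᶜ u) = 0 := by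
  funext i; by_cases h : i ∈ A <;> simp [onSet, h]

lemma blockM_mulVec_onSet (B : Matrix ι ι ℝ) (A : Finset ι) (u : ι → ℝ) :
    blockM B A *ᵥ onSet A u = onSet A (blockM B A *ᵥ u) := by
  funext i
  simp only [mulVec, dotProduct, onSet, blockM]
  by_cases h : i ∈ A
  · simp only [h, if_true, true_iff]
    exact Finset.sum_congr rfl fun j _ => by split_ifs <;> simp
  · simp only [h, if_false, false_iff]
    exact Finset.sum_eq_zero fun j _ => by split_ifs <;> simp

lemma blockM_mulVec_onSet' (B : Matrix ι ι ℝ) (A : Finset ι) (u : ι → ℝ) :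
    blockM B A *ᵥ onSet A u = onSet A (B *ᵥ onSet A u) := by
  funext i
  simp only [mulVec, dotProduct, onSet, blockM]
  by_cases h : i ∈ A
  · simp only [h, if_true, true_iff]
    exact Finset.sum_congr rfl fun j _ => by split_ifs <;> simp
  · simp only [h, if_false, false_iff]
    exact Finset.sum_eq_zero fun j _ => by split_ifs <;> simp

lemma blockM_compl (B : Matrix ι ι ℝ) (A : Finset ι) : blockM B Aᶜ = blockM B A := by
  funext i j
  simp only [blockM, Finset.mem_compl, not_iff_not]

lemma blockM_quadForm (B : Matrix ι ι ℝ) (A : Finset ι) (ψ : ι → ℝ) :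
    ψ ⬝ᵥ blockM B A *ᵥ ψ =
      onSet A ψ ⬝ᵥ B *ᵥ onSet A ψ + onSet Aᶜ ψ ⬝ᵥ B *ᵥ onSet Aᶜ ψ := by
  conv_lhs => rw [← onSet_add_onSet_compl A ψ]
  rw [mulVec_add, blockM_mulVec_onSet']
  nth_rw 1 [← blockM_compl]
  rw [blockM_mulVec_onSet', add_dotProduct, dotProduct_add, dotProduct_add,
    onSet_dotProduct A ψ (onSet Aᶜ _), onSet_onSet_compl, onSet_dotProduct Aᶜ ψ (onSet A _),
    onSet_compl_onSet, ← onSet_dotProduct, ← onSet_dotProduct, onSet_onSet, onSet_onSet]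
  simp

variable {B : Matrix ι ι ℝ}

lemma blockM_posDef (hB : B.PosDef) (A : Finset ι) : (blockM B A).PosDef := by
  refine PosDef.of_dotProduct_mulVec_pos ?_ fun ψ hψ => ?_
  · have h : ∀ i j, B j i = B i j := fun i j => by
      have := hB.1
      simpa using congrFun (congrFun this i) j
    ext i j
    simp only [conjTranspose_apply, blockM, star_trivial, h i j, Iff.comm]
  · rw [star_trivial, blockM_quadForm]
    by_cases h : onSet A ψ = 0
    · have h' : onSet Aᶜ ψ ≠ 0 := fun h' => hψ (by rw [← onSet_add_onSet_compl A ψ, h, h', add_zero])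
      linarith [posDef_quadForm_nonneg hB (onSet A ψ), posDef_quadForm_pos hB h']
    · linarith [posDef_quadForm_pos hB h, posDef_quadForm_nonneg hB (onSet Aᶜ ψ)]

lemma blockM_inv_mulVec_onSet (hB : B.PosDef) (A : Finset ι) (t : ι → ℝ) :
    (blockM B A)⁻¹ *ᵥ onSet A t = onSet A ((blockM B A)⁻¹ *ᵥ t) := by
  have hM := blockM_posDef hB A
  rw [← inv_mulVec_mulVec hM (onSet A ((blockM B A)⁻¹ *ᵥ t)), blockM_mulVec_onSet,
    mulVec_inv_mulVec hM]

/-- The field built from independent blocks, the second one being split in two halves. -/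
lemma gaussM_blockM_eq_map (hB : B.PosDef) (A : Finset ι) :
    gaussM (blockM B A) = ((gaussM (blockM B A)).prod
      ((gaussM (blockM B A)).prod (gaussM (blockM B A)))).map fun p =>
        onSet A p.1 + onSet Aᶜ (fun i => √2⁻¹ * p.2.1 i + √2⁻¹ * p.2.2 i) := by
  set M := blockM B A with hMdef
  have hM : M.PosDef := blockM_posDef hB A
  have := gaussM_isProb hM
  refine HasCov.eq (G := M⁻¹) (posDef_quadForm_nonneg hM.inv) (hasCov_gaussM hM) fun t => ?_
  rw [lintegral_map (by fun_prop) (by fun_prop)]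
  have e (p : (ι → ℝ) × (ι → ℝ) × (ι → ℝ)) : ENNReal.ofReal (Real.exp (t ⬝ᵥ
      (onSet A p.1 + onSet Aᶜ (fun i => √2⁻¹ * p.2.1 i + √2⁻¹ * p.2.2 i)))) =
      ENNReal.ofReal (Real.exp (onSet A t ⬝ᵥ p.1)) *
        (ENNReal.ofReal (Real.exp ((√2⁻¹ • onSet Aᶜ t) ⬝ᵥ p.2.1)) *
        ENNReal.ofReal (Real.exp ((√2⁻¹ • onSet Aᶜ t) ⬝ᵥ p.2.2))) := by
    rw [← ENNReal.ofReal_mul (Real.exp_nonneg _), ← ENNReal.ofReal_mul (Real.exp_nonneg _),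
      ← Real.exp_add, ← Real.exp_add]
    congr 2
    rw [dotProduct_add, ← onSet_dotProduct, ← onSet_dotProduct]
    congr 1
    rw [smul_dotProduct, smul_dotProduct, ← smul_add, ← dotProduct_add, ← dotProduct_smul]
    congr 1
    funext i; simp; ring
  simp only [e]
  rw [lintegral_prod_mul (f := fun ψ => ENNReal.ofReal (Real.exp (onSet A t ⬝ᵥ ψ)))
      (g := fun p : (ι → ℝ) × (ι → ℝ) => ENNReal.ofReal (Real.exp ((√2⁻¹ • onSet Aᶜ t) ⬝ᵥ p.1)) *
        ENNReal.ofReal (Real.exp ((√2⁻¹ • onSet Aᶜ t) ⬝ᵥ p.2))) (by fun_prop) (by fun_prop),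
    lintegral_prod_mul (f := fun ψ => ENNReal.ofReal (Real.exp ((√2⁻¹ • onSet Aᶜ t) ⬝ᵥ ψ)))
      (g := fun ψ => ENNReal.ofReal (Real.exp ((√2⁻¹ • onSet Aᶜ t) ⬝ᵥ ψ)))
      (by fun_prop) (by fun_prop), lintegral_exp_gaussM hM, lintegral_exp_gaussM hM,
    ← ENNReal.ofReal_mul (Real.exp_nonneg _), ← ENNReal.ofReal_mul (Real.exp_nonneg _),
      ← Real.exp_add, ← Real.exp_add]
  congr 2
  have h1 : M⁻¹ *ᵥ onSet A t = onSet A (M⁻¹ *ᵥ t) := blockM_inv_mulVec_onSet hB A t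
  have h2 : M⁻¹ *ᵥ onSet Aᶜ t = onSet Aᶜ (M⁻¹ *ᵥ t) := by
    have := blockM_inv_mulVec_onSet hB Aᶜ t
    rwa [blockM_compl] at this
  have hs : √2⁻¹ * √2⁻¹ = (2 : ℝ)⁻¹ := Real.mul_self_sqrt (by norm_num)
  rw [mulVec_smul, smul_dotProduct, dotProduct_smul, smul_smul, hs, h1, h2, ← onSet_dotProduct,
    ← onSet_dotProduct, onSet_onSet, onSet_onSet]
  conv_rhs => rw [← onSet_add_onSet_compl A t, add_dotProduct, onSet_add_onSet_compl]
  simp only [smul_eq_mul]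
  ring

/-- The strength of the pull towards zero exerted by `A` on the other coordinates. -/
def bdryPull (B : Matrix ι ι ℝ) (A : Finset ι) (η : ι → ℝ) (j : ι) : ℝ :=
  if j ∈ A then 0 else -∑ i ∈ A, B i j * η i

@[fun_prop]
lemma measurable_bdryPull (B : Matrix ι ι ℝ) (A : Finset ι) (j : ι) :
    Measurable fun η : ι → ℝ => bdryPull B A η j := by
  unfold bdryPull; split_ifs <;> fun_prop

lemma bdryPull_nonneg {c : ι × ι → ℝ} (h : Coupled c B) {A : Finset ι} {η : ι → ℝ}
    (hη : ∀ i ∈ A, 0 < η i) (j : ι) : 0 ≤ bdryPull B A η j := by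
  unfold bdryPull
  split_ifs with hj
  · rfl
  · rw [← Finset.sum_neg_distrib]
    refine Finset.sum_nonneg fun i hi => ?_
    have hij : i ≠ j := by rintro rfl; exact hj hi
    rw [← neg_mul, ← h.add_swap i j hij]
    exact mul_nonneg (add_nonneg (h.nonneg _) (h.nonneg _)) (hη i hi).le

lemma posDef_symm_apply (hB : B.PosDef) (i j : ι) : B i j = B j i := by
  simpa using (congrFun (congrFun hB.1 j) i)

/-- The cross terms of a quadratic form. -/
lemma dotProduct_mulVec_sub_blockM (B : Matrix ι ι ℝ) (A : Finset ι) (u v : ι → ℝ)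
    (hv : ∀ i ∈ A, v i = 0) :
    u ⬝ᵥ B *ᵥ v = u ⬝ᵥ blockM B A *ᵥ v + ∑ i ∈ A, u i * (B *ᵥ v) i := by
  have hv' : onSet Aᶜ v = v := by
    funext i; by_cases hi : i ∈ A <;> simp [onSet, hi, hv]
  have h1 : blockM B A *ᵥ v = onSet Aᶜ (B *ᵥ v) := by
    rw [← blockM_compl]; nth_rw 1 [← hv']; rw [blockM_mulVec_onSet', hv']
  have h2 : ∑ i ∈ A, u i * (B *ᵥ v) i = u ⬝ᵥ onSet A (B *ᵥ v) := by
    simp [dotProduct, onSet, Finset.sum_ite_mem]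
  rw [h1, h2, ← dotProduct_add, add_comm, onSet_add_onSet_compl]

lemma quadForm_eq_blockM_add (hB : B.PosDef) (A : Finset ι) (η : ι → ℝ) :
    η ⬝ᵥ B *ᵥ η = η ⬝ᵥ blockM B A *ᵥ η - 2 * ∑ j, bdryPull B A η j * η j := by
  have h : ∑ j, bdryPull B A η j * η j = -(onSet A η ⬝ᵥ B *ᵥ onSet Aᶜ η) := by
    simp only [dotProduct, mulVec, onSet, bdryPull, Finset.mul_sum]
    rw [Finset.sum_comm, ← Finset.sum_neg_distrib]
    refine Finset.sum_congr rfl fun j _ => ?_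
    by_cases hj : j ∈ A
    · simp [hj]
    · simp only [hj, if_false, Finset.mem_compl, not_false_eq_true, if_true, ite_mul, zero_mul,
        Finset.sum_ite_mem, Finset.univ_inter, neg_mul, Finset.sum_mul]
      congr 1
      exact Finset.sum_congr rfl fun i _ => by ring
  rw [h, blockM_quadForm]
  conv_lhs => rw [← onSet_add_onSet_compl A η]
  rw [quadForm_add hB]
  ring

lemma gaussWt_mul_clusterProb {c : ι × ι → ℝ} (h : Coupled c B) (hB : B.PosDef) (x : ι)
    {A : Finset ι} {η : ι → ℝ} (hη : ∀ i ∈ A, 0 < η i) :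
    gaussWt B η * clusterProb c x A η = clusterKernel c x A η * gaussWt (blockM B A) η *
      ∏ j, Real.exp (-(bdryPull B A η j * |η j|)) := by
  rw [clusterProb_eq, prod_bdry_eq _ _ _ fun i hi => (hη i hi).le, ← Real.exp_sum, gaussWt,
    gaussWt, mul_left_comm, mul_assoc, ← Real.exp_add, ← Real.exp_add]
  congr 2
  rw [quadForm_eq_blockM_add hB A]
  have : ∑ i ∈ A, ∑ j ∈ Aᶜ, 2 * (c (i, j) + c (j, i)) * η i * max (η j) 0 =
      ∑ j, 2 * bdryPull B A η j * max (η j) 0 := by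
    rw [Finset.sum_comm, ← Finset.sum_compl_add_sum A (fun j => 2 * bdryPull B A η j * max (η j) 0)]
    have h0 : ∑ j ∈ A, 2 * bdryPull B A η j * max (η j) 0 = 0 :=
      Finset.sum_eq_zero fun j hj => by simp [bdryPull, hj]
    rw [h0, add_zero]
    refine Finset.sum_congr rfl fun j hj => ?_
    rw [Finset.mem_compl] at hj
    rw [bdryPull, if_neg hj, mul_neg, Finset.mul_sum, ← Finset.sum_neg_distrib, Finset.sum_mul]
    refine Finset.sum_congr rfl fun i hi => ?_
    rw [h.add_swap i j (by rintro rfl; exact hj hi)]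
    ring
  rw [this, mul_sub, sub_eq_add_neg, add_assoc]
  congr 1
  rw [Finset.sum_neg_distrib, Finset.mul_sum, Finset.mul_sum, ← Finset.sum_neg_distrib,
    ← Finset.sum_neg_distrib, ← Finset.sum_neg_distrib, ← Finset.sum_add_distrib]
  refine Finset.sum_congr rfl fun j _ => ?_
  rcases le_total 0 (η j) with hj | hj
  · rw [max_eq_left hj, abs_of_nonneg hj]; ring
  · rw [max_eq_right hj, abs_of_nonpos hj]; ring

/-- The probability that the cluster of `x` in the excursion set above level `a` is `A`. -/
def levelProb (B : Matrix ι ι ℝ) (c : ι × ι → ℝ) (x : ι) (A : Finset ι) (a : ℝ) : ℝ≥0∞ :=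
  ∫⁻ ψ, ENNReal.ofReal (clusterProb c x A fun i => ψ i - a) ∂gaussM B

@[fun_prop]
lemma measurable_clusterProb (c : ι × ι → ℝ) (x : ι) (A : Finset ι) :
    Measurable (clusterProb c x A) := measurable_bernProb_openProb c _

@[fun_prop]
lemma measurable_clusterKernel (c : ι × ι → ℝ) (x : ι) (A : Finset ι) :
    Measurable (clusterKernel c x A) := by
  unfold clusterKernel openProb
  refine Finset.measurable_sum _ fun S _ => ?_
  split_ifs
  · exact (Finset.measurable_prod _ fun e _ => by fun_prop).mul
      (Finset.measurable_prod _ fun e _ => by fun_prop)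
  · exact measurable_const

lemma clusterProb_eq_zero {c : ι × ι → ℝ} {x y : ι} {A : Finset ι} {η : ι → ℝ}
    (hy : y ∈ A) (hxy : x ≠ y) (h : ¬ ∀ i ∈ A, 0 < η i) : clusterProb c x A η = 0 := by
  by_contra hc
  exact h (clusterProb_pos_on hc hy hxy)

lemma levelProb_eq (hB : B.PosDef) (c : ι × ι → ℝ) (x : ι) (A : Finset ι) (a : ℝ) :
    levelProb B c x A a = (gaussZ B)⁻¹ * ∫⁻ η, ENNReal.ofReal
      (Real.exp (-(a * ∑ i, η i * ∑ j, B i j) - (1 / 2) * a ^ 2 * ∑ i, ∑ j, B i j) *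
        (gaussWt B η * clusterProb c x A η)) := by
  rw [levelProb, lintegral_gaussM _ (by fun_prop)]
  congr 1
  rw [← lintegral_add_right_eq_self _ (fun _ : ι => a)]
  refine lintegral_congr fun η => ?_
  rw [← ENNReal.ofReal_mul (gaussWt_pos _ _).le]
  have h1 : (fun i => (η + fun _ : ι => a : ι → ℝ) i - a) = η := by funext i; simp
  rw [h1, ← mul_assoc, gaussWt, quadForm_add hB, gaussWt, ← Real.exp_add]
  congr 3
  have h2 : (fun _ : ι => a) ⬝ᵥ B *ᵥ (fun _ => a) = a ^ 2 * ∑ i, ∑ j, B i j := by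
    simp only [dotProduct, mulVec, ← Finset.sum_mul, ← Finset.mul_sum]; ring
  have h3 : η ⬝ᵥ B *ᵥ (fun _ => a) = a * ∑ i, η i * ∑ j, B i j := by
    simp only [dotProduct, mulVec, ← Finset.sum_mul, ← mul_assoc]; ring
  rw [h2, h3]; ring

/-- The sign flip outside of `A`. -/
def outSign (A : Finset ι) : ι → ℤˣ := fun i => if i ∈ A then 1 else -1

lemma spinFlip_outSign_of_mem {A : Finset ι} {i : ι} (hi : i ∈ A) (η : ι → ℝ) :
    spinFlip (outSign A) η i = η i := by simp [spinFlip, outSign, spin, hi]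

lemma spinFlip_outSign_of_notMem {A : Finset ι} {i : ι} (hi : i ∉ A) (η : ι → ℝ) :
    spinFlip (outSign A) η i = -η i := by simp [spinFlip, outSign, spin, hi]

lemma gaussWt_mul_clusterProb_flip {c : ι × ι → ℝ} (h : Coupled c B) (hB : B.PosDef)
    {x y : ι} {A : Finset ι} (hy : y ∈ A) (hxy : x ≠ y) (η : ι → ℝ) :
    gaussWt B (spinFlip (outSign A) η) * clusterProb c x A (spinFlip (outSign A) η) =
      gaussWt B η * clusterProb c x A η := by
  have hA : ∀ i ∈ A, spinFlip (outSign A) η i = η i := fun i hi => spinFlip_outSign_of_mem hi η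
  by_cases hη : ∀ i ∈ A, 0 < η i
  · have hη' : ∀ i ∈ A, 0 < spinFlip (outSign A) η i := fun i hi => by rw [hA i hi]; exact hη i hi
    rw [gaussWt_mul_clusterProb h hB x hη, gaussWt_mul_clusterProb h hB x hη',
      clusterKernel_congr c x A hA]
    congr 1
    · congr 1
      have h1 : onSet A (spinFlip (outSign A) η) = onSet A η := by
        funext i; by_cases hi : i ∈ A <;> simp [onSet, hi, hA]
      have h2 : onSet Aᶜ (spinFlip (outSign A) η) = -onSet Aᶜ η := by
        funext i
        by_cases hi : i ∈ A
        · simp [onSet, hi]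
        · simp [onSet, hi, spinFlip_outSign_of_notMem]
      rw [gaussWt, gaussWt, blockM_quadForm, blockM_quadForm, h1, h2]
      simp [mulVec_neg]
    · refine Finset.prod_congr rfl fun j _ => ?_
      by_cases hj : j ∈ A
      · simp [bdryPull, hj]
      · rw [spinFlip_outSign_of_notMem hj, abs_neg]
        simp only [bdryPull, hj, if_false]
        rw [Finset.sum_congr rfl fun i hi => by rw [hA i hi]]
  · rw [clusterProb_eq_zero hy hxy hη, clusterProb_eq_zero hy hxy (η := spinFlip _ _)
      (fun h' => hη fun i hi => by rw [← hA i hi]; exact h' i hi), mul_zero, mul_zero]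

/-- Cluster probabilities of bulk sets are symmetric in the level. -/
lemma levelProb_neg {c : ι × ι → ℝ} (h : Coupled c B) (hB : B.PosDef)
    {x y : ι} {A : Finset ι} (hy : y ∈ A) (hxy : x ≠ y) (hκ : ∀ i ∈ A, ∑ j, B i j = 0) (a : ℝ) :
    levelProb B c x A (-a) = levelProb B c x A a := by
  rw [levelProb_eq hB, levelProb_eq hB]
  congr 1
  rw [← (volume_preserving_flip (outSign A)).lintegral_comp (by fun_prop)]
  refine lintegral_congr fun η => ?_
  rw [gaussWt_mul_clusterProb_flip h hB hy hxy]
  congr 4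
  · have : ∑ i, spinFlip (outSign A) η i * ∑ j, B i j = -∑ i, η i * ∑ j, B i j := by
      rw [← Finset.sum_neg_distrib]
      refine Finset.sum_congr rfl fun i _ => ?_
      by_cases hi : i ∈ A
      · rw [hκ i hi]; simp
      · rw [spinFlip_outSign_of_notMem hi]; ring
    rw [this]; ring
  · rw [neg_sq]

/-- Decay of cluster probabilities in the level. -/
lemma levelProb_le {c : ι × ι → ℝ} (h : Coupled c B) (hB : B.PosDef)
    {x y : ι} {A : Finset ι} (hy : y ∈ A) (hxy : x ≠ y) (hκ : ∀ i ∈ A, 0 ≤ ∑ j, B i j)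
    {v : ι → ℝ} (hv1 : ∀ i ∈ A, v i = 1) (hv0 : ∀ i, i ∉ A → (B *ᵥ v) i = 0) {a : ℝ} (ha : 0 ≤ a) :
    levelProb B c x A a ≤
      ENNReal.ofReal (Real.exp (-(1 / 2) * a ^ 2 * (v ⬝ᵥ B *ᵥ v))) * levelProb B c x A 0 := by
  set M := blockM B A with hMdef
  have hM : M.PosDef := blockM_posDef hB A
  have := gaussM_isProb hM
  let W : (ι → ℝ) → ℝ≥0∞ := fun η =>
    {η : ι → ℝ | ∀ i ∈ A, 0 < η i}.indicator (fun η => ENNReal.ofReal (clusterKernel c x A η)) η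
  have hmS : MeasurableSet {η : ι → ℝ | ∀ i ∈ A, 0 < η i} := by
    rw [show {η : ι → ℝ | ∀ i ∈ A, 0 < η i} = ⋂ i ∈ A, {η : ι → ℝ | 0 < η i} by ext; simp]
    exact Finset.measurableSet_biInter _ fun i _ =>
      measurableSet_lt measurable_const (measurable_pi_apply i)
  have hW : Measurable W := Measurable.indicator (by fun_prop) hmS
  let I : (ι → ℝ) → ℝ≥0∞ := fun u => ∫⁻ η, W η *
    ∏ j, ENNReal.ofReal (Real.exp (-(bdryPull B A η j * |η j - u j|))) ∂gaussM M
  have hI (u : ι → ℝ) : I u = (gaussZ M)⁻¹ * ∫⁻ η, ENNReal.ofReal (gaussWt M η) * (W η *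
      ∏ j, ENNReal.ofReal (Real.exp (-(bdryPull B A η j * |η j - u j|)))) :=
    lintegral_gaussM _ (by fun_prop)
  have hI0 (u : ι → ℝ) : I u ≤ I 0 := by
    let Ψ : (ι → ℝ) × (ι → ℝ) × (ι → ℝ) → ι → ℝ := fun p =>
      onSet A p.1 + onSet Aᶜ (fun i => √2⁻¹ * p.2.1 i + √2⁻¹ * p.2.2 i)
    have hΨ : Measurable Ψ := by fun_prop
    have key (u : ι → ℝ) : I u = ∫⁻ ψ, W ψ * ∫⁻ ξ, ∫⁻ ξ', ∏ j, ENNReal.ofReal (Real.exp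
        (-(bdryPull B A ψ j * |√2⁻¹ * ξ j + √2⁻¹ * ξ' j - u j|))) ∂gaussM M ∂gaussM M
          ∂gaussM M := by
      have hF : Measurable fun η : ι → ℝ => W η *
        ∏ j, ENNReal.ofReal (Real.exp (-(bdryPull B A η j * |η j - u j|))) := by fun_prop
      have hmap : gaussM M = ((gaussM M).prod ((gaussM M).prod (gaussM M))).map Ψ :=
        gaussM_blockM_eq_map hB A
      refine (congrArg (lintegral · fun η : ι → ℝ => W η * ∏ j, ENNReal.ofReal
        (Real.exp (-(bdryPull B A η j * |η j - u j|)))) hmap).trans ?_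
      refine (lintegral_map hF hΨ).trans
        ((lintegral_prod _ (hF.comp hΨ).aemeasurable).trans ?_)
      refine lintegral_congr fun ψ => ?_
      have hF2 := (hF.comp hΨ).comp (measurable_prodMk_left (x := ψ))
      refine (lintegral_prod _ hF2.aemeasurable).trans ?_
      rw [← lintegral_const_mul _ (by fun_prop)]
      refine lintegral_congr fun ξ => ?_
      rw [← lintegral_const_mul _ (by fun_prop)]
      refine lintegral_congr fun ξ' => ?_
      have hAi : ∀ i ∈ A, Ψ (ψ, ξ, ξ') i = ψ i := fun i hi => by simp [Ψ, onSet, hi]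
      have hWΨ : W (Ψ (ψ, ξ, ξ')) = W ψ := by
        have : (∀ i ∈ A, 0 < Ψ (ψ, ξ, ξ') i) ↔ ∀ i ∈ A, 0 < ψ i :=
          forall₂_congr fun i hi => by rw [hAi i hi]
        simp only [W, Set.indicator_apply, Set.mem_ofPred_eq]
        rw [clusterKernel_congr c x A hAi]
        simp only [this]
      refine congrArg₂ (· * ·) hWΨ ?_
      · refine Finset.prod_congr rfl fun j _ => ?_
        by_cases hj : j ∈ A
        · simp [bdryPull, hj]
        · have h1 : bdryPull B A (Ψ (ψ, ξ, ξ')) j = bdryPull B A ψ j := by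
            simp only [bdryPull, hj, if_false]
            rw [Finset.sum_congr rfl fun i hi => by rw [hAi i hi]]
          have h2 : Ψ (ψ, ξ, ξ') j = √2⁻¹ * ξ j + √2⁻¹ * ξ' j := by simp [Ψ, onSet, hj]
          rw [h1, h2]
    have hsymm : (gaussM M).map (fun ξ => -ξ) = gaussM M := by
      refine Measure.ext fun s hs => ?_
      rw [Measure.map_apply (by fun_prop) hs, ← lintegral_indicator_one hs,
        ← lintegral_gaussM_neg M (measurable_one.indicator hs),
        ← lintegral_indicator_one (hs.preimage (by fun_prop))]
      rfl
    rw [key, key]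
    refine lintegral_mono fun ψ => ?_
    by_cases hψ : ∀ i ∈ A, 0 < ψ i
    · refine mul_le_mul' le_rfl ?_
      simp only [Pi.zero_apply, sub_zero]
      exact lintegral_prod_exp_shift_le (gaussM M) hsymm (bdryPull_nonneg h hψ) u _
    · have : W ψ = 0 := Set.indicator_of_notMem (by simpa using hψ) _
      simp [this]
  have hpt (θ : ι → ℝ) : ENNReal.ofReal (gaussWt B θ * clusterProb c x A θ) =
      ENNReal.ofReal (gaussWt M θ) * (W θ *
        ∏ j, ENNReal.ofReal (Real.exp (-(bdryPull B A θ j * |θ j|)))) := by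
    by_cases hθ : ∀ i ∈ A, 0 < θ i
    · have : W θ = ENNReal.ofReal (clusterKernel c x A θ) := Set.indicator_of_mem (by simpa using hθ) _
      rw [gaussWt_mul_clusterProb h hB x hθ, this,
        ENNReal.ofReal_mul (mul_nonneg (clusterKernel_nonneg h.nonneg _ _ _) (gaussWt_pos _ _).le),
        ENNReal.ofReal_mul (clusterKernel_nonneg h.nonneg _ _ _),
        ENNReal.ofReal_prod_of_nonneg fun _ _ => (Real.exp_pos _).le]
      ring
    · have : W θ = 0 := Set.indicator_of_notMem (by simpa using hθ) _
      simp [this, clusterProb_eq_zero hy hxy hθ]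
  let C : ℝ≥0∞ := (gaussZ B)⁻¹ * gaussZ M
  have hCI (u : ι → ℝ) : C * I u = (gaussZ B)⁻¹ * ∫⁻ η, ENNReal.ofReal (gaussWt M η) * (W η *
      ∏ j, ENNReal.ofReal (Real.exp (-(bdryPull B A η j * |η j - u j|)))) := by
    rw [hI, mul_assoc, ← mul_assoc (gaussZ M), ENNReal.mul_inv_cancel (gaussZ_ne_zero M)
      (gaussZ_ne_top hM), one_mul]
  have h0 : levelProb B c x A 0 = C * I 0 := by
    rw [hCI, levelProb, lintegral_gaussM _ (by fun_prop)]
    congr 1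
    refine lintegral_congr fun η => ?_
    rw [← ENNReal.ofReal_mul (gaussWt_pos _ _).le]
    simpa only [Pi.zero_apply, sub_zero] using hpt η
  set m : ι → ℝ := fun i => a * (1 - v i) with hm
  have hma : levelProb B c x A a ≤
      ENNReal.ofReal (Real.exp (-(1 / 2) * a ^ 2 * (v ⬝ᵥ B *ᵥ v))) * (C * I m) := by
    rw [hCI, mul_left_comm, ← lintegral_const_mul _ (by fun_prop), levelProb,
      lintegral_gaussM_translate hB (by fun_prop) (a • v), lintegral_gaussM _ (by fun_prop)]
    refine mul_le_mul' le_rfl (lintegral_mono fun η => ?_)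
    have hmA : ∀ i ∈ A, m i = 0 := fun i hi => by simp [hm, hv1 i hi]
    have hθA : ∀ i ∈ A, (η - m) i = η i := fun i hi => by simp [hmA i hi]
    have hsub : (fun i => (η + a • v) i - a) = η - m := by
      funext i; simp only [hm, Pi.add_apply, Pi.smul_apply, smul_eq_mul, Pi.sub_apply]; ring
    simp only [hsub]
    by_cases hη : ∀ i ∈ A, 0 < η i
    swap
    · rw [clusterProb_eq_zero hy hxy fun h' => hη fun i hi => by rw [← hθA i hi]; exact h' i hi]
      simp
    have hW' : W η = W (η - m) := by
      simp only [W, Set.indicator_apply, Set.mem_ofPred_eq]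
      rw [clusterKernel_congr c x A hθA]
      have : (∀ i ∈ A, 0 < (η - m) i) ↔ ∀ i ∈ A, 0 < η i :=
        forall₂_congr fun i hi => by rw [hθA i hi]
      simp only [this]
    have hd (j : ι) : bdryPull B A η j = bdryPull B A (η - m) j := by
      simp only [bdryPull]
      rw [Finset.sum_congr rfl fun i (hi : i ∈ A) =>
        show B i j * η i = B i j * (η - m) i by rw [hθA i hi]]
    have hsplit (N : Matrix ι ι ℝ) (hN : N.PosDef) : gaussWt N η = gaussWt N (η - m) *
        Real.exp (-(η ⬝ᵥ N *ᵥ m) + (1 / 2) * (m ⬝ᵥ N *ᵥ m)) := by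
      rw [gaussWt, gaussWt, ← Real.exp_add]
      congr 1
      have := quadForm_add hN (η - m) m
      rw [sub_add_cancel, sub_dotProduct η m (N *ᵥ m)] at this
      rw [this]; ring
    have e1 : ∏ j, ENNReal.ofReal (Real.exp (-(bdryPull B A η j * |η j - m j|))) =
        ∏ j, ENNReal.ofReal (Real.exp (-(bdryPull B A (η - m) j * |(η - m) j|))) :=
      Finset.prod_congr rfl fun j _ => by rw [hd j]; rfl
    have e2 := hpt (η - m)
    rw [hW', e1, hsplit M hM, ENNReal.ofReal_mul (gaussWt_pos _ _).le,
      mul_right_comm (ENNReal.ofReal (gaussWt M (η - m))), ← e2, hsplit B hB,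
      ← ENNReal.ofReal_mul (Real.exp_nonneg _),
      ← ENNReal.ofReal_mul (mul_pos (gaussWt_pos _ _) (Real.exp_pos _)).le,
      ← ENNReal.ofReal_mul (mul_nonneg (gaussWt_pos _ _).le (clusterProb_nonneg h.nonneg _ _ _)),
      ← ENNReal.ofReal_mul (Real.exp_nonneg _)]
    refine ENNReal.ofReal_le_ofReal ?_
    have hP := mul_nonneg (gaussWt_pos B (η - m)).le (clusterProb_nonneg h.nonneg x A (η - m))
    have hmain : Real.exp (-(η ⬝ᵥ B *ᵥ m) + (1 / 2) * (m ⬝ᵥ B *ᵥ m)) *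
        Real.exp (-(η ⬝ᵥ B *ᵥ (a • v)) - 1 / 2 * ((a • v) ⬝ᵥ B *ᵥ (a • v))) ≤
        Real.exp (-(1 / 2) * a ^ 2 * (v ⬝ᵥ B *ᵥ v)) *
          Real.exp (-(η ⬝ᵥ M *ᵥ m) + (1 / 2) * (m ⬝ᵥ M *ᵥ m)) := by
      rw [← Real.exp_add, ← Real.exp_add, Real.exp_le_exp]
      rw [dotProduct_mulVec_sub_blockM B A η m hmA, dotProduct_mulVec_sub_blockM B A m m hmA]
      have h1 : ∑ i ∈ A, m i * (B *ᵥ m) i = 0 :=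
        Finset.sum_eq_zero fun i hi => by rw [hmA i hi, zero_mul]
      have h2 : η ⬝ᵥ B *ᵥ (a • v) = ∑ i ∈ A, η i * (a * (B *ᵥ v) i) := by
        rw [mulVec_smul, dotProduct, ← Finset.sum_subset (Finset.subset_univ A)]
        · rfl
        · intro i _ hi; simp [hv0 i hi]
      have h3 : 0 ≤ ∑ i ∈ A, η i * (B *ᵥ m) i + ∑ i ∈ A, η i * (a * (B *ᵥ v) i) := by
        rw [← Finset.sum_add_distrib]
        refine Finset.sum_nonneg fun i hi => ?_
        rw [← mul_add]
        refine mul_nonneg (hη i hi).le ?_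
        have : (B *ᵥ m) i + a * (B *ᵥ v) i = a * ∑ j, B i j := by
          simp only [mulVec, dotProduct, hm, Finset.mul_sum, ← Finset.sum_add_distrib]
          exact Finset.sum_congr rfl fun j _ => by ring
        rw [this]
        exact mul_nonneg ha (hκ i hi)
      have h4 : (a • v) ⬝ᵥ B *ᵥ (a • v) = a ^ 2 * (v ⬝ᵥ B *ᵥ v) := by
        rw [mulVec_smul, dotProduct_smul, smul_dotProduct]; simp only [smul_eq_mul]; ring
      rw [h1, h2, h4, add_zero]
      linarith
    calc _ = (gaussWt B (η - m) * clusterProb c x A (η - m)) * (_ * _) := by ring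
      _ ≤ (gaussWt B (η - m) * clusterProb c x A (η - m)) * _ :=
        mul_le_mul_of_nonneg_left hmain hP
      _ = _ := by ring
  refine hma.trans ?_
  rw [h0]
  gcongr
  exact hI0 m

end LevelShift

section Decoupling

open Matrix

set_option linter.unusedSectionVars false

variable {ι : Type*} [Fintype ι] [DecidableEq ι]

lemma ofReal_integral_le_lintegral {Ω : Type*} [MeasurableSpace Ω] {μ : Measure Ω} {f : Ω → ℝ}
    (hf : Integrable f μ) : ENNReal.ofReal (∫ x, f x ∂μ) ≤ ∫⁻ x, ENNReal.ofReal (f x) ∂μ := by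
  rw [integral_eq_lintegral_pos_part_sub_lintegral_neg_part hf]
  refine (ENNReal.ofReal_le_ofReal (sub_le_self _ ENNReal.toReal_nonneg)).trans ?_
  exact ENNReal.ofReal_toReal_le

lemma exp_integral_le_lintegral {Ω : Type*} [MeasurableSpace Ω] {μ : Measure Ω}
    [IsProbabilityMeasure μ] {f : Ω → ℝ} (hf : Integrable f μ) :
    ENNReal.ofReal (Real.exp (∫ x, f x ∂μ)) ≤ ∫⁻ x, ENNReal.ofReal (Real.exp (f x)) ∂μ := by
  set m := ∫ x, f x ∂μ with hm
  have h1 : Integrable (fun x => f x - m) μ := hf.sub (integrable_const m)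
  have h2 : Integrable (fun x => 1 + (f x - m)) μ := (integrable_const 1).add h1
  have hi : Integrable (fun x => Real.exp m * (1 + (f x - m))) μ := h2.const_mul _
  have he : ∫ x, Real.exp m * (1 + (f x - m)) ∂μ = Real.exp m := by
    rw [integral_const_mul, integral_add (integrable_const 1) h1, integral_sub hf
      (integrable_const m), ← hm]
    simp
  rw [← he]
  refine (ofReal_integral_le_lintegral hi).trans (lintegral_mono fun x => ?_)
  refine ENNReal.ofReal_le_ofReal ?_
  calc Real.exp m * (1 + (f x - m)) ≤ Real.exp m * Real.exp (f x - m) := by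
        gcongr; linarith [Real.add_one_le_exp (f x - m)]
    _ = Real.exp (f x) := by rw [← Real.exp_add]; ring_nf

variable {B : Matrix ι ι ℝ}

lemma dotProduct_mulVec_symm (hB : B.PosDef) (u v : ι → ℝ) : u ⬝ᵥ B *ᵥ v = v ⬝ᵥ B *ᵥ u := by
  simp only [dotProduct, mulVec, Finset.mul_sum]
  rw [Finset.sum_comm]
  refine Finset.sum_congr rfl fun i _ => Finset.sum_congr rfl fun j _ => ?_
  rw [posDef_symm_apply hB j i]; ring

/-- Maximum principle for matrices with nonpositive off-diagonal entries. -/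
lemma nonneg_of_mulVec_nonneg (hB : B.PosDef) (hoff : ∀ i j, i ≠ j → B i j ≤ 0)
    {s : ι → ℝ} (F : Finset ι) (hF : ∀ i ∈ F, 0 ≤ (B *ᵥ s) i) (hFc : ∀ i, i ∉ F → 0 ≤ s i)
    (i : ι) : 0 ≤ s i := by
  set p : ι → ℝ := fun i => max (s i) 0 with hp
  set m : ι → ℝ := fun i => max (-s i) 0 with hm
  have hs : s = p - m := by
    funext i; simp only [hp, hm, Pi.sub_apply]
    rcases le_total (s i) 0 with h | h
    · rw [max_eq_right h, max_eq_left (by linarith)]; ring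
    · rw [max_eq_left h, max_eq_right (by linarith)]; ring
  have h1 : 0 ≤ m ⬝ᵥ B *ᵥ s := Finset.sum_nonneg fun i _ => by
    by_cases hi : i ∈ F
    · exact mul_nonneg (le_max_right _ _) (hF i hi)
    · have : m i = 0 := max_eq_right (by linarith [hFc i hi])
      simp [this]
  have h2 : m ⬝ᵥ B *ᵥ p ≤ 0 := by
    refine Finset.sum_nonpos fun i _ => ?_
    simp only [mulVec, dotProduct]
    rw [Finset.mul_sum]
    refine Finset.sum_nonpos fun j _ => ?_
    by_cases hij : i = j
    · subst hij
      rcases le_total (s i) 0 with h | h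
      · simp [hp, max_eq_right h]
      · have : m i = 0 := max_eq_right (by linarith)
        simp [this]
    · exact mul_nonpos_of_nonneg_of_nonpos (le_max_right _ _)
        (mul_nonpos_of_nonpos_of_nonneg (hoff i j hij) (le_max_right _ _))
  have h3 : m ⬝ᵥ B *ᵥ m ≤ 0 := by
    rw [hs, mulVec_sub, dotProduct_sub] at h1
    linarith
  have h4 : m = 0 := by
    by_contra h
    exact absurd (posDef_quadForm_pos hB h) (not_lt.2 h3)
  have : m i = 0 := congrFun h4 i
  have h5 : -s i ≤ m i := le_max_left _ _
  linarith

/-- The Dirichlet energy identity weighted by a kernel whose image vanishes where `χ` lives. -/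
lemma sum_mul_mul_kernel_le (hB : B.PosDef) (hoff : ∀ i j, i ≠ j → B i j ≤ 0)
    (hκ : ∀ i, 0 ≤ ∑ j, B i j) {χ : ι → ℝ} {k : Matrix ι ι ℝ} (hks : ∀ i j, k i j = k j i)
    (hk : ∀ i, χ i ≠ 0 → ∑ j, B i j * k j i = 0) {K : ℝ} (hK : ∀ i j, χ j ≠ 0 → k i j ≤ K)
    (hK0 : 0 ≤ K) :
    ∑ i, ∑ j, B i j * χ i * χ j * k i j ≤ K * (χ ⬝ᵥ B *ᵥ χ) := by
  have hexp (w : Matrix ι ι ℝ) (hw : ∀ i j, w i j = w j i) :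
      ∑ i, ∑ j, B i j * χ i * χ j * w i j = ∑ i, χ i ^ 2 * ∑ j, B i j * w j i +
        (1 / 2) * ∑ i, ∑ j, (-B i j) * (χ i - χ j) ^ 2 * w i j := by
    have e1 : ∑ i, ∑ j, (-B i j) * (χ i - χ j) ^ 2 * w i j =
        2 * ∑ i, ∑ j, B i j * χ i * χ j * w i j - (∑ i, ∑ j, χ i ^ 2 * (B i j * w j i) +
          ∑ i, ∑ j, χ j ^ 2 * (B j i * w i j)) := by
      rw [Finset.mul_sum, ← Finset.sum_add_distrib, ← Finset.sum_sub_distrib]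
      refine Finset.sum_congr rfl fun i _ => ?_
      rw [Finset.mul_sum, ← Finset.sum_add_distrib, ← Finset.sum_sub_distrib]
      refine Finset.sum_congr rfl fun j _ => ?_
      rw [posDef_symm_apply hB j i, hw j i]; ring
    have e2 : ∑ i, ∑ j, χ j ^ 2 * (B j i * w i j) = ∑ i, ∑ j, χ i ^ 2 * (B i j * w j i) :=
      Finset.sum_comm
    have e3 : ∑ i, χ i ^ 2 * ∑ j, B i j * w j i = ∑ i, ∑ j, χ i ^ 2 * (B i j * w j i) := by
      simp only [Finset.mul_sum]
    rw [e1, e2, e3]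
    ring
  rw [hexp k hks]
  have h0 : ∑ i, χ i ^ 2 * ∑ j, B i j * k j i = 0 := Finset.sum_eq_zero fun i _ => by
    by_cases h : χ i = 0
    · simp [h]
    · rw [hk i h, mul_zero]
  have h1 := hexp (fun _ _ => K) fun _ _ => rfl
  have h2 : ∑ i, ∑ j, B i j * χ i * χ j * K = K * (χ ⬝ᵥ B *ᵥ χ) := by
    simp only [dotProduct, mulVec, Finset.mul_sum]
    refine Finset.sum_congr rfl fun i _ => Finset.sum_congr rfl fun j _ => by ring
  have h3 : 0 ≤ ∑ i, χ i ^ 2 * ∑ j, B i j * K := Finset.sum_nonneg fun i _ => by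
    rw [← Finset.sum_mul]; exact mul_nonneg (sq_nonneg _) (mul_nonneg (hκ i) hK0)
  have h4 : ∑ i, ∑ j, (-B i j) * (χ i - χ j) ^ 2 * k i j ≤
      ∑ i, ∑ j, (-B i j) * (χ i - χ j) ^ 2 * K := by
    refine Finset.sum_le_sum fun i _ => Finset.sum_le_sum fun j _ => ?_
    by_cases hij : i = j
    · subst hij; simp
    by_cases hχ : χ i = χ j
    · simp [hχ]
    refine mul_le_mul_of_nonneg_left ?_ (mul_nonneg (by linarith [hoff i j hij]) (sq_nonneg _))
    by_cases hj : χ j = 0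
    · rw [hks]; exact hK j i fun hi => hχ (by rw [hi, hj])
    · exact hK i j hj
  linarith

/-- The Green matrix of the block `α`. -/
def blockGreen (B : Matrix ι ι ℝ) (α : Finset ι) : Matrix ι ι ℝ :=
  fun i j => if i ∈ α then (blockM B α)⁻¹ i j else 0

/-- The harmonic extension into `α` of the field outside of `α`. -/
def harmExt (B : Matrix ι ι ℝ) (α : Finset ι) : Matrix ι ι ℝ := 1 - blockGreen B α * B

lemma blockGreen_mulVec (B : Matrix ι ι ℝ) (α : Finset ι) (t : ι → ℝ) :
    blockGreen B α *ᵥ t = onSet α ((blockM B α)⁻¹ *ᵥ t) := by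
  funext i
  by_cases h : i ∈ α <;> simp [mulVec, dotProduct, onSet, blockGreen, h]

lemma blockGreen_eq_zero (hB : B.PosDef) {α : Finset ι} {i j : ι} (hj : j ∉ α) :
    blockGreen B α i j = 0 := by
  have h := congrFun (blockM_inv_mulVec_onSet hB α (Pi.single j 1)) i
  have h0 : onSet α (Pi.single j (1 : ℝ)) = 0 := by
    funext l
    by_cases hl : l = j
    · subst hl; simp [onSet, hj]
    · simp [onSet, hl]
  rw [h0, ← blockGreen_mulVec] at h
  simpa using h.symm

lemma blockGreen_transpose (hB : B.PosDef) (α : Finset ι) :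
    (blockGreen B α)ᵀ = blockGreen B α := by
  ext i j
  rw [transpose_apply]
  by_cases hi : i ∈ α
  · by_cases hj : j ∈ α
    · simp only [blockGreen, hi, hj, if_true]
      exact posDef_symm_apply (blockM_posDef hB α).inv j i
    · rw [blockGreen_eq_zero hB hj, blockGreen, if_neg hj]
  · rw [blockGreen_eq_zero hB hi, blockGreen, if_neg hi]

lemma mul_blockGreen_apply (hB : B.PosDef) {α : Finset ι} {i : ι} (hi : i ∈ α) (j : ι) :
    (B * blockGreen B α) i j = if i = j then 1 else 0 := by
  have hM := blockM_posDef hB α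
  have h : (B * blockGreen B α) *ᵥ Pi.single j 1 = B *ᵥ onSet α ((blockM B α)⁻¹ *ᵥ Pi.single j 1) := by
    rw [← mulVec_mulVec, blockGreen_mulVec]
  have h2 := congrFun (blockM_mulVec_onSet B α ((blockM B α)⁻¹ *ᵥ Pi.single j 1)) i
  rw [blockM_mulVec_onSet', mulVec_inv_mulVec hM, onSet, onSet, if_pos hi, if_pos hi] at h2
  have h3 := congrFun h i
  rw [h2] at h3
  simpa [Pi.single_apply] using h3

lemma blockGreen_mul_mul (hB : B.PosDef) (α : Finset ι) :
    blockGreen B α * (B * blockGreen B α) = blockGreen B α := by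
  ext i j
  rw [mul_apply, Finset.sum_congr rfl (g := fun l => blockGreen B α i l * if l = j then 1 else 0)]
  · simp
  · intro l _
    by_cases hl : l ∈ α
    · rw [mul_blockGreen_apply hB hl]
    · rw [blockGreen_eq_zero hB hl, zero_mul, zero_mul]

lemma harmExt_mul_inv_mul (hB : B.PosDef) (α : Finset ι) :
    harmExt B α * B⁻¹ * (harmExt B α)ᵀ = B⁻¹ - blockGreen B α := by
  have h1 : B * B⁻¹ = 1 := mul_nonsing_inv _ (B.isUnit_iff_isUnit_det.1 hB.isUnit)
  have h2 : B⁻¹ * B = 1 := nonsing_inv_mul _ (B.isUnit_iff_isUnit_det.1 hB.isUnit)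
  have hBt : Bᵀ = B := by ext i j; exact posDef_symm_apply hB j i
  have h3 : (harmExt B α)ᵀ = 1 - B * blockGreen B α := by
    rw [harmExt, transpose_sub, transpose_mul, blockGreen_transpose hB, hBt, transpose_one]
  have h4 : harmExt B α * B⁻¹ = B⁻¹ - blockGreen B α := by
    rw [harmExt, Matrix.sub_mul, Matrix.mul_assoc, h1, Matrix.mul_one, Matrix.one_mul]
  rw [h3, h4, Matrix.mul_sub, Matrix.mul_one, Matrix.sub_mul, blockGreen_mul_mul hB,
    ← Matrix.mul_assoc, h2, Matrix.one_mul]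
  abel

/-- Domain Markov decomposition. -/
lemma gaussM_eq_map_harmExt (hB : B.PosDef) (α : Finset ι) :
    gaussM B = ((gaussM B).prod (gaussM (blockM B α))).map fun p =>
      onSet α p.2 + harmExt B α *ᵥ p.1 := by
  have hM : (blockM B α).PosDef := blockM_posDef hB α
  have := gaussM_isProb hM
  have := gaussM_isProb hB
  refine HasCov.eq (G := B⁻¹) (posDef_quadForm_nonneg hB.inv) (hasCov_gaussM hB) fun t => ?_
  have hmeas : Measurable fun p : (ι → ℝ) × (ι → ℝ) => onSet α p.2 + harmExt B α *ᵥ p.1 := by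
    exact Measurable.add (by fun_prop) (measurable_pi_lambda _ fun i =>
      (measurable_dotProduct_left (harmExt B α i)).comp measurable_fst)
  rw [lintegral_map (by fun_prop) hmeas]
  have e (p : (ι → ℝ) × (ι → ℝ)) : ENNReal.ofReal (Real.exp (t ⬝ᵥ
      (onSet α p.2 + harmExt B α *ᵥ p.1))) =
      ENNReal.ofReal (Real.exp (((harmExt B α)ᵀ *ᵥ t) ⬝ᵥ p.1)) *
        ENNReal.ofReal (Real.exp (onSet α t ⬝ᵥ p.2)) := by
    rw [← ENNReal.ofReal_mul (Real.exp_nonneg _), ← Real.exp_add, dotProduct_add,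
      ← onSet_dotProduct, dotProduct_mulVec, mulVec_transpose, add_comm]
  simp only [e]
  rw [lintegral_prod_mul (f := fun ψ => ENNReal.ofReal (Real.exp (((harmExt B α)ᵀ *ᵥ t) ⬝ᵥ ψ)))
      (g := fun ψ => ENNReal.ofReal (Real.exp (onSet α t ⬝ᵥ ψ)))
      (by fun_prop) (by fun_prop), lintegral_exp_gaussM hM, lintegral_exp_gaussM hB,
    ← ENNReal.ofReal_mul (Real.exp_nonneg _), ← Real.exp_add]
  congr 2
  have h1 : onSet α t ⬝ᵥ (blockM B α)⁻¹ *ᵥ onSet α t = t ⬝ᵥ blockGreen B α *ᵥ t := by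
    rw [blockM_inv_mulVec_onSet hB, onSet_dotProduct, onSet_onSet, blockGreen_mulVec]
  have h2 : ((harmExt B α)ᵀ *ᵥ t) ⬝ᵥ B⁻¹ *ᵥ ((harmExt B α)ᵀ *ᵥ t) =
      t ⬝ᵥ (B⁻¹ - blockGreen B α) *ᵥ t := by
    rw [← harmExt_mul_inv_mul hB, ← mulVec_mulVec, ← mulVec_mulVec, mulVec_transpose,
      ← dotProduct_mulVec]
  rw [h1, h2, sub_mulVec, dotProduct_sub]
  ring

/-- The part of the Green matrix coming from outside of `α`. -/
lemma inv_sub_blockGreen_le (hB : B.PosDef) (hoff : ∀ i j, i ≠ j → B i j ≤ 0)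
    (hκ : ∀ i, 0 ≤ ∑ j, B i j) {α : Finset ι} {j : ι} {K : ℝ} (hK0 : 0 ≤ K)
    (hK : ∀ l, l ∉ α → B⁻¹ l j ≤ K) (i : ι) : (B⁻¹ - blockGreen B α) i j ≤ K := by
  have h := nonneg_of_mulVec_nonneg hB hoff
    (s := fun i => K - (B⁻¹ - blockGreen B α) i j) α (fun i hi => ?_) (fun l hl => ?_) i
  · exact sub_nonneg.1 h
  · have h1 : B * B⁻¹ = 1 := mul_nonsing_inv _ (B.isUnit_iff_isUnit_det.1 hB.isUnit)
    have h2 : (B * (B⁻¹ - blockGreen B α)) i j = 0 := by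
      rw [Matrix.mul_sub, h1, Matrix.sub_apply, mul_blockGreen_apply hB hi, one_apply, sub_self]
    have : (B *ᵥ fun i => K - (B⁻¹ - blockGreen B α) i j) i =
        (∑ l, B i l) * K - (B * (B⁻¹ - blockGreen B α)) i j := by
      simp only [mulVec, dotProduct, mul_sub, Finset.sum_sub_distrib, Finset.sum_mul, mul_apply]
    rw [this, h2, sub_zero]
    exact mul_nonneg (hκ i) hK0
  · have : blockGreen B α l j = 0 := by simp [blockGreen, hl]
    simp only [Matrix.sub_apply, this, sub_zero, sub_nonneg]
    exact hK l hl

lemma lintegral_lintegral_mul_exp_swap {α' β' : Type*} [MeasurableSpace α'] [MeasurableSpace β']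
    {μ : Measure α'} {ν : Measure β'} [SFinite μ] [SFinite ν] {F : β' → ℝ≥0∞} (hF : Measurable F)
    {X : β' → α' → ℝ} (hX : Measurable fun p : α' × β' => X p.2 p.1) :
    ∫⁻ φ, ∫⁻ ψ, F ψ * ENNReal.ofReal (Real.exp (X ψ φ)) ∂ν ∂μ =
      ∫⁻ ψ, F ψ * ∫⁻ φ, ENNReal.ofReal (Real.exp (X ψ φ)) ∂μ ∂ν := by
  rw [lintegral_lintegral_swap]
  · refine lintegral_congr fun ψ => ?_
    rw [lintegral_const_mul]
    have : Measurable fun φ => X ψ φ := hX.comp (measurable_prodMk_right (y := ψ))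
    fun_prop
  · refine Measurable.aemeasurable ?_
    exact (hF.comp measurable_snd).mul
      (ENNReal.measurable_ofReal.comp (Real.measurable_exp.comp hX))

/-- Changing the field outside of `α` and the level costs at most the Dirichlet energies of the
two cutoff functions. -/
theorem gaussM_shift_lower (hB : B.PosDef) (hoff : ∀ i j, i ≠ j → B i j ≤ 0)
    (hκ : ∀ i, 0 ≤ ∑ j, B i j) (α D : Finset ι) {f χ : ι → ℝ} (hf : ∀ i ∈ D, f i = 1)
    (hBf : ∀ i ∈ α, (B *ᵥ f) i = 0) (hχ : ∀ i ∈ D, χ i = 1) (hχ0 : ∀ i, i ∉ α → χ i = 0)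
    {K : ℝ} (hK0 : 0 ≤ K) (hK : ∀ l, l ∉ α → ∀ j, χ j ≠ 0 → B⁻¹ l j ≤ K)
    {F : (ι → ℝ) → ℝ≥0∞} (hF : Measurable F)
    (hFD : ∀ ψ ψ' : ι → ℝ, (∀ i ∈ D, ψ i = ψ' i) → F ψ = F ψ') (a : ℝ) :
    ENNReal.ofReal (Real.exp (-(1 / 2) * (a ^ 2 * (f ⬝ᵥ B *ᵥ f) + K * (χ ⬝ᵥ B *ᵥ χ)))) *
      ∫⁻ ψ, F ψ ∂gaussM (blockM B α) ≤ ∫⁻ ψ, F (fun i => ψ i - a) ∂gaussM B := by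
  set M := blockM B α with hMdef
  have hM : M.PosDef := blockM_posDef hB α
  have := gaussM_isProb hM
  have := gaussM_isProb hB
  set H := harmExt B α with hH
  set h : (ι → ℝ) → ι → ℝ := fun φ i => χ i * (H.row i ⬝ᵥ φ) with hh
  have hhm : Measurable h := measurable_pi_lambda _ fun i => by simp only [hh]; fun_prop
  have hHf : H *ᵥ f = f := by
    have : blockGreen B α *ᵥ (B *ᵥ f) = 0 := by
      funext i
      refine Finset.sum_eq_zero fun j _ => ?_
      by_cases hj : j ∈ α
      · rw [hBf j hj, mul_zero]
      · exact (congrArg (· * _) (blockGreen_eq_zero hB hj)).trans (zero_mul _)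
    rw [hH, harmExt, sub_mulVec, one_mulVec, ← mulVec_mulVec, this, sub_zero]
  let X : (ι → ℝ) → (ι → ℝ) → ℝ := fun ψ φ =>
    (-(φ ⬝ᵥ B *ᵥ (a • f)) - (1 / 2) * ((a • f) ⬝ᵥ B *ᵥ (a • f))) +
      (-(ψ ⬝ᵥ M *ᵥ (-h φ)) - (1 / 2) * ((-h φ) ⬝ᵥ M *ᵥ (-h φ)))
  have hXm : Measurable fun p : (ι → ℝ) × (ι → ℝ) => X p.2 p.1 := by
    simp only [X, dotProduct, mulVec, Pi.neg_apply]
    fun_prop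
  have hXm' (φ : ι → ℝ) : Measurable fun ψ => X ψ φ :=
    hXm.comp (measurable_prodMk_left (x := φ))
  have hXm'' (ψ : ι → ℝ) : Measurable fun φ => X ψ φ :=
    hXm.comp (measurable_prodMk_right (y := ψ))
  have hΨ : Measurable fun p : (ι → ℝ) × (ι → ℝ) => fun i =>
      (onSet α p.2 + H *ᵥ p.1) i - a := by
    refine measurable_pi_lambda _ fun i => ?_
    have : Measurable fun p : (ι → ℝ) × (ι → ℝ) => (H *ᵥ p.1) i :=
      (measurable_dotProduct_left (H.row i)).comp measurable_fst
    simp only [Pi.add_apply]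
    fun_prop
  have hrep : ∫⁻ ψ, F (fun i => ψ i - a) ∂gaussM B =
      ∫⁻ ψ, F ψ * (∫⁻ φ, ENNReal.ofReal (Real.exp (X ψ φ)) ∂gaussM B) ∂gaussM M := by
    have hFa : Measurable fun ψ : ι → ℝ => F (fun i => ψ i - a) := hF.comp (by fun_prop)
    have hPm : Measurable fun p : (ι → ℝ) × (ι → ℝ) => onSet α p.2 + H *ᵥ p.1 :=
      Measurable.add (by fun_prop) (measurable_pi_lambda _ fun i =>
        (measurable_dotProduct_left (H.row i)).comp measurable_fst)
    refine (congrArg (lintegral · fun ψ : ι → ℝ => F (fun i => ψ i - a))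
      (gaussM_eq_map_harmExt hB α)).trans ?_
    refine (lintegral_map hFa hPm).trans ?_
    refine (lintegral_prod _ (hFa.comp hPm).aemeasurable).trans ?_
    have hG : Measurable fun φ : ι → ℝ =>
        ∫⁻ ψ, F (fun i => (onSet α ψ + H *ᵥ φ) i - a) ∂gaussM M :=
      Measurable.lintegral_prod_right' (hFa.comp hPm)
    refine (lintegral_gaussM_translate hB hG (a • f)).trans ?_
    have step (φ : ι → ℝ) : ∫⁻ ψ, F (fun i => (onSet α ψ + H *ᵥ (φ + a • f)) i - a) ∂gaussM M =
        ∫⁻ ψ, ENNReal.ofReal (Real.exp (-(ψ ⬝ᵥ M *ᵥ (-h φ)) -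
          (1 / 2) * ((-h φ) ⬝ᵥ M *ᵥ (-h φ)))) * F ψ ∂gaussM M := by
      have hm1 : Measurable fun ψ : ι → ℝ => F (fun i => (onSet α ψ + H *ᵥ (φ + a • f)) i - a) := by
        refine hF.comp (measurable_pi_lambda _ fun i => ?_)
        simp only [Pi.add_apply]
        fun_prop
      rw [lintegral_gaussM_translate hM hm1 (-h φ)]
      refine lintegral_congr fun ψ => ?_
      congr 1
      refine hFD _ _ fun i hi => ?_
      have hiα : i ∈ α := by
        by_contra hc
        have := hχ0 i hc
        rw [hχ i hi] at this
        norm_num at this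
      have h1 : (H *ᵥ (φ + a • f)) i = H.row i ⬝ᵥ φ + a := by
        rw [mulVec_add, mulVec_smul, hHf, Pi.add_apply, Pi.smul_apply, hf i hi, smul_eq_mul,
          mul_one]
        rfl
      rw [Pi.add_apply, h1]
      simp only [onSet, hiα, if_true, Pi.add_apply, Pi.neg_apply, hh, hχ i hi]
      ring
    rw [← lintegral_lintegral_mul_exp_swap hF hXm]
    refine lintegral_congr fun φ => ?_
    rw [step, ← lintegral_const_mul' _ _ ENNReal.ofReal_ne_top]
    refine lintegral_congr fun ψ => ?_
    rw [← mul_assoc, ← ENNReal.ofReal_mul (Real.exp_nonneg _), ← Real.exp_add, mul_comm]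
  have hJ (ψ : ι → ℝ) : ENNReal.ofReal (Real.exp (-(1 / 2) * (a ^ 2 * (f ⬝ᵥ B *ᵥ f) +
      K * (χ ⬝ᵥ B *ᵥ χ)))) ≤ ∫⁻ φ, ENNReal.ofReal (Real.exp (X ψ φ)) ∂gaussM B := by
    have hlin (t : ι → ℝ) : Integrable (fun φ => t ⬝ᵥ φ) (gaussM B) :=
      (memLp_dotProduct_gaussM hB t).integrable (by norm_num)
    have hXe (φ : ι → ℝ) : X ψ φ = -(1 / 2) * (a ^ 2 * (f ⬝ᵥ B *ᵥ f)) +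
        (((-a) • (B *ᵥ f)) ⬝ᵥ φ + (∑ i, (χ i * (M *ᵥ ψ) i) * (H.row i ⬝ᵥ φ) +
          ∑ i, ∑ j, (-(1 / 2) * (M i j * χ i * χ j)) * ((H.row i ⬝ᵥ φ) * (H.row j ⬝ᵥ φ)))) := by
      simp only [X]
      rw [dotProduct_mulVec_symm hM ψ, mulVec_smul, dotProduct_smul, smul_dotProduct,
        dotProduct_smul, smul_dotProduct, mulVec_neg, neg_dotProduct, neg_dotProduct,
        dotProduct_neg, dotProduct_comm φ]
      have e1 : h φ ⬝ᵥ M *ᵥ ψ = ∑ i, (χ i * (M *ᵥ ψ) i) * (H.row i ⬝ᵥ φ) := by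
        refine Finset.sum_congr rfl fun i _ => ?_
        simp only [hh]; ring
      have e2 : ∑ i, ∑ j, (-(1 / 2) * (M i j * χ i * χ j)) * ((H.row i ⬝ᵥ φ) * (H.row j ⬝ᵥ φ)) =
          -(1 / 2) * (h φ ⬝ᵥ M *ᵥ h φ) := by
        have : h φ ⬝ᵥ M *ᵥ h φ = ∑ i, ∑ j, h φ i * (M i j * h φ j) := by
          simp only [dotProduct, mulVec, Finset.mul_sum]
        rw [this, Finset.mul_sum]
        refine Finset.sum_congr rfl fun i _ => ?_
        rw [Finset.mul_sum]
        refine Finset.sum_congr rfl fun j _ => ?_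
        simp only [hh]; ring
      rw [← e1, e2]
      simp only [smul_eq_mul]
      ring
    have i2 : Integrable (fun φ => ∑ i, (χ i * (M *ᵥ ψ) i) * (H.row i ⬝ᵥ φ)) (gaussM B) :=
      integrable_finsetSum _ fun i _ => (hlin _).const_mul _
    have i3' (i : ι) : Integrable (fun φ => ∑ j, (-(1 / 2) * (M i j * χ i * χ j)) *
        ((H.row i ⬝ᵥ φ) * (H.row j ⬝ᵥ φ))) (gaussM B) :=
      integrable_finsetSum _ fun j _ => (dotProduct_mul_integrable hB _ _).const_mul _
    have i3 : Integrable (fun φ => ∑ i, ∑ j, (-(1 / 2) * (M i j * χ i * χ j)) *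
        ((H.row i ⬝ᵥ φ) * (H.row j ⬝ᵥ φ))) (gaussM B) := integrable_finsetSum _ fun i _ => i3' i
    have i23 : Integrable (fun φ => ∑ i, (χ i * (M *ᵥ ψ) i) * (H.row i ⬝ᵥ φ) +
      ∑ i, ∑ j, (-(1 / 2) * (M i j * χ i * χ j)) * ((H.row i ⬝ᵥ φ) * (H.row j ⬝ᵥ φ))) (gaussM B) :=
      i2.add i3
    have i123 : Integrable (fun φ => ((-a) • (B *ᵥ f)) ⬝ᵥ φ +
      (∑ i, (χ i * (M *ᵥ ψ) i) * (H.row i ⬝ᵥ φ) +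
      ∑ i, ∑ j, (-(1 / 2) * (M i j * χ i * χ j)) * ((H.row i ⬝ᵥ φ) * (H.row j ⬝ᵥ φ)))) (gaussM B) :=
      (hlin _).add i23
    have hXi : Integrable (fun φ => X ψ φ) (gaussM B) := by
      simp only [hXe]
      exact (integrable_const _).add i123
    have hmean : ∫ φ, X ψ φ ∂gaussM B = -(1 / 2) * (a ^ 2 * (f ⬝ᵥ B *ᵥ f)) +
        ∑ i, ∑ j, (-(1 / 2) * (M i j * χ i * χ j)) * (B⁻¹ - blockGreen B α) i j := by
      simp only [hXe]
      rw [integral_add (integrable_const _) i123, integral_add (hlin _) i23, integral_add i2 i3,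
        integral_dotProduct_gaussM hB, integral_finsetSum _ fun i _ => (hlin _).const_mul _,
        integral_finsetSum _ fun i _ => i3' i]
      simp only [integral_const_mul, integral_dotProduct_gaussM hB, mul_zero,
        Finset.sum_const_zero, zero_add, integral_const, probReal_univ, one_smul]
      congr 1
      refine Finset.sum_congr rfl fun i _ => ?_
      rw [integral_finsetSum _ fun j _ => (dotProduct_mul_integrable hB _ _).const_mul _]
      refine Finset.sum_congr rfl fun j _ => ?_
      rw [integral_const_mul, integral_dotProduct_mul_gaussM hB, ← harmExt_mul_inv_mul hB]
      congr 1
      rw [← hH, Matrix.mul_assoc, mul_apply]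
      refine Finset.sum_congr rfl fun l _ => ?_
      rw [mul_apply]
      rfl
    refine (ENNReal.ofReal_le_ofReal (Real.exp_le_exp.2 ?_)).trans (exp_integral_le_lintegral hXi)
    rw [hmean]
    have hk := sum_mul_mul_kernel_le hB hoff hκ (χ := χ) (k := B⁻¹ - blockGreen B α)
      (fun i j => by
        rw [Matrix.sub_apply, Matrix.sub_apply, posDef_symm_apply hB.inv i j,
          ← blockGreen_transpose hB, transpose_apply, blockGreen_transpose hB])
      (fun i hi => by
        have hiα : i ∈ α := by_contra fun hc => hi (hχ0 i hc)
        have h1 : B * B⁻¹ = 1 := mul_nonsing_inv _ (B.isUnit_iff_isUnit_det.1 hB.isUnit)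
        rw [← mul_apply, Matrix.mul_sub, h1, Matrix.sub_apply, mul_blockGreen_apply hB hiα,
          one_apply, sub_self])
      (K := K) (fun i j hj => inv_sub_blockGreen_le hB hoff hκ hK0 (fun l hl => hK l hl j hj) i) hK0
    have e : ∑ i, ∑ j, (-(1 / 2) * (M i j * χ i * χ j)) * (B⁻¹ - blockGreen B α) i j =
        -(1 / 2) * ∑ i, ∑ j, B i j * χ i * χ j * (B⁻¹ - blockGreen B α) i j := by
      rw [Finset.mul_sum]
      refine Finset.sum_congr rfl fun i _ => ?_
      rw [Finset.mul_sum]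
      refine Finset.sum_congr rfl fun j _ => ?_
      by_cases hi : i ∈ α
      · by_cases hj : j ∈ α
        · have : M i j = B i j := by simp [hMdef, blockM, hi, hj]
          rw [this]; ring
        · rw [hχ0 j hj]; ring
      · rw [hχ0 i hi]; ring
    rw [e]
    linarith
  rw [hrep, ← lintegral_const_mul _ hF]
  refine lintegral_mono fun ψ => ?_
  rw [mul_comm]
  exact mul_le_mul' le_rfl (hJ ψ)

end Decoupling

section DomainMatrix

open Matrix

set_option linter.unusedSectionVars false

variable {ι : Type*} [Fintype ι] [DecidableEq ι]

/-- The matrix `B` with all interactions not inside `D` removed. -/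
def domM (B : Matrix ι ι ℝ) (D : Finset ι) : Matrix ι ι ℝ :=
  fun i j => if i = j ∨ (i ∈ D ∧ j ∈ D) then B i j else 0

variable {B : Matrix ι ι ℝ}

lemma domM_mulVec_of_mem (B : Matrix ι ι ℝ) {D : Finset ι} {w : ι → ℝ} {i : ι} (hi : i ∈ D) :
    (domM B D *ᵥ w) i = (B *ᵥ onSet D w) i := by
  simp only [mulVec, dotProduct, domM, onSet]
  refine Finset.sum_congr rfl fun j _ => ?_
  by_cases hj : j ∈ D
  · simp [hi, hj]
  · have : i ≠ j := fun h => hj (h ▸ hi)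
    simp [hj, this]

lemma domM_mulVec_of_notMem (B : Matrix ι ι ℝ) {D : Finset ι} {w : ι → ℝ} {i : ι} (hi : i ∉ D) :
    (domM B D *ᵥ w) i = B i i * w i := by
  simp only [mulVec, dotProduct, domM]
  rw [Finset.sum_eq_single i]
  · simp
  · intro j _ hj
    simp [hi, Ne.symm hj]
  · simp

lemma posDef_diag_pos (hB : B.PosDef) (i : ι) : 0 < B i i := by
  have := posDef_quadForm_pos hB (ψ := Pi.single i (1 : ℝ)) (by simp)
  simpa using this

lemma domM_posDef (hB : B.PosDef) (D : Finset ι) : (domM B D).PosDef := by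
  have hq (w : ι → ℝ) : w ⬝ᵥ domM B D *ᵥ w =
      onSet D w ⬝ᵥ B *ᵥ onSet D w + ∑ i, if i ∈ D then 0 else B i i * w i ^ 2 := by
    simp only [dotProduct]
    rw [← Finset.sum_add_distrib]
    refine Finset.sum_congr rfl fun i _ => ?_
    by_cases hi : i ∈ D
    · rw [domM_mulVec_of_mem B hi]; simp [onSet, hi]
    · rw [domM_mulVec_of_notMem B hi]; simp [onSet, hi]; ring
  refine PosDef.of_dotProduct_mulVec_pos ?_ fun w hw => ?_
  · ext i j
    simp only [conjTranspose_apply, domM, star_trivial]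
    rw [posDef_symm_apply hB j i]
    congr 1
    rw [eq_comm (a := j), and_comm]
  · rw [star_trivial, hq]
    have h2 : ∀ i, 0 ≤ if i ∈ D then 0 else B i i * w i ^ 2 := fun i => by
      split_ifs
      exacts [le_rfl, mul_nonneg (posDef_diag_pos hB i).le (sq_nonneg _)]
    by_cases h : onSet D w = 0
    · obtain ⟨i, hi⟩ := Function.ne_iff.1 hw
      have hiD : i ∉ D := fun hc => hi (by simpa [onSet, hc] using congrFun h i)
      have h3 : 0 < ∑ i, if i ∈ D then 0 else B i i * w i ^ 2 := by
        refine Finset.sum_pos' (fun i _ => h2 i) ⟨i, Finset.mem_univ _, ?_⟩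
        rw [if_neg hiD]
        have : w i ≠ 0 := hi
        have := posDef_diag_pos hB i
        positivity
      linarith [posDef_quadForm_nonneg hB (onSet D w)]
    · linarith [posDef_quadForm_pos hB h, Finset.sum_nonneg fun i (_ : i ∈ Finset.univ) => h2 i]

lemma domM_inv_eq_zero (hB : B.PosDef) {D : Finset ι} {i y : ι} (hy : y ∈ D) (hi : i ∉ D) :
    (domM B D)⁻¹ i y = 0 := by
  have h := congrFun (mulVec_inv_mulVec (domM_posDef hB D) (Pi.single y 1)) i
  rw [domM_mulVec_of_notMem B hi, Pi.single_eq_of_ne (by rintro rfl; exact hi hy)] at h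
  have := (mul_eq_zero.1 h).resolve_left (posDef_diag_pos hB i).ne'
  simpa using this

lemma mulVec_domM_inv (hB : B.PosDef) {D : Finset ι} {i y : ι} (hy : y ∈ D) (hi : i ∈ D) :
    (B *ᵥ fun j => (domM B D)⁻¹ j y) i = if i = y then 1 else 0 := by
  have h := congrFun (mulVec_inv_mulVec (domM_posDef hB D) (Pi.single y 1)) i
  rw [domM_mulVec_of_mem B hi, Pi.single_apply] at h
  rw [← h]
  congr 2
  funext j
  by_cases hj : j ∈ D
  · simp [onSet, hj]
  · simp [onSet, hj, domM_inv_eq_zero hB hy hj]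

lemma inv_nonneg_apply (hB : B.PosDef) (hoff : ∀ i j, i ≠ j → B i j ≤ 0) (i j : ι) :
    0 ≤ B⁻¹ i j := by
  have h := nonneg_of_mulVec_nonneg hB hoff (s := B⁻¹ *ᵥ Pi.single j 1)
    Finset.univ (fun l _ => ?_) (by simp) i
  · simpa using h
  · rw [mulVec_inv_mulVec hB, Pi.single_apply]
    split_ifs <;> norm_num

lemma domM_off (hoff : ∀ i j, i ≠ j → B i j ≤ 0) (D : Finset ι) (i j : ι) (hij : i ≠ j) :
    domM B D i j ≤ 0 := by
  unfold domM; split_ifs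
  exacts [hoff i j hij, le_rfl]

lemma domM_inv_le (hB : B.PosDef) (hoff : ∀ i j, i ≠ j → B i j ≤ 0) {D : Finset ι} {y : ι}
    (hy : y ∈ D) (i : ι) : (domM B D)⁻¹ i y ≤ B⁻¹ i y := by
  have h := nonneg_of_mulVec_nonneg hB hoff
    (s := B⁻¹ *ᵥ Pi.single y 1 - fun i => (domM B D)⁻¹ i y) D (fun i hi => ?_) (fun l hl => ?_) i
  · simpa using h
  · rw [mulVec_sub, Pi.sub_apply, mulVec_domM_inv hB hy hi, mulVec_inv_mulVec hB, Pi.single_apply,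
      sub_self]
  · simpa [domM_inv_eq_zero hB hy hl] using inv_nonneg_apply hB hoff l y

lemma Coupled.off {c : ι × ι → ℝ} (h : Coupled c B) (i j : ι) (hij : i ≠ j) : B i j ≤ 0 := by
  linarith [h.add_swap i j hij, h.nonneg (i, j), h.nonneg (j, i)]

/-- Lower bound on connection probabilities at level `a` by means of cutoff functions. -/
theorem exists_connection_lower : ∃ c₀ > 0, ∀ {ι : Type*} [Fintype ι] [DecidableEq ι]
    (B : Matrix ι ι ℝ) (c : ι × ι → ℝ) (_ : Coupled c B) (_ : B.PosDef)
    (_ : ∀ i, 0 ≤ ∑ j, B i j) (α D : Finset ι) (f χ : ι → ℝ) (_ : ∀ i ∈ D, f i = 1)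
    (_ : ∀ i ∈ α, (B *ᵥ f) i = 0) (_ : ∀ i ∈ D, χ i = 1) (_ : ∀ i, i ∉ α → χ i = 0)
    (K : ℝ) (_ : 0 ≤ K) (_ : ∀ l, l ∉ α → ∀ j, χ j ≠ 0 → B⁻¹ l j ≤ K)
    (x y : ι) (_ : x ≠ y) (_ : x ∈ D) (_ : y ∈ D) (k : ℝ) (_ : B⁻¹ x x ≤ k) (_ : B⁻¹ y y ≤ k)
    (a : ℝ),
    ENNReal.ofReal (Real.exp (-(1 / 2) * (a ^ 2 * (f ⬝ᵥ B *ᵥ f) + K * (χ ⬝ᵥ B *ᵥ χ))) *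
      (c₀ * ((domM B D)⁻¹ x y / k))) ≤
      ∫⁻ ψ, ENNReal.ofReal (bernProb (openProb c fun i => ψ i - a) fun ω => eConn ω x y)
        ∂gaussM B := by
  obtain ⟨c₀, hc₀, hlow⟩ := exists_sameSign_lower
  refine ⟨c₀, hc₀, ?_⟩
  intro ι _ _ B c h hB hκ α D f χ hf hBf hχ hχ0 K hK0 hK x y hxy hx hy k hkx hky a
  have hoff := h.off
  have hDα : ∀ i ∈ D, i ∈ α := fun i hi => by
    by_contra hc
    have := hχ0 i hc
    rw [hχ i hi] at this
    norm_num at this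
  set E' : Finset (ι × ι) := D ×ˢ D with hE'
  have hEmem (e : ι × ι) : e ∈ E' ↔ e.1 ∈ D ∧ e.2 ∈ D := Finset.mem_product
  set F : (ι → ℝ) → ℝ≥0∞ := fun ψ =>
    ENNReal.ofReal (bernProb (openProb c ψ) fun ω => eConn (ω ∩ E') x y) with hFdef
  have hF : Measurable F := by simp only [hFdef]; fun_prop
  have hFD : ∀ ψ ψ' : ι → ℝ, (∀ i ∈ D, ψ i = ψ' i) → F ψ = F ψ' := fun ψ ψ' hψ => by
    simp only [hFdef]
    congr 1
    refine bernProb_congr_on E' _ (fun ω => by rw [Finset.inter_assoc, Finset.inter_self])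
      fun e he => ?_
    obtain ⟨h1, h2⟩ := (hEmem e).1 he
    simp only [openProb, hψ _ h1, hψ _ h2]
  have hshift := gaussM_shift_lower hB hoff hκ α D hf hBf hχ hχ0 hK0 hK hF hFD a
  set cM : ι × ι → ℝ := fun e => if (e.1 ∈ α ↔ e.2 ∈ α) then c e else 0 with hcM
  have hcoupM : Coupled cM (blockM B α) := by
    refine ⟨fun e => ?_, fun i => ?_, fun i j hij => ?_⟩
    · simp only [hcM]; split_ifs
      exacts [h.nonneg e, le_rfl]
    · simp [hcM, h.diag]
    · simp only [hcM, blockM]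
      by_cases hα : i ∈ α ↔ j ∈ α
      · rw [if_pos hα, if_pos hα.symm, if_pos hα, h.add_swap i j hij]
      · rw [if_neg hα, if_neg (fun h' => hα h'.symm), if_neg hα]; simp
  have hcoup' : Coupled (fun e => if e ∈ E' then cM e else 0) (domM B D) := by
    refine ⟨fun e => ?_, fun i => ?_, fun i j hij => ?_⟩
    · show 0 ≤ if e ∈ E' then cM e else 0
      split_ifs
      exacts [hcoupM.nonneg e, le_rfl]
    · simp [hcoupM.diag]
    · simp only [hEmem, domM, hij, false_or]
      by_cases hd : i ∈ D ∧ j ∈ D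
      · have : i ∈ α ↔ j ∈ α := by simp [hDα i hd.1, hDα j hd.2]
        rw [if_pos hd, if_pos hd.symm, if_pos hd, hcoupM.add_swap i j hij, blockM, if_pos this]
      · rw [if_neg hd, if_neg (fun h' => hd h'.symm), if_neg hd]; simp
  have hM := blockM_posDef hB α
  have hD := domM_posDef hB D
  have hsame := hcoupM.sameSign_le hM hD E' hcoup' (fun i => by simp [domM, blockM]) hxy
  have hlow' := hlow (domM B D) hD x y hxy k ((domM_inv_le hB hoff hx x).trans hkx)
    ((domM_inv_le hB hoff hy y).trans hky) (inv_nonneg_apply hD (domM_off hoff D) x y)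
  have hle := (ENNReal.add_le_add_iff_left (by norm_num)).1 (hlow'.trans hsame)
  rw [ENNReal.ofReal_mul (Real.exp_nonneg _)]
  refine (mul_le_mul' le_rfl (hle.trans ?_)).trans (hshift.trans ?_)
  · refine (lintegral_congr fun ψ => ?_).le
    simp only [hFdef]
    congr 1
    refine bernProb_congr_on E' _ (fun ω => by rw [Finset.inter_assoc, Finset.inter_self])
      fun e he => ?_
    obtain ⟨h1, h2⟩ := (hEmem e).1 he
    simp only [openProb, hcM, hDα _ h1, hDα _ h2, if_true]
  · refine lintegral_mono fun ψ => ENNReal.ofReal_le_ofReal ?_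
    refine bernProb_mono (openProb_nonneg h.nonneg _) (openProb_le_one c _) fun ω _ hω => ?_
    exact eConn_mono Finset.inter_subset_left hω

end DomainMatrix

namespace WGraph

section Green

variable (M : WGraph)

/-- The neighbours of a vertex. -/
def nbr (x : M.V) : Finset M.V := (M.locFin x).toFinset

/-- The graph Laplacian. -/
def lap (f : M.V → ℝ) (x : M.V) : ℝ := ∑ w ∈ M.nbr x, M.lam x w * (f x - f w)

variable {M}

lemma mem_nbr {x y : M.V} : y ∈ M.nbr x ↔ 0 < M.lam x y := by
  rw [nbr, Set.Finite.mem_toFinset, Function.mem_support]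
  exact ⟨fun h => lt_of_le_of_ne (M.lam_nonneg x y) (Ne.symm h), ne_of_gt⟩

lemma mem_nbr_comm {x y : M.V} : y ∈ M.nbr x ↔ x ∈ M.nbr y := by
  rw [mem_nbr, mem_nbr, M.lam_symm]

lemma lam_eq_zero {x y : M.V} (h : y ∉ M.nbr x) : M.lam x y = 0 :=
  le_antisymm (not_lt.1 fun h' => h (mem_nbr.2 h')) (M.lam_nonneg x y)

lemma finsum_lam_mul (x : M.V) (f : M.V → ℝ) :
    ∑ᶠ z, M.lam x z * f z = ∑ z ∈ M.nbr x, M.lam x z * f z := by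
  refine finsum_eq_sum_of_support_subset _ fun z hz => ?_
  by_contra h
  exact hz (by simp [lam_eq_zero (by simpa using h)])

lemma lamTot_eq (x : M.V) : M.lamTot x = ∑ z ∈ M.nbr x, M.lam x z := by
  have := finsum_lam_mul x (fun _ => 1)
  simpa [lamTot] using this

lemma lap_eq (f : M.V → ℝ) (x : M.V) :
    M.lap f x = M.lamTot x * f x - ∑ w ∈ M.nbr x, M.lam x w * f w := by
  simp only [lap, lamTot_eq, mul_sub, Finset.sum_sub_distrib, Finset.sum_mul]

lemma pstep_succ (n : ℕ) (x y : M.V) :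
    M.pstep (n + 1) x y = ∑ z ∈ M.nbr x, M.p x z * M.pstep n z y := by
  have : ∀ z, M.p x z * M.pstep n z y = M.lam x z * (M.pstep n z y / M.lamTot x) := by
    intro z; rw [p]; ring
  rw [pstep]
  simp only [this]
  exact finsum_lam_mul x _

lemma pstep_succ' (n : ℕ) (x y : M.V) :
    M.pstep (n + 1) x y = ∑ z ∈ M.nbr y, M.pstep n x z * M.p z y := by
  induction n generalizing x with
  | zero =>
    rw [pstep_succ]
    simp only [pstep, mul_ite, mul_one, mul_zero, ite_mul, one_mul, zero_mul, Finset.sum_ite_eq,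
      Finset.sum_ite_eq']
    by_cases h : y ∈ M.nbr x
    · simp [h, mem_nbr_comm.1 h]
    · have h' : x ∉ M.nbr y := fun h' => h (mem_nbr_comm.1 h')
      have h'' : M.p x y = 0 := by rw [p, lam_eq_zero h, zero_div]
      simp [h', h'']
  | succ n ih =>
    rw [pstep_succ]
    simp only [ih, pstep_succ n, Finset.mul_sum, Finset.sum_mul]
    rw [Finset.sum_comm]
    simp only [mul_assoc]

lemma p_nonneg (x y : M.V) : 0 ≤ M.p x y :=
  div_nonneg (M.lam_nonneg x y) (finsum_nonneg fun z => M.lam_nonneg x z)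

lemma pstep_nonneg (n : ℕ) (x y : M.V) : 0 ≤ M.pstep n x y := by
  induction n generalizing x with
  | zero => rw [pstep]; split_ifs <;> norm_num
  | succ n ih => rw [pstep_succ]; exact Finset.sum_nonneg fun z _ => mul_nonneg (p_nonneg x z) (ih z)

lemma GreenDecay.lamTot_pos (h : M.GreenDecay) (x : M.V) : 0 < M.lamTot x := by
  obtain ⟨c, hc, C, -, hd, -⟩ := h
  refine lt_of_le_of_ne (finsum_nonneg fun z => M.lam_nonneg x z) fun h0 => ?_
  have := (hd x).1
  rw [green, ← h0, div_zero] at this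
  linarith

section

variable (hpos : ∀ x, 0 < M.lamTot x)

include hpos

lemma lamTot_mul_p (x y : M.V) : M.lamTot x * M.p x y = M.lam x y := by
  rw [p, mul_div_cancel₀ _ (hpos x).ne']

lemma lamTot_mul_pstep (n : ℕ) (x y : M.V) :
    M.lamTot x * M.pstep n x y = M.lamTot y * M.pstep n y x := by
  induction n generalizing x with
  | zero =>
    simp only [pstep]
    by_cases h : x = y
    · simp [h]
    · simp [h, Ne.symm h]
  | succ n ih =>
    rw [pstep_succ, pstep_succ', Finset.mul_sum, Finset.mul_sum]
    refine Finset.sum_congr rfl fun z _ => ?_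
    rw [← mul_assoc, lamTot_mul_p hpos, M.lam_symm, ← lamTot_mul_p hpos, mul_right_comm, ih]
    ring

lemma green_symm (x y : M.V) : M.green x y = M.green y x := by
  have : ∀ n, M.pstep n y x = M.lamTot x / M.lamTot y * M.pstep n x y := by
    intro n
    have := lamTot_mul_pstep hpos n x y
    field_simp [(hpos x).ne', (hpos y).ne']
    linarith
  rw [green, green, tsum_congr this, tsum_mul_left]
  field_simp [(hpos x).ne', (hpos y).ne']

lemma summable_pstep (hT : M.Transient) (x y : M.V) : Summable fun n => M.pstep n x y := by
  have h := M.connectedG y x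
  induction h with
  | refl => exact hT y
  | @tail u v _ huv ih =>
    have hp : 0 < M.p u v := div_pos huv (hpos u)
    have h1 := (summable_nat_add_iff 1).2 ih
    refine Summable.of_nonneg_of_le (fun n => pstep_nonneg n v y) (fun n => ?_)
      (h1.mul_left (M.p u v)⁻¹)
    rw [pstep_succ, inv_mul_eq_div, le_div_iff₀ hp, mul_comm]
    exact Finset.single_le_sum (f := fun z => M.p u z * M.pstep n z y)
      (fun z _ => mul_nonneg (p_nonneg u z) (pstep_nonneg n z y)) (mem_nbr.2 huv)

lemma lap_green (hT : M.Transient) (x y : M.V) :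
    M.lap (fun v => M.green v y) x = if x = y then 1 else 0 := by
  have hs := summable_pstep hpos hT
  have h1 : ∑' n, M.pstep n x y =
      (if x = y then 1 else 0) + ∑ z ∈ M.nbr x, M.p x z * ∑' n, M.pstep n z y := by
    rw [(hs x y).tsum_eq_zero_add]
    congr 1
    simp only [pstep_succ]
    rw [Summable.tsum_finsetSum fun z _ => (hs z y).mul_left _]
    exact Finset.sum_congr rfl fun z _ => tsum_mul_left
  rw [lap_eq]
  simp only [green]
  rw [h1]
  have h2 : ∀ z, M.lam x z * ((∑' n, M.pstep n z y) / M.lamTot y) =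
      M.lamTot x * (M.p x z * ∑' n, M.pstep n z y) / M.lamTot y := by
    intro z; rw [← lamTot_mul_p hpos x z]; ring
  simp only [h2, ← Finset.sum_div, ← Finset.mul_sum]
  by_cases h : x = y
  · subst h
    have := (hpos x).ne'
    simp only [if_true]
    field_simp
    ring
  · simp [h]
    ring

end

lemma green_nonneg (hpos : ∀ x, 0 < M.lamTot x) (x y : M.V) : 0 ≤ M.green x y :=
  div_nonneg (tsum_nonneg fun n => pstep_nonneg n x y) (hpos y).le

end Green

section Distance

variable {M : WGraph} (hgr : ∀ x y, M.d x y = M.graphDist x y)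

include hgr

lemma exists_geodesic (x y : M.V) : ∃ (n : ℕ) (γ : ℕ → M.V), M.d x y = n ∧ γ 0 = x ∧ γ n = y ∧
    ∀ i < n, 0 < M.lam (γ i) (γ (i + 1)) := by
  set S : Set ℕ := {n | ∃ γ : ℕ → M.V, γ 0 = x ∧ γ n = y ∧ ∀ i < n, 0 < M.lam (γ i) (γ (i + 1))}
    with hS
  have hne : S.Nonempty := by
    rw [hS]
    clear hS S
    have h := M.connectedG x y
    induction h with
    | refl => exact ⟨0, fun _ => x, rfl, rfl, by simp⟩
    | @tail u v _ huv ih =>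
      obtain ⟨n, γ, h0, hn, hγ⟩ := ih
      · refine ⟨n + 1, fun i => if i ≤ n then γ i else v, by simpa using h0, by simp, fun i hi => ?_⟩
        rcases Nat.lt_or_ge i n with h | h
        · simpa [h.le, Nat.succ_le_of_lt h] using hγ i h
        · obtain rfl : i = n := by omega
          simpa [hn] using huv
  have hset : {r : ℝ | ∃ n : ℕ, r = n ∧ ∃ γ : Fin (n + 1) → M.V, γ 0 = x ∧ γ (Fin.last n) = y ∧
    ∀ i : Fin n, 0 < M.lam (γ i.castSucc) (γ i.succ)} = (fun n : ℕ => (n : ℝ)) '' S := by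
    ext r
    constructor
    · rintro ⟨n, rfl, γ, h0, hl, hγ⟩
      refine ⟨n, ⟨fun i => γ ⟨min i n, by omega⟩, ?_, ?_, fun i hi => ?_⟩, rfl⟩
      · simpa using h0
      · simpa [Fin.last] using hl
      · have := hγ ⟨i, hi⟩
        simpa [Fin.castSucc, Fin.succ, hi.le, Nat.succ_le_of_lt hi] using this
    · rintro ⟨n, ⟨γ, h0, hl, hγ⟩, rfl⟩
      exact ⟨n, rfl, fun i => γ i, by simpa using h0, by simpa using hl, fun i => by
        simpa using hγ i i.2⟩
  have hmem : sInf S ∈ S := Nat.sInf_mem hne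
  obtain ⟨γ, h0, hl, hγ⟩ := hmem
  refine ⟨sInf S, γ, ?_, h0, hl, hγ⟩
  rw [hgr, graphDist, hset]
  refine le_antisymm (csInf_le ⟨0, ?_⟩ ⟨_, Nat.sInf_mem hne, rfl⟩)
    (le_csInf (hne.image _) ?_)
  · rintro _ ⟨n, -, rfl⟩
    positivity
  · rintro _ ⟨n, hn, rfl⟩
    exact Nat.cast_le.2 (Nat.sInf_le hn)

lemma d_le_of_path {n : ℕ} {γ : ℕ → M.V} (hγ : ∀ i < n, 0 < M.lam (γ i) (γ (i + 1))) :
    M.d (γ 0) (γ n) ≤ n := by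
  rw [hgr, graphDist]
  refine csInf_le ⟨0, ?_⟩ ⟨n, rfl, fun i => γ i, by simp, by simp, fun i => by simpa using hγ i i.2⟩
  rintro _ ⟨n, rfl, -⟩
  positivity

lemma d_le_one {x y : M.V} (h : 0 < M.lam x y) : M.d x y ≤ 1 := by
  have := d_le_of_path hgr (n := 1) (γ := fun i => if i = 0 then x else y) (by
    intro i hi
    obtain rfl : i = 0 := by omega
    simpa using h)
  simpa using this

/-- Geodesics parametrized by arc length. -/
lemma exists_geodesic' (x y : M.V) : ∃ (n : ℕ) (γ : ℕ → M.V), M.d x y = n ∧ γ 0 = x ∧ γ n = y ∧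
    (∀ i < n, 0 < M.lam (γ i) (γ (i + 1))) ∧ ∀ i j, i ≤ j → j ≤ n → M.d (γ i) (γ j) = (j : ℝ) - i := by
  obtain ⟨n, γ, hn, h0, hl, hγ⟩ := exists_geodesic hgr x y
  have hle : ∀ i j, i ≤ j → j ≤ n → M.d (γ i) (γ j) ≤ (j : ℝ) - i := by
    intro i j hij hj
    have := d_le_of_path hgr (n := j - i) (γ := fun k => γ (i + k)) (fun k hk => by
      simpa [add_assoc] using hγ (i + k) (by omega))
    rw [Nat.cast_sub hij] at this
    simpa [Nat.add_sub_cancel' hij] using this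
  refine ⟨n, γ, hn, h0, hl, hγ, fun i j hij hj => le_antisymm (hle i j hij hj) ?_⟩
  have h1 := hle 0 i (by omega) (by omega)
  have h2 := hle j n hj le_rfl
  have h3 := M.d_triangle (γ 0) (γ i) (γ n)
  have h4 := M.d_triangle (γ i) (γ j) (γ n)
  rw [h0, hl, hn] at h3
  rw [h0] at h1
  rw [hl] at h2 h4
  push_cast at h1
  linarith

lemma ball_finite (x : M.V) (r : ℝ) : (M.ball x r).Finite := by
  have key : ∀ n : ℕ, (M.ball x n).Finite := by
    intro n
    induction n with
    | zero =>
      refine (Set.finite_singleton x).subset fun y hy => ?_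
      by_contra h
      have h1 := M.d_pos x y (Ne.symm (by simpa using h))
      have h2 : M.d x y ≤ ((0 : ℕ) : ℝ) := hy
      push_cast at h2
      linarith
    | succ n ih =>
      refine ((ih.biUnion fun z _ => (M.nbr z).finite_toSet).union ih).subset fun y hy => ?_
      have h2 : M.d x y ≤ ((n + 1 : ℕ) : ℝ) := hy
      obtain ⟨m, γ, hm, h0, hl, hγ, hd⟩ := exists_geodesic' hgr x y
      rw [hm] at h2
      have h3 : m ≤ n + 1 := by exact_mod_cast h2
      rcases Nat.lt_or_ge m (n + 1) with h | h
      · right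
        show M.d x y ≤ n
        rw [hm]
        exact_mod_cast Nat.lt_succ_iff.1 h
      · left
        obtain rfl : m = n + 1 := by omega
        refine Set.mem_biUnion (x := γ n) ?_ ?_
        · have := hd 0 n (by omega) (by omega)
          show M.d x (γ n) ≤ n
          rw [← h0, this]
          simp
        · simpa [mem_nbr, ← hl] using hγ n (by omega)
  obtain ⟨n, hn⟩ := exists_nat_ge r
  exact (key n).subset fun y hy => le_trans hy hn

end Distance

section MaxPrinciple

variable {M : WGraph}

/-- Minimum principle. -/
lemma nonneg_of_lap [Infinite M.V] {u : M.V → ℝ} (hlap : ∀ v, u v < 0 → 0 ≤ M.lap u v)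
    (hfin : ∀ ε > 0, {v | u v ≤ -ε}.Finite) (v : M.V) : 0 ≤ u v := by
  by_contra! hv
  have hF := hfin (-u v) (by linarith)
  obtain ⟨m, hm, hmin⟩ := hF.toFinset.exists_min_image u ⟨v, by simp⟩
  have hmv : u m ≤ u v := by simpa using hm
  have hglob : ∀ w, u m ≤ u w := by
    intro w
    by_cases hw : u w ≤ u v
    · exact hmin w (by simpa using hw)
    · linarith
  have hm0 : u m < 0 := by linarith
  have hstep : ∀ w, u w = u m → ∀ z, 0 < M.lam w z → u z = u m := by
    intro w hw z hz
    have h1 := hlap w (by linarith)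
    by_contra hne
    have h2 : M.lap u w < 0 := by
      rw [lap]
      refine Finset.sum_neg' (fun i _ => ?_) ⟨z, mem_nbr.2 hz, ?_⟩
      · exact mul_nonpos_of_nonneg_of_nonpos (M.lam_nonneg w i) (by linarith [hglob i])
      · exact mul_neg_of_pos_of_neg hz (by
          have := lt_of_le_of_ne (hglob z) (Ne.symm hne); linarith)
    linarith
  have hall : ∀ z, u z = u m := by
    intro z
    have h := M.connectedG m z
    induction h with
    | refl => rfl
    | tail _ h ih => exact hstep _ ih _ h
  refine Set.infinite_univ (α := M.V) (hF.subset fun z _ => ?_)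
  simp only [neg_neg, Set.mem_ofPred_eq]
  rw [hall z]; exact hmv

lemma finite_le_neg_of_tendsto {u : M.V → ℝ} (h : Tendsto u cofinite (𝓝 0)) {ε : ℝ} (hε : 0 < ε) :
    {v | u v ≤ -ε}.Finite := by
  have := h.eventually (lt_mem_nhds (neg_lt_zero.2 hε))
  simpa [Filter.eventually_cofinite] using this

lemma lap_sum {κ : Type*} (s : Finset κ) (b : κ → ℝ) (f : κ → M.V → ℝ) (x : M.V) :
    M.lap (fun v => ∑ j ∈ s, b j * f j v) x = ∑ j ∈ s, b j * M.lap (f j) x := by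
  simp only [lap, ← Finset.sum_sub_distrib, Finset.mul_sum]
  rw [Finset.sum_comm]
  refine Finset.sum_congr rfl fun j _ => Finset.sum_congr rfl fun w _ => by ring

lemma lap_sub (f h : M.V → ℝ) (x : M.V) :
    M.lap (fun v => f v - h v) x = M.lap f x - M.lap h x := by
  simp only [lap, ← Finset.sum_sub_distrib]
  exact Finset.sum_congr rfl fun w _ => by ring

lemma lap_const (k : ℝ) (x : M.V) : M.lap (fun _ => k) x = 0 := by
  simp [lap]

end MaxPrinciple

end WGraph

section Energy

open Matrix

set_option linter.unusedSectionVars false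

variable {ι : Type*} [Fintype ι] [DecidableEq ι] {B : Matrix ι ι ℝ}

/-- Expression of a quadratic form through gradients and row sums. -/
lemma quadForm_eq_energy (hB : ∀ i j, B i j = B j i) (u : ι → ℝ) :
    u ⬝ᵥ B *ᵥ u = ∑ i, u i ^ 2 * ∑ j, B i j + (1 / 2) * ∑ i, ∑ j, (-B i j) * (u i - u j) ^ 2 := by
  have e1 : ∑ i, ∑ j, (-B i j) * (u i - u j) ^ 2 =
      2 * ∑ i, ∑ j, u i * (B i j * u j) - (∑ i, ∑ j, u i ^ 2 * B i j +
        ∑ i, ∑ j, u j ^ 2 * B j i) := by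
    rw [Finset.mul_sum, ← Finset.sum_add_distrib, ← Finset.sum_sub_distrib]
    refine Finset.sum_congr rfl fun i _ => ?_
    rw [Finset.mul_sum, ← Finset.sum_add_distrib, ← Finset.sum_sub_distrib]
    refine Finset.sum_congr rfl fun j _ => ?_
    rw [hB j i]; ring
  have e2 : ∑ i, ∑ j, u j ^ 2 * B j i = ∑ i, ∑ j, u i ^ 2 * B i j := Finset.sum_comm
  rw [e1, e2]
  have e3 : u ⬝ᵥ B *ᵥ u = ∑ i, ∑ j, u i * (B i j * u j) := by
    simp only [dotProduct, mulVec, Finset.mul_sum]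
  have e4 : ∑ i, u i ^ 2 * ∑ j, B i j = ∑ i, ∑ j, u i ^ 2 * B i j := by
    simp only [Finset.mul_sum]
  rw [e3, e4]
  ring

lemma posSemidef_of_rowSum_nonneg (hB : ∀ i j, B i j = B j i) (hoff : ∀ i j, i ≠ j → B i j ≤ 0)
    (hκ : ∀ i, 0 ≤ ∑ j, B i j) : B.PosSemidef := by
  refine PosSemidef.of_dotProduct_mulVec_nonneg (by ext i j; simp [hB i j]) fun u => ?_
  rw [star_trivial, quadForm_eq_energy hB]
  refine add_nonneg (Finset.sum_nonneg fun i _ => mul_nonneg (sq_nonneg _) (hκ i))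
    (mul_nonneg (by norm_num) (Finset.sum_nonneg fun i _ => Finset.sum_nonneg fun j _ => ?_))
  by_cases h : i = j
  · simp [h]
  · exact mul_nonneg (by linarith [hoff i j h]) (sq_nonneg _)

/-- Truncation at height one decreases the energy. -/
lemma min_one_energy_le (hB : B.PosDef) (hoff : ∀ i j, i ≠ j → B i j ≤ 0)
    (hκ : ∀ i, 0 ≤ ∑ j, B i j) {u w : ι → ℝ} (hu : ∀ i, 0 ≤ u i) (hw : ∀ i, 0 ≤ w i)
    (huw : ∀ i, (B *ᵥ u) i ≤ w i) :
    (fun i => min (u i) 1) ⬝ᵥ B *ᵥ (fun i => min (u i) 1) ≤ ∑ i, w i := by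
  set f : ι → ℝ := fun i => min (u i) 1 with hf
  have hf1 : ∀ i, f i ≤ 1 := fun i => min_le_right _ _
  have hf0 : ∀ i, 0 ≤ f i := fun i => le_min (hu i) zero_le_one
  have h1 : f ⬝ᵥ B *ᵥ u ≤ ∑ i, w i := by
    refine Finset.sum_le_sum fun i _ => ?_
    have := mul_le_mul_of_nonneg_left (huw i) (hf0 i)
    have := mul_le_mul_of_nonneg_right (hf1 i) (hw i)
    linarith
  have h2 : 0 ≤ f ⬝ᵥ B *ᵥ (u - f) := by
    rw [posDef_isSymm hB]
    refine Finset.sum_nonneg fun i _ => ?_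
    rcases le_total (u i) 1 with h | h
    · have : f i = u i := min_eq_left h
      simp [this]
    · have hfi : f i = 1 := min_eq_right h
      refine mul_nonneg (by simp [hfi, h]) ((hκ i).trans (Finset.sum_le_sum fun j _ => ?_))
      by_cases hij : i = j
      · subst hij; simp [hfi]
      · nlinarith [hoff i j hij, hf1 j]
  rw [mulVec_sub, dotProduct_sub] at h2
  linarith

end Energy

namespace WGraph

open Matrix

/-- The properties of the Green's function that are used below. -/
structure GreenKernel (M : WGraph) : Prop where
  lap_green : ∀ x y, M.lap (fun v => M.green v y) x = if x = y then 1 else 0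
  symm : ∀ x y, M.green x y = M.green y x
  nonneg : ∀ x y, 0 ≤ M.green x y
  tendsto : ∀ y, Tendsto (fun v => M.green v y) cofinite (𝓝 0)
  infinite : Infinite M.V

variable {M : WGraph}

lemma Standing.infinite (hS : M.Standing) (hα : 0 < M.α) : Infinite M.V := by
  obtain ⟨-, ⟨c, hc, C, hC, hV⟩, hG⟩ := hS
  by_contra hinf
  have hfin : Finite M.V := not_infinite_iff_finite.1 hinf
  have := Fintype.ofFinite M.V
  have h1 : Tendsto (fun r : ℝ => c * r ^ M.α) atTop atTop :=
    (tendsto_rpow_atTop hα).const_mul_atTop hc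
  obtain ⟨r, hr1, hr⟩ := ((eventually_ge_atTop (1 : ℝ)).and
    (h1.eventually_gt_atTop (∑ y, M.lamTot y))).exists
  have h2 := (hV M.o r hr1).1
  have h3 : ∑ᶠ y ∈ M.ball M.o r, M.lamTot y ≤ ∑ y, M.lamTot y := by
    rw [finsum_mem_eq_finite_toFinset_sum _ (Set.toFinite _)]
    exact Finset.sum_le_sum_of_subset_of_nonneg (Finset.subset_univ _)
      fun y _ _ => (hG.lamTot_pos y).le
  linarith

lemma Standing.greenKernel (hS : M.Standing) (hν : 0 < M.ν) (hα : 0 < M.α)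
    (hgr : ∀ x y, M.d x y = M.graphDist x y) : M.GreenKernel := by
  have hpos := hS.2.2.lamTot_pos
  refine ⟨WGraph.lap_green hpos hS.1, green_symm hpos, green_nonneg hpos, fun y => ?_,
    hS.infinite hα⟩
  obtain ⟨c, hc, C, hC, -, hg⟩ := hS.2.2
  have h1 : Tendsto (fun v => M.d v y) cofinite atTop := by
    refine tendsto_atTop.2 fun r => ?_
    rw [Filter.eventually_cofinite]
    refine (ball_finite hgr y r).subset fun v hv => ?_
    rw [Set.mem_ofPred_eq, not_le] at hv
    show M.d y v ≤ r
    rw [M.d_symm]; exact hv.le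
  have h2 : Tendsto (fun v => C * M.d v y ^ (-M.ν)) cofinite (𝓝 0) := by
    have := ((tendsto_rpow_neg_atTop hν).comp h1).const_mul C
    simpa using this
  refine squeeze_zero' (Eventually.of_forall fun v => green_nonneg hpos v y) ?_ h2
  have : ∀ᶠ v in cofinite, v ≠ y := by
    simp [Filter.eventually_cofinite]
  filter_upwards [this] with v hv using (hg v y hv).2

namespace GreenKernel

variable (h : M.GreenKernel) (Λ : Finset M.V)

/-- The Green's matrix of a finite set. -/
def greenMat (Λ : Finset M.V) : Matrix Λ Λ ℝ := fun i j => M.green i j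

/-- The precision matrix of the field restricted to a finite set. -/
def precM (Λ : Finset M.V) : Matrix Λ Λ ℝ := (greenMat Λ)⁻¹

/-- Linear combinations of Green's functions. -/
def pot (Λ : Finset M.V) (b : Λ → ℝ) (v : M.V) : ℝ := ∑ j : Λ, b j * M.green v j

variable {Λ}

lemma tendsto_pot {h : M.GreenKernel} (b : Λ → ℝ) : Tendsto (pot Λ b) cofinite (𝓝 0) := by
  have := tendsto_finsetSum (Finset.univ : Finset Λ) fun j _ => (h.tendsto j).const_mul (b j)
  simp only [mul_zero, Finset.sum_const_zero] at this
  exact this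

include h

lemma lap_pot (b : Λ → ℝ) (v : M.V) : M.lap (pot Λ b) v = if hv : v ∈ Λ then b ⟨v, hv⟩ else 0 := by
  have := lap_sum (M := M) (Finset.univ : Finset Λ) b (fun j v => M.green v j) v
  rw [show pot Λ b = fun v => ∑ j : Λ, b j * M.green v j from rfl, this]
  simp only [h.lap_green]
  split_ifs with hv
  · rw [Finset.sum_eq_single ⟨v, hv⟩] <;> aesop
  · refine Finset.sum_eq_zero fun j _ => ?_
    have : v ≠ j := fun h => hv (h ▸ j.2)
    simp [this]

lemma pot_nonneg {b : Λ → ℝ} (hb : ∀ v : Λ, 0 ≤ pot Λ b v) (v : M.V) : 0 ≤ pot Λ b v := by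
  have := h.infinite
  refine nonneg_of_lap (fun v hv => ?_)
    (fun ε hε => finite_le_neg_of_tendsto (tendsto_pot (h := h) b) hε) v
  rw [h.lap_pot]
  split_ifs with hv'
  · exact absurd hv (not_lt.2 (hb ⟨v, hv'⟩))
  · rfl

lemma isUnit_greenMat : IsUnit (greenMat Λ).det := by
  rw [isUnit_iff_ne_zero]
  intro hdet
  obtain ⟨b, hb0, hb⟩ := Matrix.exists_mulVec_eq_zero_iff.2 hdet
  have hz : ∀ v : Λ, pot Λ b v = 0 := fun v => by
    have := congrFun hb v
    simpa [mulVec, dotProduct, greenMat, pot, mul_comm] using this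
  have hneg : ∀ v, pot Λ (-b) v = -pot Λ b v := fun v => by simp [pot]
  have h0 : ∀ v, pot Λ b v = 0 := fun v => le_antisymm
    (by have := h.pot_nonneg (b := -b) (fun v => by simp [hneg, hz]) v
        rw [hneg] at this; linarith)
    (h.pot_nonneg (fun v => (hz v).ge) v)
  refine hb0 (funext fun i => ?_)
  have h1 := h.lap_pot b i
  rw [dif_pos i.2, show pot Λ b = fun _ => 0 from funext h0, lap_const] at h1
  exact h1.symm

lemma precM_inv : (precM Λ)⁻¹ = greenMat Λ := Matrix.nonsing_inv_nonsing_inv _ h.isUnit_greenMat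

lemma precM_symm (i j : Λ) : precM Λ i j = precM Λ j i := by
  have h1 : (greenMat Λ)ᵀ = greenMat Λ := by
    ext i j; exact h.symm _ _
  have : (precM Λ)ᵀ = precM Λ := by rw [precM, Matrix.transpose_nonsing_inv, h1]
  exact congrFun (congrFun this j) i

lemma pot_precM_apply (b : Λ → ℝ) (v : Λ) : pot Λ (precM Λ *ᵥ b) v = b v := by
  have : pot Λ (precM Λ *ᵥ b) v = (greenMat Λ *ᵥ (precM Λ *ᵥ b)) v := by
    simp [pot, mulVec, dotProduct, greenMat, mul_comm]
  rw [this, mulVec_mulVec, precM, Matrix.mul_nonsing_inv _ h.isUnit_greenMat, one_mulVec]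

lemma precM_mulVec_eq_lap (b : Λ → ℝ) (i : Λ) :
    (precM Λ *ᵥ b) i = M.lap (pot Λ (precM Λ *ᵥ b)) i := by
  rw [h.lap_pot, dif_pos i.2]

lemma precM_off (i j : Λ) (hij : i ≠ j) : precM Λ i j ≤ 0 := by
  have h1 := h.precM_mulVec_eq_lap (Pi.single j 1) i
  have h2 : ∀ v : Λ, pot Λ (precM Λ *ᵥ Pi.single j 1) v = Pi.single (M := fun _ => ℝ) j 1 v :=
    h.pot_precM_apply _
  rw [mulVec_single_one] at h1 h2
  rw [show precM Λ i j = (precM Λ).col j i from rfl, h1, lap]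
  have h3 : pot Λ ((precM Λ).col j) i = 0 := by
    rw [h2]; simp [hij]
  refine Finset.sum_nonpos fun w _ => mul_nonpos_of_nonneg_of_nonpos (M.lam_nonneg _ _) ?_
  rw [h3, zero_sub, neg_nonpos]
  refine h.pot_nonneg (fun v => ?_) w
  rw [h2]
  by_cases hv : v = j
  · simp [hv]
  · simp [hv]

lemma pot_le_one (v : M.V) : pot Λ (precM Λ *ᵥ 1) v ≤ 1 := by
  have := h.infinite
  have key := nonneg_of_lap (u := fun v => 1 - pot Λ (precM Λ *ᵥ 1) v) (fun v hv => ?_) (fun ε hε => ?_) v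
  · linarith
  · rw [lap_sub, lap_const, h.lap_pot]
    split_ifs with hv'
    · have := h.pot_precM_apply 1 ⟨v, hv'⟩
      simp only [this, Pi.one_apply] at hv
      norm_num at hv
    · simp
  · have := (tendsto_pot (h := h) (precM Λ *ᵥ 1)).neg
    rw [neg_zero] at this
    refine (finite_le_neg_of_tendsto this hε).subset fun v hv => ?_
    rw [Set.mem_ofPred_eq] at hv ⊢
    linarith

lemma precM_rowSum_nonneg (i : Λ) : 0 ≤ ∑ j, precM Λ i j := by
  have h1 := h.precM_mulVec_eq_lap 1 i
  rw [show ∑ j, precM Λ i j = (precM Λ *ᵥ 1) i by simp [mulVec, dotProduct], h1, lap]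
  refine Finset.sum_nonneg fun w _ => mul_nonneg (M.lam_nonneg _ _) ?_
  rw [h.pot_precM_apply 1 i]
  simpa using h.pot_le_one w

lemma precM_posDef (Λ : Finset M.V) : (precM Λ).PosDef := by
  refine (posSemidef_of_rowSum_nonneg h.precM_symm h.precM_off h.precM_rowSum_nonneg).posDef_iff_isUnit.2 ?_
  rw [precM, Matrix.isUnit_nonsing_inv_iff, Matrix.isUnit_iff_isUnit_det]
  exact h.isUnit_greenMat

lemma precM_mulVec_interior {i : Λ} (hi : ∀ w, 0 < M.lam i w → w ∈ Λ) (f : M.V → ℝ) :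
    (precM Λ *ᵥ fun j => f j) i = M.lap f i := by
  rw [h.precM_mulVec_eq_lap, lap, lap]
  refine Finset.sum_congr rfl fun w hw => ?_
  have h1 := h.pot_precM_apply (fun j => f j) i
  have h2 := h.pot_precM_apply (fun j => f j) ⟨w, hi w (mem_nbr.1 hw)⟩
  simp only at h1 h2
  rw [h1, h2]

lemma precM_rowSum_interior {i : Λ} (hi : ∀ w, 0 < M.lam i w → w ∈ Λ) : ∑ j, precM Λ i j = 0 := by
  have := h.precM_mulVec_interior hi (fun _ => 1)
  rw [lap_const] at this
  simpa [mulVec, dotProduct] using this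

lemma precM_apply_interior {i : Λ} (hi : ∀ w, 0 < M.lam i w → w ∈ Λ) {j : Λ} (hij : i ≠ j) :
    precM Λ i j = -M.lam i j := by
  have h1 := h.precM_mulVec_interior hi (fun v => if v = j then 1 else 0)
  have h2 : (precM Λ *ᵥ fun k : Λ => if (k : M.V) = j then (1 : ℝ) else 0) i = precM Λ i j := by
    simp only [mulVec, dotProduct]
    rw [Finset.sum_eq_single j]
    · simp
    · intro b _ hb
      have : (b : M.V) ≠ j := fun h => hb (Subtype.ext h)
      simp [this]
    · simp
  have h3 : (i : M.V) ≠ j := fun h => hij (Subtype.ext h)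
  rw [← h2, h1, lap]
  simp only [h3, if_false, zero_sub, mul_neg, mul_ite, mul_one, mul_zero, Finset.sum_neg_distrib,
    Finset.sum_ite_eq']
  split_ifs with hw
  · rfl
  · rw [lam_eq_zero hw]

end GreenKernel

end WGraph

section GreenBox

open Matrix

set_option linter.unusedSectionVars false

variable {ι : Type*} [Fintype ι] [DecidableEq ι]

/-- A precision matrix whose inverse decays polynomially with respect to a distance, and which
acts as a local operator on the set `I`. -/
structure GreenBox (B : Matrix ι ι ℝ) (d : ι → ι → ℝ) (I : Set ι) (ν c C : ℝ) : Prop where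
  posDef : B.PosDef
  off : ∀ i j, i ≠ j → B i j ≤ 0
  rowSum_nonneg : ∀ i, 0 ≤ ∑ j, B i j
  rowSum_eq : ∀ i ∈ I, ∑ j, B i j = 0
  near : ∀ i ∈ I, ∀ j, i ≠ j → B i j ≠ 0 → d i j ≤ 1
  d_symm : ∀ i j, d i j = d j i
  d_self : ∀ i, d i i = 0
  d_triangle : ∀ i j k, d i k ≤ d i j + d j k
  lower : ∀ r, 1 ≤ r → ∀ i j, d i j ≤ r → c * r ^ (-ν) ≤ B⁻¹ i j
  upper : ∀ r, 0 < r → ∀ i j, r ≤ d i j → B⁻¹ i j ≤ C * r ^ (-ν)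
  diag_le : ∀ i, B⁻¹ i i ≤ C

/-- The Green's function killed outside a domain. -/
def killed (B : Matrix ι ι ℝ) (F : Finset ι) (y i : ι) : ℝ := (domM B F)⁻¹ i y

namespace GreenBox

variable {B : Matrix ι ι ℝ} {d : ι → ι → ℝ} {I : Set ι} {ν c C : ℝ} (h : GreenBox B d I ν c C)

include h

lemma killed_nonneg (F : Finset ι) (y i : ι) : 0 ≤ killed B F y i :=
  inv_nonneg_apply (domM_posDef h.posDef F) (domM_off h.off F) i y

lemma mulVec_killed {F : Finset ι} {y i : ι} (hy : y ∈ F) (hi : i ∈ F) :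
    (B *ᵥ killed B F y) i = if i = y then 1 else 0 := mulVec_domM_inv h.posDef hy hi

lemma mulVec_killed_le {F : Finset ι} {y : ι} (hy : y ∈ F) (i : ι) :
    (B *ᵥ killed B F y) i ≤ if i = y then 1 else 0 := by
  by_cases hi : i ∈ F
  · exact (h.mulVec_killed hy hi).le
  · have hiy : i ≠ y := fun h' => hi (h' ▸ hy)
    rw [if_neg hiy]
    refine Finset.sum_nonpos fun j _ => ?_
    by_cases hij : i = j
    · subst hij
      rw [killed, domM_inv_eq_zero h.posDef hy hi, mul_zero]
    · exact mul_nonpos_of_nonpos_of_nonneg (h.off i j hij) (h.killed_nonneg F y j)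

lemma mulVec_inv_col (y i : ι) : (B *ᵥ fun j => B⁻¹ j y) i = if i = y then 1 else 0 := by
  have := congrFun (mulVec_inv_mulVec h.posDef (Pi.single y 1)) i
  rw [mulVec_single_one, Pi.single_apply] at this
  exact this

lemma killed_lower {F : Finset ι} {y : ι} (hy : y ∈ F) {K : ℝ} (hK : 0 ≤ K)
    (hF : ∀ i, i ∉ F → B⁻¹ i y ≤ K) (i : ι) : B⁻¹ i y - K ≤ killed B F y i := by
  have key := nonneg_of_mulVec_nonneg h.posDef h.off
    (s := (killed B F y - fun j => B⁻¹ j y) + fun _ => K) F (fun i hi => ?_) (fun i hi => ?_) i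
  · simp only [Pi.add_apply, Pi.sub_apply] at key
    linarith
  · rw [mulVec_add, mulVec_sub, Pi.add_apply, Pi.sub_apply, h.mulVec_killed hy hi,
      h.mulVec_inv_col, sub_self, zero_add]
    simp only [mulVec, dotProduct, ← Finset.sum_mul]
    exact mul_nonneg (h.rowSum_nonneg i) hK
  · simp only [Pi.add_apply, Pi.sub_apply, killed, domM_inv_eq_zero h.posDef hy hi]
    linarith [hF i hi]

/-- One step of the chaining argument for killed Green's functions. -/
lemma chain_step (hc : 0 < c) (hcC : c ≤ C) (hν : 0 ≤ ν) {K : ℝ} (hK1 : 1 ≤ K)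
    (hK : C * K ^ (-ν) ≤ c / 2 * 2 ^ (-ν)) {R : ℝ} (hR : 2 ≤ R) {D : Finset ι} {y p : ι}
    (hy : y ∈ D) (hD : ∀ i, d i p ≤ K * R → i ∈ D ∧ i ∈ I) {s : ℝ} (hs : 0 ≤ s)
    (hlow : ∀ i, d i p ≤ R → s ≤ killed B D y i) (i : ι) (hi : d i p ≤ 2 * R) :
    c / 2 * 2 ^ (-ν) / (C * 2 ^ ν) * s ≤ killed B D y i := by
  have hC : 0 < C := hc.trans_le hcC
  have hR0 : 0 < R := by linarith
  set t := R ^ (-ν) with ht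
  have ht0 : 0 < t := rpow_pos_of_pos hR0 _
  have h2 : (0 : ℝ) < 2 ^ ν := rpow_pos_of_pos two_pos _
  have hhalf : (R / 2) ^ (-ν) = 2 ^ ν * t := by
    rw [div_rpow hR0.le (by norm_num), rpow_neg (by norm_num : (0 : ℝ) ≤ 2), div_inv_eq_mul, mul_comm]
  set m := C * (2 ^ ν * t) with hm
  have hm0 : 0 < m := by positivity
  set F : Finset ι := Finset.univ.filter fun i => d i p ≤ K * R with hF
  have hpF : p ∈ F := by
    simp only [hF, Finset.mem_filter, Finset.mem_univ, true_and, h.d_self]; positivity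
  set g := killed B F p with hg
  have hg0 : ∀ i, 0 ≤ g i := h.killed_nonneg F p
  have hgoff : ∀ i, i ∉ F → g i = 0 := fun i hi => domM_inv_eq_zero h.posDef hpF hi
  have hgup : ∀ i, R / 2 ≤ d i p → g i ≤ m := fun i hi =>
    (domM_inv_le h.posDef h.off hpF i).trans
      ((h.upper (R / 2) (by linarith) i p hi).trans (by rw [hhalf]))
  set w : ι → ℝ := fun i => min (g i / m) 1 with hw
  have hw1 : ∀ i, w i ≤ 1 := fun i => min_le_right _ _
  have hweq : ∀ i, R / 2 ≤ d i p → w i = g i / m := fun i hi =>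
    min_eq_left ((div_le_one hm0).2 (hgup i hi))
  have key := nonneg_of_mulVec_nonneg h.posDef h.off (s := killed B D y - s • w)
    (F.filter fun i => R < d i p) (fun i hi => ?_) (fun i hi => ?_) i
  · simp only [Pi.sub_apply, Pi.smul_apply, smul_eq_mul] at key
    have hKR : (K * R) ^ (-ν) = K ^ (-ν) * t := mul_rpow (by linarith) hR0.le
    have h2R : (2 * R) ^ (-ν) = 2 ^ (-ν) * t := mul_rpow (by norm_num) hR0.le
    have hgi : c / 2 * 2 ^ (-ν) * t ≤ g i := by
      have e1 := h.killed_lower hpF (K := C * (K * R) ^ (-ν)) (by positivity) (fun j hj => by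
        refine h.upper (K * R) (by positivity) j p ?_
        simp only [hF, Finset.mem_filter, Finset.mem_univ, true_and, not_le] at hj
        exact hj.le) i
      have e2 := h.lower (2 * R) (by linarith) i p hi
      rw [hKR] at e1
      rw [h2R] at e2
      have e3 := mul_le_mul_of_nonneg_right hK ht0.le
      change _ ≤ g i at e1
      linarith
    have hwi : c / 2 * 2 ^ (-ν) / (C * 2 ^ ν) ≤ w i := by
      have e0 : c / 2 * 2 ^ (-ν) / (C * 2 ^ ν) = c / 2 * 2 ^ (-ν) * t / m := by
        rw [hm]; field_simp
      refine le_min ?_ ?_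
      · rw [e0]; gcongr
      · have e4 : (2 : ℝ) ^ (-ν) ≤ 1 := rpow_le_one_of_one_le_of_nonpos (by norm_num) (by linarith)
        have e5 : (1 : ℝ) ≤ 2 ^ ν := one_le_rpow (by norm_num) hν
        rw [div_le_one (by positivity)]
        nlinarith
    nlinarith
  · simp only [hF, Finset.mem_filter, Finset.mem_univ, true_and] at hi
    have hiF : i ∈ F := by simp [hF, hi.1]
    have hip : i ≠ p := by rintro rfl; rw [h.d_self] at hi; linarith [hi.2]
    have hwB : (B *ᵥ w) i = 0 := by
      have : (B *ᵥ w) i = (B *ᵥ g) i / m := by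
        simp only [mulVec, dotProduct, Finset.sum_div]
        refine Finset.sum_congr rfl fun j _ => ?_
        by_cases hB : B i j = 0
        · simp [hB]
        · rw [hweq j ?_, mul_div_assoc]
          by_cases hij : i = j
          · subst hij; linarith [hi.2]
          · have := h.near i (hD i hi.1).2 j hij hB
            have := h.d_triangle i j p
            linarith [hi.2]
      rw [this, h.mulVec_killed hpF hiF, if_neg hip, zero_div]
    rw [mulVec_sub, mulVec_smul, Pi.sub_apply, Pi.smul_apply, hwB, smul_zero, sub_zero,
      h.mulVec_killed hy (hD i hi.1).1]
    split_ifs <;> norm_num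
  · simp only [Pi.sub_apply, Pi.smul_apply, smul_eq_mul]
    by_cases hiF : i ∈ F
    · have : d i p ≤ R := by
        by_contra! h'
        exact hi (Finset.mem_filter.2 ⟨hiF, h'⟩)
      nlinarith [hlow i this, hw1 i]
    · simp only [hw, hgoff i hiF]
      simp [h.killed_nonneg D y i]

lemma chain (hc : 0 < c) (hcC : c ≤ C) (hν : 0 ≤ ν) {K : ℝ} (hK1 : 1 ≤ K)
    (hK : C * K ^ (-ν) ≤ c / 2 * 2 ^ (-ν)) {R : ℝ} (hR : 2 ≤ R) {D : Finset ι} {p : ℕ → ι} {k₀ : ℕ}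
    (hp : ∀ k < k₀, d (p (k + 1)) (p k) ≤ R)
    (hD : ∀ k ≤ k₀, ∀ i, d i (p k) ≤ K * R → i ∈ D ∧ i ∈ I) (k : ℕ) (hk : k ≤ k₀) (i : ι)
    (hi : d i (p k) ≤ R) :
    (c / 2 * 2 ^ (-ν) / (C * 2 ^ ν)) ^ k * (c / 2 * R ^ (-ν)) ≤ killed B D (p 0) i := by
  have hC : 0 < C := hc.trans_le hcC
  have hR0 : 0 < R := by linarith
  have hK0 : 0 < K := by linarith
  have hp0 : p 0 ∈ D := (hD 0 (Nat.zero_le _) _ (by rw [h.d_self]; positivity)).1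
  induction k generalizing i with
  | zero =>
    have ht0 : 0 < R ^ (-ν) := rpow_pos_of_pos hR0 _
    have hKR : (K * R) ^ (-ν) = K ^ (-ν) * R ^ (-ν) := mul_rpow hK0.le hR0.le
    have e1 := h.killed_lower hp0 (K := C * (K * R) ^ (-ν)) (by positivity) (fun j hj => by
      refine h.upper (K * R) (by positivity) j (p 0) ?_
      by_contra! h'
      exact hj (hD 0 (Nat.zero_le _) j h'.le).1) i
    have e2 := h.lower R (by linarith) i (p 0) hi
    have e4 : (2 : ℝ) ^ (-ν) ≤ 1 := rpow_le_one_of_one_le_of_nonpos (by norm_num) (by linarith)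
    have e5 : C * K ^ (-ν) ≤ c / 2 := by nlinarith
    have e3 := mul_le_mul_of_nonneg_right e5 ht0.le
    rw [hKR] at e1
    rw [pow_zero, one_mul]
    linarith
  | succ k ih =>
    have hs : 0 ≤ (c / 2 * 2 ^ (-ν) / (C * 2 ^ ν)) ^ k * (c / 2 * R ^ (-ν)) := by positivity
    have := h.chain_step hc hcC hν hK1 hK hR hp0 (hD k (by omega)) hs (ih (by omega)) i (by
      have := h.d_triangle i (p (k + 1)) (p k)
      linarith [hp k (by omega)])
    rwa [pow_succ', mul_assoc]

end GreenBox

end GreenBox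

section BoxConnection

open Matrix

namespace GreenBox

variable {ι : Type*} [Fintype ι] [DecidableEq ι]
variable {B : Matrix ι ι ℝ} {d : ι → ι → ℝ} {I : Set ι} {ν c C : ℝ}

/-- Lower bound for the potential of a geodesic segment. -/
lemma sum_inv_geodesic_ge (h : GreenBox B d I ν c C) {r : ℝ} (hr : 1 ≤ r) {n : ℕ}
    {z : ℕ → ι} (hz : ∀ i j, i ≤ j → j ≤ n → d (z i) (z j) = (j : ℝ) - i) {i : ℕ} (hi : i ≤ n)
    {v : ι} (hv : d v (z i) ≤ r) :
    c * ∑ k ∈ Finset.range (n / 2 + 1), (r + k) ^ (-ν) ≤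
      ∑ j ∈ Finset.range (n + 1), B⁻¹ v (z j) := by
  have hnn : ∀ j, 0 ≤ B⁻¹ v (z j) := fun j => inv_nonneg_apply h.posDef h.off _ _
  have hterm : ∀ (k j : ℕ), d (z i) (z j) = k → c * (r + k) ^ (-ν) ≤ B⁻¹ v (z j) := by
    intro k j hj
    refine h.lower _ (by linarith [(Nat.cast_nonneg k : (0 : ℝ) ≤ k)]) _ _ ?_
    have := h.d_triangle v (z i) (z j)
    linarith
  rw [Finset.mul_sum]
  rcases le_total i (n - n / 2) with hle | hle
  · refine (Finset.sum_le_sum fun k hk => hterm k (i + k) ?_).trans ?_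
    · have := Finset.mem_range.1 hk
      rw [hz i (i + k) (by omega) (by omega)]; push_cast; ring
    · rw [← Finset.sum_image (s := Finset.range (n / 2 + 1)) (g := fun k => i + k)
        (f := fun j => B⁻¹ v (z j)) (fun a _ b _ hab => by simpa using hab)]
      refine Finset.sum_le_sum_of_subset_of_nonneg (fun j hj => ?_) fun j _ _ => hnn j
      obtain ⟨k, hk, rfl⟩ := Finset.mem_image.1 hj
      have := Finset.mem_range.1 hk
      exact Finset.mem_range.2 (by omega)
  · refine (Finset.sum_le_sum fun k hk => hterm k (i - k) ?_).trans ?_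
    · have := Finset.mem_range.1 hk
      rw [h.d_symm, hz (i - k) i (by omega) (by omega), Nat.cast_sub (by omega)]; ring
    · rw [← Finset.sum_image (s := Finset.range (n / 2 + 1)) (g := fun k => i - k)
        (f := fun j => B⁻¹ v (z j)) (fun a ha b hb hab => by
          have := Finset.mem_range.1 ha
          have := Finset.mem_range.1 hb
          have : i - a = i - b := hab
          omega)]
      refine Finset.sum_le_sum_of_subset_of_nonneg (fun j hj => ?_) fun j _ _ => hnn j
      obtain ⟨k, hk, rfl⟩ := Finset.mem_image.1 hj
      exact Finset.mem_range.2 (by omega)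

/-- Energy of the truncated potential of a family of points. -/
lemma truncated_energy_le (h : GreenBox B d I ν c C) {m : ℝ} (hm : 0 < m) (N : ℕ) (q : ℕ → ι)
    (u : ℕ → ι → ℝ) (hu : ∀ k i, 0 ≤ u k i)
    (hBu : ∀ k < N, ∀ i, (B *ᵥ u k) i ≤ if i = q k then 1 else 0) :
    (fun i => min ((∑ k ∈ Finset.range N, u k i) / m) 1) ⬝ᵥ B *ᵥ
      (fun i => min ((∑ k ∈ Finset.range N, u k i) / m) 1) ≤ N / m := by
  refine (min_one_energy_le h.posDef h.off h.rowSum_nonneg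
    (w := fun i => (∑ k ∈ Finset.range N, if i = q k then 1 else 0) / m)
    (fun i => div_nonneg (Finset.sum_nonneg fun k _ => hu k i) hm.le)
    (fun i => div_nonneg (Finset.sum_nonneg fun k _ => by split_ifs <;> norm_num) hm.le)
    fun i => ?_).trans (le_of_eq ?_)
  · have : (B *ᵥ fun i => (∑ k ∈ Finset.range N, u k i) / m) i =
        (∑ k ∈ Finset.range N, (B *ᵥ u k) i) / m := by
      simp only [mulVec, dotProduct, Finset.mul_sum, Finset.sum_div, mul_div_assoc]
      rw [Finset.sum_comm]
    rw [this]
    gcongr with k hk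
    exact hBu k (Finset.mem_range.1 hk) i
  · rw [← Finset.sum_div, Finset.sum_comm]
    simp

set_option maxHeartbeats 1000000 in
theorem _root_.exists_box_connection {ν c C : ℝ} (hν : 0 < ν) (hc : 0 < c) (hcC : c ≤ C) :
    ∃ K ≥ (1 : ℝ), ∃ C₁ > (0 : ℝ), ∀ {ι : Type} [Fintype ι] [DecidableEq ι] {B : Matrix ι ι ℝ}
      {d : ι → ι → ℝ} {I : Set ι} (_ : GreenBox B d I ν c C) (cpl : ι × ι → ℝ) (_ : Coupled cpl B)
      (L n : ℕ) (_ : 2 ≤ L) (_ : 0 < n) (z : ℕ → ι)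
      (_ : ∀ i j, i ≤ j → j ≤ n → d (z i) (z j) = (j : ℝ) - i)
      (_ : ∀ i ≤ n, ∀ v, d v (z i) ≤ K * L → v ∈ I) (a : ℝ),
      ENNReal.ofReal (C₁⁻¹ * (L : ℝ) ^ (-ν) * exp (-(C₁ * (a ^ 2 * ((n + 1) /
        ∑ k ∈ Finset.range (n / 2 + 1), (K * L + k) ^ (-ν)) + (n / L + 1))))) ≤
      ∫⁻ ψ, ENNReal.ofReal (bernProb (openProb cpl fun i => ψ i - a) fun ω => eConn ω (z n) (z 0))
        ∂gaussM B := by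
  obtain ⟨c₀, hc₀, hlow⟩ := exists_connection_lower.{0}
  have hC : 0 < C := hc.trans_le hcC
  have htend : Tendsto (fun K : ℝ => C * K ^ (-ν)) atTop (𝓝 0) := by
    simpa using (tendsto_rpow_neg_atTop hν).const_mul C
  obtain ⟨K₁, hK₁1, hK₁⟩ := ((eventually_ge_atTop (1 : ℝ)).and
    (htend.eventually (ge_mem_nhds (show (0 : ℝ) < c / 2 * 2 ^ (-ν) by positivity)))).exists
  have hK₁0 : 0 < K₁ := by linarith
  obtain ⟨K₂, hK₂1, hK₂⟩ := ((eventually_ge_atTop K₁).and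
    (htend.eventually (ge_mem_nhds (show (0 : ℝ) < c / 2 * K₁ ^ (-ν) by positivity)))).exists
  have hK₂0 : 0 < K₂ := by linarith
  set δ : ℝ := c / 2 * 2 ^ (-ν) / (C * 2 ^ ν) with hδ
  have hδ0 : 0 < δ := by positivity
  set A : ℝ := C / (c / 2 * K₁ ^ (-ν)) with hA
  have hA0 : 0 < A := by positivity
  set b : ℝ := c₀ * (c / 2) / C with hb
  have hb0 : 0 < b := by positivity
  refine ⟨K₂ + 2, by linarith, 1 / c + A + |log δ| + b⁻¹, by positivity, ?_⟩
  intro ι _ _ B d I h cpl hcpl L n hL hn z hz hI a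
  have hL' : (2 : ℝ) ≤ L := by exact_mod_cast hL
  have hL0 : (0 : ℝ) < L := by linarith
  have hLK₁ : (L : ℝ) ≤ K₁ * L := le_mul_of_one_le_left hL0.le hK₁1
  have hK₁₂ : K₁ * (L : ℝ) ≤ K₂ * L := mul_le_mul_of_nonneg_right hK₂1 hL0.le
  set S : ℝ := ∑ k ∈ Finset.range (n / 2 + 1), ((K₂ + 2) * L + k) ^ (-ν) with hS
  have hS0 : 0 < S := Finset.sum_pos (fun k _ => rpow_pos_of_pos (by positivity) _)
    ⟨0, Finset.mem_range.2 (Nat.succ_pos _)⟩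
  set t : ℝ := (L : ℝ) ^ (-ν) with ht
  have ht0 : 0 < t := rpow_pos_of_pos hL0 _
  set k₀ := n / L with hk₀
  have hkn : ∀ k ≤ k₀, k * L ≤ n := fun k hk =>
    (Nat.mul_le_mul_right L hk).trans (Nat.div_mul_le_self n L)
  set p : ℕ → ι := fun k => z (k * L) with hp
  set nb : ℝ → Finset ι := fun r => Finset.univ.filter fun i => ∃ k ≤ k₀, d i (p k) ≤ r with hnb
  have mem_nb : ∀ r i, i ∈ nb r ↔ ∃ k ≤ k₀, d i (p k) ≤ r := fun r i => by simp [hnb]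
  have hII : ∀ k ≤ k₀, ∀ i, d i (p k) ≤ (K₂ + 2) * L → i ∈ I := fun k hk i hi =>
    hI _ (hkn k hk) i hi
  have hpp : ∀ k < k₀, d (p (k + 1)) (p k) ≤ L := fun k hk => by
    rw [h.d_symm, hp]
    simp only
    rw [hz _ _ (Nat.mul_le_mul_right L (Nat.le_succ k)) (hkn _ hk)]
    push_cast
    exact le_of_eq (by ring)
  have hzn : d (z n) (p k₀) ≤ L := by
    rw [h.d_symm, hp]
    simp only
    rw [hz _ _ (hkn k₀ le_rfl) le_rfl]
    have : (n : ℝ) ≤ k₀ * L + L := by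
      have := Nat.lt_div_mul_add (a := n) (b := L) (by omega)
      exact_mod_cast this.le
    push_cast
    linarith
  have hpos : (0 : ℝ) < n := by exact_mod_cast hn
  have hne : z n ≠ z 0 := fun h' => by
    have := hz 0 n (Nat.zero_le _) le_rfl
    rw [h', h.d_self] at this
    push_cast at this
    linarith
  have hK1L : (K₁ * L) ^ (-ν) = K₁ ^ (-ν) * t := mul_rpow hK₁0.le hL0.le
  have hK2L : (K₂ * L) ^ (-ν) = K₂ ^ (-ν) * t := mul_rpow hK₂0.le hL0.le
  set m : ℝ := c * S with hm
  have hm0 : 0 < m := by positivity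
  set m' : ℝ := c / 2 * K₁ ^ (-ν) * t with hm'
  have hm'0 : 0 < m' := by positivity
  set F : ℕ → Finset ι := fun k => Finset.univ.filter fun i => d i (p k) ≤ K₂ * L with hF
  have mem_F : ∀ k i, i ∈ F k ↔ d i (p k) ≤ K₂ * L := fun k i => by simp [hF]
  have hpF : ∀ k, p k ∈ F k := fun k => by rw [mem_F, h.d_self]; positivity
  set U : ℕ → ι → ℝ := fun j i => B⁻¹ i (z j) with hU
  have hU0 : ∀ j i, 0 ≤ U j i := fun j i => inv_nonneg_apply h.posDef h.off _ _
  set W : ℕ → ι → ℝ := fun k => killed B (F k) (p k) with hW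
  have hW0 : ∀ k i, 0 ≤ W k i := fun k i => h.killed_nonneg _ _ _
  set f : ι → ℝ := fun i => min ((∑ j ∈ Finset.range (n + 1), U j i) / m) 1 with hf
  set χ : ι → ℝ := fun i => min ((∑ k ∈ Finset.range (k₀ + 1), W k i) / m') 1 with hχ
  have hfE : f ⬝ᵥ B *ᵥ f ≤ ((n + 1 : ℕ) : ℝ) / m :=
    h.truncated_energy_le hm0 (n + 1) z U hU0 fun j _ i => (h.mulVec_inv_col (z j) i).le
  have hχE : χ ⬝ᵥ B *ᵥ χ ≤ ((k₀ + 1 : ℕ) : ℝ) / m' :=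
    h.truncated_energy_le hm'0 (k₀ + 1) p W hW0 fun k _ i => h.mulVec_killed_le (hpF k) i
  have hf1 : ∀ i ∈ nb ((K₂ + 2) * L), f i = 1 := fun i hi => by
    obtain ⟨k, hk, hik⟩ := (mem_nb _ _).1 hi
    refine min_eq_right ((one_le_div hm0).2 ?_)
    exact h.sum_inv_geodesic_ge (r := (K₂ + 2) * L) (by linarith) hz (hkn k hk) hik
  have hnbmono : ∀ r s i, r ≤ s → i ∈ nb r → i ∈ nb s := fun r s i hrs hi => by
    obtain ⟨k, hk, hik⟩ := (mem_nb _ _).1 hi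
    exact (mem_nb _ _).2 ⟨k, hk, hik.trans hrs⟩
  have key := hlow B cpl hcpl h.posDef h.rowSum_nonneg (nb ((K₂ + 1) * L)) (nb (K₁ * L)) f χ
    (fun i hi => hf1 i (hnbmono _ _ i (by linarith) hi)) (fun i hi => ?_) (fun i hi => ?_)
    (fun i hi => ?_) (C * t) (by positivity) (fun l hl j hj => ?_) (z n) (z 0) hne
    ((mem_nb _ _).2 ⟨k₀, le_rfl, hzn.trans (by linarith)⟩)
    ((mem_nb _ _).2 ⟨0, Nat.zero_le _, by simp only [hp, zero_mul, h.d_self]; positivity⟩) C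
    (h.diag_le _) (h.diag_le _) a
  · refine le_trans (ENNReal.ofReal_le_ofReal ?_) key
    have hchain := h.chain hc hcC hν.le hK₁1 hK₁ hL' hpp (D := nb (K₁ * L)) (fun k hk i hi =>
      ⟨(mem_nb _ _).2 ⟨k, hk, hi⟩, hII k hk i (hi.trans (by linarith))⟩) k₀ le_rfl (z n) hzn
    rw [← hδ, ← ht] at hchain
    have hp0 : p 0 = z 0 := by simp [hp]
    rw [hp0] at hchain
    have hk₀' : (k₀ : ℝ) ≤ n / L := Nat.cast_div_le
    have hk₀0 : (0 : ℝ) ≤ k₀ := Nat.cast_nonneg _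
    set Q : ℝ := a ^ 2 * ((n + 1) / S) with hQ
    have hQ0 : 0 ≤ Q := by positivity
    have hδk : exp (-(|log δ| * (n / L + 1))) ≤ δ ^ k₀ := by
      rw [← exp_log (pow_pos hδ0 k₀), log_pow]
      refine exp_le_exp.2 ?_
      have := neg_abs_le (log δ)
      nlinarith [abs_nonneg (log δ)]
    have hexp : -(Q / c + A * (n / L + 1)) ≤
        -(1 / 2) * (a ^ 2 * (f ⬝ᵥ B *ᵥ f) + C * t * (χ ⬝ᵥ B *ᵥ χ)) := by
      have e1 : a ^ 2 * (f ⬝ᵥ B *ᵥ f) ≤ Q / c := by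
        refine (mul_le_mul_of_nonneg_left hfE (sq_nonneg a)).trans (le_of_eq ?_)
        rw [hQ, hm]; push_cast; field_simp
      have e2 : C * t * (χ ⬝ᵥ B *ᵥ χ) ≤ A * (k₀ + 1) := by
        refine (mul_le_mul_of_nonneg_left hχE (by positivity)).trans (le_of_eq ?_)
        rw [hA, hm']; push_cast; field_simp
      have e3 : A * (k₀ + 1) ≤ A * (n / L + 1) := by gcongr
      have : 0 ≤ Q / c := by positivity
      have : 0 ≤ A * (n / L + 1) := by positivity
      linarith
    calc (1 / c + A + |log δ| + b⁻¹)⁻¹ * t *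
          exp (-((1 / c + A + |log δ| + b⁻¹) * (Q + (n / L + 1))))
        ≤ b * t * exp (-(Q / c + A * (n / L + 1)) + -(|log δ| * (n / L + 1))) := by
          gcongr
          · rw [inv_le_comm₀ (by positivity) hb0]
            have : 0 ≤ 1 / c + A + |log δ| := by positivity
            linarith
          · have h1 : 0 ≤ (A + |log δ| + b⁻¹) * Q := by positivity
            have h2 : 0 ≤ (1 / c + b⁻¹) * (n / L + 1) := by positivity
            have h3 : Q / c = 1 / c * Q := by ring
            rw [h3]
            linarith
      _ = exp (-(Q / c + A * (n / L + 1))) *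
          (c₀ * ((exp (-(|log δ| * (n / L + 1))) * (c / 2 * t)) / C)) := by
          rw [exp_add, hb]; ring
      _ ≤ _ := by
          have hmid : exp (-(|log δ| * (n / L + 1))) * (c / 2 * t) ≤ killed B (nb (K₁ * L)) (z 0) (z n) :=
            (mul_le_mul_of_nonneg_right hδk (by positivity)).trans hchain
          refine mul_le_mul (exp_le_exp.2 hexp) ?_ (by positivity) (exp_pos _).le
          refine mul_le_mul_of_nonneg_left ?_ hc₀.le
          exact div_le_div_of_nonneg_right hmid hC.le
  · obtain ⟨k, hk, hik⟩ := (mem_nb _ _).1 hi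
    have hiI := hII k hk i (hik.trans (by linarith))
    rw [← h.rowSum_eq i hiI]
    refine Finset.sum_congr rfl fun j _ => ?_
    by_cases hB : B i j = 0
    · simp [hB]
    · rw [hf1 j ?_, mul_one]
      refine (mem_nb _ _).2 ⟨k, hk, ?_⟩
      by_cases hij : i = j
      · subst hij; exact hik.trans (by linarith)
      · have h1 := h.near i hiI j hij hB
        have h2 := h.d_triangle j i (p k)
        rw [h.d_symm j i] at h2
        linarith
  · obtain ⟨k, hk, hik⟩ := (mem_nb _ _).1 hi
    refine min_eq_right ((one_le_div hm'0).2 ?_)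
    refine le_trans ?_ (Finset.single_le_sum (f := fun k => W k i) (fun k _ => hW0 k i)
      (Finset.mem_range.2 (Nat.lt_succ_of_le hk)))
    have e1 := h.killed_lower (hpF k) (K := C * (K₂ * L) ^ (-ν)) (by positivity) (fun j hj => by
      refine h.upper (K₂ * L) (by positivity) j (p k) ?_
      rw [mem_F, not_le] at hj
      exact hj.le) i
    have e2 := h.lower (K₁ * L) (by linarith) i (p k) hik
    rw [hK2L] at e1
    rw [hK1L] at e2
    have e3 := mul_le_mul_of_nonneg_right hK₂ ht0.le
    change _ ≤ W k i at e1
    linarith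
  · have : ∑ k ∈ Finset.range (k₀ + 1), W k i = 0 := Finset.sum_eq_zero fun k hk => by
      refine domM_inv_eq_zero h.posDef (hpF k) fun hik => hi ((mem_nb _ _).2
        ⟨k, Nat.lt_succ_iff.1 (Finset.mem_range.1 hk), ((mem_F _ _).1 hik).trans (by linarith)⟩)
    simp only [hχ, this]
    simp
  · have : ∃ k ≤ k₀, j ∈ F k := by
      by_contra! h'
      have h0 : ∑ k ∈ Finset.range (k₀ + 1), W k j = 0 := Finset.sum_eq_zero fun k hk =>
        domM_inv_eq_zero h.posDef (hpF k) (h' k (Nat.lt_succ_iff.1 (Finset.mem_range.1 hk)))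
      refine hj ?_
      simp only [hχ, h0]
      simp
    obtain ⟨k, hk, hjk⟩ := this
    rw [mem_F] at hjk
    rw [mem_nb] at hl
    push Not at hl
    have h1 := hl k hk
    have h2 := h.d_triangle l j (p k)
    refine h.upper L hL0 l j ?_
    linarith

end GreenBox

end BoxConnection

section OuterClusters

open Matrix

variable {ι : Type*} [Fintype ι] [DecidableEq ι] {B : Matrix ι ι ℝ}

/-- Existence of equilibrium potentials. -/
lemma exists_equilibrium (hB : B.PosDef) (A : Finset ι) :
    ∃ v : ι → ℝ, (∀ i ∈ A, v i = 1) ∧ ∀ i, i ∉ A → (B *ᵥ v) i = 0 := by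
  set s : ι → ℝ := fun y => ∑ j, B y j with hs
  refine ⟨fun i => 1 - ∑ y ∈ Aᶜ, (domM B Aᶜ)⁻¹ i y * s y, fun i hi => ?_, fun i hi => ?_⟩
  · have : ∑ y ∈ Aᶜ, (domM B Aᶜ)⁻¹ i y * s y = 0 := Finset.sum_eq_zero fun y hy => by
      rw [domM_inv_eq_zero hB hy (by simpa using hi), zero_mul]
    simp only [this, sub_zero]
  · have hi' : i ∈ Aᶜ := by simpa using hi
    have h1 : ∀ y ∈ Aᶜ, ∑ j, B i j * (domM B Aᶜ)⁻¹ j y = if i = y then 1 else 0 := fun y hy =>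
      mulVec_domM_inv hB hy hi'
    have h2 : ∑ j, B i j * ∑ y ∈ Aᶜ, (domM B Aᶜ)⁻¹ j y * s y = s i := by
      calc ∑ j, B i j * ∑ y ∈ Aᶜ, (domM B Aᶜ)⁻¹ j y * s y
          = ∑ y ∈ Aᶜ, (∑ j, B i j * (domM B Aᶜ)⁻¹ j y) * s y := by
            simp only [Finset.mul_sum, Finset.sum_mul]
            rw [Finset.sum_comm]
            exact Finset.sum_congr rfl fun y _ => Finset.sum_congr rfl fun j _ => by ring
        _ = ∑ y ∈ Aᶜ, (if i = y then 1 else 0) * s y :=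
            Finset.sum_congr rfl fun y hy => by rw [h1 y hy]
        _ = s i := by simp [hi]
    change ∑ j, B i j * (1 - ∑ y ∈ Aᶜ, (domM B Aᶜ)⁻¹ j y * s y) = 0
    simp only [mul_sub, mul_one]
    rw [Finset.sum_sub_distrib, h2, sub_self]

/-- The variational lower bound for the energy of a potential. -/
lemma inv_le_energy (hB : B.PosDef) {μ v : ι → ℝ} (hμ : μ ⬝ᵥ v = 1) {ε : ℝ} (hε : 0 < ε)
    (hle : μ ⬝ᵥ B⁻¹ *ᵥ μ ≤ ε) : ε⁻¹ ≤ v ⬝ᵥ B *ᵥ v := by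
  have h0 := posDef_quadForm_nonneg hB (v - ε⁻¹ • (B⁻¹ *ᵥ μ))
  have e1 : B *ᵥ (v - ε⁻¹ • (B⁻¹ *ᵥ μ)) = B *ᵥ v - ε⁻¹ • μ := by
    rw [mulVec_sub, mulVec_smul, mulVec_inv_mulVec hB]
  have e2 : (B⁻¹ *ᵥ μ) ⬝ᵥ B *ᵥ v = 1 := by
    rw [← hμ, posDef_isSymm hB, mulVec_inv_mulVec hB, dotProduct_comm]
  have e3 : v ⬝ᵥ μ = 1 := by rw [dotProduct_comm, hμ]
  have e4 : (B⁻¹ *ᵥ μ) ⬝ᵥ μ = μ ⬝ᵥ B⁻¹ *ᵥ μ := dotProduct_comm _ _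
  rw [e1, sub_dotProduct, dotProduct_sub, dotProduct_sub, smul_dotProduct, smul_dotProduct,
    dotProduct_smul, dotProduct_smul, e2, e3, e4] at h0
  simp only [smul_eq_mul, mul_one] at h0
  have h1 : ε⁻¹ * (ε⁻¹ * (μ ⬝ᵥ B⁻¹ *ᵥ μ)) ≤ ε⁻¹ := by
    calc ε⁻¹ * (ε⁻¹ * (μ ⬝ᵥ B⁻¹ *ᵥ μ)) ≤ ε⁻¹ * (ε⁻¹ * ε) := by gcongr
      _ = ε⁻¹ := by rw [inv_mul_cancel₀ hε.ne', mul_one]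
  linarith

namespace GreenBox

variable {d : ι → ι → ℝ} {I : Set ι} {ν c C : ℝ}

/-- Energy of a potential which equals one on a spread-out family of points. -/
lemma energy_ge (h : GreenBox B d I ν c C) (hC : 0 < C) {N : ℕ} (hN : 0 < N) {r : ℝ} (hr : 0 < r)
    {u : ℕ → ι} (hu : ∀ k l, k < l → l < N → r ≤ d (u k) (u l)) {v : ι → ℝ}
    (hv : ∀ k < N, v (u k) = 1) : (C / N + C * r ^ (-ν))⁻¹ ≤ v ⬝ᵥ B *ᵥ v := by
  have hN' : (0 : ℝ) < N := by exact_mod_cast hN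
  have hr' : 0 < r ^ (-ν) := rpow_pos_of_pos hr _
  set μ : ι → ℝ := ∑ k ∈ Finset.range N, (N : ℝ)⁻¹ • Pi.single (u k) (1 : ℝ) with hμ
  refine inv_le_energy h.posDef (μ := μ) ?_ (by positivity) ?_
  · rw [hμ, sum_dotProduct]
    simp only [smul_dotProduct, single_dotProduct, one_mul, smul_eq_mul]
    rw [Finset.sum_congr rfl fun k hk => by rw [hv k (Finset.mem_range.1 hk)]]
    simp [hN'.ne']
  · have e1 : μ ⬝ᵥ B⁻¹ *ᵥ μ = ∑ k ∈ Finset.range N, ∑ l ∈ Finset.range N,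
        ((N : ℝ)⁻¹ * (N : ℝ)⁻¹) * B⁻¹ (u k) (u l) := by
      rw [hμ, sum_dotProduct]
      refine Finset.sum_congr rfl fun k _ => ?_
      rw [smul_dotProduct, single_dotProduct, one_mul, mulVec_sum, Finset.sum_apply, smul_eq_mul,
        Finset.mul_sum]
      refine Finset.sum_congr rfl fun l _ => ?_
      rw [mulVec_smul, mulVec_single_one, Pi.smul_apply, smul_eq_mul, mul_assoc]
      rfl
    have e2 : ∀ k ∈ Finset.range N, ∀ l ∈ Finset.range N,
        ((N : ℝ)⁻¹ * (N : ℝ)⁻¹) * B⁻¹ (u k) (u l) ≤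
          ((N : ℝ)⁻¹ * (N : ℝ)⁻¹) * ((if k = l then C else 0) + C * r ^ (-ν)) := by
      intro k hk l hl
      refine mul_le_mul_of_nonneg_left ?_ (by positivity)
      have hpos : 0 ≤ C * r ^ (-ν) := by positivity
      rcases lt_trichotomy k l with hkl | rfl | hkl
      · have := h.upper r hr _ _ (hu k l hkl (Finset.mem_range.1 hl))
        rw [if_neg hkl.ne]; linarith
      · have := h.diag_le (u k)
        rw [if_pos rfl]; linarith
      · have := h.upper r hr (u k) (u l)
          (by rw [h.d_symm]; exact hu l k hkl (Finset.mem_range.1 hk))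
        rw [if_neg hkl.ne']; linarith
    rw [e1]
    refine (Finset.sum_le_sum fun k hk => Finset.sum_le_sum fun l hl => e2 k hk l hl).trans
      (le_of_eq ?_)
    simp only [← Finset.mul_sum, Finset.sum_add_distrib, Finset.sum_const, Finset.card_range,
      Finset.sum_ite_eq, nsmul_eq_mul]
    rw [Finset.sum_congr rfl fun k hk => by rw [if_pos hk]]
    simp only [Finset.sum_const, Finset.card_range, nsmul_eq_mul]
    field_simp

/-- A cluster leaving the bulk meets all annuli around its root. -/
lemma exists_mem_annulus (h : GreenBox B d I ν c C) {cpl : ι × ι → ℝ} (hcpl : Coupled cpl B)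
    {x : ι} {R : ℝ} (hR : ∀ i, i ∉ I → R ≤ d x i) {A : Finset ι} {i : ι} (hiA : i ∈ A)
    (hiI : i ∉ I) {ψ : ι → ℝ} (hne : clusterProb cpl x A ψ ≠ 0) {t : ℝ} (ht0 : 0 ≤ t)
    (htR : t ≤ R) : ∃ u ∈ A, t ≤ d x u ∧ d x u ≤ t + 1 := by
  obtain ⟨ω, -, hω⟩ := Finset.exists_ne_zero_of_sum_ne_zero hne
  have hA : eCluster ω x = A := by
    by_contra hA; exact hω (by rw [if_neg hA])
  rw [if_pos hA] at hω
  have hedge : ∀ u v, ((u, v) ∈ ω ∨ (v, u) ∈ ω) → u ≠ v ∧ B u v ≠ 0 := by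
    have hop : ∀ e ∈ ω, cpl e ≠ 0 := fun e he hc => by
      refine hω (Finset.prod_eq_zero (Finset.mem_univ e) ?_)
      rw [if_pos he, openProb, hc]
      simp
    intro u v huv
    have hne' : u ≠ v := by
      rintro rfl
      rcases huv with huv | huv <;> exact hop _ huv (hcpl.diag u)
    refine ⟨hne', fun hB => ?_⟩
    have h1 := hcpl.add_swap u v hne'
    rw [hB, neg_zero] at h1
    have h2 := hcpl.nonneg (u, v)
    have h3 := hcpl.nonneg (v, u)
    rcases huv with huv | huv
    · exact hop _ huv (by linarith)
    · exact hop _ huv (by linarith)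
  have key : ∀ j, eConn ω x j → t ≤ d x j → ∃ u, eConn ω x u ∧ t ≤ d x u ∧ d x u ≤ t + 1 := by
    clear hne hω hA hiA hiI
    intro j hj
    induction hj with
    | refl => exact fun h' => ⟨x, Relation.ReflTransGen.refl, h', by rw [h.d_self]; linarith⟩
    | @tail b e hb hbe ih =>
      intro hte
      by_cases htb : t ≤ d x b
      · exact ih htb
      · push Not at htb
        have hbI : b ∈ I := by
          by_contra hbI
          linarith [hR b hbI]
        obtain ⟨hne', hB⟩ := hedge b e hbe
        have h1 := h.near b hbI e hne' hB
        have h2 := h.d_triangle x b e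
        exact ⟨e, hb.tail hbe, hte, by linarith⟩
  obtain ⟨u, hu, hu1, hu2⟩ := key i (mem_eCluster.1 (hA ▸ hiA)) (htR.trans (hR i hiI))
  exact ⟨u, hA ▸ mem_eCluster.2 hu, hu1, hu2⟩

/-- Clusters leaving the bulk are unlikely away from level zero. -/
lemma levelProb_outer_le (h : GreenBox B d I ν c C) (hC : 0 < C) {cpl : ι × ι → ℝ}
    (hcpl : Coupled cpl B) {x y : ι} (hxy : x ≠ y) {N : ℕ} (hN : 0 < N) {r : ℝ} (hr : 0 < r)
    (hR : ∀ i, i ∉ I → N * (r + 1) ≤ d x i) {A : Finset ι} (hy : y ∈ A) {i : ι} (hiA : i ∈ A)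
    (hiI : i ∉ I) {a : ℝ} (ha : 0 ≤ a) :
    levelProb B cpl x A a ≤
      ENNReal.ofReal (exp (-(1 / 2) * a ^ 2 * (C / N + C * r ^ (-ν))⁻¹)) * levelProb B cpl x A 0 := by
  by_cases hne : ∃ ψ : ι → ℝ, clusterProb cpl x A ψ ≠ 0
  · obtain ⟨ψ, hψ⟩ := hne
    have hex : ∀ k : ℕ, ∃ u, k < N → u ∈ A ∧ k * (r + 1) ≤ d x u ∧ d x u ≤ k * (r + 1) + 1 := by
      intro k
      by_cases hk : k < N
      · have hk' : (k : ℝ) ≤ N := by exact_mod_cast hk.le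
        obtain ⟨u, hu⟩ := h.exists_mem_annulus hcpl hR hiA hiI hψ (t := k * (r + 1))
          (by positivity) (by gcongr)
        exact ⟨u, fun _ => hu⟩
      · exact ⟨x, fun h' => absurd h' hk⟩
    choose u hu using hex
    obtain ⟨v, hv1, hv0⟩ := exists_equilibrium h.posDef A
    refine (levelProb_le hcpl h.posDef hy hxy (fun i _ => h.rowSum_nonneg i) hv1 hv0 ha).trans ?_
    gcongr ENNReal.ofReal (exp ?_) * _
    have := h.energy_ge hC hN hr (u := u) (fun k l hkl hl => ?_) (v := v)
      (fun k hk => hv1 _ (hu k hk).1)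
    · nlinarith [sq_nonneg a]
    · have h1 := (hu k (hkl.trans hl)).2.2
      have h2 := (hu l hl).2.1
      have h3 := h.d_triangle x (u k) (u l)
      have h4 : (k : ℝ) + 1 ≤ l := by exact_mod_cast hkl
      nlinarith
  · push Not at hne
    simp only [levelProb, hne]
    simp

/-- Connections are realised by clusters in the bulk up to a small error. -/
theorem connection_le (h : GreenBox B d I ν c C) (hC : 0 < C) {cpl : ι × ι → ℝ}
    (hcpl : Coupled cpl B) {x y : ι} (hxy : x ≠ y) {N : ℕ} (hN : 0 < N) {r : ℝ} (hr : 0 < r)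
    (hR : ∀ i, i ∉ I → N * (r + 1) ≤ d x i) {a : ℝ} (ha : 0 ≤ a) :
    ∫⁻ ψ, ENNReal.ofReal (bernProb (openProb cpl fun i => ψ i - a) fun ω => eConn ω x y)
      ∂gaussM B ≤
      ∑ A : Finset ι with y ∈ A ∧ ∀ i ∈ A, i ∈ I, levelProb B cpl x A a +
        ENNReal.ofReal (exp (-(1 / 2) * a ^ 2 * (C / N + C * r ^ (-ν))⁻¹)) := by
  have := gaussM_isProb h.posDef
  have hsum : ∀ s : Finset (Finset ι), ∀ b : ℝ, ∫⁻ ψ, ENNReal.ofReal (∑ A ∈ s,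
      clusterProb cpl x A fun i => ψ i - b) ∂gaussM B = ∑ A ∈ s, levelProb B cpl x A b := by
    intro s b
    simp only [levelProb]
    rw [← lintegral_finsetSum _ fun A _ => by fun_prop]
    refine lintegral_congr fun ψ => ?_
    exact ENNReal.ofReal_sum_of_nonneg fun A _ => clusterProb_nonneg hcpl.nonneg _ _ _
  have hle : ∀ s : Finset (Finset ι), ∀ b : ℝ, ∑ A ∈ s, levelProb B cpl x A b ≤ 1 := by
    intro s b
    rw [← hsum]
    refine (lintegral_mono fun ψ => ENNReal.ofReal_le_one.2 ?_).trans (by simp)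
    rw [← sum_clusterProb cpl x fun i => ψ i - b]
    exact Finset.sum_le_sum_of_subset_of_nonneg (Finset.subset_univ s)
      fun A _ _ => clusterProb_nonneg hcpl.nonneg _ _ _
  have e1 : ∫⁻ ψ, ENNReal.ofReal (bernProb (openProb cpl fun i => ψ i - a) fun ω => eConn ω x y)
      ∂gaussM B = ∑ A : Finset ι with y ∈ A, levelProb B cpl x A a := by
    rw [← hsum]
    refine lintegral_congr fun ψ => ?_
    rw [bernProb_eConn_eq_sum]
    rfl
  rw [e1, ← Finset.sum_filter_add_sum_filter_not _ fun A : Finset ι => ∀ i ∈ A, i ∈ I,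
    Finset.filter_filter]
  gcongr
  set E := ENNReal.ofReal (exp (-(1 / 2) * a ^ 2 * (C / N + C * r ^ (-ν))⁻¹))
  calc _ ≤ ∑ A ∈ (Finset.univ.filter fun A : Finset ι => y ∈ A).filter
        (fun A => ¬ ∀ i ∈ A, i ∈ I), E * levelProb B cpl x A 0 := by
        refine Finset.sum_le_sum fun A hA => ?_
        simp only [Finset.mem_filter, Finset.mem_univ, true_and] at hA
        obtain ⟨hyA, hA⟩ := hA
        push Not at hA
        obtain ⟨i, hiA, hiI⟩ := hA
        exact h.levelProb_outer_le hC hcpl hxy hN hr hR hyA hiA hiI ha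
    _ ≤ E := by
        rw [← Finset.mul_sum]
        exact mul_le_of_le_one_right' (hle _ _)

end GreenBox

end OuterClusters

section ModelLink

open Matrix WGraph WGraph.GreenKernel

namespace Model

variable {M : Model}

/-- An enumeration of the vertices, used to orient the edges. -/
def rank (v : M.V) : ℕ :=
  haveI := M.countableV
  (exists_injective_nat M.V).choose v

lemma rank_injective : Function.Injective (rank : M.V → ℕ) :=
  haveI := M.countableV
  (exists_injective_nat M.V).choose_spec

variable (Λ : Finset M.V)

/-- Oriented version of a symmetric weight function. -/
def orient {Λ : Finset M.V} (w : Λ → Λ → ℝ) (e : Λ × Λ) : ℝ :=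
  if rank (e.1 : M.V) < rank (e.2 : M.V) then w e.1 e.2 else 0

/-- The oriented edges inside a finite set. -/
def edges : Finset (Λ × Λ) := Finset.univ.filter fun e => rank (e.1 : M.V) < rank (e.2 : M.V)

/-- The oriented conductances of the graph. -/
def cond : Λ × Λ → ℝ := orient fun i j => M.lam i j

/-- The oriented conductances of the trace of the graph on a finite set. -/
def traceCond : Λ × Λ → ℝ := orient fun i j => -precM (M := M.toWGraph) Λ i j

/-- The open oriented edges inside a finite set. -/
def pattern (a : ℝ) (ω : M.Ω) : Finset (Λ × Λ) :=
  (edges Λ).filter fun e => M.opn a ω e.1 e.2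

variable {Λ}

lemma mem_edges {e : Λ × Λ} : e ∈ edges Λ ↔ rank (e.1 : M.V) < rank (e.2 : M.V) := by simp [edges]

lemma coupled_traceCond (h : M.toWGraph.GreenKernel) :
    Coupled (traceCond Λ) (precM (M := M.toWGraph) Λ) := by
  refine ⟨fun e => ?_, fun i => by simp [traceCond, orient], fun i j hij => ?_⟩
  · unfold traceCond orient
    split_ifs with hr
    · have := h.precM_off e.1 e.2 fun h' => by rw [h'] at hr; exact lt_irrefl _ hr
      linarith
    · exact le_rfl
  · have hne : rank (i : M.V) ≠ rank (j : M.V) := fun h' => hij (Subtype.ext (rank_injective h'))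
    unfold traceCond orient
    rcases hne.lt_or_gt with hlt | hlt
    · rw [if_pos hlt, if_neg hlt.not_gt, add_zero]
    · rw [if_pos hlt, if_neg hlt.not_gt, zero_add, h.precM_symm]

lemma pattern_subset (a : ℝ) (ω : M.Ω) : pattern Λ a ω ⊆ edges Λ := Finset.filter_subset _ _

lemma pattern_eq_iff {S : Finset (Λ × Λ)} (hS : S ⊆ edges Λ) (a : ℝ) (ω : M.Ω) :
    pattern Λ a ω = S ↔ (∀ e ∈ S, M.opn a ω e.1 e.2) ∧ ∀ e ∈ edges Λ \ S, ¬ M.opn a ω e.1 e.2 := by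
  constructor
  · rintro rfl
    exact ⟨fun e he => (Finset.mem_filter.1 he).2, fun e he ho =>
      (Finset.mem_sdiff.1 he).2 (Finset.mem_filter.2 ⟨(Finset.mem_sdiff.1 he).1, ho⟩)⟩
  · rintro ⟨h1, h2⟩
    ext e
    refine ⟨fun he => ?_, fun he => Finset.mem_filter.2 ⟨hS he, h1 e he⟩⟩
    by_contra heS
    obtain ⟨he1, he2⟩ := Finset.mem_filter.1 he
    exact h2 e (Finset.mem_sdiff.2 ⟨he1, heS⟩) he2

lemma measurableSet_pattern_eq (a : ℝ) (S : Finset (Λ × Λ)) :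
    MeasurableSet {ω | pattern Λ a ω = S} := by
  by_cases hS : S ⊆ edges Λ
  · simp only [pattern_eq_iff hS, Set.ofPred_and]
    refine MeasurableSet.inter ?_ ?_
    · simp only [Set.ofPred_forall]
      exact Finset.measurableSet_biInter _ fun e _ => M.opn_meas a _ _
    · simp only [Set.ofPred_forall]
      exact Finset.measurableSet_biInter _ fun e _ => (M.opn_meas a _ _).compl
  · convert MeasurableSet.empty
    rw [Set.eq_empty_iff_forall_notMem]
    rintro ω rfl
    exact hS (pattern_subset a ω)

lemma measurableSet_pattern (a : ℝ) (Q : Finset (Λ × Λ) → Prop) :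
    MeasurableSet {ω | Q (pattern Λ a ω)} := by
  have : {ω | Q (pattern Λ a ω)} = ⋃ S ∈ {S | Q S}, {ω | pattern Λ a ω = S} := by
    ext ω; simp
  rw [this]
  exact MeasurableSet.biUnion (Set.to_countable _) fun S _ => measurableSet_pattern_eq a S

lemma measure_pattern_eq {S : Finset (Λ × Λ)} (hS : S ⊆ edges Λ) (a : ℝ) :
    M.P {ω | pattern Λ a ω = S} = ∫⁻ ω, ENNReal.ofReal
      ((∏ e ∈ S, openProb (cond Λ) (fun i => M.φ ω i - a) e) *
        ∏ e ∈ edges Λ \ S, (1 - openProb (cond Λ) (fun i => M.φ ω i - a) e)) ∂M.P := by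
  set emb : Λ × Λ ↪ M.V × M.V := ⟨fun e => (e.1, e.2), fun e f hef => by
    simp only [Prod.mk.injEq, Subtype.coe_inj] at hef
    exact Prod.ext hef.1 hef.2⟩ with hemb
  have hlaw := M.opn_law a (S.map emb) ((edges Λ \ S).map emb)
    ((Finset.disjoint_map emb).2 Finset.disjoint_sdiff) (fun e he f hf hef => ?_) Set.univ
    MeasurableSet.univ
  · simp only [Set.mem_univ, Set.ofPred_true, Set.univ_inter, Measure.restrict_univ,
      Finset.prod_map, Finset.forall_mem_map] at hlaw
    simp only [pattern_eq_iff hS]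
    refine hlaw.trans (lintegral_congr fun ω => ?_)
    congr 2
    · refine Finset.prod_congr rfl fun e he => ?_
      simp only [openProb, cond, orient, if_pos (mem_edges.1 (hS he))]
      rfl
    · refine Finset.prod_congr rfl fun e he => ?_
      simp only [openProb, cond, orient, if_pos (mem_edges.1 (Finset.mem_sdiff.1 he).1),
        sub_sub_cancel]
      rfl
  · rw [← Finset.map_union, Finset.union_sdiff_of_subset hS] at he hf
    obtain ⟨e, he', rfl⟩ := Finset.mem_map.1 he
    obtain ⟨f, hf', rfl⟩ := Finset.mem_map.1 hf
    rw [mem_edges] at he' hf'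
    intro h'
    have h1 : (e.1 : M.V) = f.2 := congrArg Prod.fst h'
    have h2 : (e.2 : M.V) = f.1 := congrArg Prod.snd h'
    rw [h1, h2] at he'
    exact lt_asymm he' hf'

lemma cond_nonneg (e : Λ × Λ) : 0 ≤ cond Λ e := by
  unfold cond orient
  split_ifs
  exacts [M.lam_nonneg _ _, le_rfl]

/-- The law of the configuration inside a finite set. -/
lemma measure_pattern (a : ℝ) (Q : Finset (Λ × Λ) → Prop) :
    M.P {ω | Q (pattern Λ a ω)} = ∫⁻ ω, ENNReal.ofReal
      (bernProb (openProb (cond Λ) fun i => M.φ ω i - a) Q) ∂M.P := by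
  have e1 : {ω | Q (pattern Λ a ω)} =
      pattern Λ a ⁻¹' (((edges Λ).powerset.filter Q : Finset (Finset (Λ × Λ))) : Set _) := by
    ext ω
    simp [pattern_subset a ω]
  have e2 : ∀ ω : M.Ω, bernProb (openProb (cond Λ) fun i => M.φ ω i - a) Q =
      ∑ S ∈ (edges Λ).powerset.filter Q,
        ((∏ e ∈ S, openProb (cond Λ) (fun i => M.φ ω i - a) e) *
        ∏ e ∈ edges Λ \ S, (1 - openProb (cond Λ) (fun i => M.φ ω i - a) e)) := by
    intro ω
    set p := openProb (cond Λ) fun i => M.φ ω i - a with hp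
    have hsub : ∀ η, bernWeight p η ≠ 0 → η ∩ edges Λ = η := fun η hη => by
      refine Finset.inter_eq_left.2 fun e he => ?_
      by_contra he'
      refine hη (Finset.prod_eq_zero (Finset.mem_univ e) ?_)
      rw [if_pos he, hp, openProb, cond, orient, if_neg fun h' => he' (mem_edges.2 h')]
      simp
    have h0 := openProb_nonneg (cond_nonneg (Λ := Λ)) fun i => M.φ ω i - a
    have h1 := openProb_le_one (cond Λ) fun i => M.φ ω i - a
    have e3 : bernProb p Q = bernProb p fun η => Q (η ∩ edges Λ) :=
      le_antisymm (bernProb_mono h0 h1 fun η hη hQ => by rwa [hsub η hη])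
        (bernProb_mono h0 h1 fun η hη hQ => by rwa [hsub η hη] at hQ)
    rw [e3, bernProb_cylinder p (edges Λ) (fun η => Q (η ∩ edges Λ)) (fun η => by simp),
      Finset.sum_filter]
    refine Finset.sum_congr rfl fun S hS => ?_
    rw [Finset.inter_eq_left.2 (Finset.mem_powerset.1 hS)]
  rw [e1, ← sum_measure_preimage_singleton _ fun S _ => measurableSet_pattern_eq a S]
  simp only [e2]
  have hm : ∀ e, Measurable fun ω => openProb (cond Λ) (fun i => M.φ ω i - a) e := fun e => by
    have h1 := M.φ_meas e.1
    have h2 := M.φ_meas e.2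
    unfold openProb
    fun_prop
  rw [lintegral_congr fun ω => ENNReal.ofReal_sum_of_nonneg fun S _ => ?_, lintegral_finsetSum]
  · refine Finset.sum_congr rfl fun S hS => ?_
    exact measure_pattern_eq (Finset.mem_powerset.1 (Finset.mem_filter.1 hS).1) a
  · intro S _
    fun_prop
  · refine mul_nonneg (Finset.prod_nonneg fun e _ => openProb_nonneg cond_nonneg _ e)
      (Finset.prod_nonneg fun e _ => ?_)
    linarith [openProb_le_one (cond Λ) (fun i => M.φ ω i - a) e]

/-- The law of the field restricted to a finite set. -/
lemma map_field (h : M.toWGraph.GreenKernel) (Λ : Finset M.V) :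
    M.P.map (fun ω (i : Λ) => M.φ ω i) = gaussM (precM (M := M.toWGraph) Λ) := by
  have := M.Pprob
  have := gaussM_isProb (h.precM_posDef Λ)
  have hm : Measurable fun ω (i : Λ) => M.φ ω i := measurable_pi_lambda _ fun i => M.φ_meas i
  have := Measure.isProbabilityMeasure_map (μ := M.P) hm.aemeasurable
  have hG : ∀ t, 0 ≤ t ⬝ᵥ greenMat (M := M.toWGraph) Λ *ᵥ t := fun t => by
    rw [← h.precM_inv]
    exact posDef_quadForm_nonneg (h.precM_posDef Λ).inv t
  refine measure_eq_of_laplace (fun L => ((fun i => L (Pi.single i 1)) ⬝ᵥ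
    greenMat (M := M.toWGraph) Λ *ᵥ (fun i => L (Pi.single i 1))).toNNReal) (fun L => ?_)
    (fun L => ?_)
  · set t : Λ → ℝ := fun i => L (Pi.single i 1) with ht
    have h1 := M.φ_gauss Λ fun v => if hv : v ∈ Λ then t ⟨v, hv⟩ else 0
    rw [Measure.map_map L.continuous.measurable hm]
    have e1 : (fun ω => ∑ x ∈ Λ, (if hv : x ∈ Λ then t ⟨x, hv⟩ else 0) * M.φ ω x) =
        L ∘ fun ω (i : Λ) => M.φ ω i := by
      funext ω
      rw [← Finset.sum_coe_sort Λ]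
      simp only [Finset.coe_mem, dite_true, Function.comp_apply]
      exact (strongDual_pi_apply L _).symm
    rw [← e1, h1]
    congr 2
    rw [← Finset.sum_coe_sort Λ]
    simp only [dotProduct, mulVec, Finset.mul_sum]
    refine Finset.sum_congr rfl fun i _ => ?_
    rw [← Finset.sum_coe_sort Λ]
    refine Finset.sum_congr rfl fun j _ => ?_
    simp only [Finset.coe_mem, dite_true, greenMat]
    ring
  · have h1 := hasCov_gaussM (h.precM_posDef Λ)
    rw [h.precM_inv] at h1
    rw [← h1.map_dotProduct _ (hG _)]
    congr 1; ext ψ; exact strongDual_pi_apply L ψ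

end Model

end ModelLink

section FiniteCluster

open Matrix WGraph WGraph.GreenKernel

namespace Model

variable {M : Model} {Λ : Finset M.V}

lemma mem_pattern_or_swap {a : ℝ} {ω : M.Ω} {u v : Λ} :
    ((u, v) ∈ pattern Λ a ω ∨ (v, u) ∈ pattern Λ a ω) ↔ u ≠ v ∧ M.opn a ω u v := by
  simp only [pattern, Finset.mem_filter, mem_edges]
  constructor
  · rintro (⟨hr, ho⟩ | ⟨hr, ho⟩)
    · exact ⟨fun h => by rw [h] at hr; exact lt_irrefl _ hr, ho⟩
    · exact ⟨fun h => by rw [h] at hr; exact lt_irrefl _ hr, M.opn_symm _ _ _ _ ho⟩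
  · rintro ⟨hne, ho⟩
    have hr : rank (u : M.V) ≠ rank (v : M.V) := fun h' => hne (Subtype.ext (rank_injective h'))
    rcases hr.lt_or_gt with hr | hr
    · exact Or.inl ⟨hr, ho⟩
    · exact Or.inr ⟨hr, M.opn_symm _ _ _ _ ho⟩

lemma conn_of_eConn_pattern {a : ℝ} {ω : M.Ω} {u v : Λ} (h : eConn (pattern Λ a ω) u v) :
    M.conn a ω u v := by
  unfold eConn at h
  induction h with
  | refl => exact Relation.ReflTransGen.refl
  | tail _ hbc ih => exact ih.tail (mem_pattern_or_swap.1 hbc).2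

lemma eConn_pattern_tail {a : ℝ} {ω : M.Ω} {x u v : Λ} (h : eConn (pattern Λ a ω) x u)
    (ho : M.opn a ω u v) : eConn (pattern Λ a ω) x v := by
  by_cases huv : u = v
  · exact huv ▸ h
  · exact Relation.ReflTransGen.tail h (mem_pattern_or_swap.2 ⟨huv, ho⟩)

/-- The set of vertices of `Λ` all of whose neighbours are in `Λ`. -/
def interior (Λ : Finset M.V) : Set Λ := {i | ∀ w, 0 < M.lam i w → w ∈ Λ}

lemma cluster_eq_iff {A : Finset Λ} (hA : ∀ i ∈ A, i ∈ interior Λ) (a : ℝ) (ω : M.Ω) (x : Λ) :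
    M.cluster a ω x = Subtype.val '' (A : Set Λ) ↔ eCluster (pattern Λ a ω) x = A := by
  constructor
  · intro h
    have hmem : ∀ y : Λ, M.conn a ω x y → y ∈ A := fun y hy => by
      have : (y : M.V) ∈ M.cluster a ω x := hy
      rw [h] at this
      obtain ⟨z, hz, hzy⟩ := this
      rwa [← Subtype.ext hzy]
    have hconn : ∀ y, M.conn a ω x y → ∃ hy : y ∈ Λ, eConn (pattern Λ a ω) x ⟨y, hy⟩ := by
      intro y hy
      unfold conn at hy
      induction hy with
      | refl => exact ⟨x.2, Relation.ReflTransGen.refl⟩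
      | @tail b c hb hbc ih =>
        obtain ⟨hbΛ, ih⟩ := ih
        have hcΛ := hA ⟨b, hbΛ⟩ (hmem _ hb) c (M.opn_edge _ _ _ _ hbc)
        exact ⟨hcΛ, eConn_pattern_tail ih hbc⟩
    ext y
    rw [mem_eCluster]
    refine ⟨fun hy => hmem y (conn_of_eConn_pattern hy), fun hy => ?_⟩
    have : (y : M.V) ∈ M.cluster a ω x := by rw [h]; exact ⟨y, hy, rfl⟩
    exact (hconn y this).2
  · intro h
    have hconn : ∀ y, M.conn a ω x y → ∃ hy : y ∈ Λ, eConn (pattern Λ a ω) x ⟨y, hy⟩ := by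
      intro y hy
      unfold conn at hy
      induction hy with
      | refl => exact ⟨x.2, Relation.ReflTransGen.refl⟩
      | @tail b c hb hbc ih =>
        obtain ⟨hbΛ, ih⟩ := ih
        have hcΛ := hA ⟨b, hbΛ⟩ (h ▸ mem_eCluster.2 ih) c (M.opn_edge _ _ _ _ hbc)
        exact ⟨hcΛ, eConn_pattern_tail ih hbc⟩
    ext y
    constructor
    · intro hy
      obtain ⟨hyΛ, hy⟩ := hconn y hy
      exact ⟨⟨y, hyΛ⟩, h ▸ mem_eCluster.2 hy, rfl⟩
    · rintro ⟨z, hz, rfl⟩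
      exact conn_of_eConn_pattern (mem_eCluster.1 (by rw [h]; exact hz))

lemma measurableSet_cluster_eq_image {A : Finset Λ} (hA : ∀ i ∈ A, i ∈ interior Λ) (a : ℝ)
    (x : Λ) : MeasurableSet {ω | M.cluster a ω x = Subtype.val '' (A : Set Λ)} := by
  simp only [cluster_eq_iff hA]
  exact measurableSet_pattern a fun S => eCluster S x = A

/-- The law of a finite cluster. -/
lemma measure_cluster_eq_image (h : M.toWGraph.GreenKernel) {A : Finset Λ}
    (hA : ∀ i ∈ A, i ∈ interior Λ) (a : ℝ) (x : Λ) :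
    M.P {ω | M.cluster a ω x = Subtype.val '' (A : Set Λ)} =
      levelProb (precM (M := M.toWGraph) Λ) (traceCond Λ) x A a := by
  simp only [cluster_eq_iff hA]
  rw [measure_pattern a fun S => eCluster S x = A, levelProb, ← map_field h Λ]
  have hm : Measurable fun ω (i : Λ) => M.φ ω i := measurable_pi_lambda _ fun i => M.φ_meas i
  refine Eq.trans ?_ (lintegral_map (μ := M.P) (f := fun ψ : Λ → ℝ =>
    ENNReal.ofReal (clusterProb (traceCond Λ) x A fun i => ψ i - a)) (by fun_prop) hm).symm
  refine lintegral_congr fun ω => ?_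
  congr 1
  unfold clusterProb
  refine bernProb_congr_on (edgeTouch A) _ (fun η => eCluster_eq_inter_iff η x A subset_rfl)
    fun e he => ?_
  have : cond Λ e = traceCond Λ e := by
    unfold cond traceCond orient
    split_ifs with hr
    · have hne : e.1 ≠ e.2 := fun h' => by rw [h'] at hr; exact lt_irrefl _ hr
      rcases (Finset.mem_filter.1 he).2 with h1 | h1
      · have h2 := h.precM_apply_interior (hA _ h1) hne
        exact (neg_eq_iff_eq_neg.2 h2).symm
      · have h2 := h.precM_apply_interior (hA _ h1) hne.symm
        have h3 := M.lam_symm e.1 e.2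
        exact h3.trans (neg_eq_iff_eq_neg.2 ((h.precM_symm _ _).trans h2)).symm
    · rfl
  simp only [openProb, this]

/-- A finite set together with its neighbours. -/
def hull (S : Finset M.V) : Finset M.V := S ∪ S.biUnion fun v => nbr (M := M.toWGraph) v

lemma subset_hull (S : Finset M.V) : S ⊆ hull S := Finset.subset_union_left

lemma mem_interior_of_hull_subset {S Λ : Finset M.V} (h : hull S ⊆ Λ) {i : Λ} (hi : (i : M.V) ∈ S) :
    i ∈ interior Λ := fun _ hw => h (Finset.mem_union_right _ (Finset.mem_biUnion.2
      ⟨i, hi, mem_nbr.2 hw⟩))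

/-- The preimage in `Λ` of a finite set of vertices. -/
def restr (Λ S : Finset M.V) : Finset Λ := Finset.univ.filter fun i => (i : M.V) ∈ S

lemma image_restr {Λ S : Finset M.V} (h : S ⊆ Λ) :
    Subtype.val '' (restr Λ S : Set Λ) = (S : Set M.V) := by
  ext v
  simp only [restr, Finset.coe_filter, Finset.mem_univ, true_and, Set.mem_image]
  exact ⟨fun ⟨i, hi, hiv⟩ => hiv ▸ hi, fun hv => ⟨⟨v, h hv⟩, hv, rfl⟩⟩

lemma measure_cluster_eq (h : M.toWGraph.GreenKernel) {S Λ : Finset M.V} (hS : hull S ⊆ Λ)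
    (a : ℝ) (x : Λ) : M.P {ω | M.cluster a ω x = S} =
      levelProb (precM (M := M.toWGraph) Λ) (traceCond Λ) x (restr Λ S) a := by
  rw [← image_restr ((subset_hull S).trans hS)]
  exact measure_cluster_eq_image h (fun i hi => mem_interior_of_hull_subset hS
    (Finset.mem_filter.1 hi).2) a x

lemma self_mem_cluster (a : ℝ) (ω : M.Ω) (x : M.V) : x ∈ M.cluster a ω x :=
  Relation.ReflTransGen.refl

lemma measurableSet_cluster_eq (S : Finset M.V) (a : ℝ) (x : M.V) :
    MeasurableSet {ω | M.cluster a ω x = S} := by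
  by_cases hx : x ∈ S
  · have := measurableSet_cluster_eq_image (M := M) (Λ := hull S) (A := restr (hull S) S)
      (fun i hi => mem_interior_of_hull_subset subset_rfl (Finset.mem_filter.1 hi).2) a
      ⟨x, subset_hull S hx⟩
    rwa [image_restr (subset_hull S)] at this
  · convert MeasurableSet.empty
    rw [Set.eq_empty_iff_forall_notMem]
    intro ω (hω : M.cluster a ω x = S)
    exact hx (Finset.mem_coe.1 (hω ▸ self_mem_cluster a ω x))

lemma measure_truncated_eq_tsum (a : ℝ) (x y : M.V) :
    M.P {ω | M.conn a ω x y ∧ (M.cluster a ω x).Finite} =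
      ∑' S : {S : Finset M.V // x ∈ S ∧ y ∈ S}, M.P {ω | M.cluster a ω x = S.1} := by
  have := M.countableV
  have e : {ω | M.conn a ω x y ∧ (M.cluster a ω x).Finite} =
      ⋃ S : {S : Finset M.V // x ∈ S ∧ y ∈ S}, {ω | M.cluster a ω x = S.1} := by
    ext ω
    simp only [Set.mem_ofPred_eq, Set.mem_iUnion]
    constructor
    · rintro ⟨h1, h2⟩
      exact ⟨⟨h2.toFinset, by simpa using self_mem_cluster a ω x, h2.mem_toFinset.2 h1⟩, by simp⟩
    · rintro ⟨S, hS⟩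
      refine ⟨?_, hS ▸ S.1.finite_toSet⟩
      have : y ∈ M.cluster a ω x := hS ▸ Finset.mem_coe.2 S.2.2
      exact this
  refine (congrArg M.P e).trans (measure_iUnion ?_ fun S => measurableSet_cluster_eq S.1 a x)
  intro S T hST
  rw [Function.onFun, Set.disjoint_left]
  intro ω (h1 : M.cluster a ω x = S.1) (h2 : M.cluster a ω x = T.1)
  exact hST (Subtype.ext (Finset.coe_injective (h1.symm.trans h2)))

/-- The truncated two-point function is symmetric in the level. -/
theorem tau_neg (h : M.toWGraph.GreenKernel) (a : ℝ) {x y : M.V} (hxy : x ≠ y) :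
    M.tau (-a) x y = M.tau a x y := by
  unfold tau prob
  rw [measure_truncated_eq_tsum, measure_truncated_eq_tsum]
  congr 2
  funext S
  obtain ⟨S, hx, hy⟩ := S
  have hxΛ := subset_hull S hx
  have hyΛ := subset_hull S hy
  have e := fun b => measure_cluster_eq h (subset_refl (hull S)) b ⟨x, hxΛ⟩
  simp only at e ⊢
  rw [e, e]
  refine levelProb_neg (coupled_traceCond h) (h.precM_posDef _) (y := ⟨y, hyΛ⟩) ?_
    (fun h' => hxy (Subtype.ext_iff.1 h')) (fun i hi => ?_) a
  · exact Finset.mem_filter.2 ⟨Finset.mem_univ _, hy⟩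
  · exact h.precM_rowSum_interior (mem_interior_of_hull_subset subset_rfl (Finset.mem_filter.1 hi).2)

lemma sum_levelProb_le {Λ : Finset M.V} (h : M.toWGraph.GreenKernel) (x y : Λ)
    (F : Finset (Finset Λ)) (hF : ∀ A ∈ F, y ∈ A) (a : ℝ) :
    ∑ A ∈ F, levelProb (precM (M := M.toWGraph) Λ) (traceCond Λ) x A a ≤
      ∫⁻ ψ, ENNReal.ofReal (bernProb (openProb (traceCond Λ) fun i => ψ i - a)
        fun ω => eConn ω x y) ∂gaussM (precM (M := M.toWGraph) Λ) := by
  have hc := (coupled_traceCond (Λ := Λ) h).nonneg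
  unfold levelProb
  rw [← lintegral_finsetSum _ fun A _ => by fun_prop]
  refine lintegral_mono fun ψ => ?_
  rw [← ENNReal.ofReal_sum_of_nonneg fun A _ => clusterProb_nonneg hc _ _ _]
  refine ENNReal.ofReal_le_ofReal ?_
  rw [bernProb_eConn_eq_sum]
  exact Finset.sum_le_sum_of_subset_of_nonneg
    (fun A hA => Finset.mem_filter.2 ⟨Finset.mem_univ _, hF A hA⟩)
    fun A _ _ => clusterProb_nonneg hc x A _

lemma measure_truncated_zero_le (h : M.toWGraph.GreenKernel) {x y : M.V} (hxy : x ≠ y) {k : ℝ}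
    (hk : 0 < k) (hx : k ≤ M.green x x) (hy : k ≤ M.green y y) :
    M.P {ω | M.conn 0 ω x y ∧ (M.cluster 0 ω x).Finite} ≤
      ENNReal.ofReal (4 * (M.green x y / k)) := by
  rw [measure_truncated_eq_tsum, ENNReal.tsum_eq_iSup_sum]
  refine iSup_le fun F => ?_
  set Λ : Finset M.V := {x, y} ∪ F.biUnion fun S => hull S.1 with hΛ
  have hxΛ : x ∈ Λ := by simp [hΛ]
  have hyΛ : y ∈ Λ := by simp [hΛ]
  have hsub : ∀ S ∈ F, hull S.1 ⊆ Λ := fun S hS =>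
    (Finset.subset_biUnion_of_mem (fun S : {S : Finset M.V // x ∈ S ∧ y ∈ S} => hull S.1) hS).trans
      Finset.subset_union_right
  have hinj : Set.InjOn (fun S : {S : Finset M.V // x ∈ S ∧ y ∈ S} => restr Λ S.1) F := by
    intro S hS T hT hST
    have := congrArg (fun A : Finset Λ => Subtype.val '' (A : Set Λ)) hST
    simp only at this
    rw [image_restr ((subset_hull _).trans (hsub S hS)),
      image_restr ((subset_hull _).trans (hsub T hT))] at this
    exact Subtype.ext (Finset.coe_injective this)
  calc ∑ S ∈ F, M.P {ω | M.cluster 0 ω x = S.1}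
      = ∑ S ∈ F, levelProb (precM (M := M.toWGraph) Λ) (traceCond Λ) ⟨x, hxΛ⟩ (restr Λ S.1) 0 :=
        Finset.sum_congr rfl fun S hS => measure_cluster_eq h (hsub S hS) 0 ⟨x, hxΛ⟩
    _ = ∑ A ∈ F.image fun S => restr Λ S.1,
        levelProb (precM (M := M.toWGraph) Λ) (traceCond Λ) ⟨x, hxΛ⟩ A 0 :=
        (Finset.sum_image (f := fun A => levelProb (precM (M := M.toWGraph) Λ) (traceCond Λ)
          ⟨x, hxΛ⟩ A 0) hinj).symm
    _ ≤ _ := sum_levelProb_le h _ ⟨y, hyΛ⟩ _ (fun A hA => by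
        obtain ⟨S, hS, rfl⟩ := Finset.mem_image.1 hA
        exact Finset.mem_filter.2 ⟨Finset.mem_univ _, S.2.2⟩) 0
    _ ≤ _ := by
      have hne : (⟨x, hxΛ⟩ : Λ) ≠ ⟨y, hyΛ⟩ := fun h' => hxy (Subtype.ext_iff.1 h')
      have h1 := (coupled_traceCond (Λ := Λ) h).sameSign_eq (h.precM_posDef Λ) hne
      have h2 := sameSign_upper (h.precM_posDef Λ) hne hk (by rwa [h.precM_inv])
        (by rwa [h.precM_inv]) (by rw [h.precM_inv]; exact h.nonneg _ _)
      rw [h1, h.precM_inv] at h2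
      simp only [sub_zero]
      exact (ENNReal.add_le_add_iff_left (by simp)).1 h2

theorem tau_zero_le (h : M.toWGraph.GreenKernel) {x y : M.V} (hxy : x ≠ y) {k : ℝ}
    (hk : 0 < k) (hx : k ≤ M.green x x) (hy : k ≤ M.green y y) :
    M.tau 0 x y ≤ 4 * (M.green x y / k) :=
  ENNReal.toReal_le_of_le_ofReal (by have := h.nonneg x y; positivity)
    (measure_truncated_zero_le h hxy hk hx hy)

lemma sum_levelProb_le_tau {Λ : Finset M.V} (h : M.toWGraph.GreenKernel) (x y : Λ)
    (F : Finset (Finset Λ)) (hF : ∀ A ∈ F, y ∈ A ∧ ∀ i ∈ A, i ∈ interior Λ) (a : ℝ) :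
    ∑ A ∈ F, levelProb (precM (M := M.toWGraph) Λ) (traceCond Λ) x A a ≤
      ENNReal.ofReal (M.tau a x y) := by
  have := M.Pprob
  unfold tau prob
  rw [ENNReal.ofReal_toReal (measure_ne_top _ _)]
  rw [← Finset.sum_congr rfl fun A hA => measure_cluster_eq_image h (hF A hA).2 a x,
    ← measure_biUnion_finset _ fun A hA => measurableSet_cluster_eq_image (hF A hA).2 a x]
  · refine measure_mono fun ω hω => ?_
    simp only [Set.mem_iUnion] at hω
    obtain ⟨A, hA, hω⟩ := hω
    rw [Set.mem_ofPred_eq] at hω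
    refine ⟨?_, ?_⟩
    · have : (y : M.V) ∈ M.cluster a ω x := by rw [hω]; exact ⟨y, (hF A hA).1, rfl⟩
      exact this
    · rw [hω]; exact Set.toFinite _
  · intro A _ A' _ hne
    rw [Function.onFun, Set.disjoint_left]
    intro ω h1 h2
    exact hne (Finset.coe_injective (Subtype.val_injective.image_injective (h1.symm.trans h2)))

end Model

end FiniteCluster

section TauLower

open Matrix WGraph WGraph.GreenKernel

namespace Model

variable {M : Model}

lemma greenBox_precM (h : M.toWGraph.GreenKernel) (hν : 0 ≤ M.ν)
    (hgr : ∀ x y, M.d x y = M.toWGraph.graphDist x y) {c C : ℝ} (hc : 0 < c) (hC : 0 < C)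
    (hdiag : ∀ x, c ≤ M.green x x ∧ M.green x x ≤ C)
    (hoff : ∀ x y, x ≠ y → c * M.d x y ^ (-M.ν) ≤ M.green x y ∧ M.green x y ≤ C * M.d x y ^ (-M.ν))
    (Λ : Finset M.V) :
    GreenBox (precM (M := M.toWGraph) Λ) (fun i j => M.d i j) (interior Λ) M.ν c C where
  posDef := h.precM_posDef Λ
  off := h.precM_off
  rowSum_nonneg := h.precM_rowSum_nonneg
  rowSum_eq i hi := h.precM_rowSum_interior hi
  near i hi j hij hne := by
    refine d_le_one hgr (lt_of_le_of_ne (M.lam_nonneg _ _) fun h' => hne ?_)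
    have h2 := h.precM_apply_interior hi hij
    rw [h2, ← h', neg_zero]
  d_symm i j := M.d_symm i j
  d_self i := M.d_self i
  d_triangle i j k := M.d_triangle i j k
  lower r hr i j hij := by
    rw [h.precM_inv]
    change c * r ^ (-M.ν) ≤ M.green i j
    by_cases hne : (i : M.V) = j
    · rw [← hne]
      refine le_trans ?_ (hdiag i).1
      exact mul_le_of_le_one_right hc.le (rpow_le_one_of_one_le_of_nonpos hr (by linarith))
    · refine le_trans ?_ (hoff i j hne).1
      gcongr c * ?_
      exact rpow_le_rpow_of_nonpos (M.d_pos _ _ hne) hij (by linarith)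
  upper r hr i j hij := by
    rw [h.precM_inv]
    change M.green i j ≤ C * r ^ (-M.ν)
    have hne : (i : M.V) ≠ j := fun h' => by
      rw [h', M.d_self] at hij
      linarith
    refine (hoff i j hne).2.trans ?_
    gcongr C * ?_
    exact rpow_le_rpow_of_nonpos hr hij (by linarith)
  diag_le i := by
    rw [h.precM_inv]
    exact (hdiag i).2

lemma tendsto_escape_error {ν C a : ℝ} (hν : 0 < ν) (hC : 0 < C) (ha : 0 < a) :
    Tendsto (fun m : ℕ => exp (-(1 / 2) * a ^ 2 *
      (C / (m + 1 : ℕ) + C * ((m + 1 : ℕ) : ℝ) ^ (-ν))⁻¹)) atTop (𝓝 0) := by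
  have h1 : Tendsto (fun m : ℕ => ((m + 1 : ℕ) : ℝ)) atTop atTop :=
    tendsto_natCast_atTop_atTop.comp (tendsto_add_atTop_nat 1)
  have h2 : Tendsto (fun m : ℕ => C / ((m + 1 : ℕ) : ℝ) + C * ((m + 1 : ℕ) : ℝ) ^ (-ν)) atTop
      (𝓝[>] 0) := by
    refine tendsto_nhdsWithin_iff.2 ⟨?_, Eventually.of_forall fun m => ?_⟩
    · have := (h1.const_div_atTop C).add (((tendsto_rpow_neg_atTop hν).comp h1).const_mul C)
      simpa using this
    · have : (0 : ℝ) < ((m + 1 : ℕ) : ℝ) := by positivity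
      rw [Set.mem_Ioi]
      positivity
  have h3 := (tendsto_inv_nhdsGT_zero.comp h2).const_mul_atTop_of_neg
    (show -(1 / 2) * a ^ 2 < 0 by nlinarith [sq_pos_of_pos ha])
  exact tendsto_exp_atBot.comp h3

/-- A quantitative lower bound on the truncated two-point function, with a free length scale. -/
theorem exists_tau_lower (hS : M.toWGraph.Standing) (hν1 : 1 ≤ M.ν) (hα : 0 < M.α)
    (hgr : ∀ x y, M.d x y = M.toWGraph.graphDist x y) :
    ∃ K ≥ (1 : ℝ), ∃ C₁ > (0 : ℝ), ∀ x y : M.V, ∀ L n : ℕ, 2 ≤ L → 0 < n → M.d x y = n →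
      ∀ a : ℝ, 0 < a →
      C₁⁻¹ * (L : ℝ) ^ (-M.ν) * exp (-(C₁ * (a ^ 2 * ((n + 1) /
        ∑ k ∈ Finset.range (n / 2 + 1), (K * L + k) ^ (-M.ν)) + (n / L + 1)))) ≤ M.tau a x y := by
  have hν : 0 < M.ν := by linarith
  have h := hS.greenKernel hν hα hgr
  obtain ⟨c, hc, C, hC, hdiag, hoff⟩ := hS.2.2
  have hcC : c ≤ C := (hdiag M.o).1.trans (hdiag M.o).2
  obtain ⟨K, hK, C₁, hC₁, hbox⟩ := exists_box_connection hν hc hcC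
  refine ⟨K, hK, C₁, hC₁, fun x y L n hL hn hd a ha => ?_⟩
  set X := C₁⁻¹ * (L : ℝ) ^ (-M.ν) * exp (-(C₁ * (a ^ 2 * ((n + 1) /
        ∑ k ∈ Finset.range (n / 2 + 1), (K * L + k) ^ (-M.ν)) + (n / L + 1)))) with hX
  have key : ∀ m : ℕ, X ≤ M.tau a x y + exp (-(1 / 2) * a ^ 2 *
      (C / (m + 1 : ℕ) + C * ((m + 1 : ℕ) : ℝ) ^ (-M.ν))⁻¹) := by
    intro m
    obtain ⟨n', γ, hd', h0, hl, -, hγ⟩ := exists_geodesic' hgr y x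
    obtain rfl : n' = n := by
      rw [M.d_symm, hd] at hd'
      exact_mod_cast hd'.symm
    set N := m + 1 with hN
    set R : ℝ := max (n' + K * L) (N * ((N : ℝ) + 1)) + 1 with hR
    set Λ : Finset M.V := (ball_finite hgr x R).toFinset with hΛ
    have hmem : ∀ v, v ∈ Λ ↔ M.d x v ≤ R := fun v => by simp [hΛ, ball]
    have hint : ∀ v : Λ, v ∉ interior Λ → R - 1 < M.d x v := by
      intro v hv
      by_contra! hv'
      refine hv fun w hw => (hmem w).2 ?_
      have := M.d_triangle x v w
      have := d_le_one hgr hw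
      linarith
    have hdγ : ∀ i ≤ n', M.d x (γ i) ≤ n' := fun i hi => by
      rw [M.d_symm, ← hl, hγ i n' hi le_rfl]
      have : (0 : ℝ) ≤ i := by positivity
      linarith
    have hKL : 0 ≤ K * L := by positivity
    have hR1 : n' + K * L ≤ R - 1 := by rw [hR]; simp
    have hR2 : N * ((N : ℝ) + 1) ≤ R - 1 := by rw [hR]; simp
    set z : ℕ → Λ := fun i => ⟨γ (min i n'), (hmem _).2 (by
      linarith [hdγ _ (min_le_right i n')])⟩ with hz
    have hzc : ∀ i ≤ n', (z i : M.V) = γ i := fun i hi => by simp [hz, min_eq_left hi]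
    have hB := greenBox_precM h hν.le hgr hc hC hdiag hoff Λ
    have h1 := hbox hB (traceCond Λ) (coupled_traceCond h) L n' hL hn z (fun i j hij hj => by
      rw [hzc i (hij.trans hj), hzc j hj]
      exact hγ i j hij hj) (fun i hi v hv => by
      by_contra hvI
      have h2 := hint v hvI
      have h3 := M.d_triangle x (γ i) v
      have h4 := hdγ i hi
      rw [hzc i hi, M.d_symm] at hv
      linarith) a
    have hzn : (z n' : M.V) = x := by rw [hzc _ le_rfl, hl]
    have hz0 : (z 0 : M.V) = y := by rw [hzc _ (Nat.zero_le _), h0]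
    have hne : z n' ≠ z 0 := fun h' => by
      have h2 := hγ 0 n' (Nat.zero_le _) le_rfl
      rw [h0, hl, ← hz0, ← hzn, h', M.d_self] at h2
      have : (0 : ℝ) < n' := by exact_mod_cast hn
      push_cast at h2
      linarith
    have h2 := hB.connection_le hC (coupled_traceCond h) hne (N := N) (Nat.succ_pos m) (r := N)
      (by positivity) (fun i hi => by
        have := hint i hi
        rw [hzn]
        linarith) ha.le
    have h3 := sum_levelProb_le_tau h (z n') (z 0)
      (Finset.univ.filter fun A : Finset Λ => z 0 ∈ A ∧ ∀ i ∈ A, i ∈ interior Λ)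
      (fun A hA => (Finset.mem_filter.1 hA).2) a
    rw [hzn, hz0] at h3
    have h0τ : 0 ≤ M.tau a x y := ENNReal.toReal_nonneg
    have h4 := (h1.trans h2).trans (add_le_add_left h3 _)
    rw [← ENNReal.ofReal_add h0τ (exp_nonneg _), ENNReal.ofReal_le_ofReal_iff (by positivity)] at h4
    exact h4
  have hlim := (tendsto_escape_error hν hC ha).const_add (M.tau a x y)
  rw [add_zero] at hlim
  exact ge_of_tendsto' hlim key

/-- An upper bound on the critical truncated two-point function. -/
theorem exists_tau_zero_upper (hS : M.toWGraph.Standing) (hν1 : 1 ≤ M.ν) (hα : 0 < M.α)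
    (hgr : ∀ x y, M.d x y = M.toWGraph.graphDist x y) :
    ∃ C > (0 : ℝ), ∀ x y : M.V, x ≠ y → M.tau 0 x y ≤ C * M.d x y ^ (-M.ν) := by
  have h := hS.greenKernel (by linarith) hα hgr
  obtain ⟨c, hc, C, hC, hdiag, hoff⟩ := hS.2.2
  refine ⟨4 * (C / c), by positivity, fun x y hxy => ?_⟩
  refine (tau_zero_le h hxy hc (hdiag x).1 (hdiag y).1).trans ?_
  rw [mul_assoc, div_mul_eq_mul_div]
  gcongr
  exact (hoff x y hxy).2

end Model

end TauLower

section ScaleChoice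

lemma mul_exp_neg_le_of_le {t₀ t C C₁ P E F : ℝ} (hC : 0 < C) (hC₁ : 0 < C₁) (hP : 0 ≤ P)
    (h0 : t₀ ≤ C * P) (h1 : C₁⁻¹ * P * exp (-E) ≤ t) (hF : E + |log (C * C₁)| ≤ F) :
    t₀ * exp (-F) ≤ t := by
  refine le_trans ?_ h1
  have h2 : exp (-F) ≤ exp (-E) * (C * C₁)⁻¹ := by
    rw [← exp_log (show 0 < (C * C₁)⁻¹ by positivity), ← exp_add, exp_le_exp, log_inv]
    linarith [le_abs_self (log (C * C₁))]
  calc t₀ * exp (-F) ≤ C * P * (exp (-E) * (C * C₁)⁻¹) := by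
        refine mul_le_mul h0 h2 (exp_nonneg _) (by positivity)
    _ = C₁⁻¹ * P * exp (-E) := by field_simp

lemma log_div_le_sum_inv {A : ℝ} (hA : 0 < A) (m : ℕ) :
    log ((A + m) / A) ≤ ∑ k ∈ Finset.range m, (A + k) ^ (-1 : ℝ) := by
  induction m with
  | zero => simp [div_self hA.ne']
  | succ m ih =>
    rw [Finset.sum_range_succ]
    have hAm : 0 < A + m := by positivity
    have e : (A + ((m + 1 : ℕ) : ℝ)) / A = (A + m) / A * ((A + m + 1) / (A + m)) := by
      push_cast
      field_simp
      ring
    rw [e, log_mul (by positivity) (by positivity), rpow_neg_one]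
    have h1 := log_le_sub_one_of_pos (show 0 < (A + m + 1) / (A + m) by positivity)
    have h2 : (A + m + 1) / (A + m) - 1 = (A + m)⁻¹ := by field_simp; ring
    linarith

lemma exists_scale_of_one {K C₁ C : ℝ} (hK : 1 ≤ K) (hC₁ : 0 < C₁) (hC : 0 < C) :
    ∃ C₀ > (0 : ℝ), ∀ C₂ ≥ C₀, ∀ (b : ℝ) (n : ℕ) (t₀ t : ℝ), 0 < b → b ≤ 1 → C₂ ≤ b ^ 2 * n →
      t₀ ≤ C * (n : ℝ) ^ (-1 : ℝ) →
      (∀ L : ℕ, 2 ≤ L → C₁⁻¹ * (L : ℝ) ^ (-1 : ℝ) * exp (-(C₁ * (b ^ 2 * ((n + 1) /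
        ∑ k ∈ Finset.range (n / 2 + 1), (K * L + k) ^ (-1 : ℝ)) + (n / L + 1)))) ≤ t) →
      t₀ * exp (-(C₂ * b ^ 2 * n / log (b ^ 2 * n))) ≤ t := by
  have hlo : ∀ᶠ N : ℝ in atTop, log N ≤ 1 / (4 * K) * N ^ (1 / 2 : ℝ) := by
    have := (isLittleO_log_rpow_atTop (show (0 : ℝ) < 1 / 2 by norm_num)).bound
      (show 0 < 1 / (4 * K) by positivity)
    filter_upwards [this, eventually_ge_atTop 1] with N hN h1
    rwa [norm_of_nonneg (log_nonneg h1), norm_of_nonneg (by positivity)] at hN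
  obtain ⟨N₀, hN₀⟩ := eventually_atTop.1 hlo
  refine ⟨max (max N₀ (exp 2)) (6 * C₁ + |log (C * C₁)|), by positivity,
    fun C₂ hC₂ b n t₀ t hb hb1 hN h0 h1 => ?_⟩
  set N := b ^ 2 * n with hNdef
  have hN0 : N₀ ≤ N := ((le_max_left _ _).trans (le_max_left _ _)).trans (hC₂.le.trans hN)
  have hNe : exp 2 ≤ N := ((le_max_right _ _).trans (le_max_left _ _)).trans (hC₂.le.trans hN)
  have hC₂' : 6 * C₁ + |log (C * C₁)| ≤ C₂ := (le_max_right _ _).trans hC₂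
  have hNpos : 0 < N := (exp_pos _).trans_le hNe
  have hl2 : 2 ≤ log N := (le_log_iff_exp_le hNpos).2 hNe
  have hl : 4 * K * log N ≤ N ^ (1 / 2 : ℝ) := by
    have := hN₀ N hN0
    calc 4 * K * log N ≤ 4 * K * (1 / (4 * K) * N ^ (1 / 2 : ℝ)) := by gcongr
      _ = N ^ (1 / 2 : ℝ) := by field_simp
  have hN1 : 1 ≤ N := (one_le_exp (by norm_num)).trans hNe
  have hsqrt : N ^ (1 / 2 : ℝ) ≤ N := by
    simpa using rpow_le_rpow_of_exponent_le hN1 (show (1 / 2 : ℝ) ≤ 1 by norm_num)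
  have h4 : 4 * log N ≤ N := by nlinarith
  have hnpos : (0 : ℝ) < n := by
    by_contra! hn
    have : N ≤ 0 := mul_nonpos_of_nonneg_of_nonpos (by positivity) hn
    linarith
  have hn1 : (1 : ℝ) ≤ n := by exact_mod_cast (show 0 < n by exact_mod_cast hnpos)
  set u := log N / b ^ 2 with hu
  have hb2 : b ^ 2 ≤ 1 := by nlinarith
  have hb2p : 0 < b ^ 2 := by positivity
  have hu2 : 2 ≤ u := by
    rw [hu, le_div_iff₀ hb2p]
    nlinarith
  set L := ⌈u⌉₊ with hL
  have hLu : u ≤ L := Nat.le_ceil u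
  have hL2 : (2 : ℝ) ≤ L := hu2.trans hLu
  have hLu' : (L : ℝ) ≤ 2 * u := by
    have := (Nat.ceil_lt_add_one (show 0 ≤ u by linarith)).le
    linarith
  have hLpos : (0 : ℝ) < L := by linarith
  have hnu : (n : ℝ) / u = N / log N := by
    rw [hu, hNdef]
    field_simp
  have hnL : (n : ℝ) / L ≤ N / log N := by
    rw [← hnu]
    gcongr
  have hLn : (L : ℝ) ≤ n := by
    have : 4 * u ≤ n := by
      rw [hu, ← mul_div_assoc, div_le_iff₀ hb2p]
      linarith
    linarith
  set S := ∑ k ∈ Finset.range (n / 2 + 1), (K * L + k) ^ (-1 : ℝ) with hS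
  have hSlow : log N / 2 ≤ S := by
    refine le_trans ?_ (log_div_le_sum_inv (A := K * L) (by positivity) _)
    have hm : (n : ℝ) / 2 ≤ ((n / 2 + 1 : ℕ) : ℝ) := by
      have : n ≤ 2 * (n / 2 + 1) := by omega
      have : (n : ℝ) ≤ 2 * ((n / 2 + 1 : ℕ) : ℝ) := by exact_mod_cast this
      linarith
    have hhalf : log N / 2 = log (N ^ (1 / 2 : ℝ)) := by rw [log_rpow hNpos]; ring
    rw [hhalf]
    refine log_le_log (by positivity) ?_
    rw [le_div_iff₀ (by positivity)]
    have e1 : N ^ (1 / 2 : ℝ) * N ^ (1 / 2 : ℝ) = N := by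
      rw [← rpow_add hNpos]; norm_num
    have e2 : N ^ (1 / 2 : ℝ) * (4 * K * log N) ≤ N := by
      calc _ ≤ N ^ (1 / 2 : ℝ) * N ^ (1 / 2 : ℝ) := by gcongr
        _ = N := e1
    have e3 : N ^ (1 / 2 : ℝ) * (K * L) ≤ n / 2 := by
      calc N ^ (1 / 2 : ℝ) * (K * L) ≤ N ^ (1 / 2 : ℝ) * (K * (2 * u)) := by gcongr
        _ = N ^ (1 / 2 : ℝ) * (4 * K * log N) / (2 * b ^ 2) := by rw [hu]; field_simp; ring
        _ ≤ N / (2 * b ^ 2) := by gcongr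
        _ = n / 2 := by rw [hNdef]; field_simp
    have : 0 ≤ K * L := by positivity
    linarith
  refine mul_exp_neg_le_of_le hC hC₁ (P := (n : ℝ) ^ (-1 : ℝ)) (by positivity) h0
    (E := C₁ * (b ^ 2 * ((n + 1) / S) + (n / L + 1))) ((mul_le_mul_of_nonneg_right ?_
      (exp_nonneg _)).trans (h1 L (by exact_mod_cast hL2))) ?_
  · exact mul_le_mul_of_nonneg_left (rpow_le_rpow_of_nonpos hLpos hLn (by norm_num))
      (by positivity)
  · set W := N / log N with hW
    have hW1 : 1 ≤ W := by
      rw [hW, le_div_iff₀ (by linarith)]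
      linarith
    have hb4 : b ^ 2 * ((n + 1) / S) ≤ 4 * W := by
      calc b ^ 2 * ((n + 1) / S) ≤ b ^ 2 * ((n + n) / (log N / 2)) := by gcongr
        _ = 4 * W := by rw [hW, hNdef]; field_simp; ring
    have hend : C₂ * b ^ 2 * n / log N = C₂ * W := by rw [hW, hNdef]; ring
    rw [hend]
    calc C₁ * (b ^ 2 * ((n + 1) / S) + (n / L + 1)) + |log (C * C₁)|
        ≤ C₁ * (4 * W + (W + W)) + |log (C * C₁)| * W := by
          have := le_mul_of_one_le_right (abs_nonneg (log (C * C₁))) hW1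
          gcongr
      _ = (6 * C₁ + |log (C * C₁)|) * W := by ring
      _ ≤ C₂ * W := by gcongr

lemma exists_scale_of_one_lt {ν K C₁ C : ℝ} (hν : 1 < ν) (hK : 1 ≤ K) (hC₁ : 0 < C₁)
    (hC : 0 < C) :
    ∃ C₀ > (0 : ℝ), ∀ C₂ ≥ C₀, ∀ (b : ℝ) (n : ℕ) (t₀ t : ℝ), 0 < b → b < 1 →
      C₂ ≤ b ^ (2 / ν) * n → t₀ ≤ C * (n : ℝ) ^ (-ν) →
      (∀ L : ℕ, 2 ≤ L → C₁⁻¹ * (L : ℝ) ^ (-ν) * exp (-(C₁ * (b ^ 2 * ((n + 1) /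
        ∑ k ∈ Finset.range (n / 2 + 1), (K * L + k) ^ (-ν)) + (n / L + 1)))) ≤ t) →
      t₀ * exp (-(C₂ * b ^ (2 / ν) * n * log (b ^ (2 / ν) * n) ^ (ν - 1))) ≤ t := by
  set D : ℝ := 2 * ((K + 1) ^ ν * 2 ^ (ν - 1)) with hD
  have hDpos : 0 < D := by positivity
  refine ⟨max (max 4 (exp 1)) (C₁ * (D + 2) + |log (C * C₁)|), by positivity,
    fun C₂ hC₂ b n t₀ t hb hb1 hN h0 h1 => ?_⟩
  have hν0 : 0 < ν := by linarith
  set β := b ^ (2 / ν) with hβ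
  have hβ0 : 0 < β := by positivity
  have hβ1 : β < 1 := rpow_lt_one hb.le hb1 (by positivity)
  have hβν : β ^ ν = b ^ 2 := by
    rw [hβ, ← rpow_mul hb.le, div_mul_cancel₀ _ hν0.ne', rpow_two]
  set N := β * n with hNdef
  have hN4 : 4 ≤ N := ((le_max_left _ _).trans (le_max_left _ _)).trans (hC₂.le.trans hN)
  have hNe : exp 1 ≤ N := ((le_max_right _ _).trans (le_max_left _ _)).trans (hC₂.le.trans hN)
  have hC₂' : C₁ * (D + 2) + |log (C * C₁)| ≤ C₂ := (le_max_right _ _).trans hC₂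
  have hl1 : 1 ≤ log N := (le_log_iff_exp_le (by linarith)).2 hNe
  have hnpos : (0 : ℝ) < n := by
    by_contra! hn
    have : N ≤ 0 := mul_nonpos_of_nonneg_of_nonpos hβ0.le hn
    linarith
  have hn1 : (1 : ℝ) ≤ n := by exact_mod_cast (show 0 < n by exact_mod_cast hnpos)
  set L := ⌈β⁻¹⌉₊ with hL
  have hβi : 1 < β⁻¹ := (one_lt_inv₀ hβ0).2 hβ1
  have hLu : β⁻¹ ≤ L := Nat.le_ceil _
  have hL2 : 2 ≤ L := by
    have : (1 : ℝ) < L := hβi.trans_le hLu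
    exact_mod_cast this
  have hLu' : (L : ℝ) ≤ 2 * β⁻¹ := by
    have := (Nat.ceil_lt_add_one (show 0 ≤ β⁻¹ by positivity)).le
    linarith
  have hLpos : (0 : ℝ) < L := by linarith
  have hnβ : (n : ℝ) = N * β⁻¹ := by rw [hNdef]; field_simp
  have hnL : (n : ℝ) / L ≤ N := by
    rw [div_le_iff₀ hLpos, hnβ]
    gcongr
  have hLn2 : 2 * (L : ℝ) ≤ n := by
    rw [hnβ]
    nlinarith [inv_pos.2 hβ0]
  set S := ∑ k ∈ Finset.range (n / 2 + 1), (K * L + k) ^ (-ν) with hS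
  have hSlow : (L : ℝ) * ((K + 1) * L) ^ (-ν) ≤ S := by
    have hLn : L ≤ n / 2 + 1 := by
      have : 2 * L ≤ n := by exact_mod_cast hLn2
      omega
    calc (L : ℝ) * ((K + 1) * L) ^ (-ν) = ∑ k ∈ Finset.range L, ((K + 1) * L) ^ (-ν) := by
          simp
      _ ≤ ∑ k ∈ Finset.range L, (K * L + k) ^ (-ν) := by
          refine Finset.sum_le_sum fun k hk => rpow_le_rpow_of_nonpos (by positivity) ?_
            (by linarith)
          have : (k : ℝ) ≤ L := by exact_mod_cast (Finset.mem_range.1 hk).le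
          linarith
      _ ≤ S := Finset.sum_le_sum_of_subset_of_nonneg (Finset.range_subset_range.2 hLn)
          fun k _ _ => by positivity
  refine mul_exp_neg_le_of_le hC hC₁ (P := (n : ℝ) ^ (-ν)) (by positivity) h0
    (E := C₁ * (b ^ 2 * ((n + 1) / S) + (n / L + 1))) ((mul_le_mul_of_nonneg_right ?_
      (exp_nonneg _)).trans (h1 L hL2)) ?_
  · exact mul_le_mul_of_nonneg_left (rpow_le_rpow_of_nonpos hLpos (by linarith) (by linarith))
      (by positivity)
  · have hb4 : b ^ 2 * ((n + 1) / S) ≤ D * N := by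
      have e1 : (L : ℝ) * ((K + 1) * L) ^ (-ν) = ((K + 1) ^ ν * (L : ℝ) ^ (ν - 1))⁻¹ := by
        rw [mul_rpow (by positivity) hLpos.le, rpow_neg (by positivity), rpow_neg hLpos.le,
          rpow_sub_one hLpos.ne']
        field_simp
      have e2 : (L : ℝ) ^ (ν - 1) ≤ 2 ^ (ν - 1) * (β⁻¹) ^ (ν - 1) := by
        rw [← mul_rpow (by norm_num) (by positivity)]
        exact rpow_le_rpow hLpos.le hLu' (by linarith)
      have e3 : b ^ 2 * (β⁻¹) ^ (ν - 1) = β := by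
        rw [← hβν, inv_rpow hβ0.le, rpow_sub_one hβ0.ne']
        field_simp
      calc b ^ 2 * ((n + 1) / S)
          ≤ b ^ 2 * ((n + n) / ((L : ℝ) * ((K + 1) * L) ^ (-ν))) := by gcongr
        _ = b ^ 2 * (2 * n * ((K + 1) ^ ν * (L : ℝ) ^ (ν - 1))) := by
          rw [e1, div_inv_eq_mul]; ring
        _ ≤ b ^ 2 * (2 * n * ((K + 1) ^ ν * (2 ^ (ν - 1) * (β⁻¹) ^ (ν - 1)))) := by gcongr
        _ = D * (b ^ 2 * (β⁻¹) ^ (ν - 1)) * n := by rw [hD]; ring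
        _ = D * N := by rw [e3, hNdef]; ring
    have hend : C₂ * β * n * log N ^ (ν - 1) = C₂ * N * log N ^ (ν - 1) := by
      rw [hNdef]; ring
    rw [hend]
    have hC₂0 : 0 ≤ C₂ := le_trans (by positivity) hC₂'
    calc C₁ * (b ^ 2 * ((n + 1) / S) + (n / L + 1)) + |log (C * C₁)|
        ≤ C₁ * (D * N + (N + N)) + |log (C * C₁)| * N := by
          have := le_mul_of_one_le_right (abs_nonneg (log (C * C₁))) (show 1 ≤ N by linarith)
          gcongr
          linarith
      _ = (C₁ * (D + 2) + |log (C * C₁)|) * N := by ring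
      _ ≤ C₂ * N := by gcongr
      _ ≤ C₂ * N * log N ^ (ν - 1) :=
          le_mul_of_one_le_right (by positivity) (one_le_rpow hl1 (by linarith))

end ScaleChoice

section NearCritical

/-- At small levels the logarithmic corrections are at least one. -/
lemma one_le_log_log_inv_abs {a : ℝ} (ha : a ≠ 0) (h : |a| ≤ exp (-exp (exp (exp 1)))) :
    1 ≤ log |a|⁻¹ ∧ 1 ≤ log (log |a|⁻¹) ∧ 1 ≤ log (log (log |a|⁻¹)) ∧ |a| < 1 := by
  have h0 : 0 < |a| := abs_pos.2 ha
  have e1 : (1 : ℝ) ≤ exp 1 := one_le_exp (by norm_num)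
  have e2 : (1 : ℝ) ≤ exp (exp 1) := one_le_exp (by linarith)
  have e3 : (1 : ℝ) ≤ exp (exp (exp 1)) := one_le_exp (by linarith)
  have h1 : exp (exp (exp 1)) ≤ log |a|⁻¹ := by
    rw [log_inv, le_neg]
    exact (log_le_iff_le_exp h0).2 h
  have h2 : exp (exp 1) ≤ log (log |a|⁻¹) := (le_log_iff_exp_le (by linarith)).2 h1
  have h3 : exp 1 ≤ log (log (log |a|⁻¹)) := (le_log_iff_exp_le (by linarith)).2 h2
  refine ⟨by linarith, by linarith, by linarith, h.trans_lt ?_⟩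
  rw [exp_lt_one_iff]
  linarith

lemma sq_rpow_neg_two_mul {b C D Q : ℝ} (s : ℝ) (hb : 0 < b) (hC : 0 < C) (hQ : 1 ≤ Q)
    (h : C * b ^ (-s) * Q ≤ D) : C ≤ b ^ s * D := by
  have hbs : 0 < b ^ s := by positivity
  calc C = b ^ s * (C * b ^ (-s) * 1) := by rw [rpow_neg hb.le]; field_simp
    _ ≤ b ^ s * (C * b ^ (-s) * Q) := by gcongr
    _ ≤ b ^ s * D := by gcongr

lemma Model.tau_abs {M : Model} (h : M.toWGraph.GreenKernel) (a : ℝ) {x y : M.V} (hxy : x ≠ y) :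
    M.tau |a| x y = M.tau a x y := by
  rcases abs_choice a with h' | h' <;> rw [h']
  exact M.tau_neg h a hxy

end NearCritical

/-- **Lower bound on the near-critical truncated two-point function ((1.11)).** -/
theorem near_critical_two_point_lower_bound (M : Model)
    (hS : M.toWGraph.Standing) (hν1 : 1 ≤ M.ν) (hνα : M.ν < M.α / 2)
    (hgr : ∀ x y, M.d x y = M.toWGraph.graphDist x y) :
    ∃ c > (0:ℝ), ∃ C₂ > (0:ℝ), ∀ (a : ℝ) (x y : M.V), |a| ≤ c →
      (M.ν = 1 →
        C₂ * |a| ^ (-2 : ℝ) * qArm M.ν M.α |a|⁻¹ * Real.log (qArm M.ν M.α |a|⁻¹) ≤ M.d x y →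
        M.tau 0 x y * Real.exp (-(C₂ * a ^ 2 * M.d x y / Real.log (a ^ 2 * M.d x y))) ≤
          M.tau a x y) ∧
      (1 < M.ν →
        C₂ * |a| ^ (-(2 / M.ν)) * qArm M.ν M.α |a|⁻¹ ≤ M.d x y →
        M.tau 0 x y * Real.exp (-(C₂ * |a| ^ (2 / M.ν) * M.d x y *
            Real.log (|a| ^ (2 / M.ν) * M.d x y) ^ (M.ν - 1))) ≤ M.tau a x y) := by
  have hα : 0 < M.α := by linarith
  have hker := hS.greenKernel (by linarith) hα hgr
  obtain ⟨C, hC, hup⟩ := M.exists_tau_zero_upper hS hν1 hα hgr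
  obtain ⟨K, hK, C₁, hC₁, hlow⟩ := M.exists_tau_lower hS hν1 hα hgr
  have hdist : ∀ {a D : ℝ} {x y : M.V}, a ≠ 0 → 0 < D → D ≤ |a| ^ 2 * M.d x y ∨
      D ≤ |a| ^ (2 / M.ν) * M.d x y → x ≠ y ∧ ∃ n : ℕ, 0 < n ∧ M.d x y = n := by
    intro a D x y ha hD h
    have hxy : x ≠ y := by
      rintro rfl
      rw [M.d_self, mul_zero, mul_zero, or_self] at h
      linarith
    obtain ⟨n, -, hn, -⟩ := WGraph.exists_geodesic' hgr x y
    refine ⟨hxy, n, ?_, hn⟩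
    have := M.d_pos x y hxy
    rw [hn] at this
    exact_mod_cast this
  refine ⟨exp (-exp (exp (exp 1))), exp_pos _, ?_⟩
  rcases hν1.eq_or_lt with hν | hν
  · obtain ⟨C₀, hC₀, key⟩ := exists_scale_of_one hK hC₁ hC
    refine ⟨C₀, hC₀, fun a x y hac => ⟨fun _ hd => ?_, fun h => absurd hν h.ne⟩⟩
    rcases eq_or_ne a 0 with rfl | ha
    · simp
    obtain ⟨-, h2, h3, h1⟩ := one_le_log_log_inv_abs ha hac
    have hb : 0 < |a| := abs_pos.2 ha
    rw [qArm, if_pos hν.symm, mul_assoc _ (log _)] at hd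
    have hN := sq_rpow_neg_two_mul 2 hb hC₀ (one_le_mul_of_one_le_of_one_le h2 h3) hd
    rw [rpow_two] at hN
    obtain ⟨hxy, n, hn, hdn⟩ := hdist ha hC₀ (Or.inl hN)
    have hu := hup x y hxy
    rw [hdn] at hN hu ⊢
    rw [← hν] at hu hlow
    rw [← M.tau_abs hker a hxy, ← sq_abs a]
    exact key C₀ le_rfl |a| n _ _ hb h1.le hN hu fun L hL => hlow x y L n hL hn hdn |a| hb
  · obtain ⟨C₀, hC₀, key⟩ := exists_scale_of_one_lt hν hK hC₁ hC
    refine ⟨C₀, hC₀, fun a x y hac => ⟨fun h => absurd h hν.ne', fun _ hd => ?_⟩⟩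
    rcases eq_or_ne a 0 with rfl | ha
    · simp [zero_rpow (show 2 / M.ν ≠ 0 by positivity)]
    obtain ⟨h0, h2, h3, h1⟩ := one_le_log_log_inv_abs ha hac
    have hb : 0 < |a| := abs_pos.2 ha
    rw [qArm, if_neg hν.ne', if_pos hνα] at hd
    have hN := sq_rpow_neg_two_mul (2 / M.ν) hb hC₀ (one_le_mul_of_one_le_of_one_le
      (one_le_rpow h0 (by linarith)) (one_le_rpow h2 (by linarith))) hd
    obtain ⟨hxy, n, hn, hdn⟩ := hdist ha hC₀ (Or.inr hN)
    have hu := hup x y hxy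
    rw [hdn] at hN hu ⊢
    rw [← M.tau_abs hker a hxy]
    exact key C₀ le_rfl |a| n _ _ hb h1 hN hu fun L hL => hlow x y L n hL hn hdn |a| hb
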